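/- For every integer n ≥ 0, writing N_i = N(i,11,11n+6), the following hold: N_0 + N_3 ≥ N_1 + N_4; N_1 + N_2 + N_4 ≥ N_3 + 2N_5; N_2 + 2N_3 ≥ N_1 + N_4 + N_5; N_0 + N_1 + N_4 ≥ N_2 + 2N_5; 3N_3 ≥ N_2 + 2N_5; and N_0 + 2N_3 ≥ 2N_2 + N_5. -/

import Mathlib

/-- `p n`: the number of partitions of `n`. -/
def partitionCount (n : ℕ) : ℕ := Fintype.card (Nat.Partition n)

/-- The rank of a partition: its largest part minus its number of parts
(the empty partition has rank 0). -/
def partitionRank {n : ℕ} (π : Nat.Partition n) : ℤ :=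
  (π.parts.sup : ℤ) - (Multiset.card π.parts : ℤ)

/-- The crank of a partition `π`: if `π` has no parts equal to 1, it is the largest part;
otherwise it is (number of parts larger than the number of ones) − (number of ones). -/
def partitionCrank {n : ℕ} (π : Nat.Partition n) : ℤ :=
  if π.parts.count 1 = 0 then (π.parts.sup : ℤ)
  else ((π.parts.filter fun x => π.parts.count 1 < x).card : ℤ) - (π.parts.count 1 : ℤ)

/-- `rankCount a r n` = `N(a,r,n)`: the number of partitions of `n` whose rank is
congruent to `a` modulo `r`. -/
def rankCount (a r : ℤ) (n : ℕ) : ℕ :=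
  (Finset.univ.filter fun π : Nat.Partition n => partitionRank π % r = a % r).card

/-- `crankCount a n` = `M(a,11,n)`: for `n ≠ 1`, the number of partitions of `n` whose crank
is congruent to `a` modulo 11; at `n = 1` the standard convention `M(0,11,1) = −1`,
`M(1,11,1) = M(10,11,1) = 1`, and `M(a,11,1) = 0` otherwise. -/
def crankCount (a : ℤ) (n : ℕ) : ℤ :=
  if n = 1 then
    if a % 11 = 0 then -1
    else if a % 11 = 1 ∨ a % 11 = 10 then 1
    else 0
  else ((Finset.univ.filter fun π : Nat.Partition n => partitionCrank π % 11 = a % 11).card : ℤ)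

namespace RankEleven
open Finset

/-- The number of partitions of `n` with rank at least `r`. -/
def rankGe (r : ℤ) (n : ℕ) : ℕ :=
  (univ.filter fun π : Nat.Partition n => r ≤ partitionRank π).card

/-- The number of partitions of `n` with rank at most `r`. -/
def rankLe (r : ℤ) (n : ℕ) : ℕ :=
  (univ.filter fun π : Nat.Partition n => partitionRank π ≤ r).card

lemma rankLe_add_rankGe (r : ℤ) (n : ℕ) :
    rankLe r n + rankGe (r + 1) n = Fintype.card (Nat.Partition n) := by
  have h : rankGe (r + 1) n =
      (univ.filter fun π : Nat.Partition n => ¬ partitionRank π ≤ r).card :=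
    congrArg card (Finset.filter_congr fun π _ => by omega)
  rw [h, rankLe, Finset.card_filter_add_card_filter_not, Finset.card_univ]

lemma sup_mem_parts {s : Multiset ℕ} (hs : s ≠ 0) : s.sup ∈ s := by
  induction s using Multiset.induction_on with
  | empty => exact absurd rfl hs
  | cons a t ih =>
    rcases eq_or_ne t 0 with rfl | ht
    · simp
    · rw [Multiset.sup_cons]
      rcases le_total a t.sup with h | h
      · rw [sup_eq_right.mpr h]; exact Multiset.mem_cons_of_mem (ih ht)
      · rw [sup_eq_left.mpr h]; exact Multiset.mem_cons_self _ _

lemma sum_map_add_one (t : Multiset ℕ) : (t.map (· + 1)).sum = t.sum + Multiset.card t := by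
  induction t using Multiset.induction_on with
  | empty => simp
  | cons a t ih => simp [ih]; omega

lemma sum_map_sub_one {t : Multiset ℕ} (ht : ∀ x ∈ t, 0 < x) :
    (t.map (· - 1)).sum + Multiset.card t = t.sum := by
  induction t using Multiset.induction_on with
  | empty => simp
  | cons a t ih =>
    have := ih fun x hx => ht x (Multiset.mem_cons_of_mem hx)
    have := ht a (Multiset.mem_cons_self _ _)
    simp; omega

lemma sum_filter_ne_zero (t : Multiset ℕ) : (t.filter (· ≠ 0)).sum = t.sum := by
  induction t using Multiset.induction_on with
  | empty => simp
  | cons a t ih =>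
    by_cases h : a = 0
    · simp only [ne_eq] at ih; simp [h, ih]
    · rw [Multiset.filter_cons_of_pos (p := fun x => x ≠ 0) _ h]; simp only [ne_eq] at ih; simp [ih]

/-- Dyson's map: delete the largest part `b`, then add a first column of length `b - r - 1`. -/
def dysonParts (r : ℤ) (s : Multiset ℕ) : Multiset ℕ :=
  (s.erase s.sup).map (· + 1) +
    Multiset.replicate ((s.sup - r - 1).toNat - Multiset.card (s.erase s.sup)) 1

/-- The inverse of Dyson's map: delete the first column, then add a part. -/
def dysonInvParts (r : ℤ) (s : Multiset ℕ) : Multiset ℕ :=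
  (Multiset.card s + r + 1).toNat ::ₘ ((s.map (· - 1)).filter (· ≠ 0))

lemma card_dysonParts {r : ℤ} {s : Multiset ℕ} (hs : s ≠ 0)
    (hr : r ≤ (s.sup : ℤ) - Multiset.card s) :
    (Multiset.card (dysonParts r s) : ℤ) = s.sup - r - 1 := by
  have h1 := Multiset.card_erase_add_one (sup_mem_parts hs)
  rw [dysonParts, Multiset.card_add, Multiset.card_map, Multiset.card_replicate]
  omega

lemma sum_dysonParts {r : ℤ} {s : Multiset ℕ} (hs : s ≠ 0)
    (hr : r ≤ (s.sup : ℤ) - Multiset.card s) :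
    ((dysonParts r s).sum : ℤ) = s.sum - r - 1 := by
  have h1 := Multiset.card_erase_add_one (sup_mem_parts hs)
  have h2 := Multiset.sum_erase (sup_mem_parts hs)
  rw [dysonParts, Multiset.sum_add, sum_map_add_one, Multiset.sum_replicate]
  simp only [smul_eq_mul, mul_one]
  omega

lemma sup_dysonParts_le {r : ℤ} {s : Multiset ℕ} :
    (dysonParts r s).sup ≤ s.sup + 1 := by
  rw [Multiset.sup_le]
  intro x hx
  rw [dysonParts, Multiset.mem_add, Multiset.mem_map] at hx
  rcases hx with ⟨a, ha, rfl⟩ | hx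
  · have := Multiset.le_sup (Multiset.mem_of_mem_erase ha); omega
  · have := Multiset.eq_of_mem_replicate hx; omega

lemma dysonInv_dyson {r : ℤ} {s : Multiset ℕ} (hs : s ≠ 0) (hpos : ∀ x ∈ s, 0 < x)
    (hr : r ≤ (s.sup : ℤ) - Multiset.card s) :
    dysonInvParts r (dysonParts r s) = s := by
  rw [dysonInvParts, card_dysonParts hs hr]
  have h1 : ((s.sup : ℤ) - r - 1 + r + 1).toNat = s.sup := by omega
  rw [h1, dysonParts, Multiset.map_add, Multiset.filter_add, Multiset.map_map,
    Multiset.map_replicate]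
  have h2 : (s.erase s.sup).map ((· - 1) ∘ (· + 1)) = s.erase s.sup := by
    simp
  rw [h2, Multiset.filter_eq_self.mpr fun a ha => (hpos a (Multiset.mem_of_mem_erase ha)).ne',
    Multiset.filter_eq_nil.mpr fun a ha => by simpa using Multiset.eq_of_mem_replicate ha]
  rw [add_zero, Multiset.cons_erase (sup_mem_parts hs)]

lemma map_filter_add_replicate {s : Multiset ℕ} (hpos : ∀ x ∈ s, 0 < x) :
    (((s.map (· - 1)).filter (· ≠ 0)).map (· + 1)) +
      Multiset.replicate (Multiset.card s - Multiset.card ((s.map (· - 1)).filter (· ≠ 0))) 1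
      = s := by
  induction s using Multiset.induction_on with
  | empty => simp
  | cons a t ih =>
    have ih' := ih fun x hx => hpos x (Multiset.mem_cons_of_mem hx)
    have ha := hpos a (Multiset.mem_cons_self _ _)
    have hle : Multiset.card ((t.map (· - 1)).filter (· ≠ 0)) ≤ Multiset.card t := by
      simpa using Multiset.card_le_card (Multiset.filter_le (· ≠ 0) (t.map (· - 1)))
    rw [Multiset.map_cons]
    by_cases h : a - 1 = 0
    · have e : ((a - 1) ::ₘ t.map (· - 1)).filter (· ≠ 0) = (t.map (· - 1)).filter (· ≠ 0) := by
        simp [h]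
      rw [e, Multiset.card_cons,
        Nat.succ_sub hle, Multiset.replicate_succ, Multiset.add_cons, ih']
      congr 1; omega
    · rw [Multiset.filter_cons_of_pos (p := fun x => x ≠ 0) _ h, Multiset.map_cons, Multiset.card_cons,
        Multiset.card_cons, Nat.add_sub_add_right, Multiset.cons_add, ih']
      congr 1; omega

lemma sup_dysonInvParts {r : ℤ} {s : Multiset ℕ}
    (hr : (s.sup : ℤ) - Multiset.card s ≤ r + 2) :
    (dysonInvParts r s).sup = (Multiset.card s + r + 1).toNat := by
  rw [dysonInvParts, Multiset.sup_cons, sup_eq_left, Multiset.sup_le]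
  intro x hx
  obtain ⟨a, ha, rfl⟩ := Multiset.mem_map.mp (Multiset.mem_of_mem_filter hx)
  have := Multiset.le_sup ha
  omega

lemma dyson_dysonInv {r : ℤ} {s : Multiset ℕ} (hpos : ∀ x ∈ s, 0 < x)
    (hr : (s.sup : ℤ) - Multiset.card s ≤ r + 2) (h0 : 0 ≤ Multiset.card s + r + 1) :
    dysonParts r (dysonInvParts r s) = s := by
  rw [dysonParts, sup_dysonInvParts hr, dysonInvParts, Multiset.erase_cons_head]
  have : (((Multiset.card s + r + 1).toNat : ℤ) - r - 1).toNat = Multiset.card s := by omega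
  rw [this]
  exact map_filter_add_replicate hpos

/-- Dyson's bijection at the level of cardinalities. -/
theorem rankGe_eq_rankLe (r : ℤ) {n m : ℕ} (hn : n ≠ 0) (h : (m : ℤ) = n - r - 1) :
    rankGe r n = rankLe (r + 2) m := by
  have hne : ∀ π : Nat.Partition n, π.parts ≠ 0 := by
    intro π h0
    have := π.parts_sum
    rw [h0] at this
    exact hn (by simpa using this.symm)
  have key : ∀ ρ : Nat.Partition m, partitionRank ρ ≤ r + 2 →
      0 < (Multiset.card ρ.parts : ℤ) + r + 1 := by
    intro ρ hρ
    rw [partitionRank] at hρ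
    by_contra hlt
    have hsup : ρ.parts.sup ≤ 1 := by omega
    have h1 : ρ.parts.sum ≤ Multiset.card ρ.parts * 1 := by
      simpa using Multiset.sum_le_card_nsmul ρ.parts 1
        fun x hx => (Multiset.le_sup hx).trans hsup
    have h2 := ρ.parts_sum
    omega
  have inv_sum : ∀ ρ : Nat.Partition m, partitionRank ρ ≤ r + 2 →
      (dysonInvParts r ρ.parts).sum = n := by
    intro ρ hρ
    have h1 := sum_map_sub_one (t := ρ.parts) fun x hx => ρ.parts_pos hx
    have h2 := key ρ hρ
    have h3 := ρ.parts_sum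
    rw [dysonInvParts, Multiset.sum_cons, sum_filter_ne_zero]
    omega
  refine Finset.card_bij' (i := fun π hπ => ⟨dysonParts r π.parts, ?_, ?_⟩)
    (j := fun ρ hρ => ⟨dysonInvParts r ρ.parts, ?_, ?_⟩) ?_ ?_ ?_ ?_
  · intro x hx
    rw [dysonParts, Multiset.mem_add, Multiset.mem_map] at hx
    rcases hx with ⟨a, ha, rfl⟩ | hx
    · omega
    · rw [Multiset.eq_of_mem_replicate hx]; exact one_pos
  · have := sum_dysonParts (hne π) (mem_filter.mp hπ).2
    have := π.parts_sum
    omega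
  · intro x hx
    rw [dysonInvParts, Multiset.mem_cons] at hx
    rcases hx with rfl | hx
    · have := key ρ (mem_filter.mp hρ).2
      omega
    · exact Nat.pos_of_ne_zero (Multiset.mem_filter.mp hx).2
  · exact inv_sum ρ (mem_filter.mp hρ).2
  · intro π hπ
    have h1 := card_dysonParts (hne π) (mem_filter.mp hπ).2
    have h2 := sup_dysonParts_le (r := r) (s := π.parts)
    refine mem_filter.mpr ⟨mem_univ _, ?_⟩
    simp only [partitionRank]
    omega
  · intro ρ hρ
    have h1 := sup_dysonInvParts (mem_filter.mp hρ).2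
    have h2 := key ρ (mem_filter.mp hρ).2
    refine mem_filter.mpr ⟨mem_univ _, ?_⟩
    simp only [partitionRank, h1]
    have h3 : Multiset.card (dysonInvParts r ρ.parts) ≤ Multiset.card ρ.parts + 1 := by
      rw [dysonInvParts, Multiset.card_cons]
      simpa using Multiset.card_le_card
        (Multiset.filter_le (· ≠ 0) (ρ.parts.map (· - 1)))
    omega
  · intro π hπ
    exact Nat.Partition.ext (dysonInv_dyson (hne π) (fun x hx => π.parts_pos hx)
      (mem_filter.mp hπ).2)
  · intro ρ hρ
    exact Nat.Partition.ext (dyson_dysonInv (fun x hx => ρ.parts_pos hx)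
      (mem_filter.mp hρ).2 (key ρ (mem_filter.mp hρ).2).le)

lemma card_partition_le (n : ℕ) : Fintype.card (Nat.Partition n) ≤ 2 ^ n := by
  have h := Fintype.card_le_of_surjective _ (Nat.Partition.ofComposition_surj (n := n))
  rw [composition_card] at h
  exact h.trans (Nat.pow_le_pow_right (by norm_num) (by omega))

/-- The number of partitions of `n ≥ 1` of rank at least `r`, and `0` for `n = 0`. -/
def rankGePos (r n : ℕ) : ℕ := if n = 0 then 0 else rankGe r n

lemma rankGe_le (r : ℤ) (n : ℕ) : rankGe r n ≤ Fintype.card (Nat.Partition n) :=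
  Finset.card_le_univ _

lemma rankGePos_le (r n : ℕ) : rankGePos r n ≤ Fintype.card (Nat.Partition n) := by
  unfold rankGePos
  split_ifs
  · exact Nat.zero_le _
  · exact rankGe_le _ _

lemma rank_zero (π : Nat.Partition 0) : partitionRank π = 0 := by
  have : π = Nat.Partition.indiscrete 0 := Subsingleton.elim _ _
  subst this
  simp [partitionRank]

lemma rankGe_zero {r : ℤ} (hr : 0 < r) : rankGe r 0 = 0 := by
  rw [rankGe, card_eq_zero, filter_eq_empty_iff]
  intro π _
  rw [rank_zero]; omega

lemma rank_bounds {n : ℕ} (hn : n ≠ 0) (π : Nat.Partition n) :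
    1 - (n : ℤ) ≤ partitionRank π ∧ partitionRank π ≤ n - 1 := by
  have hne : π.parts ≠ 0 := by
    intro h0
    have := π.parts_sum
    rw [h0] at this
    exact hn (by simpa using this.symm)
  have h1 : 0 < π.parts.sup := π.parts_pos (sup_mem_parts hne)
  have h2 : 0 < Multiset.card π.parts := Multiset.card_pos.mpr hne
  have h3 : Multiset.card π.parts ≤ n := by
    have := Multiset.card_nsmul_le_sum (s := π.parts) (a := 1) fun x hx => π.parts_pos hx
    simpa [π.parts_sum] using this
  have h4 : π.parts.sup ≤ n := by
    rw [Multiset.sup_le]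
    intro b hb
    have := Multiset.le_sum_of_mem hb
    rwa [π.parts_sum] at this
  rw [partitionRank]
  omega

lemma rankGePos_of_le {r n : ℕ} (h : n ≤ r) : rankGePos r n = 0 := by
  unfold rankGePos
  split_ifs with h0
  · rfl
  · rw [rankGe, card_eq_zero, filter_eq_empty_iff]
    intro π _
    have := rank_bounds h0 π
    omega

lemma rankGePos_add (r m : ℕ) :
    rankGePos r (m + (r + 1)) + rankGePos (r + 3) m = Fintype.card (Nat.Partition m) := by
  have h1 := rankGe_eq_rankLe (r : ℤ) (n := m + (r + 1)) (m := m) (by omega) (by push_cast; ring)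
  have h2 := rankLe_add_rankGe ((r : ℤ) + 2) m
  have h3 : rankGePos (r + 3) m = rankGe ((r : ℤ) + 2 + 1) m := by
    unfold rankGePos
    split_ifs with h
    · subst h; rw [rankGe_zero (by omega)]
    · norm_num [add_assoc]
  rw [h3, ← h2, ← h1, rankGePos, if_neg (by omega)]

lemma rankLe_neg_succ (r : ℕ) : rankLe (-(r : ℤ)) (r + 1) = 1 := by
  rw [rankLe, card_eq_one]
  refine ⟨⟨Multiset.replicate (r + 1) 1, ?_, ?_⟩, ?_⟩
  · intro i hi
    rw [Multiset.eq_of_mem_replicate hi]; exact one_pos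
  · simp [add_comm]
  · rw [eq_singleton_iff_unique_mem]
    constructor
    · refine mem_filter.mpr ⟨mem_univ _, ?_⟩
      have : (Multiset.replicate (r + 1) 1).sup ≤ 1 := by
        rw [Multiset.sup_le]; intro b hb; exact (Multiset.eq_of_mem_replicate hb).le
      simp only [partitionRank, Multiset.card_replicate]
      omega
    · intro π hπ
      have hr := (mem_filter.mp hπ).2
      rw [partitionRank] at hr
      have h3 : Multiset.card π.parts ≤ r + 1 := by
        have := Multiset.card_nsmul_le_sum (s := π.parts) (a := 1) fun x hx => π.parts_pos hx
        simpa [π.parts_sum] using this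
      have h5 : π.parts = Multiset.replicate (Multiset.card π.parts) 1 := by
        rw [Multiset.eq_replicate]
        refine ⟨rfl, fun b hb => ?_⟩
        have h6 := Multiset.le_sup hb
        have h7 := π.parts_pos hb
        omega
      have h6 := π.parts_sum
      rw [h5, Multiset.sum_replicate, smul_eq_mul, mul_one] at h6
      exact Nat.Partition.ext (by rw [h5, h6])

/-- The distribution of the rank is symmetric. -/
lemma rankLe_neg (n : ℕ) : ∀ r : ℕ, n ≠ 0 → rankLe (-(r : ℤ)) n = rankGePos r n := by
  induction n using Nat.strong_induction_on with
  | _ n ih =>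
    intro r hn
    rcases lt_trichotomy n (r + 1) with h | h | h
    · rw [rankGePos_of_le (by omega), rankLe, card_eq_zero, filter_eq_empty_iff]
      intro π _
      have := rank_bounds hn π
      omega
    · subst h
      rw [rankLe_neg_succ]
      have := rankGePos_add r 0
      rw [zero_add, rankGePos_of_le (Nat.zero_le _)] at this
      simpa using this.symm
    · obtain ⟨m, rfl⟩ : ∃ m, n = m + (r + 1) := ⟨n - (r + 1), by omega⟩
      have hm : m ≠ 0 := by omega
      have h1 := rankGe_eq_rankLe (-(r : ℤ) - 2) (n := m) (m := m + (r + 1)) hm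
        (by push_cast; ring)
      have h2 := rankLe_add_rankGe (-(r : ℤ) - 3) m
      have h3 := ih m (by omega) (r + 3) hm
      have h4 := rankGePos_add r m
      have e1 : -(r : ℤ) - 2 + 2 = -r := by ring
      have e2 : -(r : ℤ) - 3 + 1 = -r - 2 := by ring
      have e3 : -((r + 3 : ℕ) : ℤ) = -(r : ℤ) - 3 := by push_cast; ring
      rw [e1] at h1
      rw [e2] at h2
      rw [e3] at h3
      omega

lemma rankGePos_zero_add_one {n : ℕ} (hn : n ≠ 0) :
    rankGePos 0 n + rankGePos 1 n = Fintype.card (Nat.Partition n) := by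
  have h1 := rankLe_add_rankGe (-1) n
  have h2 := rankLe_neg n 1 hn
  have h3 : rankGePos 0 n = rankGe 0 n := by simp [rankGePos, hn]
  simp at h1 h2
  omega

lemma card_rank_eq {n : ℕ} (r : ℕ) (hn : n ≠ 0) :
    (univ.filter fun π : Nat.Partition n => partitionRank π = r).card + rankGePos (r + 1) n
      = rankGePos r n := by
  simp only [rankGePos, hn, if_false, rankGe]
  rw [← card_union_of_disjoint]
  · congr 1; ext π; simp; omega
  · rw [disjoint_filter]; intro π _ h; omega

lemma card_rank_eq_neg {n : ℕ} (r : ℕ) (hn : n ≠ 0) :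
    (univ.filter fun π : Nat.Partition n => partitionRank π = -r).card + rankGePos (r + 1) n
      = rankGePos r n := by
  rw [← rankLe_neg n _ hn, ← rankLe_neg n _ hn]
  simp only [rankLe]
  rw [← card_union_of_disjoint]
  · congr 1; ext π; simp; omega
  · rw [disjoint_filter]; intro π _ h; omega

/-- `∑ j, rankGePos (r + 11 j) n`. -/
def rankTail (r n : ℕ) : ℕ := ∑ j ∈ range (n + 1), rankGePos (r + 11 * j) n

lemma rankCount_eq {n : ℕ} (a : ℕ) (ha : a ≤ 10) (hn : n ≠ 0) :
    rankCount a 11 n + rankTail (a + 1) n + rankTail (12 - a) n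
      = rankTail a n + rankTail (11 - a) n := by
  have h1 : rankCount a 11 n =
      ∑ j ∈ range (n + 1), (univ.filter fun π : Nat.Partition n =>
          partitionRank π = ((a + 11 * j : ℕ) : ℤ)).card +
      ∑ j ∈ range (n + 1), (univ.filter fun π : Nat.Partition n =>
          partitionRank π = -((11 - a + 11 * j : ℕ) : ℤ)).card := by
    rw [rankCount, ← card_biUnion, ← card_biUnion, ← card_union_of_disjoint]
    · congr 1
      ext π
      have := rank_bounds hn π
      simp only [mem_filter, mem_univ, true_and, mem_union, mem_biUnion, mem_range]
      constructor
      · intro h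
        rcases le_or_gt 0 (partitionRank π) with h0 | h0
        · exact Or.inl ⟨(partitionRank π / 11).toNat, by omega, by omega⟩
        · exact Or.inr ⟨((-partitionRank π - (11 - a : ℕ)) / 11).toNat, by omega, by omega⟩
      · rintro (⟨j, hj, h⟩ | ⟨j, hj, h⟩) <;> omega
    · rw [disjoint_left]
      intro π h h'
      simp only [mem_biUnion, mem_filter, mem_univ, true_and] at h h'
      obtain ⟨j, _, h⟩ := h
      obtain ⟨j', _, h'⟩ := h'
      omega
    · intro i _ j _ hij
      rw [Function.onFun, disjoint_filter]
      intro π _ h; omega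
    · intro i _ j _ hij
      rw [Function.onFun, disjoint_filter]
      intro π _ h; omega
  have h2 := fun j => card_rank_eq (n := n) (a + 11 * j) hn
  have h3 := fun j => card_rank_eq_neg (n := n) (11 - a + 11 * j) hn
  rw [h1]
  simp only [rankTail]
  rw [← sum_congr rfl fun j _ => h2 j, ← sum_congr rfl fun j _ => h3 j, sum_add_distrib,
    sum_add_distrib]
  have e1 : ∀ j, a + 11 * j + 1 = a + 1 + 11 * j := fun j => by ring
  have e2 : ∀ j, 11 - a + 11 * j + 1 = 12 - a + 11 * j := fun j => by omega
  simp only [e1, e2]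
  ring

open Filter Topology

lemma exp_mul_natCast (w : ℝ) (n : ℕ) : Real.exp (w * n) = Real.exp w ^ n := by
  rw [mul_comm, Real.exp_nat_mul]

lemma two_mul_exp_lt_one {w : ℝ} (hw : w ≤ -1) : 2 * Real.exp w < 1 := by
  have h1 : Real.exp w ≤ Real.exp (-1) := Real.exp_le_exp.mpr hw
  have h2 : Real.exp (-1) < 1 / 2 := by
    rw [Real.exp_neg, inv_lt_comm₀ (Real.exp_pos _) (by norm_num)]
    have := Real.exp_one_gt_d9
    norm_num; linarith
  linarith

lemma summable_exp_mul {w : ℝ} (hw : w < 0) : Summable fun n : ℕ => Real.exp (w * n) := by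
  simp only [exp_mul_natCast]
  exact summable_geometric_of_lt_one (Real.exp_pos _).le (Real.exp_lt_one_iff.mpr hw)

lemma summable_of_le_card {w : ℝ} (hw : w ≤ -1) {f : ℕ → ℝ} (h0 : ∀ n, 0 ≤ f n)
    (hf : ∀ n, f n ≤ Fintype.card (Nat.Partition n)) :
    Summable fun n : ℕ => f n * Real.exp (w * n) := by
  refine Summable.of_nonneg_of_le (fun n => mul_nonneg (h0 n) (Real.exp_pos _).le) (fun n => ?_)
    (summable_geometric_of_lt_one (r := 2 * Real.exp w) (by positivity) (two_mul_exp_lt_one hw))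
  have h1 : (Fintype.card (Nat.Partition n) : ℝ) ≤ 2 ^ n := by
    exact_mod_cast card_partition_le n
  rw [mul_pow, exp_mul_natCast]
  exact mul_le_mul_of_nonneg_right ((hf n).trans h1) (by positivity)

/-- The generating function of the partition numbers, at `q = exp w`. -/
noncomputable def partGF (w : ℝ) : ℝ :=
  ∑' n : ℕ, (Fintype.card (Nat.Partition n) : ℝ) * Real.exp (w * n)

/-- The generating function of `rankGePos r`, at `q = exp w`. -/
noncomputable def rankGF (r : ℕ) (w : ℝ) : ℝ :=
  ∑' n : ℕ, (rankGePos r n : ℝ) * Real.exp (w * n)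

lemma summable_partGF {w : ℝ} (hw : w ≤ -1) :
    Summable fun n : ℕ => (Fintype.card (Nat.Partition n) : ℝ) * Real.exp (w * n) :=
  summable_of_le_card hw (fun _ => Nat.cast_nonneg _) fun _ => le_rfl

lemma summable_rankGF {w : ℝ} (hw : w ≤ -1) (r : ℕ) :
    Summable fun n : ℕ => (rankGePos r n : ℝ) * Real.exp (w * n) :=
  summable_of_le_card hw (fun _ => Nat.cast_nonneg _) fun n => by exact_mod_cast rankGePos_le r n

lemma rankGF_nonneg (r : ℕ) (w : ℝ) : 0 ≤ rankGF r w :=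
  tsum_nonneg fun _ => by positivity

lemma rankGF_le {w : ℝ} (hw : w ≤ -1) (r : ℕ) : rankGF r w ≤ partGF w :=
  (summable_rankGF hw r).tsum_le_tsum (fun n => mul_le_mul_of_nonneg_right
    (by exact_mod_cast rankGePos_le r n) (Real.exp_pos _).le) (summable_partGF hw)

lemma rankGF_rec {w : ℝ} (hw : w ≤ -1) (r : ℕ) :
    rankGF r w = Real.exp (w * (r + 1)) * (partGF w - rankGF (r + 3) w) := by
  rw [rankGF, ← (summable_rankGF hw r).sum_add_tsum_nat_add (r + 1), sum_eq_zero, zero_add,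
    partGF, rankGF, ← (summable_partGF hw).tsum_sub (summable_rankGF hw _), ← tsum_mul_left]
  · refine tsum_congr fun m => ?_
    have : (rankGePos r (m + (r + 1)) : ℝ) + rankGePos (r + 3) m = Fintype.card (Nat.Partition m) := by
      exact_mod_cast rankGePos_add r m
    rw [← this]
    push_cast
    rw [mul_add, Real.exp_add]
    ring
  · intro n hn
    rw [rankGePos_of_le (by have := mem_range.mp hn; omega)]
    simp

lemma rankGF_iterate {w : ℝ} (hw : w ≤ -1) (r K : ℕ) :
    rankGF r w = partGF w * ∑ k ∈ range K,
        (-1) ^ k * Real.exp (w * ((k + 1) * (3 * k + 2) / 2 + r * (k + 1)))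
      + (-1) ^ K * Real.exp (w * (K * (3 * K - 1) / 2 + r * K)) * rankGF (r + 3 * K) w := by
  induction K with
  | zero => simp
  | succ K ih =>
    have e1 : ((K : ℝ) + 1) * (3 * K + 2) / 2 + r * (K + 1)
        = K * (3 * K - 1) / 2 + r * K + ((r + 3 * K : ℕ) + 1) := by push_cast; ring
    have e2 : ((K + 1 : ℕ) : ℝ) * (3 * (K + 1 : ℕ) - 1) / 2 + r * (K + 1 : ℕ)
        = K * (3 * K - 1) / 2 + r * K + ((r + 3 * K : ℕ) + 1) := by push_cast; ring
    have e3 : Real.exp (w * (K * (3 * K - 1) / 2 + r * K + ((r + 3 * K : ℕ) + 1)))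
        = Real.exp (w * (K * (3 * K - 1) / 2 + r * K)) * Real.exp (w * ((r + 3 * K : ℕ) + 1)) := by
      rw [mul_add w (_ / 2 + _), Real.exp_add]
    rw [ih, sum_range_succ, rankGF_rec hw (r + 3 * K), e1, e2, e3,
      show r + 3 * (K + 1) = r + 3 * K + 3 by ring]
    ring

/-- `∑_{k ≥ 1} (-1)^(k-1) q^(k(3k-1)/2 + r k)`. -/
noncomputable def pentTail (r w : ℝ) : ℝ :=
  ∑' k : ℕ, (-1) ^ k * Real.exp (w * ((k + 1) * (3 * k + 2) / 2 + r * (k + 1)))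

lemma summable_pentTail {w : ℝ} (hw : w < 0) {r : ℝ} (hr : 0 ≤ r) :
    Summable fun k : ℕ =>
      (-1 : ℝ) ^ k * Real.exp (w * ((k + 1) * (3 * k + 2) / 2 + r * (k + 1))) := by
  refine Summable.of_norm_bounded (summable_exp_mul hw) fun k => ?_
  rw [norm_mul, norm_pow, norm_neg, norm_one, one_pow, one_mul, Real.norm_eq_abs, Real.abs_exp]
  refine Real.exp_le_exp.mpr (mul_le_mul_of_nonpos_left ?_ hw.le)
  have : (0 : ℝ) ≤ k := Nat.cast_nonneg k
  nlinarith [mul_nonneg hr this]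

lemma rankGF_eq {w : ℝ} (hw : w ≤ -1) (r : ℕ) : rankGF r w = partGF w * pentTail r w := by
  have hw0 : w < 0 := by linarith
  have h1 := ((summable_pentTail hw0 (r := r) (Nat.cast_nonneg r)).hasSum.tendsto_sum_nat).const_mul
    (partGF w)
  have h2 : Tendsto (fun K : ℕ => (-1) ^ K * Real.exp (w * (K * (3 * K - 1) / 2 + r * K))
      * rankGF (r + 3 * K) w) atTop (𝓝 0) := by
    refine squeeze_zero_norm (a := fun K : ℕ => Real.exp (w * K) * partGF w) (fun K => ?_) ?_
    · rw [norm_mul, norm_mul, norm_pow, norm_neg, norm_one, one_pow, one_mul, Real.norm_eq_abs,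
        Real.abs_exp, Real.norm_eq_abs, abs_of_nonneg (rankGF_nonneg _ _)]
      refine mul_le_mul (Real.exp_le_exp.mpr (mul_le_mul_of_nonpos_left ?_ hw0.le))
        (rankGF_le hw _) (rankGF_nonneg _ _) (Real.exp_pos _).le
      have h3 : (0 : ℝ) ≤ r * K := by positivity
      rcases Nat.eq_zero_or_pos K with h | h
      · subst h; simp
      · have h4 : (1 : ℝ) ≤ K := by exact_mod_cast h
        nlinarith
    · simpa using (summable_exp_mul hw0).tendsto_atTop_zero.mul_const (partGF w)
  have h3 := h1.add h2
  simp only [← rankGF_iterate hw] at h3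
  simpa [pentTail] using tendsto_nhds_unique tendsto_const_nhds h3

/-- The pentagonal number series. -/
noncomputable def pent (w : ℝ) : ℝ := 1 - pentTail 0 w - pentTail 1 w

theorem pent_mul_partGF {w : ℝ} (hw : w ≤ -1) : pent w * partGF w = 1 := by
  have h0 := rankGF_eq hw 0
  have h1 := rankGF_eq hw 1
  have h2 : rankGF 0 w + rankGF 1 w = partGF w - 1 := by
    rw [rankGF, rankGF, ← (summable_rankGF hw 0).tsum_add (summable_rankGF hw 1), partGF,
      (summable_partGF hw).tsum_eq_zero_add, Summable.tsum_eq_zero_add]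
    · have : ∀ n : ℕ, (rankGePos 0 (n + 1) : ℝ) * Real.exp (w * (n + 1 : ℕ)) +
          (rankGePos 1 (n + 1) : ℝ) * Real.exp (w * (n + 1 : ℕ)) =
          (Fintype.card (Nat.Partition (n + 1)) : ℝ) * Real.exp (w * (n + 1 : ℕ)) := by
        intro n
        rw [← add_mul]
        congr 1
        exact_mod_cast rankGePos_zero_add_one (Nat.succ_ne_zero n)
      rw [tsum_congr this]
      simp [rankGePos]
    · exact (summable_rankGF hw 0).add (summable_rankGF hw 1)
  rw [pent]
  push_cast at h0 h1
  linear_combination -h2 + h0 + h1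

/-- `∑_{k ≥ 1} (-1)^(k-1) q^(k(3k-1)/2 + r k) / (1 - q^(11 k))`. -/
noncomputable def lambertTail (r w : ℝ) : ℝ :=
  ∑' k : ℕ, (-1) ^ k * Real.exp (w * ((k + 1) * (3 * k + 2) / 2 + r * (k + 1)))
    / (1 - Real.exp (w * (11 * (k + 1))))

lemma hasSum_pentTail {w : ℝ} (hw : w < 0) {r : ℝ} (hr : 0 ≤ r) :
    HasSum (fun j : ℕ => pentTail (r + 11 * j) w) (lambertTail r w) := by
  have hE := Real.exp_pos w
  let f : ℕ → ℕ → ℝ := fun k j =>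
    (-1) ^ k * Real.exp (w * ((k + 1) * (3 * k + 2) / 2 + (r + 11 * j) * (k + 1)))
  have hs : Summable (Function.uncurry f) := by
    have h1 := (summable_exp_mul hw).mul_of_nonneg (summable_exp_mul hw)
      (fun _ => (Real.exp_pos _).le) (fun _ => (Real.exp_pos _).le)
    refine Summable.of_norm_bounded h1 fun ⟨k, j⟩ => ?_
    simp only [Function.uncurry_apply_pair, f]
    rw [norm_mul, norm_pow, norm_neg, norm_one, one_pow, one_mul, Real.norm_eq_abs, Real.abs_exp,
      ← Real.exp_add, ← mul_add]
    refine Real.exp_le_exp.mpr (mul_le_mul_of_nonpos_left ?_ hw.le)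
    have h2 : (0 : ℝ) ≤ k := Nat.cast_nonneg k
    have h3 : (0 : ℝ) ≤ j := Nat.cast_nonneg j
    nlinarith [mul_nonneg hr h2, mul_nonneg h2 h3]
  have hg : ∀ k : ℕ, HasSum (f k)
      ((-1) ^ k * Real.exp (w * ((k + 1) * (3 * k + 2) / 2 + r * (k + 1)))
        / (1 - Real.exp (w * (11 * (k + 1))))) := by
    intro k
    have h1 := (hasSum_geometric_of_lt_one (r := Real.exp (w * (11 * (k + 1))))
      (Real.exp_pos _).le (Real.exp_lt_one_iff.mpr (mul_neg_of_neg_of_pos hw (by positivity)))).mul_left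
        ((-1) ^ k * Real.exp (w * ((k + 1) * (3 * k + 2) / 2 + r * (k + 1))))
    rw [← div_eq_mul_inv] at h1
    have e : f k = fun j : ℕ => (-1) ^ k * Real.exp (w * ((k + 1) * (3 * k + 2) / 2 + r * (k + 1)))
        * Real.exp (w * (11 * (k + 1))) ^ j := by
      funext j
      simp only [f]
      rw [← Real.exp_nat_mul, mul_assoc, ← Real.exp_add]
      congr 2; ring
    rw [e]; exact h1
  have h2 : HasSum (Function.uncurry fun j k => f k j) (∑' p, Function.uncurry f p) := by
    have := (Equiv.prodComm ℕ ℕ).hasSum_iff.mpr hs.hasSum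
    exact this
  have h3 := h2.prod_fiberwise fun j =>
    (summable_pentTail hw (r := r + 11 * j) (by positivity)).hasSum
  rw [(hs.hasSum.prod_fiberwise hg).unique ((hs.hasSum.prod_fiberwise hg).summable.hasSum)] at h3
  exact h3

lemma hasSum_rankTail {w : ℝ} (hw : w ≤ -1) (r : ℕ) :
    HasSum (fun n : ℕ => (rankTail r n : ℝ) * Real.exp (w * n)) (partGF w * lambertTail r w) := by
  have hw0 : w < 0 := by linarith
  let f : ℕ → ℕ → ℝ := fun j n => (rankGePos (r + 11 * j) n : ℝ) * Real.exp (w * n)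
  have h1 : ∀ j, HasSum (f j) (partGF w * pentTail (r + 11 * j) w) := by
    intro j
    have := rankGF_eq hw (r + 11 * j)
    push_cast at this
    rw [← this]
    exact (summable_rankGF hw _).hasSum
  have h2 := (hasSum_pentTail hw0 (r := r) (Nat.cast_nonneg r)).mul_left (partGF w)
  have h3 : Summable (Function.uncurry f) := by
    rw [summable_prod_of_nonneg]
    · exact ⟨fun j => (h1 j).summable, h2.summable.congr fun j => (h1 j).tsum_eq.symm⟩
    · rintro ⟨j, n⟩
      simp only [Function.uncurry_apply_pair, f, Pi.zero_apply]
      positivity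
  have h4 : HasSum (Function.uncurry fun n j => f j n) (∑' p, Function.uncurry f p) :=
    (Equiv.prodComm ℕ ℕ).hasSum_iff.mpr h3.hasSum
  rw [h2.unique (h3.hasSum.prod_fiberwise h1)]
  refine h4.prod_fiberwise fun n => ?_
  have h5 : (rankTail r n : ℝ) * Real.exp (w * n) = ∑ j ∈ range (n + 1), f j n := by
    simp only [rankTail, f]; push_cast; rw [sum_mul]
  rw [h5]
  refine hasSum_sum_of_ne_finset_zero fun j hj => ?_
  have : rankGePos (r + 11 * j) n = 0 :=
    rankGePos_of_le (by rw [mem_range] at hj; omega)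
  simp [f, this]

/-- The Lambert series `D_i`. -/
noncomputable def lambert (i w : ℝ) : ℝ :=
  ∑' k : ℕ, (-1) ^ (k + 1) * Real.exp (w * (3 * (k + 1) ^ 2 / 2 + 11 * (k + 1) / 2))
    * (Real.exp (-(w * (i * (k + 1)))) - Real.exp (w * (i * (k + 1))))
    / (1 - Real.exp (w * (11 * (k + 1))))

lemma summable_lambertTail {w : ℝ} (hw : w < 0) {r : ℝ} (hr : 0 ≤ r) :
    Summable fun k : ℕ => (-1) ^ k * Real.exp (w * ((k + 1) * (3 * k + 2) / 2 + r * (k + 1)))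
      / (1 - Real.exp (w * (11 * (k + 1)))) := by
  refine Summable.of_norm_bounded ((summable_exp_mul hw).mul_right (1 - Real.exp w)⁻¹)
    fun k => ?_
  have h0 : (0 : ℝ) ≤ k := Nat.cast_nonneg k
  have h1 : Real.exp (w * (11 * (k + 1))) ≤ Real.exp w := Real.exp_le_exp.mpr (by nlinarith)
  have h2 := Real.exp_lt_one_iff.mpr hw
  rw [norm_div, norm_mul, norm_pow, norm_neg, norm_one, one_pow, one_mul, Real.norm_eq_abs,
    Real.abs_exp, div_eq_mul_inv, Real.norm_eq_abs, abs_of_pos (by linarith)]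
  refine mul_le_mul (Real.exp_le_exp.mpr (mul_le_mul_of_nonpos_left ?_ hw.le))
    (inv_anti₀ (by linarith) (by linarith)) (by rw [inv_nonneg]; linarith) (Real.exp_pos _).le
  nlinarith [mul_nonneg hr h0]

lemma lambert_sub {w : ℝ} (hw : w < 0) {a : ℝ} (ha : 0 ≤ a) (ha' : a ≤ 11) :
    lambertTail a w - lambertTail (a + 1) w + lambertTail (11 - a) w - lambertTail (12 - a) w
      = lambert (5 - a) w - lambert (6 - a) w := by
  have key : ∀ k : ℕ, ∀ b : ℝ, (-1) ^ (k + 1) * Real.exp (w * (3 * (k + 1) ^ 2 / 2 + 11 * (k + 1) / 2))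
    * (Real.exp (-(w * ((6 - b) * (k + 1)))) - Real.exp (w * ((6 - b) * (k + 1))))
    / (1 - Real.exp (w * (11 * (k + 1)))) =
    (-1) ^ k * Real.exp (w * ((k + 1) * (3 * k + 2) / 2 + (12 - b) * (k + 1)))
      / (1 - Real.exp (w * (11 * (k + 1)))) -
    (-1) ^ k * Real.exp (w * ((k + 1) * (3 * k + 2) / 2 + b * (k + 1)))
      / (1 - Real.exp (w * (11 * (k + 1)))) := by
    intro k b
    rw [mul_assoc, mul_sub, ← Real.exp_add, ← Real.exp_add, pow_succ]
    ring_nf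
  have h6 : ∀ b : ℝ, 0 ≤ b → b ≤ 12 →
      lambert (6 - b) w = lambertTail (12 - b) w - lambertTail b w := by
    intro b hb hb'
    rw [lambert, tsum_congr fun k => key k b,
      (summable_lambertTail hw (by linarith)).tsum_sub (summable_lambertTail hw hb)]
    rfl
  have e1 := h6 a ha (by linarith)
  have e2 := h6 (a + 1) (by linarith) (by linarith)
  rw [show 6 - (a + 1) = 5 - a by ring, show 12 - (a + 1) = 11 - a by ring] at e2
  rw [e1, e2]; ring

theorem hasSum_rankCount {w : ℝ} (hw : w ≤ -1) (a : ℕ) (ha : a ≤ 10) :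
    HasSum (fun n : ℕ => (if n = 0 then 0 else (rankCount a 11 n : ℝ)) * Real.exp (w * n))
      (partGF w * (lambert (5 - a) w - lambert (6 - a) w)) := by
  have hw0 : w < 0 := by linarith
  have ha' : (a : ℝ) ≤ 10 := by exact_mod_cast ha
  rw [← lambert_sub hw0 (Nat.cast_nonneg a) (by linarith)]
  have h1 := hasSum_rankTail hw a
  have h2 := hasSum_rankTail hw (a + 1)
  have h3 := hasSum_rankTail hw (11 - a)
  have h4 := hasSum_rankTail hw (12 - a)
  have h5 := ((h1.sub h2).add h3).sub h4
  rw [Nat.cast_sub (by omega), Nat.cast_sub (by omega)] at h5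
  push_cast at h5
  have e : partGF w * (lambertTail a w - lambertTail (a + 1) w + lambertTail (11 - a) w
        - lambertTail (12 - a) w) = partGF w * lambertTail a w - partGF w * lambertTail (a + 1) w
        + partGF w * lambertTail (11 - a) w - partGF w * lambertTail (12 - a) w := by ring
  rw [e]
  refine h5.congr_fun fun n => ?_
  split_ifs with hn
  · subst hn
    simp [rankTail, rankGePos]
  · have h6 : (rankCount a 11 n : ℝ) + rankTail (a + 1) n + rankTail (12 - a) n
      = rankTail a n + rankTail (11 - a) n := by exact_mod_cast rankCount_eq a ha hn
    linear_combination Real.exp (w * n) * h6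

/-- `q ^ x` where `q = exp w`. -/
noncomputable def qpow (w : ℝ) (x : ℂ) : ℂ := Complex.exp (w * x)

lemma qpow_add (w : ℝ) (x y : ℂ) : qpow w (x + y) = qpow w x * qpow w y := by
  rw [qpow, mul_add, Complex.exp_add]; rfl

lemma qpow_zero (w : ℝ) : qpow w 0 = 1 := by simp [qpow]

lemma qpow_ne_zero (w : ℝ) (x : ℂ) : qpow w x ≠ 0 := Complex.exp_ne_zero _

lemma qpow_neg (w : ℝ) (x : ℂ) : qpow w (-x) = (qpow w x)⁻¹ := by
  rw [qpow, mul_neg, Complex.exp_neg]; rfl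

lemma norm_qpow (w : ℝ) (x : ℂ) : ‖qpow w x‖ = Real.exp (w * x.re) := by
  rw [qpow, Complex.norm_exp]; simp

lemma qpow_ofReal (w x : ℝ) : qpow w x = (Real.exp (w * x) : ℝ) := by
  rw [qpow]; push_cast; rfl

lemma hasDerivAt_qpow (w : ℝ) (x : ℂ) : HasDerivAt (qpow w) (w * qpow w x) x := by
  have h := ((hasDerivAt_id x).const_mul (w : ℂ)).cexp
  simp only [id, mul_one] at h
  rw [mul_comm]; exact h

@[fun_prop]
lemma differentiable_qpow (w : ℝ) : Differentiable ℂ (qpow w) := fun x =>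
  (hasDerivAt_qpow w x).differentiableAt

lemma summable_exp_mul_abs {w : ℝ} (hw : w < 0) :
    Summable fun n : ℤ => Real.exp (w * |(n : ℝ)|) := by
  refine Summable.of_nat_of_neg ?_ ?_
  · simpa using summable_exp_mul hw
  · simpa using summable_exp_mul hw

lemma quad_lower {α B β n : ℝ} (hα : 0 < α) (hβ : |β| ≤ B) :
    |n| - (B + 1) ^ 2 / (4 * α) ≤ α * n ^ 2 + β * n := by
  have h1 : -(B * |n|) ≤ β * n := by
    have : |β * n| ≤ B * |n| := by
      rw [abs_mul]; exact mul_le_mul_of_nonneg_right hβ (abs_nonneg n)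
    linarith [neg_abs_le (β * n)]
  have h2 : (B + 1) * |n| - (B + 1) ^ 2 / (4 * α) ≤ α * n ^ 2 := by
    rw [sub_le_iff_le_add, ← sub_le_iff_le_add', le_div_iff₀ (by positivity), ← sq_abs n]
    nlinarith [sq_nonneg (2 * α * |n| - (B + 1))]
  linarith

lemma summable_gauss {w : ℝ} (hw : w < 0) {α : ℝ} (hα : 0 < α) (β γ : ℝ) :
    Summable fun n : ℤ => Real.exp (w * (α * n ^ 2 + β * n + γ)) := by
  refine Summable.of_nonneg_of_le (fun _ => (Real.exp_pos _).le) (fun n => ?_)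
    ((summable_exp_mul_abs hw).mul_left (Real.exp (w * (γ - (|β| + 1) ^ 2 / (4 * α)))))
  rw [← Real.exp_add, ← mul_add]
  refine Real.exp_le_exp.mpr (mul_le_mul_of_nonpos_left ?_ hw.le)
  linarith [quad_lower (n := n) hα (le_refl |β|)]

/-- The theta series `∑ s ^ n q ^ (κ (11 (n + δ) + v)²)`. -/
noncomputable def gtheta (s : ℂ) (κ δ : ℝ) (w : ℝ) (v : ℂ) : ℂ :=
  ∑' n : ℤ, s ^ n * qpow w (κ * (11 * (n + δ) + v) ^ 2)

lemma norm_zpow_of_sq_eq_one {s : ℂ} (hs : s ^ 2 = 1) (n : ℤ) : ‖s ^ n‖ = 1 := by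
  have : ‖s‖ = 1 := by
    have h : ‖s‖ ^ 2 = 1 := by rw [← norm_pow, hs, norm_one]
    nlinarith [norm_nonneg s]
  rw [norm_zpow, this, one_zpow]

lemma norm_gtheta_term {s : ℂ} (hs : s ^ 2 = 1) (κ δ w : ℝ) (v : ℂ) (n : ℤ) :
    ‖s ^ n * qpow w (κ * (11 * (n + δ) + v) ^ 2)‖ =
      Real.exp (w * (121 * κ * n ^ 2 + 22 * κ * (11 * δ + v.re) * n
        + κ * ((11 * δ + v.re) ^ 2 - v.im ^ 2))) := by
  rw [norm_mul, norm_zpow_of_sq_eq_one hs, one_mul, norm_qpow]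
  congr 2
  simp [sq]
  ring

lemma summable_gtheta {s : ℂ} (hs : s ^ 2 = 1) {κ w : ℝ} (hκ : 0 < κ) (hw : w < 0) (δ : ℝ)
    (v : ℂ) : Summable fun n : ℤ => s ^ n * qpow w (κ * (11 * (n + δ) + v) ^ 2) := by
  refine Summable.of_norm ?_
  simp only [norm_gtheta_term hs]
  exact summable_gauss hw (by positivity) _ _

lemma differentiable_gtheta {s : ℂ} (hs : s ^ 2 = 1) {κ w : ℝ} (hκ : 0 < κ) (hw : w < 0)
    (δ : ℝ) : Differentiable ℂ (gtheta s κ δ w) := by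
  intro v₀
  let M := ‖v₀‖ + 1
  let B := 22 * κ * (11 * |δ| + M)
  have h := Complex.differentiableOn_tsum_of_summable_norm (U := Metric.ball 0 M)
    (F := fun (n : ℤ) v => s ^ n * qpow w (κ * (11 * (n + δ) + v) ^ 2))
    (u := fun n : ℤ => Real.exp (w * (-κ * M ^ 2 - (B + 1) ^ 2 / (4 * (121 * κ))))
      * Real.exp (w * |(n : ℝ)|))
    ((summable_exp_mul_abs hw).mul_left _) (fun n => by fun_prop) Metric.isOpen_ball ?_
  · exact h.differentiableAt (Metric.isOpen_ball.mem_nhds (by simp [M]))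
  · intro n v hv
    have hv' : ‖v‖ < M := by simpa using hv
    have h1 := Complex.abs_re_le_norm v
    have h2 := Complex.abs_im_le_norm v
    have hM : 0 ≤ M := by positivity
    rw [norm_gtheta_term hs, ← Real.exp_add, ← mul_add]
    refine Real.exp_le_exp.mpr (mul_le_mul_of_nonpos_left ?_ hw.le)
    have hβ : |22 * κ * (11 * δ + v.re)| ≤ B := by
      rw [abs_mul, abs_of_pos (by positivity : 0 < 22 * κ)]
      refine mul_le_mul_of_nonneg_left ?_ (by positivity)
      refine (abs_add_le _ _).trans ?_
      rw [abs_mul, abs_of_pos (by norm_num : (0 : ℝ) < 11)]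
      linarith
    have h3 := quad_lower (α := 121 * κ) (n := n) (by positivity) hβ
    have h4 : -κ * M ^ 2 ≤ κ * ((11 * δ + v.re) ^ 2 - v.im ^ 2) := by
      have : v.im ^ 2 ≤ M ^ 2 := by
        rw [← sq_abs v.im]; exact pow_le_pow_left₀ (abs_nonneg _) (by linarith) 2
      nlinarith [sq_nonneg (11 * δ + v.re)]
    linarith

lemma gtheta_add_eleven {s : ℂ} (hs : s ^ 2 = 1) (κ δ w : ℝ) (v : ℂ) :
    gtheta s κ δ w (v + 11) = s * gtheta s κ δ w v := by
  have hs0 : s ≠ 0 := by rintro rfl; norm_num at hs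
  rw [gtheta, gtheta, ← (Equiv.addRight (1 : ℤ)).tsum_eq
    (fun n : ℤ => s ^ n * qpow w (κ * (11 * (n + δ) + v) ^ 2)), ← tsum_mul_left]
  refine tsum_congr fun n => ?_
  simp only [Equiv.coe_addRight]
  have e : s * (s ^ (n + 1)) = s ^ n := by
    rw [zpow_add₀ hs0, zpow_one, mul_comm, mul_assoc, ← sq, hs, mul_one]
  rw [← mul_assoc, e]
  push_cast
  congr 3; ring

lemma zpow_neg_of_sq {s : ℂ} (hs : s ^ 2 = 1) (n : ℤ) : s ^ (-n) = s ^ n := by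
  rw [zpow_neg, ← inv_zpow]
  congr 1
  exact inv_eq_of_mul_eq_one_left (by rw [← sq, hs])

lemma gtheta_neg {s : ℂ} (hs : s ^ 2 = 1) (κ w : ℝ) (v : ℂ) :
    gtheta s κ 0 w (-v) = gtheta s κ 0 w v := by
  rw [gtheta, gtheta, ← (Equiv.neg ℤ).tsum_eq]
  refine tsum_congr fun n => ?_
  simp only [Equiv.neg_apply]
  rw [zpow_neg_of_sq hs]
  push_cast
  congr 2; ring

lemma gtheta_half_neg {s : ℂ} (hs : s ^ 2 = 1) (κ w : ℝ) (v : ℂ) :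
    gtheta s κ (1 / 2) w (-v) = s * gtheta s κ (1 / 2) w v := by
  have hs0 : s ≠ 0 := by rintro rfl; norm_num at hs
  rw [gtheta, gtheta, ← tsum_mul_left, ← (Equiv.subLeft (-1 : ℤ)).tsum_eq]
  refine tsum_congr fun n => ?_
  simp only [Equiv.subLeft_apply]
  rw [sub_eq_add_neg, zpow_add₀ hs0, zpow_neg_of_sq hs, zpow_neg_of_sq hs, zpow_one, mul_assoc]
  push_cast
  congr 3; ring

/-- The odd theta function `∑ (-1) ^ n q ^ ((11 (n + 1/2) + v)² / 2)`. -/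
noncomputable def theta (w : ℝ) : ℂ → ℂ := gtheta (-1) (1 / 2) (1 / 2) w

lemma theta_add_eleven (w : ℝ) (v : ℂ) : theta w (v + 11) = -theta w v := by
  rw [theta, gtheta_add_eleven (by norm_num)]; ring

lemma theta_neg (w : ℝ) (v : ℂ) : theta w (-v) = -theta w v := by
  rw [theta, gtheta_half_neg (by norm_num)]; ring

@[fun_prop]
lemma differentiable_theta {w : ℝ} (hw : w < 0) : Differentiable ℂ (theta w) :=
  differentiable_gtheta (by norm_num) (by norm_num) hw _

/-- The half period `2πi / (11 w)` of `theta`. -/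
noncomputable def eta (w : ℝ) : ℂ := 2 * Real.pi * Complex.I / (11 * w)

lemma qpow_eta {w : ℝ} (hw : w < 0) (n : ℤ) : qpow w (11 * n * eta w) = 1 := by
  have : (w : ℂ) ≠ 0 := by exact_mod_cast hw.ne
  rw [qpow, eta]
  have e : (w : ℂ) * (11 * n * (2 * Real.pi * Complex.I / (11 * w))) = n * (2 * Real.pi * Complex.I) := by
    field_simp
  rw [e, Complex.exp_int_mul_two_pi_mul_I]

lemma qpow_half_eta {w : ℝ} (hw : w < 0) : qpow w (11 / 2 * eta w) = -1 := by
  have : (w : ℂ) ≠ 0 := by exact_mod_cast hw.ne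
  rw [qpow, eta]
  have e : (w : ℂ) * (11 / 2 * (2 * Real.pi * Complex.I / (11 * w))) = Real.pi * Complex.I := by
    field_simp
  rw [e, Complex.exp_pi_mul_I]

/-- The multiplier of `theta` for the translation by `eta`. -/
noncomputable def thetaMul (w : ℝ) (v : ℂ) : ℂ := qpow w (v * eta w + eta w ^ 2 / 2)

lemma theta_add_eta {w : ℝ} (hw : w < 0) (v : ℂ) :
    theta w (v + eta w) = -(thetaMul w v * theta w v) := by
  rw [theta, gtheta, gtheta, ← neg_mul, ← tsum_mul_left]
  refine tsum_congr fun n => ?_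
  have e : ((1 / 2 : ℝ) : ℂ) * (11 * (n + (1 / 2 : ℝ)) + (v + eta w)) ^ 2 =
      11 / 2 * eta w + 11 * n * eta w + (v * eta w + eta w ^ 2 / 2)
        + ((1 / 2 : ℝ) : ℂ) * (11 * (n + (1 / 2 : ℝ)) + v) ^ 2 := by push_cast; ring
  rw [e, qpow_add, qpow_add, qpow_add, qpow_eta hw, qpow_half_eta hw, thetaMul]
  ring

/-- `q ^ (-11 v / 2) - q ^ (11 v / 2)`. -/
noncomputable def bracket (w : ℝ) (v : ℂ) : ℂ := qpow w (-(11 / 2 * v)) - qpow w (11 / 2 * v)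

/-- The Dirichlet kernel `∑_{|j| ≤ n} q ^ (11 j v)`. -/
noncomputable def dirichletKer (w : ℝ) (n : ℕ) (v : ℂ) : ℂ :=
  ∑ j ∈ range (2 * n + 1), qpow w (11 * ((j : ℂ) - n) * v)

lemma dirichletKer_mul_bracket (w : ℝ) (n : ℕ) (v : ℂ) :
    dirichletKer w n v * bracket w v =
      qpow w (-(11 * (n + 1 / 2) * v)) - qpow w (11 * (n + 1 / 2) * v) := by
  have h := Finset.sum_range_sub' (fun j : ℕ => qpow w (11 * ((j : ℂ) - n - 1 / 2) * v)) (2 * n + 1)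
  rw [dirichletKer, sum_mul]
  refine (sum_congr rfl fun j _ => ?_).trans (h.trans ?_)
  · rw [bracket, mul_sub, ← qpow_add, ← qpow_add]
    push_cast
    congr 2 <;> ring
  · push_cast
    congr 2 <;> ring

lemma dirichletKer_neg (w : ℝ) (n : ℕ) (v : ℂ) : dirichletKer w n (-v) = dirichletKer w n v := by
  rw [dirichletKer, dirichletKer, ← Finset.sum_range_reflect]
  refine sum_congr rfl fun j hj => ?_
  have hj' : j ≤ 2 * n := by have := mem_range.mp hj; omega
  rw [show 2 * n + 1 - 1 - j = 2 * n - j by omega, Nat.cast_sub hj']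
  push_cast
  congr 1; ring

lemma dirichletKer_add_eta {w : ℝ} (hw : w < 0) (n : ℕ) (v : ℂ) :
    dirichletKer w n (v + eta w) = dirichletKer w n v := by
  refine sum_congr rfl fun j _ => ?_
  have := qpow_eta hw ((j : ℤ) - n)
  push_cast at this
  rw [mul_add, qpow_add, this, mul_one]

lemma norm_dirichletKer_le {w : ℝ} (hw : w < 0) (n : ℕ) (v : ℂ) :
    ‖dirichletKer w n v‖ ≤ (2 * n + 1) * Real.exp (-(11 * w * n * |v.re|)) := by
  refine (norm_sum_le _ _).trans ?_
  have h : ∀ j ∈ range (2 * n + 1), ‖qpow w (11 * ((j : ℂ) - n) * v)‖ ≤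
      Real.exp (-(11 * w * n * |v.re|)) := by
    intro j hj
    have hj' : (j : ℝ) ≤ 2 * n := by
      have := mem_range.mp hj
      exact_mod_cast (by omega : j ≤ 2 * n)
    have hj0 : (0 : ℝ) ≤ j := Nat.cast_nonneg j
    rw [norm_qpow]
    refine Real.exp_le_exp.mpr ?_
    have e : (11 * ((j : ℂ) - n) * v).re = 11 * (j - n) * v.re := by simp
    rw [e]
    have h2 : |((j : ℝ) - n) * v.re| ≤ n * |v.re| := by
      rw [abs_mul]
      refine mul_le_mul_of_nonneg_right (abs_le.mpr ⟨?_, ?_⟩) (abs_nonneg _) <;> linarith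
    nlinarith [neg_abs_le (((j : ℝ) - n) * v.re)]
  refine (sum_le_card_nsmul _ _ _ h).trans ?_
  rw [card_range, nsmul_eq_mul]
  push_cast; rfl

/-- The terms of the series defining `sigma`. -/
noncomputable def sigmaTerm (w : ℝ) (n : ℕ) (v : ℂ) : ℂ :=
  -((-1) ^ n * qpow w (v ^ 2 / 2 + 121 * (n + 1 / 2) ^ 2 / 2) * dirichletKer w n v)

/-- The entire function `theta / bracket`. -/
noncomputable def sigma (w : ℝ) (v : ℂ) : ℂ := ∑' n : ℕ, sigmaTerm w n v

lemma norm_sigmaTerm_le {w : ℝ} (hw : w ≤ -1) (n : ℕ) (v : ℂ) :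
    ‖sigmaTerm w n v‖ ≤ Real.exp (-(w * ‖v‖ ^ 2 / 2)) * Real.exp (w * n) := by
  have hw0 : w < 0 := by linarith
  have hn : (0 : ℝ) ≤ n := Nat.cast_nonneg n
  rw [sigmaTerm, norm_neg, norm_mul, norm_mul, norm_pow, norm_neg, norm_one, one_pow, one_mul,
    norm_qpow]
  have h1 : (2 * n + 1 : ℝ) ≤ Real.exp (-(2 * w * n)) := by
    have := Real.add_one_le_exp (-(2 * w * n))
    nlinarith
  have h2 := (norm_dirichletKer_le hw0 n v).trans
    (mul_le_mul_of_nonneg_right h1 (Real.exp_pos _).le)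
  refine (mul_le_mul_of_nonneg_left h2 (Real.exp_pos _).le).trans ?_
  rw [← Real.exp_add, ← Real.exp_add, ← Real.exp_add]
  refine Real.exp_le_exp.mpr ?_
  have e : (v ^ 2 / 2 + 121 * ((n : ℂ) + 1 / 2) ^ 2 / 2).re =
      (v.re ^ 2 - v.im ^ 2) / 2 + 121 * (n + 1 / 2) ^ 2 / 2 := by
    simp [sq]
  rw [e, Complex.sq_norm, Complex.normSq_apply]
  have h4 : (n : ℝ) ≤ n ^ 2 := by
    rcases Nat.eq_zero_or_pos n with h | h
    · simp [h]
    · have : (1 : ℝ) ≤ n := by exact_mod_cast h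
      nlinarith
  have h3 : 3 * n ≤ 121 / 4 * (n : ℝ) ^ 2 + (11 / 2 * n - |v.re|) ^ 2 := by
    nlinarith [sq_nonneg (11 / 2 * n - |v.re|)]
  rw [sub_sq, sq_abs] at h3
  nlinarith [mul_nonneg hn (abs_nonneg v.re)]

/-- The constant in the bound for `sigma`. -/
noncomputable def sigmaConst (w : ℝ) : ℝ := ∑' n : ℕ, Real.exp (w * n)

lemma norm_sigma_le {w : ℝ} (hw : w ≤ -1) (v : ℂ) :
    ‖sigma w v‖ ≤ Real.exp (-(w * ‖v‖ ^ 2 / 2)) * sigmaConst w := by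
  rw [sigmaConst, ← tsum_mul_left]
  exact tsum_of_norm_bounded ((summable_exp_mul (by linarith)).mul_left _).hasSum
    fun n => norm_sigmaTerm_le hw n v

@[fun_prop]
lemma differentiable_sigma {w : ℝ} (hw : w ≤ -1) : Differentiable ℂ (sigma w) := by
  intro v₀
  let M := ‖v₀‖ + 1
  have h := Complex.differentiableOn_tsum_of_summable_norm (U := Metric.ball 0 M)
    (F := sigmaTerm w)
    (u := fun n : ℕ => Real.exp (-(w * M ^ 2 / 2)) * Real.exp (w * n))
    ((summable_exp_mul (by linarith)).mul_left _)
    (fun n => by unfold sigmaTerm dirichletKer; fun_prop) Metric.isOpen_ball ?_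
  · exact h.differentiableAt (Metric.isOpen_ball.mem_nhds (by simp [M]))
  · intro n v hv
    have hv' : ‖v‖ < M := by simpa using hv
    refine (norm_sigmaTerm_le hw n v).trans
      (mul_le_mul_of_nonneg_right (Real.exp_le_exp.mpr ?_) (Real.exp_pos _).le)
    nlinarith [norm_nonneg v, pow_le_pow_left₀ (norm_nonneg v) hv'.le 2]

lemma sigma_mul_bracket {w : ℝ} (hw : w ≤ -1) (v : ℂ) :
    sigma w v * bracket w v = theta w v := by
  have hw0 : w < 0 := by linarith
  have hs := summable_gtheta (s := -1) (by norm_num) (κ := 1 / 2) (by norm_num) hw0 (1 / 2) v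
  rw [theta, gtheta, sigma, ← tsum_mul_right]
  have h := HasSum.nat_add_neg_add_one hs.hasSum
  rw [← h.tsum_eq]
  refine tsum_congr fun n => ?_
  rw [sigmaTerm, neg_mul, mul_assoc, dirichletKer_mul_bracket]
  have e0 : (-1 : ℂ) ^ (-((n : ℤ) + 1)) = -(-1) ^ n := by
    rw [zpow_neg_of_sq (by norm_num), zpow_add₀ (by norm_num), zpow_one, zpow_natCast]; ring
  have e1 : qpow w (((1 / 2 : ℝ) : ℂ) * (11 * (((n : ℤ) : ℂ) + (1 / 2 : ℝ)) + v) ^ 2) =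
      qpow w (v ^ 2 / 2 + 121 * (n + 1 / 2) ^ 2 / 2) * qpow w (11 * (n + 1 / 2) * v) := by
    rw [← qpow_add]; push_cast; congr 1; ring
  have e2 : qpow w (((1 / 2 : ℝ) : ℂ) * (11 * (((-((n : ℤ) + 1) : ℤ) : ℂ) + (1 / 2 : ℝ)) + v) ^ 2) =
      qpow w (v ^ 2 / 2 + 121 * (n + 1 / 2) ^ 2 / 2) * qpow w (-(11 * (n + 1 / 2) * v)) := by
    rw [← qpow_add]; push_cast; congr 1; ring
  rw [e0, e1, e2, zpow_natCast]
  ring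

lemma sigma_neg (w : ℝ) (v : ℂ) : sigma w (-v) = sigma w v :=
  tsum_congr fun n => by rw [sigmaTerm, sigmaTerm, dirichletKer_neg, neg_sq]

lemma sigma_add_eta {w : ℝ} (hw : w < 0) (v : ℂ) :
    sigma w (v + eta w) = thetaMul w v * sigma w v := by
  rw [sigma, sigma, ← tsum_mul_left]
  refine tsum_congr fun n => ?_
  have e : (v + eta w) ^ 2 / 2 + 121 * ((n : ℂ) + 1 / 2) ^ 2 / 2 =
    (v * eta w + eta w ^ 2 / 2) + (v ^ 2 / 2 + 121 * ((n : ℂ) + 1 / 2) ^ 2 / 2) := by ring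
  rw [sigmaTerm, sigmaTerm, dirichletKer_add_eta hw, e, qpow_add w (v * eta w + _), thetaMul]
  ring

/-- The entire function `∑ q ^ (3 l² / 2) sigma (v + l)`, summed over `l ≡ r (mod 11)`. -/
noncomputable def phi (w : ℝ) (r : ℤ) (v : ℂ) : ℂ :=
  ∑' m : ℤ, qpow w (3 / 2 * (r + 11 * m) ^ 2) * sigma w (v + (r + 11 * m))

lemma norm_phi_term_le {w : ℝ} (hw : w ≤ -1) (r m : ℤ) {v : ℂ} {M : ℝ} (hv : ‖v‖ ≤ M) :
    ‖qpow w (3 / 2 * (r + 11 * m) ^ 2) * sigma w (v + (r + 11 * m))‖ ≤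
      sigmaConst w * Real.exp (-(5 * w / 2 * M ^ 2)) *
        Real.exp (w * (7 / 8 * 121 * m ^ 2 + 7 / 8 * 22 * r * m + 7 / 8 * r ^ 2)) := by
  have hK : 0 ≤ sigmaConst w := tsum_nonneg fun _ => (Real.exp_pos _).le
  rw [norm_mul, norm_qpow]
  refine (mul_le_mul_of_nonneg_left (norm_sigma_le hw _) (Real.exp_pos _).le).trans ?_
  rw [← mul_assoc, mul_comm, mul_assoc, ← Real.exp_add, ← Real.exp_add]
  refine mul_le_mul_of_nonneg_left (Real.exp_le_exp.mpr ?_) hK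
  have e : ((3 / 2 * ((r : ℂ) + 11 * m) ^ 2)).re = 3 / 2 * ((r : ℝ) + 11 * m) ^ 2 := by
    rw [show (3 / 2 * ((r : ℂ) + 11 * m) ^ 2) = ((3 / 2 * ((r : ℝ) + 11 * m) ^ 2 : ℝ) : ℂ) by
      push_cast; ring, Complex.ofReal_re]
  have h1 : ‖v + (r + 11 * m)‖ ≤ ‖v‖ + |(r : ℝ) + 11 * m| := by
    refine (norm_add_le _ _).trans (add_le_add_right (le_of_eq ?_) _)
    rw [show ((r : ℂ) + 11 * m) = (((r : ℝ) + 11 * m : ℝ) : ℂ) by push_cast; ring,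
      Complex.norm_real, Real.norm_eq_abs]
  have h2 : ‖v + (r + 11 * m)‖ ^ 2 ≤ 5 * M ^ 2 + 5 / 4 * ((r : ℝ) + 11 * m) ^ 2 := by
    have := pow_le_pow_left₀ (norm_nonneg _) h1 2
    have h3 := pow_le_pow_left₀ (norm_nonneg _) hv 2
    nlinarith [sq_nonneg (4 * ‖v‖ - |(r : ℝ) + 11 * m|), sq_abs ((r : ℝ) + 11 * m)]
  rw [e]
  nlinarith

lemma summable_phi_bound {w : ℝ} (hw : w ≤ -1) (r : ℤ) (M : ℝ) :
    Summable fun m : ℤ => sigmaConst w * Real.exp (-(5 * w / 2 * M ^ 2)) *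
        Real.exp (w * (7 / 8 * 121 * m ^ 2 + 7 / 8 * 22 * r * m + 7 / 8 * r ^ 2)) :=
  (summable_gauss (by linarith) (by norm_num) _ _).mul_left _

lemma summable_phi {w : ℝ} (hw : w ≤ -1) (r : ℤ) (v : ℂ) :
    Summable fun m : ℤ => qpow w (3 / 2 * (r + 11 * m) ^ 2) * sigma w (v + (r + 11 * m)) :=
  Summable.of_norm_bounded (summable_phi_bound hw r ‖v‖) fun m => norm_phi_term_le hw r m le_rfl

@[fun_prop]
lemma differentiable_phi {w : ℝ} (hw : w ≤ -1) (r : ℤ) : Differentiable ℂ (phi w r) := by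
  intro v₀
  have h := Complex.differentiableOn_tsum_of_summable_norm (U := Metric.ball 0 (‖v₀‖ + 1))
    (F := fun (m : ℤ) v => qpow w (3 / 2 * (r + 11 * m) ^ 2) * sigma w (v + (r + 11 * m)))
    (summable_phi_bound hw r (‖v₀‖ + 1)) (fun n => by fun_prop (disch := assumption)) Metric.isOpen_ball
    fun m v hv => norm_phi_term_le hw r m (by simpa using (mem_ball_zero_iff.mp hv).le)
  exact h.differentiableAt (Metric.isOpen_ball.mem_nhds (by simp))

lemma hasSum_deriv_phi {w : ℝ} (hw : w ≤ -1) (r : ℤ) (v : ℂ) :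
    HasSum (fun m : ℤ => qpow w (3 / 2 * (r + 11 * m) ^ 2) * deriv (sigma w) (v + (r + 11 * m)))
      (deriv (phi w r) v) := by
  have h := Complex.hasSum_deriv_of_summable_norm (U := Metric.ball 0 (‖v‖ + 1))
    (F := fun (m : ℤ) v => qpow w (3 / 2 * (r + 11 * m) ^ 2) * sigma w (v + (r + 11 * m)))
    (summable_phi_bound hw r (‖v‖ + 1)) (fun n => by fun_prop (disch := assumption)) Metric.isOpen_ball
    (fun m v hv => norm_phi_term_le hw r m (by simpa using (mem_ball_zero_iff.mp hv).le))
    (z := v) (by simp)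
  refine h.congr_fun fun m => ?_
  rw [deriv_const_mul, deriv_comp_add_const]
  fun_prop (disch := assumption)

lemma phi_add_eta {w : ℝ} (hw : w < 0) (r : ℤ) (v : ℂ) :
    phi w r (v + eta w) = thetaMul w v * qpow w (r * eta w) * phi w r v := by
  rw [phi, phi, ← tsum_mul_left]
  refine tsum_congr fun m => ?_
  have h : v + eta w + (r + 11 * m) = v + (r + 11 * m) + eta w := by ring
  have e : (v + (r + 11 * m)) * eta w + eta w ^ 2 / 2 =
    (v * eta w + eta w ^ 2 / 2) + r * eta w + 11 * m * eta w := by ring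
  rw [h, sigma_add_eta hw, thetaMul, thetaMul, e, qpow_add, qpow_add, qpow_eta hw]
  ring

lemma theta_add_eleven_mul (w : ℝ) (v : ℂ) (m : ℤ) :
    theta w (v + 11 * m) = (-1) ^ m * theta w v := by
  induction m using Int.induction_on with
  | zero => simp
  | succ k ih =>
    have e : v + 11 * ((k : ℤ) + 1 : ℤ) = v + 11 * (k : ℤ) + 11 := by push_cast; ring
    rw [e, theta_add_eleven, ih, zpow_add₀ (by norm_num), zpow_one]; ring
  | pred k ih =>
    have e : v + 11 * (-(k : ℤ) : ℤ) = v + 11 * (-(k : ℤ) - 1 : ℤ) + 11 := by push_cast; ring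
    rw [e, theta_add_eleven] at ih
    rw [zpow_sub₀ (by norm_num), zpow_one, div_neg, div_one, neg_mul, ← ih, neg_neg]

/-- The cubic theta series `∑ (-1) ^ n q ^ (3 (11 n + v)² / 2)`. -/
noncomputable def thetaCubic (w : ℝ) : ℂ → ℂ := gtheta (-1) (3 / 2) 0 w

lemma thetaCubic_neg (w : ℝ) (v : ℂ) : thetaCubic w (-v) = thetaCubic w v :=
  gtheta_neg (by norm_num) _ _ _

lemma thetaCubic_add_eleven (w : ℝ) (v : ℂ) : thetaCubic w (v + 11) = -thetaCubic w v := by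
  rw [thetaCubic, gtheta_add_eleven (by norm_num)]; ring

lemma summable_thetaCubic {w : ℝ} (hw : w < 0) (v : ℂ) :
    Summable fun m : ℤ => (-1 : ℂ) ^ m * qpow w (3 / 2 * (v + 11 * m) ^ 2) := by
  refine (summable_gtheta (s := -1) (κ := 3 / 2) (by norm_num) (by norm_num) hw 0 v).congr
    fun m => ?_
  push_cast
  congr 2; ring

lemma thetaCubic_eq (w : ℝ) (v : ℂ) :
    thetaCubic w v = ∑' m : ℤ, (-1 : ℂ) ^ m * qpow w (3 / 2 * (v + 11 * m) ^ 2) := by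
  rw [thetaCubic, gtheta]
  refine tsum_congr fun m => ?_
  push_cast
  congr 2; ring

/-- The `i`-th coefficient in the translation formula of `phi`. -/
noncomputable def shiftCoeff (w : ℝ) (c v : ℂ) : ℂ :=
  qpow w (363 / 2 - 3 / 2 * c ^ 2 + (33 - 3 * c) * v)

lemma phi_add_eleven {w : ℝ} (hw : w ≤ -1) (r : ℤ) (v : ℂ) :
    phi w r (v + 11) = qpow w (363 / 2 + 33 * v) * phi w r v + theta w (v + r) *
      (shiftCoeff w (55 / 6) v * thetaCubic w (r - 55 / 6)
        + shiftCoeff w (11 / 2) v * thetaCubic w (r - 11 / 2)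
        + shiftCoeff w (11 / 6) v * thetaCubic w (r - 11 / 6)) := by
  have hw0 : w < 0 := by linarith
  have hG : ∀ c : ℂ, HasSum (fun m : ℤ => (-1 : ℂ) ^ m * qpow w (3 / 2 * (r - c + 11 * m) ^ 2))
      (thetaCubic w (r - c)) := fun c => by
    rw [thetaCubic_eq]; exact (summable_thetaCubic hw0 _).hasSum
  have hS := ((summable_phi hw r v).hasSum.mul_left (qpow w (363 / 2 + 33 * v))).add
    (((((hG (55 / 6)).mul_left (shiftCoeff w (55 / 6) v)).add
      ((hG (11 / 2)).mul_left (shiftCoeff w (11 / 2) v))).add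
      ((hG (11 / 6)).mul_left (shiftCoeff w (11 / 6) v))).mul_left (theta w (v + r)))
  rw [phi, ← (Equiv.subRight (1 : ℤ)).tsum_eq, phi, ← hS.tsum_eq]
  refine tsum_congr fun m => ?_
  have ht := theta_add_eleven_mul w (v + r) m
  have hs : (-1 : ℂ) ^ m * (-1 : ℂ) ^ m = 1 := by rw [← mul_zpow]; simp
  have hσ := sigma_mul_bracket hw (v + (r + 11 * m))
  rw [show v + (r + 11 * m) = v + r + 11 * (m : ℂ) by ring, ht] at hσ
  have hθ : theta w (v + r) = (-1) ^ m * (sigma w (v + r + 11 * m) * bracket w (v + r + 11 * m)) := by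
    rw [hσ, ← mul_assoc, hs, one_mul]
  have key : ∀ c : ℂ, theta w (v + r) *
      (shiftCoeff w c v * ((-1) ^ m * qpow w (3 / 2 * (r - c + 11 * m) ^ 2))) =
      sigma w (v + r + 11 * m) *
      (qpow w (363 / 2 + 33 * v + 3 / 2 * (r + 11 * m) ^ 2 - 3 * c * (v + r + 11 * m) - 11 / 2 * (v + r + 11 * m)) -
       qpow w (363 / 2 + 33 * v + 3 / 2 * (r + 11 * m) ^ 2 - 3 * c * (v + r + 11 * m) + 11 / 2 * (v + r + 11 * m))) := by
    intro c
    have e1 : shiftCoeff w c v * qpow w (3 / 2 * (r - c + 11 * m) ^ 2) * bracket w (v + r + 11 * m) =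
      (qpow w (363 / 2 + 33 * v + 3 / 2 * (r + 11 * m) ^ 2 - 3 * c * (v + r + 11 * m) - 11 / 2 * (v + r + 11 * m)) -
       qpow w (363 / 2 + 33 * v + 3 / 2 * (r + 11 * m) ^ 2 - 3 * c * (v + r + 11 * m) + 11 / 2 * (v + r + 11 * m))) := by
      rw [shiftCoeff, bracket, mul_sub, ← qpow_add, ← qpow_add, ← qpow_add]
      congr 2 <;> ring
    rw [← e1, hθ]
    linear_combination (sigma w (v + r + 11 * m) * bracket w (v + r + 11 * m) * shiftCoeff w c v *
      qpow w (3 / 2 * (r - c + 11 * m) ^ 2)) * hs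
  have e0 : v + 11 + ((r : ℂ) + 11 * ((m - 1 : ℤ) : ℂ)) = v + r + 11 * m := by push_cast; ring
  simp only [Equiv.subRight_apply]
  rw [mul_add, mul_add, key, key, key, ← mul_assoc, ← qpow_add, e0, ← add_assoc v]
  have f1 : (3 / 2 * ((r : ℂ) + 11 * ((m - 1 : ℤ) : ℂ)) ^ 2) = 363 / 2 + 33 * v
    + 3 / 2 * (r + 11 * m) ^ 2 - 3 * (55 / 6) * (v + r + 11 * m) - 11 / 2 * (v + r + 11 * m) := by
    push_cast; ring
  have f2 : 363 / 2 + 33 * v + 3 / 2 * ((r : ℂ) + 11 * m) ^ 2 - 3 * (55 / 6) * (v + r + 11 * m) +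
      11 / 2 * (v + r + 11 * m) = 363 / 2 + 33 * v + 3 / 2 * (r + 11 * m) ^ 2 -
      3 * (11 / 2) * (v + r + 11 * m) - 11 / 2 * (v + r + 11 * m) := by ring
  have f3 : 363 / 2 + 33 * v + 3 / 2 * ((r : ℂ) + 11 * m) ^ 2 - 3 * (11 / 2) * (v + r + 11 * m) +
      11 / 2 * (v + r + 11 * m) = 363 / 2 + 33 * v + 3 / 2 * (r + 11 * m) ^ 2 -
      3 * (11 / 6) * (v + r + 11 * m) - 11 / 2 * (v + r + 11 * m) := by ring
  have f4 : 363 / 2 + 33 * v + 3 / 2 * ((r : ℂ) + 11 * m) ^ 2 - 3 * (11 / 6) * (v + r + 11 * m) +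
      11 / 2 * (v + r + 11 * m) = 363 / 2 + 33 * v + 3 / 2 * (r + 11 * m) ^ 2 := by ring
  rw [f1, f2, f3, f4]
  ring

/-- An entire function with periods `11` and `eta w` is constant. -/
lemma eq_of_periodic {w : ℝ} (hw : w < 0) {f : ℂ → ℂ} (hf : Differentiable ℂ f)
    (h1 : ∀ v, f (v + 11) = f v) (h2 : ∀ v, f (v + eta w) = f v) (u v : ℂ) : f u = f v := by
  have p1 : Function.Periodic f 11 := h1
  have p2 : Function.Periodic f (eta w) := h2
  refine hf.apply_eq_apply_of_bounded ?_ u v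
  have hK : IsCompact ((fun x : ℝ × ℝ => f (x.1 * 11 + x.2 * eta w)) '' (Set.Icc 0 1 ×ˢ Set.Icc 0 1)) := by
    refine (isCompact_Icc.prod isCompact_Icc).image ?_
    have := hf.continuous
    fun_prop
  refine hK.isBounded.subset ?_
  rintro _ ⟨z, rfl⟩
  set c : ℝ := 2 * Real.pi / (11 * w) with hc
  have hc0 : c ≠ 0 := div_ne_zero (by positivity) (mul_ne_zero (by norm_num) hw.ne)
  have he : eta w = c * Complex.I := by rw [eta, hc]; push_cast; ring
  have hcc : (c : ℂ) ≠ 0 := by exact_mod_cast hc0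
  have hz : z = (z.re / 11 : ℝ) * 11 + (z.im / c : ℝ) * eta w := by
    rw [he]; push_cast
    field_simp
    exact (Complex.re_add_im z).symm
  refine ⟨(Int.fract (z.re / 11), Int.fract (z.im / c)),
    ⟨⟨Int.fract_nonneg _, (Int.fract_lt_one _).le⟩, ⟨Int.fract_nonneg _, (Int.fract_lt_one _).le⟩⟩, ?_⟩
  simp only
  have e : z = (Int.fract (z.re / 11) : ℝ) * 11 + (Int.fract (z.im / c) : ℝ) * eta w
      + (⌊z.re / 11⌋ : ℤ) * 11 + (⌊z.im / c⌋ : ℤ) * eta w := by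
    conv_lhs => rw [hz]
    rw [Int.fract, Int.fract]; push_cast; ring
  conv_rhs => rw [e, p2.int_mul, p1.int_mul]

/-- The constants `E₀`. -/
noncomputable def ezero (w : ℝ) : ℂ := thetaCubic w (-(11 / 6))

/-- The constants `(-1) ^ b E_b`. -/
noncomputable def eplus (w : ℝ) (b : ℤ) : ℂ :=
  thetaCubic w (b - 11 / 6) + thetaCubic w (-b - 11 / 6)

/-- The combination of the functions `phi` that satisfies the functional equation of
`q ^ (3 v² / 2)`. -/
noncomputable def bigPhi (w : ℝ) (b : ℤ) (v : ℂ) : ℂ :=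
  ezero w * theta w v * (phi w b v * theta w (v - b) + phi w (-b) v * theta w (v + b))
    - eplus w b * phi w 0 v * theta w (v - b) * theta w (v + b)

@[fun_prop]
lemma differentiable_bigPhi {w : ℝ} (hw : w ≤ -1) (b : ℤ) : Differentiable ℂ (bigPhi w b) := by
  have hw0 : w < 0 := by linarith
  unfold bigPhi
  fun_prop (disch := assumption)

lemma bigPhi_add_eta {w : ℝ} (hw : w < 0) (b : ℤ) (v : ℂ) :
    bigPhi w b (v + eta w) = thetaMul w v ^ 3 * bigPhi w b v := by
  have h1 : v + eta w - b = v - b + eta w := by ring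
  have h2 : v + eta w + b = v + b + eta w := by ring
  have m1 : thetaMul w (v - b) * qpow w (b * eta w) = thetaMul w v := by
    rw [thetaMul, thetaMul, ← qpow_add]; congr 1; ring
  have m2 : thetaMul w (v + b) * qpow w (-b * eta w) = thetaMul w v := by
    rw [thetaMul, thetaMul, ← qpow_add]; congr 1; ring
  have m3 : qpow w (-b * eta w) * qpow w (b * eta w) = 1 := by
    rw [← qpow_add, ← qpow_zero w]; congr 1; ring
  rw [bigPhi, bigPhi, h1, h2]
  simp only [theta_add_eta hw, phi_add_eta hw]
  have m4 : thetaMul w (v - b) * thetaMul w (v + b) = thetaMul w v ^ 2 := by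
    linear_combination thetaMul w v * m1 + thetaMul w (v - b) * qpow w (b * eta w) * m2
      - thetaMul w (v - b) * thetaMul w (v + b) * m3
  push_cast
  rw [zero_mul, qpow_zero]
  linear_combination thetaMul w v ^ 2 * ezero w * theta w v * phi w b v * theta w (v - b) * m1
    + thetaMul w v ^ 2 * ezero w * theta w v * phi w (-b) v * theta w (v + b) * m2
    - thetaMul w v * eplus w b * phi w 0 v * theta w (v - b) * theta w (v + b) * m4

lemma bigPhi_add_eleven {w : ℝ} (hw : w ≤ -1) (b : ℤ) (v : ℂ) :
    bigPhi w b (v + 11) = qpow w (363 / 2 + 33 * v) * bigPhi w b v := by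
  have h1 : v + 11 - b = v - b + 11 := by ring
  have h2 : v + 11 + b = v + b + 11 := by ring
  have g1 : thetaCubic w (b - 55 / 6) = -thetaCubic w (-b - 11 / 6) := by
    rw [← thetaCubic_neg w (-b - 11 / 6), show -(-(b : ℂ) - 11 / 6) = (b - 55 / 6) + 11 by ring,
      thetaCubic_add_eleven]; ring
  have g2 : thetaCubic w (-b - 55 / 6) = -thetaCubic w (b - 11 / 6) := by
    rw [← thetaCubic_neg w (b - 11 / 6), show -((b : ℂ) - 11 / 6) = (-b - 55 / 6) + 11 by ring,
      thetaCubic_add_eleven]; ring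
  have g3 : thetaCubic w (-b - 11 / 2) = -thetaCubic w (b - 11 / 2) := by
    rw [← thetaCubic_neg w (-b - 11 / 2), show -(-(b : ℂ) - 11 / 2) = (b - 11 / 2) + 11 by ring,
      thetaCubic_add_eleven]
  have g4 : thetaCubic w (-(11 / 2)) = 0 := by
    have h : thetaCubic w (11 / 2) = -thetaCubic w (-(11 / 2)) := by
      rw [← thetaCubic_add_eleven]; congr 1; ring
    rw [thetaCubic_neg] at h
    rw [thetaCubic_neg]
    linear_combination h / 2
  have g5 : thetaCubic w (-(55 / 6)) = -ezero w := by
    rw [ezero, thetaCubic_neg w (11 / 6), show (11 / 6 : ℂ) = -(55 / 6) + 11 by ring,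
      thetaCubic_add_eleven]; ring
  rw [bigPhi, bigPhi, h1, h2]
  simp only [theta_add_eleven, phi_add_eleven hw]
  push_cast
  simp only [zero_sub, g1, g2, g3, g4, g5, eplus, add_zero]
  rw [show v + -(b : ℂ) = v - b by ring]
  simp only [ezero]
  ring

lemma bigPhi_eq {w : ℝ} (hw : w ≤ -1) (b : ℤ) (v : ℂ) :
    bigPhi w b v = qpow w (3 / 2 * v ^ 2) * bigPhi w b 0 := by
  have hw0 : w < 0 := by linarith
  have h := eq_of_periodic hw0 (f := fun v => qpow w (-(3 / 2 * v ^ 2)) * bigPhi w b v)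
    (by fun_prop (disch := assumption)) (fun v => ?_) (fun v => ?_) v 0
  · simp only [ne_eq, OfNat.ofNat_ne_zero, not_false_eq_true, zero_pow, mul_zero, neg_zero,
      qpow_zero, one_mul] at h
    rw [← h, ← mul_assoc, ← qpow_add, add_neg_cancel, qpow_zero, one_mul]
  · simp only [bigPhi_add_eleven hw, ← mul_assoc, ← qpow_add]
    congr 2; ring
  · simp only [bigPhi_add_eta hw0, thetaMul, ← mul_assoc]
    rw [pow_three, ← qpow_add, ← qpow_add, ← qpow_add]
    congr 2; ring

/-- The infinite product `∏ (1 - z Q ^ n)`. -/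
noncomputable def poch (z Q : ℝ) : ℝ := ∏' n : ℕ, (1 - z * Q ^ n)

section Poch
variable {Q : ℝ}

lemma summable_poch (hQ : 0 < Q) (hQ1 : Q < 1) (z : ℝ) :
    Summable fun n : ℕ => ‖-(z * Q ^ n)‖ := by
  simp only [norm_neg, norm_mul, norm_pow, Real.norm_of_nonneg hQ.le]
  exact (summable_geometric_of_lt_one hQ.le hQ1).mul_left _

lemma multipliable_poch (hQ : 0 < Q) (hQ1 : Q < 1) (z : ℝ) :
    Multipliable fun n : ℕ => 1 - z * Q ^ n := by
  simpa only [sub_eq_add_neg] using multipliable_one_add_of_summable (summable_poch hQ hQ1 z)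

lemma tendsto_poch (hQ : 0 < Q) (hQ1 : Q < 1) (z : ℝ) :
    Tendsto (fun n => ∏ k ∈ range n, (1 - z * Q ^ k)) atTop (𝓝 (poch z Q)) :=
  (multipliable_poch hQ hQ1 z).hasProd.tendsto_prod_nat

lemma poch_eq_mul (hQ : 0 < Q) (hQ1 : Q < 1) (z : ℝ) :
    poch z Q = (1 - z) * poch (z * Q) Q := by
  have h := tprod_eq_zero_mul' (f := fun n : ℕ => 1 - z * Q ^ n)
    (by simpa only [pow_succ', ← mul_assoc] using multipliable_poch hQ hQ1 (z * Q))
  rw [poch, h, poch]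
  simp only [pow_zero, mul_one, pow_succ', ← mul_assoc]

lemma poch_pos (hQ : 0 < Q) (hQ1 : Q < 1) {z : ℝ} (hz1 : z < 1) :
    0 < poch z Q := by
  have hpos : ∀ n : ℕ, 0 < 1 - z * Q ^ n := fun n => by
    have h1 : Q ^ n ≤ 1 := pow_le_one₀ hQ.le hQ1.le
    have h2 : 0 < Q ^ n := by positivity
    nlinarith
  refine lt_of_le_of_ne ?_ (Ne.symm ?_)
  · exact ge_of_tendsto' (tendsto_poch hQ hQ1 z) fun n => prod_nonneg fun k _ => (hpos k).le
  · have := tprod_one_add_ne_zero_of_summable (f := fun n : ℕ => -(z * Q ^ n))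
      (fun n => by simpa only [sub_eq_add_neg] using (hpos n).ne') (summable_poch hQ hQ1 z)
    simpa only [poch, sub_eq_add_neg] using this

lemma continuousAt_poch (hQ : 0 < Q) (hQ1 : Q < 1) (z : ℝ) :
    ContinuousAt (fun z => poch z Q) z := by
  have h := tendsto_tprod_one_add_of_dominated_convergence (𝓕 := 𝓝 z)
    (f := fun (x : ℝ) (n : ℕ) => -(x * Q ^ n)) (g := fun n => -(z * Q ^ n))
    (bound := fun n => (‖z‖ + 1) * Q ^ n)
    ((summable_geometric_of_lt_one hQ.le hQ1).mul_left _)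
    (fun k => by
      have : Continuous fun x : ℝ => -(x * Q ^ k) := by fun_prop
      exact this.tendsto z) ?_
  · simpa only [ContinuousAt, poch, sub_eq_add_neg] using h
  · filter_upwards [Metric.ball_mem_nhds z one_pos] with x hx k
    rw [norm_neg, norm_mul, Real.norm_of_nonneg (pow_pos hQ k).le]
    refine mul_le_mul_of_nonneg_right ?_ (pow_pos hQ k).le
    have h1 : ‖x - z‖ < 1 := by simpa [dist_eq_norm] using hx
    have h2 := norm_add_le z (x - z)
    rw [add_sub_cancel] at h2
    linarith

lemma poch_mul_poch_neg (hQ : 0 < Q) (hQ1 : Q < 1) (z : ℝ) :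
    poch z Q * poch (-z) Q = poch (z ^ 2) (Q ^ 2) := by
  rw [poch, poch, ← (multipliable_poch hQ hQ1 z).tprod_mul (multipliable_poch hQ hQ1 (-z)), poch]
  exact tprod_congr fun n => by ring

lemma poch_split_two (hQ : 0 < Q) (hQ1 : Q < 1) (z : ℝ) :
    poch z Q = poch z (Q ^ 2) * poch (z * Q) (Q ^ 2) := by
  have hQ2 : Q ^ 2 < 1 := pow_lt_one₀ hQ.le hQ1 (by norm_num)
  have h1 := (tendsto_poch (pow_pos hQ 2) hQ2 z).mul (tendsto_poch (pow_pos hQ 2) hQ2 (z * Q))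
  have h2 := (tendsto_poch hQ hQ1 z).comp (tendsto_id.const_mul_atTop' (r := 2) (by norm_num))
  refine tendsto_nhds_unique h2 (h1.congr fun n => ?_)
  simp only [Function.comp, id]
  induction n with
  | zero => simp
  | succ n ih =>
    rw [show 2 * (n + 1) = 2 * n + 1 + 1 by ring]
    simp only [prod_range_succ]
    rw [← ih]
    ring

lemma poch_split_three (hQ : 0 < Q) (hQ1 : Q < 1) (z : ℝ) :
    poch z Q = poch z (Q ^ 3) * poch (z * Q) (Q ^ 3) * poch (z * Q ^ 2) (Q ^ 3) := by
  have hQ2 : Q ^ 3 < 1 := pow_lt_one₀ hQ.le hQ1 (by norm_num)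
  have h1 := ((tendsto_poch (pow_pos hQ 3) hQ2 z).mul (tendsto_poch (pow_pos hQ 3) hQ2 (z * Q))).mul
    (tendsto_poch (pow_pos hQ 3) hQ2 (z * Q ^ 2))
  have h2 := (tendsto_poch hQ hQ1 z).comp (tendsto_id.const_mul_atTop' (r := 3) (by norm_num))
  refine tendsto_nhds_unique h2 (h1.congr fun n => ?_)
  simp only [Function.comp, id]
  induction n with
  | zero => simp
  | succ n ih =>
    rw [show 3 * (n + 1) = 3 * n + 1 + 1 + 1 by ring]
    simp only [prod_range_succ]
    rw [← ih]
    ring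

/-- Euler's identity `∏ (1 + s ^ (2 n)) (1 + s ^ (2 n - 1)) (1 - s ^ (2 n - 1)) = 1`. -/
lemma poch_euler {s : ℝ} (hs : 0 < s) (hs1 : s < 1) :
    poch (-s ^ 2) (s ^ 2) * poch (-s) (s ^ 2) * poch s (s ^ 2) = 1 := by
  have h0 : 0 < s ^ 2 := pow_pos hs 2
  have h1 : s ^ 2 < 1 := pow_lt_one₀ hs.le hs1 (by norm_num)
  have e1 := poch_mul_poch_neg h0 h1 s
  have e2 := poch_mul_poch_neg h0 h1 (s ^ 2)
  have e3 := poch_split_two h0 h1 (s ^ 2)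
  rw [← sq] at e3
  have hp := (poch_pos (pow_pos h0 2) (pow_lt_one₀ h0.le h1 (by norm_num : 2 ≠ 0))
    (z := (s ^ 2) ^ 2) (pow_lt_one₀ h0.le h1 (by norm_num))).ne'
  have hp' := (poch_pos h0 h1 (z := s ^ 2) h1).ne'
  refine mul_left_cancel₀ hp ?_
  linear_combination poch (-s ^ 2) (s ^ 2) * poch ((s ^ 2) ^ 2) ((s ^ 2) ^ 2) * e1 + e2
    - poch (-s ^ 2) (s ^ 2) * e3

/-- The finite product `∏_{k ≤ m} (1 - Q ^ k)`. -/
noncomputable def finPoch (Q : ℝ) (m : ℕ) : ℝ := ∏ k ∈ range m, (1 - Q * Q ^ k)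

lemma finPoch_pos (hQ : 0 < Q) (hQ1 : Q < 1) (m : ℕ) : 0 < finPoch Q m := by
  refine prod_pos fun k _ => ?_
  rw [← pow_succ']
  exact sub_pos.mpr (pow_lt_one₀ hQ.le hQ1 k.succ_ne_zero)

lemma finPoch_antitone (hQ : 0 < Q) (hQ1 : Q < 1) : Antitone (finPoch Q) := by
  refine antitone_nat_of_succ_le fun m => ?_
  rw [finPoch, prod_range_succ]
  refine mul_le_of_le_one_right (finPoch_pos hQ hQ1 m).le ?_
  have : 0 < Q * Q ^ m := by positivity
  linarith

lemma poch_le_finPoch (hQ : 0 < Q) (hQ1 : Q < 1) (m : ℕ) : poch Q Q ≤ finPoch Q m :=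
  (finPoch_antitone hQ hQ1).le_of_tendsto (tendsto_poch hQ hQ1 Q) m

/-- The reciprocal of `finPoch`, extended by zero to negative integers. -/
noncomputable def invPoch (Q : ℝ) (k : ℤ) : ℝ := if k < 0 then 0 else (finPoch Q k.toNat)⁻¹

lemma invPoch_sub_one (hQ : 0 < Q) (hQ1 : Q < 1) (k : ℤ) :
    invPoch Q (k - 1) = (1 - Q ^ k) * invPoch Q k := by
  rcases lt_trichotomy k 0 with h | h | h
  · simp [invPoch, h, (by omega : k - 1 < 0)]
  · subst h; simp [invPoch]
  · obtain ⟨m, rfl⟩ : ∃ m : ℕ, k = m + 1 := ⟨(k - 1).toNat, by omega⟩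
    have h1 : ¬ ((m : ℤ) + 1 - 1 < 0) := by omega
    have h2 : ¬ ((m : ℤ) + 1 < 0) := by omega
    rw [invPoch, invPoch, if_neg h1, if_neg h2, show ((m : ℤ) + 1 - 1).toNat = m by omega,
      show ((m : ℤ) + 1).toNat = m + 1 by omega]
    have e : finPoch Q (m + 1) = finPoch Q m * (1 - Q ^ ((m : ℤ) + 1)) := by
      rw [finPoch, prod_range_succ, ← pow_succ', finPoch]; norm_cast
    have p1 := finPoch_pos hQ hQ1 m
    have p2 := finPoch_pos hQ hQ1 (m + 1)
    rw [e] at p2 ⊢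
    have p3 : (1 - Q ^ ((m : ℤ) + 1)) ≠ 0 := fun h => by rw [h, mul_zero] at p2; exact lt_irrefl _ p2
    field_simp

lemma invPoch_nonneg (hQ : 0 < Q) (hQ1 : Q < 1) (k : ℤ) : 0 ≤ invPoch Q k := by
  rw [invPoch]; split_ifs
  · rfl
  · exact (inv_pos.mpr (finPoch_pos hQ hQ1 _)).le

lemma invPoch_le (hQ : 0 < Q) (hQ1 : Q < 1) (k : ℤ) : invPoch Q k ≤ (poch Q Q)⁻¹ := by
  have h := poch_pos hQ hQ1 hQ1
  rw [invPoch]; split_ifs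
  · exact (inv_pos.mpr h).le
  · exact inv_anti₀ h (poch_le_finPoch hQ hQ1 _)

lemma tendsto_invPoch (hQ : 0 < Q) (hQ1 : Q < 1) (f : ℕ → ℤ) (hf : Tendsto f atTop atTop) :
    Tendsto (fun n => invPoch Q (f n)) atTop (𝓝 (poch Q Q)⁻¹) := by
  have hg : Tendsto (fun n => (f n).toNat) atTop atTop := by
    refine tendsto_atTop_mono' atTop (f₁ := fun n => (f n).toNat) (Eventually.of_forall fun _ => le_rfl) ?_
    rw [tendsto_atTop]
    intro b
    filter_upwards [hf.eventually_ge_atTop (b : ℤ)] with n hn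
    omega
  have h := ((tendsto_poch hQ hQ1 Q).inv₀ (poch_pos hQ hQ1 hQ1).ne').comp hg
  refine h.congr' ?_
  filter_upwards [hf.eventually_ge_atTop 0] with n hn
  rw [invPoch, if_neg (by omega)]
  rfl

/-- The exponential weight in the triple product. -/
noncomputable def jacobiTerm (z Q : ℝ) (j : ℤ) : ℝ := (-1) ^ j * z ^ j * Q ^ (j * (j - 1) / 2)

lemma half_mul_pred (j : ℤ) : j * (j - 1) / 2 + j = (j + 1) * (j + 1 - 1) / 2 := by
  have h := Int.even_mul_pred_self j
  obtain ⟨k, hk⟩ := h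
  have e : (j + 1) * (j + 1 - 1) = 2 * (k + j) := by linear_combination hk
  rw [hk, e]; omega

lemma jacobiTerm_succ (hQ : 0 < Q) {z : ℝ} (hz : z ≠ 0) (j : ℤ) :
    jacobiTerm z Q (j + 1) = -(z * Q ^ j) * jacobiTerm z Q j := by
  rw [jacobiTerm, jacobiTerm, ← half_mul_pred, zpow_add₀ hQ.ne', zpow_add₀ hz,
    zpow_add₀ (by norm_num), zpow_one, zpow_one]
  ring

lemma hasSum_finite_triple (hQ : 0 < Q) (hQ1 : Q < 1) {z : ℝ} (hz : z ≠ 0) (n : ℕ) :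
    HasSum (fun j : ℤ => jacobiTerm z Q j * (finPoch Q (2 * n) * invPoch Q (n + j) * invPoch Q (n - j)))
      ((∏ k ∈ range n, (1 - z * Q ^ k)) * ∏ k ∈ range n, (1 - Q / z * Q ^ k)) := by
  induction n with
  | zero =>
    have h := hasSum_ite_eq (0 : ℤ) (1 : ℝ)
    simp only [range_zero, prod_empty, mul_one]
    refine h.congr_fun fun j => ?_
    by_cases hj : j = 0
    · subst hj; simp [jacobiTerm, finPoch, invPoch]
    · rcases lt_or_gt_of_ne hj with h' | h'
      · simp [invPoch, h', hj]
      · simp [invPoch, h', hj]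
  | succ n ih =>
    have h1 := (Equiv.addRight (1 : ℤ)).hasSum_iff.mpr ih
    have h2 := (Equiv.subRight (1 : ℤ)).hasSum_iff.mpr ih
    have h := ((ih.mul_left (1 + Q ^ (2 * n + 1))).sub (h2.mul_left (z * Q ^ n))).sub
      (h1.mul_left (Q ^ (n + 1) / z))
    rw [prod_range_succ, prod_range_succ]
    have ev : ((∏ k ∈ range n, (1 - z * Q ^ k)) * (1 - z * Q ^ n)) *
        ((∏ k ∈ range n, (1 - Q / z * Q ^ k)) * (1 - Q / z * Q ^ n)) =
        (1 + Q ^ (2 * n + 1)) * ((∏ k ∈ range n, (1 - z * Q ^ k)) * ∏ k ∈ range n, (1 - Q / z * Q ^ k))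
        - z * Q ^ n * ((∏ k ∈ range n, (1 - z * Q ^ k)) * ∏ k ∈ range n, (1 - Q / z * Q ^ k))
        - Q ^ (n + 1) / z * ((∏ k ∈ range n, (1 - z * Q ^ k)) * ∏ k ∈ range n, (1 - Q / z * Q ^ k)) := by
      field_simp
      ring
    rw [ev]
    refine h.congr_fun fun j => ?_
    simp only [Function.comp, Equiv.coe_addRight, Equiv.subRight_apply]
    have a1 := jacobiTerm_succ hQ hz j
    have a2 := jacobiTerm_succ hQ hz (j - 1)
    rw [sub_add_cancel] at a2
    set a := jacobiTerm z Q j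
    set I := invPoch Q (n + 1 + j)
    set K := invPoch Q (n + 1 - j)
    set A := Q ^ ((n : ℤ) + 1 + j) with hA
    set B := Q ^ ((n : ℤ) + 1 - j) with hB
    have i1 : invPoch Q (n + j) = (1 - A) * I := by
      rw [← invPoch_sub_one hQ hQ1]; congr 1; ring
    have k1 : invPoch Q (n - j) = (1 - B) * K := by
      rw [← invPoch_sub_one hQ hQ1]; congr 1; ring
    have i2 : invPoch Q (n + (j - 1)) = (1 - A / Q) * ((1 - A) * I) := by
      rw [← i1, hA, div_eq_mul_inv, ← zpow_sub_one₀ hQ.ne', show (n : ℤ) + 1 + j - 1 = n + j by ring,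
        ← invPoch_sub_one hQ hQ1]; congr 1; ring
    have k2 : invPoch Q (n - (j + 1)) = (1 - B / Q) * ((1 - B) * K) := by
      rw [← k1, hB, div_eq_mul_inv, ← zpow_sub_one₀ hQ.ne', show (n : ℤ) + 1 - j - 1 = n - j by ring,
        ← invPoch_sub_one hQ hQ1]; congr 1; ring
    have i3 : invPoch Q (n + (j + 1)) = I := by congr 1; ring
    have k3 : invPoch Q (n - (j - 1)) = K := by congr 1; ring
    have hAB : A * B = Q ^ (2 * n + 2) := by
      rw [hA, hB, ← zpow_add₀ hQ.ne']; rw [← zpow_natCast]; congr 1; push_cast; ring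
    have f1 : finPoch Q (2 * (n + 1)) = finPoch Q (2 * n) * (1 - A * B / Q) * (1 - A * B) := by
      rw [hAB, mul_add, mul_one, finPoch, prod_range_succ, prod_range_succ, finPoch]
      field_simp
      ring
    have q1 : Q ^ (2 * n + 1) = A * B / Q := by rw [hAB]; field_simp; ring
    have r1 : z * Q ^ n * jacobiTerm z Q (j - 1) = -(B * a) := by
      have : Q ^ n = B * Q ^ (j - 1) := by
        rw [hB, ← zpow_add₀ hQ.ne']; rw [← zpow_natCast]; congr 1; ring
      rw [a2, this]; ring
    have r2 : Q ^ (n + 1) / z * jacobiTerm z Q (j + 1) = -(A * a) := by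
      have : A = Q ^ (n + 1) * Q ^ j := by
        rw [hA, zpow_add₀ hQ.ne']; norm_cast
      rw [a1, this]; field_simp
    push_cast
    rw [← mul_assoc (z * Q ^ n), ← mul_assoc (Q ^ (n + 1) / z), r1, r2, i1, k1, i2, k2, i3, k3, f1, q1]
    field_simp
    ring

end Poch

lemma exp_zpow (x : ℝ) (n : ℤ) : Real.exp x ^ n = Real.exp (x * n) := by
  rw [← Real.rpow_intCast, ← Real.exp_mul]

lemma jacobiTerm_abs {Q : ℝ} (hQ : 0 < Q) (hQ1 : Q < 1) {z : ℝ} (hz : z ≠ 0) (j : ℤ) :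
    |jacobiTerm z Q j| = Real.exp (Real.log Q *
      (1 / 2 * (j : ℝ) ^ 2 + (Real.log |z| / Real.log Q - 1 / 2) * j + 0)) := by
  have hl : Real.log Q ≠ 0 := (Real.log_neg hQ hQ1).ne
  have e : ((j * (j - 1) / 2 : ℤ) : ℝ) = (j : ℝ) * (j - 1) / 2 := by
    obtain ⟨k, hk⟩ := Int.even_mul_pred_self j
    have h2 : j * (j - 1) / 2 = k := by omega
    rw [h2]
    have : (j : ℝ) * (j - 1) = k + k := by exact_mod_cast hk
    rw [this]; ring
  rw [jacobiTerm, abs_mul, abs_mul, abs_zpow, abs_zpow, abs_zpow, abs_neg, abs_one, one_zpow,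
    one_mul, abs_of_pos hQ, ← Real.exp_log (abs_pos.mpr hz), exp_zpow,
    ← Real.rpow_intCast, Real.rpow_def_of_pos hQ, ← Real.exp_add, e, Real.log_exp]
  congr 1
  field_simp
  ring

lemma summable_abs_jacobiTerm {Q : ℝ} (hQ : 0 < Q) (hQ1 : Q < 1) {z : ℝ} (hz : z ≠ 0) :
    Summable fun j : ℤ => |jacobiTerm z Q j| := by
  simp only [jacobiTerm_abs hQ hQ1 hz]
  exact summable_gauss (Real.log_neg hQ hQ1) (by norm_num) _ _

set_option maxHeartbeats 800000 in
/-- Jacobi's triple product identity. -/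
theorem hasSum_jacobiTerm {Q : ℝ} (hQ : 0 < Q) (hQ1 : Q < 1) {z : ℝ} (hz : z ≠ 0) :
    HasSum (jacobiTerm z Q) (poch z Q * poch (Q / z) Q * poch Q Q) := by
  have hs := summable_abs_jacobiTerm hQ hQ1 hz
  have hJ := poch_pos hQ hQ1 hQ1
  have hT : Tendsto (fun n : ℕ => ∑' j : ℤ, jacobiTerm z Q j *
      (finPoch Q (2 * n) * invPoch Q (n + j) * invPoch Q (n - j))) atTop
      (𝓝 (∑' j : ℤ, jacobiTerm z Q j * (poch Q Q * (poch Q Q)⁻¹ * (poch Q Q)⁻¹))) := by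
    refine tendsto_tsum_of_dominated_convergence
      (bound := fun j => |jacobiTerm z Q j| * ((poch Q Q)⁻¹ * (poch Q Q)⁻¹)) (hs.mul_right _) ?_ ?_
    · intro j
      refine Tendsto.const_mul _ ((Tendsto.mul ?_ ?_).mul ?_)
      · exact (tendsto_poch hQ hQ1 Q).comp (tendsto_id.const_mul_atTop' (r := 2) (by norm_num))
      · exact tendsto_invPoch hQ hQ1 _ (tendsto_atTop_add_const_right _ _ tendsto_natCast_atTop_atTop)
      · exact tendsto_invPoch hQ hQ1 _ (tendsto_atTop_add_const_right _ (-j) tendsto_natCast_atTop_atTop)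
    · refine Eventually.of_forall fun n j => ?_
      have h1 : finPoch Q (2 * n) ≤ 1 := by
        simpa [finPoch] using finPoch_antitone hQ hQ1 (Nat.zero_le (2 * n))
      have h2 := invPoch_nonneg hQ hQ1 (n + j)
      have h3 := invPoch_nonneg hQ hQ1 (n - j)
      have h4 := (finPoch_pos hQ hQ1 (2 * n)).le
      rw [norm_mul, Real.norm_eq_abs, Real.norm_eq_abs]
      refine mul_le_mul_of_nonneg_left ?_ (abs_nonneg _)
      rw [abs_of_nonneg (by positivity)]
      refine mul_le_mul ?_ (invPoch_le hQ hQ1 _) h3 (inv_pos.mpr hJ).le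
      exact (mul_le_of_le_one_left h2 h1).trans (invPoch_le hQ hQ1 _)
  have hF := (tendsto_poch hQ hQ1 z).mul (tendsto_poch hQ hQ1 (Q / z))
  have e := tendsto_nhds_unique hF
    (hT.congr fun n => (hasSum_finite_triple hQ hQ1 hz n).tsum_eq)
  rw [e, tsum_mul_right]
  have hs' : Summable (jacobiTerm z Q) := hs.of_norm
  have e2 : (∑' j, jacobiTerm z Q j) * (poch Q Q * (poch Q Q)⁻¹ * (poch Q Q)⁻¹) * poch Q Q =
      ∑' j, jacobiTerm z Q j := by field_simp
  rw [e2]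
  exact hs'.hasSum

lemma exp_lt_one_of_neg {x : ℝ} (h : x < 0) : Real.exp x < 1 := Real.exp_lt_one_iff.mpr h

/-- Product formula for the theta series at real points. -/
lemma gtheta_ofReal {s κ w : ℝ} (hs : s ^ 2 = 1) (hκ : 0 < κ) (hw : w < 0) (δ v : ℝ) {z Q : ℝ}
    (hQ : Q = Real.exp (w * (242 * κ)))
    (hz : z = -s * Real.exp (w * (121 * κ + 22 * κ * (11 * δ + v)))) :
    gtheta s κ δ w v =
      ((Real.exp (w * (κ * (11 * δ + v) ^ 2)) * (poch z Q * poch (Q / z) Q * poch Q Q) : ℝ) : ℂ) := by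
  have hs0 : s ≠ 0 := by rintro rfl; norm_num at hs
  have hQ0 : 0 < Q := hQ ▸ Real.exp_pos _
  have hQ1 : Q < 1 := hQ ▸ exp_lt_one_of_neg (mul_neg_of_neg_of_pos hw (by positivity))
  have hz0 : z ≠ 0 := hz ▸ mul_ne_zero (neg_ne_zero.mpr hs0) (Real.exp_ne_zero _)
  rw [← (hasSum_jacobiTerm hQ0 hQ1 hz0).tsum_eq, ← tsum_mul_left, Complex.ofReal_tsum, gtheta]
  refine tsum_congr fun n => ?_
  have e : ((n * (n - 1) / 2 : ℤ) : ℝ) = (n : ℝ) * (n - 1) / 2 := by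
    obtain ⟨k, hk⟩ := Int.even_mul_pred_self n
    have h2 : n * (n - 1) / 2 = k := by omega
    rw [h2]
    have : (n : ℝ) * (n - 1) = k + k := by exact_mod_cast hk
    rw [this]; ring
  have h1 : jacobiTerm z Q n = s ^ n * Real.exp (w * ((121 * κ + 22 * κ * (11 * δ + v)) * n
      + 121 * κ * n * (n - 1))) := by
    rw [jacobiTerm, hz, hQ, mul_zpow, ← mul_assoc, ← mul_zpow, exp_zpow,
      exp_zpow, e, mul_assoc, ← Real.exp_add]
    congr 2
    · ring
    · ring
  have h2 : (κ : ℂ) * (11 * (n + δ) + v) ^ 2 = ((κ * (11 * (n + δ) + v) ^ 2 : ℝ) : ℂ) := by push_cast; rfl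
  rw [h2, qpow_ofReal, h1, mul_left_comm (Real.exp (w * (κ * (11 * δ + v) ^ 2))), ← Real.exp_add]
  push_cast
  congr 2
  ring

/-- The base `q ^ 121`. -/
noncomputable def nome (w : ℝ) : ℝ := Real.exp (w * 121)

lemma nome_pos (w : ℝ) : 0 < nome w := Real.exp_pos _

lemma nome_lt_one {w : ℝ} (hw : w < 0) : nome w < 1 := exp_lt_one_of_neg (by linarith)

/-- The absolute value of `theta w a` for `0 < a < 11`. -/
noncomputable def thetaAbs (w a : ℝ) : ℝ :=
  Real.exp (w * (1 / 2 * (11 / 2 - a) ^ 2)) * (poch (Real.exp (w * (121 - 11 * a))) (nome w)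
    * poch (Real.exp (w * (11 * a))) (nome w) * poch (nome w) (nome w))

lemma theta_ofReal {w : ℝ} (hw : w < 0) (a : ℝ) : theta w a = -(thetaAbs w a : ℂ) := by
  have h := gtheta_ofReal (s := -1) (κ := 1 / 2) (by norm_num) (by norm_num) hw (1 / 2) (-a)
    (z := Real.exp (w * (121 - 11 * a))) (Q := nome w) (by rw [nome]; congr 1; ring)
    (by rw [neg_neg, one_mul]; congr 1; ring)
  have e1 : nome w / Real.exp (w * (121 - 11 * a)) = Real.exp (w * (11 * a)) := by
    rw [nome, ← Real.exp_sub]; congr 1; ring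
  rw [e1] at h
  rw [← neg_neg (a : ℂ), theta_neg, theta, thetaAbs, ← Complex.ofReal_neg]
  have e2 : 11 / 2 - a = 11 * (1 / 2) + -a := by ring
  rw [e2]
  push_cast at h ⊢
  rw [← h]

lemma thetaAbs_pos {w : ℝ} (hw : w < 0) {a : ℝ} (ha : 0 < a) (ha' : a < 11) : 0 < thetaAbs w a := by
  have h0 := nome_pos w
  have h1 := nome_lt_one hw
  refine mul_pos (Real.exp_pos _) (mul_pos (mul_pos ?_ ?_) (poch_pos h0 h1 h1))
  · exact poch_pos h0 h1 (exp_lt_one_of_neg (by nlinarith))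
  · exact poch_pos h0 h1 (exp_lt_one_of_neg (by nlinarith))

/-- The real number `E₀`. -/
noncomputable def ezeroR (w : ℝ) : ℝ := Real.exp (w * (121 / 24)) * poch (nome w) (nome w)

lemma ezeroR_pos {w : ℝ} (hw : w < 0) : 0 < ezeroR w :=
  mul_pos (Real.exp_pos _) (poch_pos (nome_pos w) (nome_lt_one hw) (nome_lt_one hw))

lemma ezero_eq {w : ℝ} (hw : w < 0) : ezero w = (ezeroR w : ℂ) := by
  have h := gtheta_ofReal (s := -1) (κ := 3 / 2) (by norm_num) (by norm_num) hw 0 (-(11 / 6))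
    (z := nome w) (Q := nome w ^ 3) (by rw [nome, ← Real.exp_nat_mul]; push_cast; congr 1; ring)
    (by rw [neg_neg, one_mul, nome]; congr 1; ring)
  have e1 : nome w ^ 3 / nome w = nome w * nome w := by have := (nome_pos w).ne'; field_simp
  have e2 : nome w ^ 3 = nome w * nome w ^ 2 := by ring
  have h3 := poch_split_three (nome_pos w) (nome_lt_one hw) (nome w)
  rw [← e2] at h3
  rw [e1, ← h3] at h
  rw [ezero, thetaCubic, ezeroR]
  have e3 : (121 / 24 : ℝ) = 3 / 2 * (11 * 0 + -(11 / 6)) ^ 2 := by norm_num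
  rw [e3]
  push_cast at h ⊢
  rw [← h]

lemma ezeroR_pow_three (w : ℝ) :
    ezeroR w ^ 3 = Real.exp (w * (121 / 8)) * poch (nome w) (nome w) ^ 3 := by
  rw [ezeroR, mul_pow, ← Real.exp_nat_mul]; push_cast; congr 2; ring

/-- Jacobi's formula for the cube of the eta function. -/
lemma sigma_zero {w : ℝ} (hw : w ≤ -1) : sigma w 0 = -ezero w ^ 3 := by
  have hw0 : w < 0 := by linarith
  have h0 := nome_pos w
  have h1 := nome_lt_one hw0
  have key : ∀ v : ℝ, v ≠ 0 → sigma w v = ((-(Real.exp (w * (11 / 2 * v)) *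
      Real.exp (w * (1 / 2 * (11 / 2 - v) ^ 2)) * (poch (Real.exp (w * (121 - 11 * v))) (nome w)
      * poch (Real.exp (w * (121 + 11 * v))) (nome w) * poch (nome w) (nome w))) : ℝ) : ℂ) := by
    intro v hv
    have hb : bracket w v = ((Real.exp (w * (-(11 / 2 * v))) * (1 - Real.exp (w * (11 * v))) : ℝ) : ℂ) := by
      rw [mul_sub, mul_one, ← Real.exp_add, bracket]
      have e1 : -(11 / 2 * (v : ℂ)) = ((-(11 / 2 * v) : ℝ) : ℂ) := by push_cast; rfl
      have e2 : (11 / 2 * (v : ℂ)) = ((11 / 2 * v : ℝ) : ℂ) := by push_cast; rfl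
      rw [e1, e2, qpow_ofReal, qpow_ofReal]
      push_cast; congr 2; ring
    have hb0 : bracket w v ≠ 0 := by
      rw [hb]
      refine Complex.ofReal_ne_zero.mpr (mul_ne_zero (Real.exp_ne_zero _) (sub_ne_zero.mpr ?_))
      rw [ne_comm, Ne, Real.exp_eq_one_iff]
      exact mul_ne_zero hw0.ne (mul_ne_zero (by norm_num) hv)
    refine mul_right_cancel₀ hb0 ?_
    rw [sigma_mul_bracket hw, theta_ofReal hw0, hb, thetaAbs, ← Complex.ofReal_neg,
      ← Complex.ofReal_mul]
    congr 1
    have hp := poch_eq_mul h0 h1 (Real.exp (w * (11 * v)))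
    have e1 : Real.exp (w * (11 * v)) * nome w = Real.exp (w * (121 + 11 * v)) := by
      rw [nome, ← Real.exp_add]; congr 1; ring
    have e2 : Real.exp (w * (11 / 2 * v)) * Real.exp (w * (-(11 / 2 * v))) = 1 := by
      rw [← Real.exp_add, ← Real.exp_zero]; congr 1; ring
    rw [e1] at hp
    rw [hp]
    linear_combination (Real.exp (w * (1 / 2 * (11 / 2 - v) ^ 2)) * (poch (Real.exp (w * (121 - 11 * v))) (nome w)
      * poch (Real.exp (w * (121 + 11 * v))) (nome w) * poch (nome w) (nome w))) *
      (1 - Real.exp (w * (11 * v))) * e2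
  have hl : Tendsto (fun v : ℝ => sigma w v) (𝓝[≠] 0) (𝓝 (sigma w 0)) := by
    have : Continuous fun v : ℝ => sigma w v :=
      (differentiable_sigma hw).continuous.comp Complex.continuous_ofReal
    have := (this.tendsto 0).mono_left (nhdsWithin_le_nhds (s := {0}ᶜ))
    simpa using this
  have hr : Tendsto (fun v : ℝ => -(Real.exp (w * (11 / 2 * v)) *
      Real.exp (w * (1 / 2 * (11 / 2 - v) ^ 2)) * (poch (Real.exp (w * (121 - 11 * v))) (nome w)
      * poch (Real.exp (w * (121 + 11 * v))) (nome w) * poch (nome w) (nome w)))) (𝓝 0)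
      (𝓝 (-(Real.exp (w * (11 / 2 * 0)) *
      Real.exp (w * (1 / 2 * (11 / 2 - 0) ^ 2)) * (poch (Real.exp (w * (121 - 11 * 0))) (nome w)
      * poch (Real.exp (w * (121 + 11 * 0))) (nome w) * poch (nome w) (nome w))))) := by
    have c1 : ContinuousAt (fun v : ℝ => poch (Real.exp (w * (121 - 11 * v))) (nome w)) 0 :=
      ContinuousAt.comp (f := fun v : ℝ => Real.exp (w * (121 - 11 * v)))
        (continuousAt_poch h0 h1 _) (by fun_prop)
    have c2 : ContinuousAt (fun v : ℝ => poch (Real.exp (w * (121 + 11 * v))) (nome w)) 0 :=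
      ContinuousAt.comp (f := fun v : ℝ => Real.exp (w * (121 + 11 * v)))
        (continuousAt_poch h0 h1 _) (by fun_prop)
    have c3 : ContinuousAt (fun v : ℝ => Real.exp (w * (11 / 2 * v)) *
      Real.exp (w * (1 / 2 * (11 / 2 - v) ^ 2))) 0 := by fun_prop
    exact (c3.mul ((c1.mul c2).mul_const _)).neg
  have hr' := (Complex.continuous_ofReal.tendsto _).comp (hr.mono_left (nhdsWithin_le_nhds (s := {0}ᶜ)))
  have e := tendsto_nhds_unique hl (hr'.congr' (by
    filter_upwards [self_mem_nhdsWithin] with v hv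
    exact (key v hv).symm))
  rw [e, ezero_eq hw0, ← Complex.ofReal_pow, ezeroR_pow_three, ← Complex.ofReal_neg]
  congr 2
  rw [nome]
  simp only [mul_zero, Real.exp_zero, sub_zero, add_zero, one_mul]
  rw [show (1 / 2 * (11 / 2) ^ 2 : ℝ) = 121 / 8 by norm_num]
  ring

/-- The product of the three even thetas at the origin. -/
lemma gtheta_mul_gtheta_mul_gtheta {w : ℝ} (hw : w < 0) :
    gtheta 1 (1 / 2) (1 / 2) w 0 * gtheta 1 (1 / 2) 0 w 0 * gtheta (-1) (1 / 2) 0 w 0 =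
      2 * ezero w ^ 3 := by
  have h0 := nome_pos w
  have h1 := nome_lt_one hw
  set s := Real.exp (w * (121 / 2)) with hs
  have hs0 : 0 < s := Real.exp_pos _
  have hs1 : s < 1 := exp_lt_one_of_neg (by linarith)
  have hn : nome w = s ^ 2 := by rw [nome, hs, ← Real.exp_nat_mul]; push_cast; congr 1; ring
  have hA := gtheta_ofReal (s := 1) (κ := 1 / 2) (by norm_num) (by norm_num) hw (1 / 2) 0
    (z := -nome w) (Q := nome w) (by rw [nome]; congr 1; ring)
    (by rw [neg_one_mul, nome]; congr 2; ring)
  have hB := gtheta_ofReal (s := 1) (κ := 1 / 2) (by norm_num) (by norm_num) hw 0 0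
    (z := -s) (Q := nome w) (by rw [nome]; congr 1; ring)
    (by rw [neg_one_mul, hs]; congr 2; ring)
  have hC := gtheta_ofReal (s := -1) (κ := 1 / 2) (by norm_num) (by norm_num) hw 0 0
    (z := s) (Q := nome w) (by rw [nome]; congr 1; ring)
    (by rw [neg_neg, one_mul, hs]; congr 1; ring)
  have e1 : nome w / -nome w = -1 := by field_simp
  have e2 : nome w / -s = -s := by rw [hn]; field_simp
  have e3 : nome w / s = s := by rw [hn]; field_simp
  rw [e1] at hA; rw [e2] at hB; rw [e3] at hC
  have hp := poch_eq_mul h0 h1 (-1)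
  rw [neg_one_mul] at hp
  have he := poch_euler hs0 hs1
  rw [← hn] at he
  rw [hp] at hA
  have hE := ezeroR_pow_three w
  push_cast at hA hB hC
  rw [hA, hB, hC, ezero_eq hw, ← Complex.ofReal_pow, hE]
  have e4 : Real.exp (w * (1 / 2 * (11 * (1 / 2) + 0) ^ 2)) = Real.exp (w * (121 / 8)) := by
    congr 1; ring
  have e5 : Real.exp (w * (1 / 2 * (11 * 0 + 0) ^ 2)) = 1 := by
    rw [← Real.exp_zero]; congr 1; ring
  have he' : (poch (-nome w) (nome w) : ℂ) * poch (-s) (nome w) * poch s (nome w) = 1 := by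
    exact_mod_cast he
  have e4' := congrArg (fun x : ℝ => (x : ℂ)) e4
  have e5' := congrArg (fun x : ℝ => (x : ℂ)) e5
  push_cast at e4' e5' ⊢
  rw [e4', e5']
  linear_combination 2 * Complex.exp (w * (121 / 8)) * poch (nome w) (nome w) ^ 3 *
    ((poch (-nome w) (nome w) : ℂ) * poch (-s) (nome w) * poch s (nome w) + 1) * he'

lemma bracket_intCast (w : ℝ) (n : ℤ) :
    bracket w n = ((Real.exp (-(11 / 2 * w * n)) - Real.exp (11 / 2 * w * n) : ℝ) : ℂ) := by
  have e1 : -(11 / 2 * (n : ℂ)) = ((-(11 / 2 * n) : ℝ) : ℂ) := by push_cast; rfl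
  have e2 : (11 / 2 * (n : ℂ)) = ((11 / 2 * n : ℝ) : ℂ) := by push_cast; rfl
  rw [bracket, e1, e2, qpow_ofReal, qpow_ofReal]
  push_cast
  congr 2 <;> ring

lemma bracket_zero (w : ℝ) : bracket w 0 = 0 := by simp [bracket]

lemma bracket_neg (w : ℝ) (v : ℂ) : bracket w (-v) = -bracket w v := by
  rw [bracket, bracket]; simp

lemma one_le_norm_bracket {w : ℝ} (hw : w ≤ -1) {n : ℤ} (hn : n ≠ 0) : 1 ≤ ‖bracket w n‖ := by
  wlog h : 0 < n generalizing n
  · have h' : 0 < -n := by omega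
    have := this (n := -n) (by omega) h'
    rwa [Int.cast_neg, bracket_neg, norm_neg] at this
  have h1 : (1 : ℝ) ≤ n := by exact_mod_cast h
  have h2 : (2 : ℝ) ≤ Real.exp (-(11 / 2 * w * n)) := by
    have := Real.add_one_le_exp (-(11 / 2 * w * n))
    nlinarith
  have h3 : Real.exp (11 / 2 * w * n) ≤ 1 := Real.exp_le_one_iff.mpr (by nlinarith)
  rw [bracket_intCast, Complex.norm_real]
  exact (by linarith : _ ≤ _).trans (le_abs_self _)

lemma bracket_intCast_ne_zero {w : ℝ} (hw : w ≤ -1) {n : ℤ} (hn : n ≠ 0) : bracket w n ≠ 0 := by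
  rw [← norm_pos_iff]
  exact zero_lt_one.trans_le (one_le_norm_bracket hw hn)

lemma norm_inv_bracket_le {w : ℝ} (hw : w ≤ -1) (n : ℤ) : ‖(bracket w n)⁻¹‖ ≤ 1 := by
  by_cases hn : n = 0
  · simp [hn, bracket_zero]
  · rw [norm_inv]; exact inv_le_one_of_one_le₀ (one_le_norm_bracket hw hn)

/-- The terms of the bilateral Lambert series, with the pole omitted. -/
noncomputable def lamTerm (w : ℝ) (c l : ℤ) : ℂ :=
  (-1) ^ l * qpow w (3 / 2 * l ^ 2) / bracket w (c + l)

lemma summable_lamTerm {w : ℝ} (hw : w ≤ -1) (c : ℤ) : Summable (lamTerm w c) := by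
  refine Summable.of_norm_bounded (summable_gauss (w := w) (by linarith) (α := 3 / 2) (by norm_num) 0 0)
    fun l => ?_
  have e : (3 / 2 * (l : ℂ) ^ 2) = ((3 / 2 * (l : ℝ) ^ 2 : ℝ) : ℂ) := by push_cast; rfl
  have h := norm_inv_bracket_le hw (c + l)
  push_cast at h
  rw [lamTerm, div_eq_mul_inv, norm_mul, norm_mul, norm_zpow_of_sq_eq_one (by norm_num), one_mul, e,
    qpow_ofReal, Complex.norm_real, Real.norm_of_nonneg (Real.exp_pos _).le, zero_mul, add_zero, add_zero]
  exact mul_le_of_le_one_right (Real.exp_pos _).le h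

/-- The part of the bilateral Lambert series with `l ≡ r (mod 11)`. -/
noncomputable def psum (w : ℝ) (r c : ℤ) : ℂ := ∑' m : ℤ, (-1) ^ r * lamTerm w c (r + 11 * m)

lemma lam_injective (r : ℤ) : Function.Injective fun m : ℤ => r + 11 * m := fun a b h => by
  simp only at h; omega

lemma hasSum_psum {w : ℝ} (hw : w ≤ -1) (r c : ℤ) :
    HasSum (fun m : ℤ => (-1) ^ r * lamTerm w c (r + 11 * m)) (psum w r c) :=
  (((summable_lamTerm hw c).comp_injective (lam_injective r)).mul_left _).hasSum

lemma neg_one_zpow_eleven (m : ℤ) : (-1 : ℂ) ^ (11 * m) = (-1) ^ m := by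
  rw [zpow_mul]; norm_num

lemma psum_term (w : ℝ) (r c m : ℤ) : (-1) ^ r * lamTerm w c (r + 11 * m) =
    (-1) ^ m * qpow w (3 / 2 * (r + 11 * m) ^ 2) / bracket w (c + (r + 11 * m)) := by
  have h : (-1 : ℂ) ^ r * (-1) ^ r = 1 := by rw [← mul_zpow]; simp
  rw [lamTerm, zpow_add₀ (by norm_num), neg_one_zpow_eleven]
  push_cast
  linear_combination (-1) ^ m * qpow w (3 / 2 * (r + 11 * m) ^ 2) / bracket w (c + (r + 11 * m)) * h

lemma theta_zero (w : ℝ) : theta w 0 = 0 := by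
  have := theta_neg w 0
  rw [neg_zero] at this
  exact self_eq_neg.mp this

lemma theta_int_ne_zero {w : ℝ} (hw : w < 0) {n : ℤ} (hn : ¬ (11 : ℤ) ∣ n) : theta w n ≠ 0 := by
  have e : (n : ℂ) = ((n % 11 : ℤ) : ℝ) + 11 * (n / 11 : ℤ) := by
    conv_lhs => rw [← Int.emod_add_mul_ediv n 11]
    push_cast; rfl
  rw [e, theta_add_eleven_mul, theta_ofReal hw]
  refine mul_ne_zero (zpow_ne_zero _ (by norm_num)) (neg_ne_zero.mpr (Complex.ofReal_ne_zero.mpr ?_))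
  refine (thetaAbs_pos hw ?_ ?_).ne'
  · have : 0 < n % 11 := by omega
    exact_mod_cast this
  · have : n % 11 < 11 := by omega
    exact_mod_cast this

lemma sigma_eleven_mul {w : ℝ} (hw : w ≤ -1) {m : ℤ} (hm : m ≠ 0) : sigma w (11 * m) = 0 := by
  have h := sigma_mul_bracket hw (11 * m)
  rw [← zero_add (11 * (m : ℂ)), theta_add_eleven_mul, theta_zero, mul_zero, zero_add] at h
  refine (mul_eq_zero.mp h).resolve_right ?_
  have := bracket_intCast_ne_zero hw (n := 11 * m) (by omega)
  push_cast at this; exact this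

lemma sigma_zero_ne_zero {w : ℝ} (hw : w ≤ -1) : sigma w 0 ≠ 0 := by
  rw [sigma_zero hw, ezero_eq (by linarith)]
  exact neg_ne_zero.mpr (pow_ne_zero _ (Complex.ofReal_ne_zero.mpr (ezeroR_pos (by linarith)).ne'))

lemma ezero_ne_zero {w : ℝ} (hw : w < 0) : ezero w ≠ 0 := by
  rw [ezero_eq hw]; exact Complex.ofReal_ne_zero.mpr (ezeroR_pos hw).ne'

lemma phi_eq_psum {w : ℝ} (hw : w ≤ -1) {r c : ℤ} (h : ¬ (11 : ℤ) ∣ c + r) :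
    phi w r c = theta w (c + r) * psum w r c := by
  rw [phi, psum, ← tsum_mul_left]
  refine tsum_congr fun m => ?_
  have h1 := sigma_mul_bracket hw (c + (r + 11 * m))
  have h2 := bracket_intCast_ne_zero hw (n := c + (r + 11 * m)) (by omega)
  push_cast at h2
  rw [psum_term, eq_div_of_mul_eq h2 h1, ← add_assoc (c : ℂ), theta_add_eleven_mul]
  field_simp

lemma phi_neg_self {w : ℝ} (hw : w ≤ -1) (b : ℤ) :
    phi w (-b) b = qpow w (3 / 2 * b ^ 2) * sigma w 0 := by
  rw [phi, tsum_eq_single 0]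
  · push_cast; congr 2 <;> ring
  · intro m hm
    have e : (b : ℂ) + (((-b : ℤ) : ℂ) + 11 * m) = 11 * m := by push_cast; ring
    rw [e, sigma_eleven_mul hw hm, mul_zero]

lemma phi_zero_zero {w : ℝ} (hw : w ≤ -1) : phi w 0 0 = sigma w 0 := by
  have := phi_neg_self hw 0
  simpa [qpow_zero] using this

lemma bigPhi_zero {w : ℝ} (hw : w ≤ -1) (b : ℤ) :
    bigPhi w b 0 = eplus w b * sigma w 0 * theta w b ^ 2 := by
  rw [bigPhi, theta_zero, phi_zero_zero hw, zero_sub, theta_neg, zero_add]; ring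

lemma eplus_mul_theta {w : ℝ} (hw : w ≤ -1) {b : ℤ} (hb : ¬ (11 : ℤ) ∣ b) :
    eplus w b * theta w b = ezero w * theta w (2 * b) := by
  have h := bigPhi_eq hw b b
  rw [bigPhi_zero hw, bigPhi, sub_self, theta_zero, phi_neg_self hw, ← two_mul] at h
  have h1 := theta_int_ne_zero (by linarith : w < 0) hb
  have h2 := sigma_zero_ne_zero hw
  have h3 := qpow_ne_zero w (3 / 2 * b ^ 2)
  refine mul_left_cancel₀ (mul_ne_zero (mul_ne_zero h1 h2) h3) ?_
  linear_combination -h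

lemma psum_generic {w : ℝ} (hw : w ≤ -1) {b c : ℤ} (hc : ¬ (11 : ℤ) ∣ c) (h1 : ¬ (11 : ℤ) ∣ c - b)
    (h2 : ¬ (11 : ℤ) ∣ c + b) :
    theta w c * theta w (c - b) * theta w (c + b) *
      (ezero w * (psum w b c + psum w (-b) c) - eplus w b * psum w 0 c) =
      qpow w (3 / 2 * c ^ 2) * (eplus w b * sigma w 0 * theta w b ^ 2) := by
  rw [← bigPhi_zero hw, ← bigPhi_eq hw, bigPhi, phi_eq_psum hw h2, phi_eq_psum hw (r := 0) (by simpa using hc),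
    phi_eq_psum hw (r := -b) (by rwa [← sub_eq_add_neg])]
  push_cast
  rw [← sub_eq_add_neg, add_zero]
  ring

lemma hasDerivAt_theta {w : ℝ} (hw : w < 0) (v : ℂ) : HasDerivAt (theta w) (deriv (theta w) v) v :=
  (differentiable_theta hw v).hasDerivAt

lemma hasDerivAt_bracket (w : ℝ) (v : ℂ) : HasDerivAt (bracket w)
    (-(11 / 2 * w) * (qpow w (-(11 / 2 * v)) + qpow w (11 / 2 * v))) v := by
  have h1 := (hasDerivAt_qpow w (-(11 / 2 * v))).comp v (((hasDerivAt_id v).const_mul (11 / 2)).neg)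
  have h2 := (hasDerivAt_qpow w (11 / 2 * v)).comp v ((hasDerivAt_id v).const_mul (11 / 2))
  exact (h1.sub h2).congr_deriv (by ring)

lemma deriv_theta_eq {w : ℝ} (hw : w ≤ -1) (v : ℂ) : deriv (theta w) v =
    deriv (sigma w) v * bracket w v
      + sigma w v * (-(11 / 2 * w) * (qpow w (-(11 / 2 * v)) + qpow w (11 / 2 * v))) := by
  have h := (differentiable_sigma hw v).hasDerivAt.mul (hasDerivAt_bracket w v)
  have e : sigma w * bracket w = theta w := funext fun v => sigma_mul_bracket hw v
  rw [e] at h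
  exact h.deriv

lemma deriv_theta_zero {w : ℝ} (hw : w ≤ -1) : deriv (theta w) 0 = -(11 * w) * sigma w 0 := by
  rw [deriv_theta_eq hw, bracket_zero]; simp [qpow_zero]; ring

lemma deriv_theta_add_eleven_mul {w : ℝ} (v : ℂ) (m : ℤ) :
    deriv (theta w) (v + 11 * m) = (-1) ^ m * deriv (theta w) v := by
  rw [← deriv_comp_add_const, show (fun x => theta w (x + 11 * (m : ℂ))) = fun x => (-1) ^ m * theta w x from
    funext fun x => theta_add_eleven_mul w x m]
  exact deriv_const_mul_field _

lemma deriv_sigma_zero (w : ℝ) : deriv (sigma w) 0 = 0 := by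
  have h : deriv (fun v => sigma w (-v)) 0 = -deriv (sigma w) (-0) := deriv_comp_neg (sigma w) 0
  rw [funext fun v => sigma_neg w v, neg_zero] at h
  exact self_eq_neg.mp h

lemma deriv_phi_neg_self {w : ℝ} (hw : w ≤ -1) (b : ℤ) :
    deriv (phi w (-b)) b = deriv (theta w) 0 * psum w (-b) b := by
  refine (hasSum_deriv_phi hw (-b) b).unique (((hasSum_psum hw (-b) b).mul_left _).congr_fun fun m => ?_)
  have e : (b : ℂ) + (((-b : ℤ) : ℂ) + 11 * m) = 11 * m := by push_cast; ring
  rw [psum_term, e]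
  by_cases hm : m = 0
  · subst hm; simp [deriv_sigma_zero, bracket_zero]
  · have h1 := deriv_theta_eq hw (11 * m)
    rw [sigma_eleven_mul hw hm, zero_mul, add_zero] at h1
    have h2 := deriv_theta_add_eleven_mul (w := w) 0 m
    rw [zero_add, h1] at h2
    have h3 := bracket_intCast_ne_zero hw (n := 11 * m) (by omega)
    push_cast at h3
    rw [eq_div_of_mul_eq h3 h2]
    ring

/-- The normalised logarithmic derivative of `theta` at integers. -/
noncomputable def logDer (w : ℝ) (a : ℤ) : ℂ := deriv (theta w) a / (11 * w * theta w a)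

lemma deriv_theta_eq_logDer {w : ℝ} (hw : w < 0) {a : ℤ} (ha : ¬ (11 : ℤ) ∣ a) :
    deriv (theta w) a = 11 * w * logDer w a * theta w a := by
  have h1 := theta_int_ne_zero hw ha
  have h2 : (w : ℂ) ≠ 0 := by exact_mod_cast hw.ne
  rw [logDer]; field_simp

lemma psum_self {w : ℝ} (hw : w ≤ -1) {b : ℤ} (hb : ¬ (11 : ℤ) ∣ b) :
    ezero w * (psum w b b + psum w (-b) b) = eplus w b * psum w 0 b +
      ezero w * qpow w (3 / 2 * b ^ 2) * (logDer w b + logDer w (2 * b) - 3 * b / 11) := by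
  have hw0 : w < 0 := by linarith
  have hwc : (w : ℂ) ≠ 0 := by exact_mod_cast hw0.ne
  have hb2 : ¬ (11 : ℤ) ∣ 2 * b := by omega
  have n1 := theta_int_ne_zero hw0 hb
  have n2 := theta_int_ne_zero hw0 hb2
  push_cast at n2
  have n3 := sigma_zero_ne_zero hw
  have hφ : ∀ r, HasDerivAt (phi w r) (deriv (phi w r) b) b := fun r =>
    (differentiable_phi hw r b).hasDerivAt
  have hm : HasDerivAt (fun v => theta w (v - b)) (deriv (theta w) 0) b := by
    have := hasDerivAt_theta hw0 ((b : ℂ) - b)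
    rw [sub_self] at this
    exact HasDerivAt.comp_sub_const (f := theta w) (b : ℂ) b (by rwa [sub_self])
  have hp : HasDerivAt (fun v => theta w (v + b)) (deriv (theta w) (2 * b)) b := by
    refine HasDerivAt.comp_add_const (f := theta w) (b : ℂ) b ?_
    rw [← two_mul]; exact hasDerivAt_theta hw0 _
  have hL := ((((hasDerivAt_theta hw0 b).const_mul (ezero w)).mul
    (((hφ b).mul hm).add ((hφ (-b)).mul hp)))).sub
    ((((hφ 0).const_mul (eplus w b)).mul hm).mul hp)
  have hR : HasDerivAt (fun v => qpow w (3 / 2 * v ^ 2) * bigPhi w b 0)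
      (w * qpow w (3 / 2 * b ^ 2) * (3 / 2 * (2 * b)) * bigPhi w b 0) b := by
    have h0 : HasDerivAt (fun v : ℂ => (3 / 2 : ℂ) * v ^ 2) ((3 / 2 : ℂ) * (2 * (b : ℂ))) (b : ℂ) :=
      ((hasDerivAt_pow 2 (b : ℂ)).const_mul (3 / 2 : ℂ)).congr_deriv (by norm_num)
    exact (HasDerivAt.comp (h₂ := qpow w) (b : ℂ) (hasDerivAt_qpow w _) h0).mul_const _
  have e := hL.unique (hR.congr_of_eventuallyEq (Eventually.of_forall fun v => bigPhi_eq hw b v))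
  have p1 := phi_eq_psum hw (r := b) (c := b) (by rwa [← two_mul])
  have p2 := phi_eq_psum hw (r := 0) (c := b) (by rwa [add_zero])
  have d2 := deriv_theta_eq_logDer hw0 hb2
  push_cast at d2
  rw [← two_mul] at p1
  rw [Int.cast_zero, add_zero] at p2
  have E := eplus_mul_theta hw hb
  simp only [Pi.mul_apply, Pi.add_apply] at e
  rw [sub_self, theta_zero, phi_neg_self hw, deriv_phi_neg_self hw, p1, p2, ← two_mul,
    bigPhi_zero hw, deriv_theta_zero hw, d2, deriv_theta_eq_logDer hw0 hb] at e
  have nn : 11 * (w : ℂ) * sigma w 0 * theta w b * theta w (2 * b) ≠ 0 :=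
    mul_ne_zero (mul_ne_zero (mul_ne_zero (mul_ne_zero (by norm_num) hwc) n3) n1) n2
  refine mul_left_cancel₀ nn ?_
  linear_combination -e - 3 * w * b * qpow w (3 / 2 * b ^ 2) * sigma w 0 * theta w b * E

lemma tsum_add_eleven_mul (f : ℤ → ℂ) (r : ℤ) :
    ∑' m : ℤ, f (r - 11 + 11 * m) = ∑' m : ℤ, f (r + 11 * m) := by
  rw [← (Equiv.addRight (1 : ℤ)).tsum_eq fun m => f (r - 11 + 11 * m)]
  refine tsum_congr fun m => ?_
  simp only [Equiv.coe_addRight]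
  congr 1; ring

/-- Splitting a bilateral sum along the symmetric residues modulo 11. -/
lemma tsum_residues {f : ℤ → ℂ} (hf : Summable f) :
    ∑' n : ℤ, f n = ∑' m : ℤ, f (0 + 11 * m) +
      ∑ b ∈ Icc (1 : ℤ) 5, (∑' m : ℤ, f (b + 11 * m) + ∑' m : ℤ, f (-b + 11 * m)) := by
  have h1 : Summable fun p : Fin 11 × ℤ => f (((p.1 : ℕ) : ℤ) + 11 * p.2) := by
    refine hf.comp_injective (i := fun p : Fin 11 × ℤ => ((p.1 : ℕ) : ℤ) + 11 * p.2) fun p q h => ?_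
    simp only at h
    refine Prod.ext (Fin.ext ?_) ?_ <;> omega
  have h2 : ∑' n : ℤ, f n = ∑ r : Fin 11, ∑' m : ℤ, f (((r : ℕ) : ℤ) + 11 * m) := by
    rw [← tsum_fintype (L := .unconditional _), ← h1.tsum_prod, ← (Int.divModEquiv 11).symm.tsum_eq f,
      ← (Equiv.prodComm (Fin 11) ℤ).tsum_eq]
    refine tsum_congr fun p => ?_
    congr 1
    simp [Int.divModEquiv]
    ring
  have e : Icc (1 : ℤ) 5 = {1, 2, 3, 4, 5} := by decide
  have g := tsum_add_eleven_mul f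
  rw [h2, e]
  simp only [Fin.sum_univ_succ, Fin.sum_univ_zero]
  rw [sum_insert (by decide), sum_insert (by decide), sum_insert (by decide), sum_insert (by decide),
    sum_singleton, show (-1 : ℤ) = 10 - 11 by rfl, show (-2 : ℤ) = 9 - 11 by rfl,
    show (-3 : ℤ) = 8 - 11 by rfl, show (-4 : ℤ) = 7 - 11 by rfl, show (-5 : ℤ) = 6 - 11 by rfl,
    g, g, g, g, g]
  simp
  ring

/-- The terms of `D_i`. -/
noncomputable def dlamTerm (w : ℝ) (i k : ℤ) : ℂ :=
  (-1) ^ k * qpow w (3 / 2 * k ^ 2 - i * k) / bracket w k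

/-- The Lambert series `D_i`, for integral `i`, as a bilateral series. -/
noncomputable def dlam (w : ℝ) (i : ℤ) : ℂ :=
  ∑' k : ℤ, dlamTerm w i k

/-- The terms of the alternating theta series with exponents `3k²/2 + xk`. -/
noncomputable def gaussTerm (w x : ℝ) (k : ℤ) : ℂ := (-1) ^ k * qpow w (3 / 2 * k ^ 2 + x * k)

lemma summable_gaussTerm {w : ℝ} (hw : w < 0) (x : ℝ) : Summable (gaussTerm w x) := by
  refine Summable.of_norm_bounded (summable_gauss hw (α := 3 / 2) (by norm_num) x 0) fun k => ?_
  have e : (3 / 2 * (k : ℂ) ^ 2 + x * k) = ((3 / 2 * (k : ℝ) ^ 2 + x * k : ℝ) : ℂ) := by push_cast; rfl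
  rw [gaussTerm, norm_mul, norm_zpow_of_sq_eq_one (by norm_num), one_mul, e,
    qpow_ofReal, Complex.norm_real, Real.norm_of_nonneg (Real.exp_pos _).le, add_zero]

lemma gaussTerm_neg (w x : ℝ) (k : ℤ) : gaussTerm w x (-k) = gaussTerm w (-x) k := by
  rw [gaussTerm, gaussTerm, zpow_neg_of_sq (by norm_num)]
  push_cast
  rw [neg_sq, mul_neg, neg_mul]

lemma tsum_gaussTerm_neg (w x : ℝ) : ∑' k, gaussTerm w (-x) k = ∑' k, gaussTerm w x k := by
  rw [← (Equiv.neg ℤ).tsum_eq]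
  exact tsum_congr fun k => by rw [Equiv.neg_apply, gaussTerm_neg, neg_neg]

lemma summable_dlam {w : ℝ} (hw : w ≤ -1) (i : ℤ) :
    Summable (dlamTerm w i) := by
  refine Summable.of_norm_bounded (summable_gaussTerm (w := w) (by linarith) (-i)).norm fun k => ?_
  rw [gaussTerm, dlamTerm, div_eq_mul_inv, norm_mul, show -((i : ℝ)) = ((-i : ℤ) : ℝ) by push_cast; rfl]
  refine (mul_le_of_le_one_right (norm_nonneg _) (norm_inv_bracket_le hw k)).trans_eq ?_
  push_cast
  rw [neg_mul, ← sub_eq_add_neg]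

lemma dlamTerm_neg (w : ℝ) (i k : ℤ) : dlamTerm w i (-k) = -dlamTerm w (-i) k := by
  have e : (3 / 2 * (-(k : ℂ)) ^ 2 - i * -(k : ℂ)) = 3 / 2 * k ^ 2 - (-i) * k := by ring
  rw [dlamTerm, dlamTerm, Int.cast_neg, Int.cast_neg, bracket_neg, div_neg, zpow_neg_of_sq (by norm_num), e]

lemma dlamTerm_zero (w : ℝ) (i : ℤ) : dlamTerm w i 0 = 0 := by
  rw [dlamTerm, Int.cast_zero, bracket_zero, div_zero]

lemma dlam_neg (w : ℝ) (i : ℤ) : dlam w (-i) = -dlam w i := by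
  rw [dlam, dlam, ← (Equiv.neg ℤ).tsum_eq, ← tsum_neg]
  refine tsum_congr fun k => ?_
  rw [Equiv.neg_apply, dlamTerm_neg, neg_neg]

lemma dlam_term_pos {w : ℝ} (hw : w ≤ -1) (i : ℤ) (k : ℕ) :
    dlamTerm w i ((k : ℤ) + 1) =
    (((-1) ^ (k + 1) * Real.exp (w * (3 * (k + 1) ^ 2 / 2 + 11 * (k + 1) / 2))
      * Real.exp (-(w * (i * (k + 1)))) / (1 - Real.exp (w * (11 * (k + 1)))) : ℝ) : ℂ) := by
  have e : (3 / 2 * (((k : ℤ) + 1 : ℤ) : ℂ) ^ 2 - i * ((k : ℤ) + 1 : ℤ)) =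
    ((3 / 2 * (k + 1) ^ 2 - i * (k + 1) : ℝ) : ℂ) := by push_cast; rfl
  have hk : (0 : ℝ) ≤ k := Nat.cast_nonneg k
  have h1 : Real.exp (w * (11 * (k + 1))) < 1 := Real.exp_lt_one_iff.mpr (by nlinarith)
  have h2 : Real.exp (-(11 / 2 * w * ((k : ℤ) + 1 : ℤ))) - Real.exp (11 / 2 * w * ((k : ℤ) + 1 : ℤ)) =
      Real.exp (-(w * (11 * (k + 1) / 2))) * (1 - Real.exp (w * (11 * (k + 1)))) := by
    rw [mul_sub, ← Real.exp_add, mul_one]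
    push_cast
    rw [show -(11 / 2 * w * ((k : ℝ) + 1)) = -(w * (11 * (k + 1) / 2)) by ring,
      show 11 / 2 * w * ((k : ℝ) + 1) = -(w * (11 * (k + 1) / 2)) + w * (11 * (k + 1)) by ring]
  rw [dlamTerm, bracket_intCast, e, qpow_ofReal, h2, show ((k : ℤ) + 1) = ((k + 1 : ℕ) : ℤ) by push_cast; rfl,
    zpow_natCast, ← Complex.ofReal_one, ← Complex.ofReal_neg, ← Complex.ofReal_pow,
    ← Complex.ofReal_mul, ← Complex.ofReal_div]
  have h3 : Real.exp (w * (3 / 2 * (k + 1) ^ 2 - i * (k + 1))) * Real.exp (w * (11 * (k + 1) / 2)) =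
      Real.exp (w * (3 * (k + 1) ^ 2 / 2 + 11 * (k + 1) / 2)) * Real.exp (-(w * (i * (k + 1)))) := by
    rw [← Real.exp_add, ← Real.exp_add]; congr 1; ring
  rw [mul_assoc (_ ^ _) (Real.exp _) (Real.exp _), ← h3, Real.exp_neg (w * (11 * (k + 1) / 2)),
    div_mul_eq_div_div, div_inv_eq_mul, mul_assoc (_ ^ _)]

lemma lambert_eq_dlam {w : ℝ} (hw : w ≤ -1) (i : ℤ) : ((lambert i w : ℝ) : ℂ) = dlam w i := by
  have hs := summable_dlam hw i
  have s1 := hs.comp_injective (i := fun k : ℕ => (k : ℤ) + 1) fun a b h => by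
    simp only at h; omega
  have s2 := hs.comp_injective (i := fun k : ℕ => -((k : ℤ) + 1)) fun a b h => by
    simp only at h; omega
  rw [dlam, tsum_of_add_one_of_neg_add_one s1 s2, lambert, Complex.ofReal_tsum, dlamTerm_zero, add_zero]
  refine Eq.trans (tsum_congr fun k => ?_) (s1.tsum_add s2)
  simp only [Function.comp_apply]
  rw [dlamTerm_neg, dlam_term_pos hw i, dlam_term_pos hw (-i), ← Complex.ofReal_neg,
    ← Complex.ofReal_add]
  congr 1
  rw [show -(w * (((-i : ℤ) : ℝ) * (k + 1))) = w * (i * (k + 1)) by push_cast; ring, mul_sub, sub_div,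
    sub_eq_add_neg]

lemma pent_eq_tsum {w : ℝ} (hw : w < 0) :
    ((pent w : ℝ) : ℂ) = ∑' k, gaussTerm w (-(1 / 2)) k := by
  have hs := summable_gaussTerm hw (-(1 / 2))
  have s1 := hs.comp_injective (i := fun k : ℕ => (k : ℤ) + 1) fun a b h => by
    simp only at h; omega
  have s2 := hs.comp_injective (i := fun k : ℕ => -((k : ℤ) + 1)) fun a b h => by
    simp only at h; omega
  have key : ∀ (r : ℝ) (k : ℕ), -(((-1) ^ k * Real.exp (w * ((k + 1) * (3 * k + 2) / 2 + r * (k + 1))) : ℝ) : ℂ)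
      = gaussTerm w (r - 1 / 2) (k + 1) := fun r k => by
    have e : (3 / 2 * ((((k : ℤ) + 1 : ℤ)) : ℂ) ^ 2 + ((r - 1 / 2 : ℝ) : ℂ) * ((k : ℤ) + 1 : ℤ)) =
      (((k + 1) * (3 * k + 2) / 2 + r * (k + 1) : ℝ) : ℂ) := by push_cast; ring
    rw [gaussTerm, e, qpow_ofReal, zpow_add_one₀ (by norm_num), zpow_natCast, mul_neg_one, neg_mul]
    push_cast; rfl
  have z : gaussTerm w (-(1 / 2)) 0 = 1 := by simp [gaussTerm, qpow_zero]
  rw [tsum_of_add_one_of_neg_add_one s1 s2, pent, pentTail, pentTail, z, Complex.ofReal_sub,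
    Complex.ofReal_sub, Complex.ofReal_one, sub_eq_add_neg, sub_eq_add_neg, Complex.ofReal_tsum,
    Complex.ofReal_tsum, ← tsum_neg, ← tsum_neg, tsum_congr (key 0), tsum_congr (key 1), add_comm 1]
  congr 1
  · congr 2; norm_num
  · refine tsum_congr fun k => ?_
    rw [gaussTerm_neg]; norm_num

lemma tsum_shift_pent {w : ℝ} (hw : w < 0) (j : ℤ) :
    ∑' k, gaussTerm w (-(1 + 6 * j) / 2) k =
      (-1) ^ j * qpow w (-(j * (3 * j + 1) / 2)) * (pent w : ℝ) := by
  rw [pent_eq_tsum hw, ← (Equiv.addRight j).tsum_eq, ← tsum_mul_left]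
  refine tsum_congr fun k => ?_
  have e : (3 / 2 * ((k + j : ℤ) : ℂ) ^ 2 + ((-(1 + 6 * j) / 2 : ℝ) : ℂ) * ((k + j : ℤ) : ℂ)) =
    -(j * (3 * j + 1) / 2) + (3 / 2 * k ^ 2 + ((-(1 / 2) : ℝ) : ℂ) * k) := by
    push_cast; ring
  rw [Equiv.coe_addRight, gaussTerm, gaussTerm, e, qpow_add, zpow_add₀ (by norm_num)]
  ring

lemma dlam_sub {w : ℝ} (hw : w ≤ -1) (j : ℤ) :
    dlam w (6 + 3 * j) - dlam w (3 * j - 5) =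
      (-1) ^ j * qpow w (-(j * (3 * j + 1) / 2)) * (pent w : ℝ) - 1 := by
  have hw0 : w < 0 := by linarith
  have h0 := (summable_gaussTerm hw0 (-(1 + 6 * j) / 2)).hasSum
  rw [tsum_shift_pent hw0] at h0
  have h1 := (hasSum_ite_eq (0 : ℤ) (1 : ℂ))
  refine ((summable_dlam hw _).hasSum.sub (summable_dlam hw _).hasSum).unique
    ((h0.sub h1).congr_fun fun k => ?_)
  rw [dlamTerm, dlamTerm, gaussTerm]
  by_cases hk : k = 0
  · subst hk; simp [bracket_zero, qpow_zero]
  · have hb := bracket_intCast_ne_zero hw hk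
    rw [if_neg hk, sub_zero, ← sub_div, div_eq_iff hb, bracket, mul_sub, mul_assoc,
      mul_assoc, ← qpow_add, ← qpow_add]
    congr 3 <;> · push_cast; ring

lemma sum_eplus {w : ℝ} (hw : w < 0) :
    ezero w + ∑ b ∈ Icc (1 : ℤ) 5, (-1) ^ b * eplus w b = qpow w (1 / 24) * (pent w : ℝ) := by
  have h1 := tsum_residues (summable_gaussTerm hw (-(11 / 2)))
  have key : ∀ b : ℤ, qpow w (121 / 24) * ∑' m : ℤ, gaussTerm w (-(11 / 2)) (b + 11 * m) =
      (-1) ^ b * thetaCubic w (b - 11 / 6) := fun b => by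
    rw [thetaCubic_eq, ← tsum_mul_left, ← tsum_mul_left]
    refine tsum_congr fun m => ?_
    have e : (3 / 2 * (b - 11 / 6 + 11 * m : ℂ) ^ 2) = 121 / 24 +
        (3 / 2 * ((b + 11 * m : ℤ) : ℂ) ^ 2 + ((-(11 / 2) : ℝ) : ℂ) * ((b + 11 * m : ℤ) : ℂ)) := by
      push_cast; ring
    rw [gaussTerm, e, qpow_add w (121 / 24), zpow_add₀ (by norm_num), neg_one_zpow_eleven]
    ring
  have h2 := tsum_shift_pent hw (-2)
  rw [show (-(1 + 6 * ((-2 : ℤ) : ℝ)) / 2) = 11 / 2 by norm_num] at h2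
  rw [tsum_gaussTerm_neg, h2] at h1
  have h3 := congrArg (qpow w (121 / 24) * ·) h1
  simp only [mul_add, mul_sum, key, zpow_neg_of_sq (show (-1 : ℂ) ^ 2 = 1 by norm_num)] at h3
  have e : (1 / 24 : ℂ) = 121 / 24 + -(((-2 : ℤ) : ℂ) * (3 * ((-2 : ℤ) : ℂ) + 1) / 2) := by
    push_cast; norm_num
  rw [e, qpow_add]
  refine Eq.trans ?_ (h3.symm.trans ?_)
  · simp [ezero, eplus, mul_add]
  · norm_num; ring

/-- The bilateral Lambert series `D_{3c}` in terms of its residue classes. -/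
lemma dlam_three_mul {w : ℝ} (hw : w ≤ -1) (c : ℤ) :
    qpow w (3 / 2 * c ^ 2) * dlam w (3 * c) = (-1) ^ c * (psum w 0 c +
      ∑ b ∈ Icc (1 : ℤ) 5, (-1) ^ b * (psum w b c + psum w (-b) c)) := by
  have h := tsum_residues (summable_lamTerm hw c)
  have key : ∀ r : ℤ, ∑' m : ℤ, lamTerm w c (r + 11 * m) = (-1) ^ r * psum w r c := fun r => by
    have h : (-1 : ℂ) ^ r * (-1) ^ r = 1 := by rw [← mul_zpow]; simp
    rw [psum, tsum_mul_left, ← mul_assoc, h, one_mul]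
  simp only [key, zpow_neg_of_sq (show (-1 : ℂ) ^ 2 = 1 by norm_num), zpow_zero, one_mul, ← mul_add] at h
  rw [← h, dlam, ← (Equiv.addLeft c).tsum_eq, ← tsum_mul_left, ← tsum_mul_left]
  refine tsum_congr fun l => ?_
  have e : (3 / 2 * (l : ℂ) ^ 2) = 3 / 2 * c ^ 2 + (3 / 2 * ((c + l : ℤ) : ℂ) ^ 2
    - ((3 * c : ℤ) : ℂ) * ((c + l : ℤ) : ℂ)) := by push_cast; ring
  rw [Equiv.coe_addLeft, dlamTerm, lamTerm, e, qpow_add, zpow_add₀ (by norm_num)]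
  push_cast
  ring

/-- The theta function at an integer, normalised to be 11-periodic. -/
noncomputable def tval (w : ℝ) (a : ℤ) : ℂ := (-1) ^ a * theta w a

/-- The mock theta part of `D_{3c}`. -/
noncomputable def mock (w : ℝ) (c : ℤ) : ℂ := (-1) ^ c * qpow w (-(3 / 2 * c ^ 2)) * psum w 0 c / ezero w

lemma tval_ne_zero {w : ℝ} (hw : w < 0) {a : ℤ} (ha : ¬ (11 : ℤ) ∣ a) : tval w a ≠ 0 :=
  mul_ne_zero (zpow_ne_zero _ (by norm_num)) (theta_int_ne_zero hw ha)

lemma neg_one_zpow_mul_self (a : ℤ) : (-1 : ℂ) ^ a * (-1) ^ a = 1 := by rw [← mul_zpow]; simp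

lemma theta_eq_tval (w : ℝ) (a : ℤ) : theta w a = (-1) ^ a * tval w a := by
  rw [tval, ← mul_assoc, neg_one_zpow_mul_self, one_mul]

lemma neg_one_zpow_two_mul (a : ℤ) : (-1 : ℂ) ^ (2 * a) = 1 := by rw [zpow_mul]; simp

lemma eplus_eq_tval {w : ℝ} (hw : w ≤ -1) {b : ℤ} (hb : ¬ (11 : ℤ) ∣ b) :
    (-1) ^ b * eplus w b = ezero w * (tval w (2 * b) / tval w b) := by
  have h := eplus_mul_theta hw hb
  have h2 := theta_eq_tval w (2 * b)
  push_cast at h2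
  rw [h2, theta_eq_tval, neg_one_zpow_two_mul, one_mul] at h
  rw [← mul_div_assoc, eq_div_iff (tval_ne_zero (by linarith) hb), ← h]; ring

/-- The theta part of `D_{3c}`. -/
noncomputable def thetaPart (w : ℝ) (c : ℤ) : ℂ :=
  logDer w c + logDer w (2 * c) - ezero w ^ 3 *
    ∑ b ∈ (Icc (1 : ℤ) 5).erase c, tval w b * tval w (2 * b) / (tval w (c - b) * tval w c * tval w (c + b))

theorem dlam_eq_mock_add {w : ℝ} (hw : w ≤ -1) {c : ℤ} (hc : c ∈ Icc (1 : ℤ) 5) :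
    dlam w (3 * c) + 3 * c / 11 = qpow w (1 / 24) * (pent w : ℝ) * mock w c + thetaPart w c := by
  have hw0 : w < 0 := by linarith
  have hc' := mem_Icc.mp hc
  have hc11 : ¬ (11 : ℤ) ∣ c := by omega
  have hE := ezero_ne_zero hw0
  have hq := qpow_ne_zero w (3 / 2 * c ^ 2)
  have s := neg_one_zpow_mul_self c
  have hs : (-1 : ℂ) ^ c ≠ 0 := zpow_ne_zero _ (by norm_num)
  have hgen : ∀ b ∈ (Icc (1 : ℤ) 5).erase c, (-1) ^ b * (psum w b c + psum w (-b) c) =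
      ((-1) ^ b * eplus w b) / ezero w * psum w 0 c - ezero w ^ 3 * (-1) ^ c * qpow w (3 / 2 * c ^ 2) *
        (tval w b * tval w (2 * b) / (tval w (c - b) * tval w c * tval w (c + b))) := by
    intro b hb
    obtain ⟨hbc, hb1⟩ := mem_erase.mp hb
    have hb' := mem_Icc.mp hb1
    have h0 : ¬ (11 : ℤ) ∣ b := by omega
    have h1 : ¬ (11 : ℤ) ∣ c - b := by omega
    have h2 : ¬ (11 : ℤ) ∣ c + b := by omega
    have h := psum_generic hw hc11 h1 h2
    have e1 := theta_eq_tval w (c - b)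
    have e2 := theta_eq_tval w (c + b)
    have e3 : (-1 : ℂ) ^ (c - b) * (-1) ^ (c + b) = 1 := by
      rw [← zpow_add₀ (by norm_num), show c - b + (c + b) = 2 * c by ring]
      exact neg_one_zpow_two_mul c
    push_cast at e1 e2
    have n0 := tval_ne_zero hw0 h0
    have n1 := tval_ne_zero hw0 h1
    have n2 := tval_ne_zero hw0 h2
    have n3 := tval_ne_zero hw0 hc11
    have hp := eplus_eq_tval hw h0
    rw [← mul_div_assoc, eq_div_iff n0] at hp
    have sb := neg_one_zpow_mul_self b
    rw [e1, e2, theta_eq_tval w c, theta_eq_tval w b, sigma_zero hw] at h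
    generalize psum w b c + psum w (-b) c = G at h ⊢
    generalize (-1 : ℂ) ^ (c - b) = s1 at *
    generalize (-1 : ℂ) ^ (c + b) = s2 at *
    generalize (-1 : ℂ) ^ c = sc at *
    generalize (-1 : ℂ) ^ b = sg at *
    have h' : sc * tval w c * tval w (c - b) * tval w (c + b) *
        (ezero w * (sg * G) - sg * eplus w b * psum w 0 c) =
        -(qpow w (3 / 2 * c ^ 2) * ezero w ^ 4 * tval w b * tval w (2 * b)) := by
      linear_combination sg * h - sc * tval w c * tval w (c - b) * tval w (c + b) * sg *
        (ezero w * G - eplus w b * psum w 0 c) * e3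
        - qpow w (3 / 2 * c ^ 2) * eplus w b * ezero w ^ 3 * tval w b ^ 2 * sg * sb
        - qpow w (3 / 2 * c ^ 2) * ezero w ^ 3 * tval w b * hp
    have h'' : sg * G = sg * eplus w b / ezero w * psum w 0 c - sc * (
        qpow w (3 / 2 * c ^ 2) * ezero w ^ 4 * tval w b * tval w (2 * b)) /
        (ezero w * (tval w (c - b) * tval w c * tval w (c + b))) := by
      rw [div_mul_eq_mul_div, div_sub_div _ _ hE (by simp [*]), eq_div_iff (by simp [*])]
      linear_combination sc * ezero w * h' - ezero w * tval w c * tval w (c - b) * tval w (c + b) *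
        (ezero w * (sg * G) - sg * eplus w b * psum w 0 c) * s
    rw [h'']
    field_simp
  have hself := psum_self hw hc11
  have hsum := sum_eplus hw0
  rw [← add_sum_erase _ _ hc] at hsum
  have h := dlam_three_mul hw c
  rw [← add_sum_erase _ _ hc, sum_congr rfl hgen, sum_sub_distrib, ← mul_sum, ← sum_mul, ← sum_div] at h
  rw [mock, thetaPart, qpow_neg, ← hsum]
  generalize ∑ b ∈ (Icc (1 : ℤ) 5).erase c, tval w b * tval w (2 * b) /
    (tval w (c - b) * tval w c * tval w (c + b)) = X at h ⊢
  generalize ∑ b ∈ (Icc (1 : ℤ) 5).erase c, (-1) ^ b * eplus w b = Y at h ⊢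
  generalize (-1 : ℂ) ^ c = sc at *
  refine mul_left_cancel₀ (mul_ne_zero hE hq) ?_
  have e1 : (qpow w (3 / 2 * c ^ 2))⁻¹ * qpow w (3 / 2 * c ^ 2) = 1 := inv_mul_cancel₀ hq
  have e2 : Y / ezero w * ezero w = Y := div_mul_cancel₀ _ hE
  have e3 : psum w 0 c / ezero w * ezero w = psum w 0 c := div_mul_cancel₀ _ hE
  generalize Y / ezero w = Z at h e2
  rw [mul_div_assoc _ (psum w 0 c)]
  generalize psum w 0 c / ezero w = p at e3 ⊢
  generalize (qpow w (3 / 2 * c ^ 2))⁻¹ = u at e1 ⊢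
  linear_combination ezero w * h + sc ^ 2 * hself + sc * psum w 0 c * e2
    - sc * (ezero w + sc * eplus w c + Y) * (ezero w * p * e1 + e3)
    - ezero w * qpow w (3 / 2 * c ^ 2) * (3 * c / 11 - (logDer w c + logDer w (2 * c)) + ezero w ^ 3 * X) * s

lemma hasSum_split_parity {F : ℤ × ℤ → ℂ} {a b : ℂ} (ha : HasSum (fun p : ℤ × ℤ => F (p.1 + p.2, p.1 - p.2)) a)
    (hb : HasSum (fun p : ℤ × ℤ => F (p.1 + p.2, p.1 - p.2 - 1)) b) : HasSum F (a + b) := by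
  let g₁ : ℤ × ℤ → ℤ × ℤ := fun p => (p.1 + p.2, p.1 - p.2)
  let g₂ : ℤ × ℤ → ℤ × ℤ := fun p => (p.1 + p.2, p.1 - p.2 - 1)
  have i₁ : Function.Injective g₁ := fun p q h => by
    simp only [g₁, Prod.mk.injEq] at h; ext <;> omega
  have i₂ : Function.Injective g₂ := fun p q h => by
    simp only [g₂, Prod.mk.injEq] at h; ext <;> omega
  have hc : IsCompl (Set.range g₁) (Set.range g₂) := by
    refine IsCompl.of_eq ?_ ?_
    · refine Set.eq_empty_iff_forall_notMem.mpr ?_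
      rintro ⟨x, y⟩ ⟨⟨p, hp⟩, ⟨q, hq⟩⟩
      simp only [g₁, g₂, Prod.mk.injEq] at hp hq
      omega
    · refine Set.eq_univ_of_forall ?_
      rintro ⟨x, y⟩
      rcases Int.even_or_odd' (x + y) with ⟨k, hk | hk⟩
      · exact Or.inl ⟨(k, x - k), by simp only [g₁, Prod.mk.injEq]; omega⟩
      · exact Or.inr ⟨(k + 1, x - (k + 1)), by simp only [g₂, Prod.mk.injEq]; omega⟩
  exact HasSum.add_isCompl hc (i₁.hasSum_range_iff.mpr ha) (i₂.hasSum_range_iff.mpr hb)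

/-- The theta function `∑ q^((11(n + 1/2) + v)^2)`. -/
noncomputable def thetaP (w : ℝ) : ℂ → ℂ := gtheta 1 1 (1 / 2) w

/-- The theta function `∑ q^((11 n + v)^2)`. -/
noncomputable def thetaR (w : ℝ) : ℂ → ℂ := gtheta 1 1 0 w

/-- The terms of `gtheta`. -/
noncomputable def gthetaTerm (s : ℂ) (κ δ w : ℝ) (v : ℂ) (n : ℤ) : ℂ :=
  s ^ n * qpow w (κ * (11 * (n + δ) + v) ^ 2)

lemma summable_gthetaTerm {s : ℂ} (hs : s ^ 2 = 1) {κ w : ℝ} (hκ : 0 < κ) (hw : w < 0) (δ : ℝ)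
    (v : ℂ) : Summable (gthetaTerm s κ δ w v) := summable_gtheta hs hκ hw δ v

lemma hasSum_gthetaTerm {s : ℂ} (hs : s ^ 2 = 1) {κ w : ℝ} (hκ : 0 < κ) (hw : w < 0) (δ : ℝ)
    (v : ℂ) : HasSum (gthetaTerm s κ δ w v) (gtheta s κ δ w v) :=
  (summable_gthetaTerm hs hκ hw δ v).hasSum

lemma gtheta_mul_gtheta {w : ℝ} (hw : w < 0) {s₁ s₂ : ℂ} (h₁ : s₁ ^ 2 = 1) (h₂ : s₂ ^ 2 = 1)
    {κ₁ κ₂ : ℝ} (k₁ : 0 < κ₁) (k₂ : 0 < κ₂) (δ₁ δ₂ : ℝ) (u v : ℂ) :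
    HasSum (fun p : ℤ × ℤ => gthetaTerm s₁ κ₁ δ₁ w u p.1 * gthetaTerm s₂ κ₂ δ₂ w v p.2)
      (gtheta s₁ κ₁ δ₁ w u * gtheta s₂ κ₂ δ₂ w v) := by
  have a := summable_gthetaTerm h₁ k₁ hw δ₁ u
  have b := summable_gthetaTerm h₂ k₂ hw δ₂ v
  exact HasSum.mul (hasSum_gthetaTerm h₁ k₁ hw δ₁ u) (hasSum_gthetaTerm h₂ k₂ hw δ₂ v)
    (summable_mul_of_summable_norm a.norm b.norm)

lemma zpow_mul_zpow_of_sq {s : ℂ} (hs : s ^ 2 = 1) {m n k : ℤ} (h : m + n = 2 * k) :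
    s ^ m * s ^ n = 1 := by
  have h0 : s ≠ 0 := fun h => by simp [h] at hs
  have hs' : s ^ (2 : ℤ) = 1 := by exact_mod_cast hs
  rw [← zpow_add₀ h0, h, zpow_mul, hs', one_zpow]

lemma gthetaTerm_mul {s : ℂ} {w δ δ₁ δ₂ : ℝ} {a b : ℂ} {m n k l : ℤ} {z : ℂ}
    (hz : s ^ m * s ^ n = z)
    (h₁ : (m : ℝ) + n + 2 * δ = 2 * (k + δ₁)) (h₂ : (m : ℝ) - n = 2 * (l + δ₂)) :
    gthetaTerm s (1 / 2) δ w (a + b) m * gthetaTerm s (1 / 2) δ w (a - b) n =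
      z * (gthetaTerm 1 1 δ₁ w a k * gthetaTerm 1 1 δ₂ w b l) := by
  have h₁' : (m : ℂ) + n + 2 * δ = 2 * (k + δ₁) := by exact_mod_cast h₁
  have h₂' : (m : ℂ) - n = 2 * (l + δ₂) := by exact_mod_cast h₂
  have e1 : (m : ℂ) = k + δ₁ + l + δ₂ - δ := by linear_combination (h₁' + h₂') / 2
  have e2 : (n : ℂ) = k + δ₁ - l - δ₂ - δ := by linear_combination (h₁' - h₂') / 2
  have e : ((1 / 2 : ℝ) : ℂ) * (11 * (m + δ) + (a + b)) ^ 2 + ((1 / 2 : ℝ) : ℂ) * (11 * (n + δ) + (a - b)) ^ 2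
      = ((1 : ℝ) : ℂ) * (11 * (k + δ₁) + a) ^ 2 + ((1 : ℝ) : ℂ) * (11 * (l + δ₂) + b) ^ 2 := by
    rw [e1, e2]; push_cast; ring
  simp only [gthetaTerm, one_zpow, one_mul]
  rw [mul_mul_mul_comm, hz, ← qpow_add, e, qpow_add]

lemma gtheta_half_add_mul_sub {w : ℝ} (hw : w < 0) {s : ℂ} (hs : s ^ 2 = 1) (a b : ℂ) :
    gtheta s (1 / 2) (1 / 2) w (a + b) * gtheta s (1 / 2) (1 / 2) w (a - b) =
      thetaP w a * thetaR w b + s * (thetaR w a * thetaP w b) := by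
  have h0 := gtheta_mul_gtheta hw hs hs (κ₁ := 1 / 2) (κ₂ := 1 / 2) (by norm_num) (by norm_num)
    (1 / 2) (1 / 2) (a + b) (a - b)
  have h1 := gtheta_mul_gtheta hw (one_pow 2) (one_pow 2) one_pos one_pos (1 / 2) 0 a b
  have h2 := (gtheta_mul_gtheta hw (one_pow 2) (one_pow 2) one_pos one_pos 0 (1 / 2) a b).mul_left s
  have hs0 : s ≠ 0 := fun h => by simp [h] at hs
  refine h0.unique (hasSum_split_parity (h1.congr_fun fun p => ?_) (h2.congr_fun fun p => ?_))
  · rw [gthetaTerm_mul (k := p.1) (l := p.2) (δ₁ := 1 / 2) (δ₂ := 0)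
      (zpow_mul_zpow_of_sq hs (k := p.1) (by ring)) (by push_cast; ring) (by push_cast; ring), one_mul]
  · refine gthetaTerm_mul ?_ (by push_cast; ring) (by push_cast; ring)
    rw [zpow_sub_one₀ hs0, ← mul_assoc, zpow_mul_zpow_of_sq hs (k := p.1) (by ring), one_mul]
    exact inv_eq_of_mul_eq_one_left (by rw [← sq, hs])

lemma gtheta_zero_add_mul_sub {w : ℝ} (hw : w < 0) {s : ℂ} (hs : s ^ 2 = 1) (a b : ℂ) :
    gtheta s (1 / 2) 0 w (a + b) * gtheta s (1 / 2) 0 w (a - b) =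
      thetaR w a * thetaR w b + s * (thetaP w a * thetaP w b) := by
  have h0 := gtheta_mul_gtheta hw hs hs (κ₁ := 1 / 2) (κ₂ := 1 / 2) (by norm_num) (by norm_num)
    0 0 (a + b) (a - b)
  have h1 := gtheta_mul_gtheta hw (one_pow 2) (one_pow 2) one_pos one_pos 0 0 a b
  have h2 := (((Equiv.addRight ((-1, 0) : ℤ × ℤ)).hasSum_iff.mpr
    (gtheta_mul_gtheta hw (one_pow 2) (one_pow 2) one_pos one_pos (1 / 2) (1 / 2) a b))).mul_left s
  have hs0 : s ≠ 0 := fun h => by simp [h] at hs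
  refine h0.unique (hasSum_split_parity (h1.congr_fun fun p => ?_) (h2.congr_fun fun p => ?_))
  · rw [gthetaTerm_mul (k := p.1) (l := p.2) (δ₁ := 0) (δ₂ := 0)
      (zpow_mul_zpow_of_sq hs (k := p.1) (by ring)) (by push_cast; ring) (by push_cast; ring), one_mul]
  · refine gthetaTerm_mul ?_ (by simp; ring) (by simp; ring)
    rw [zpow_sub_one₀ hs0, ← mul_assoc, zpow_mul_zpow_of_sq hs (k := p.1) (by ring), one_mul]
    exact inv_eq_of_mul_eq_one_left (by rw [← sq, hs])

/-- The addition formula for `theta`. -/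
lemma theta_add_mul_theta_sub {w : ℝ} (hw : w < 0) (a b : ℂ) :
    theta w (a + b) * theta w (a - b) = thetaP w a * thetaR w b - thetaR w a * thetaP w b := by
  rw [theta, gtheta_half_add_mul_sub hw (by norm_num)]; ring

lemma thetaP_zero_mul {w : ℝ} (hw : w < 0) :
    thetaP w 0 * thetaR w 0 * (thetaR w 0 ^ 4 - thetaP w 0 ^ 4) = 2 * ezero w ^ 6 := by
  have h := gtheta_mul_gtheta_mul_gtheta hw
  have a := gtheta_half_add_mul_sub hw (one_pow 2) 0 0
  have b := gtheta_zero_add_mul_sub hw (one_pow 2) 0 0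
  have c := gtheta_zero_add_mul_sub hw (s := -1) (by norm_num) 0 0
  simp only [add_zero, sub_zero] at a b c
  generalize gtheta 1 (1 / 2) (1 / 2) w 0 = A at *
  generalize gtheta 1 (1 / 2) 0 w 0 = B at *
  generalize gtheta (-1) (1 / 2) 0 w 0 = C at *
  have h2 : (A * A) * (B * B) * (C * C) = 4 * ezero w ^ 6 := by
    linear_combination (A * B * C + 2 * ezero w ^ 3) * h
  rw [a, b, c] at h2
  linear_combination h2 / 2

/-- The duplication formula for `theta`, squared. -/
lemma theta_two_mul_sq {w : ℝ} (hw : w < 0) (a : ℂ) :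
    theta w (2 * a) ^ 2 * ezero w ^ 6 = theta w a ^ 2 *
      (thetaP w a * thetaR w 0 + thetaR w a * thetaP w 0) *
      (thetaR w a ^ 2 * thetaR w 0 ^ 2 - thetaP w a ^ 2 * thetaP w 0 ^ 2) := by
  have h0 := thetaP_zero_mul hw
  have h1 := theta_add_mul_theta_sub hw (2 * a) 0
  have h2 := theta_add_mul_theta_sub hw a 0
  have b1 := gtheta_zero_add_mul_sub hw (one_pow 2) (2 * a) 0
  have c1 := gtheta_zero_add_mul_sub hw (s := -1) (by norm_num) (2 * a) 0
  have b2 := gtheta_zero_add_mul_sub hw (one_pow 2) a a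
  have c2 := gtheta_zero_add_mul_sub hw (s := -1) (by norm_num) a a
  have b := gtheta_zero_add_mul_sub hw (one_pow 2) 0 0
  have c := gtheta_zero_add_mul_sub hw (s := -1) (by norm_num) 0 0
  simp only [add_zero, sub_zero, sub_self, mul_zero, ← two_mul] at h1 h2 b1 c1 b2 c2 b c
  generalize theta w (2 * a) = T2 at *
  generalize theta w a = T at *
  generalize gtheta 1 (1 / 2) 0 w (2 * a) = B2 at *
  generalize gtheta (-1) (1 / 2) 0 w (2 * a) = C2 at *
  generalize gtheta 1 (1 / 2) 0 w 0 = B at *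
  generalize gtheta (-1) (1 / 2) 0 w 0 = C at *
  generalize thetaP w (2 * a) = P2 at *
  generalize thetaR w (2 * a) = R2 at *
  generalize thetaP w a = P at *
  generalize thetaR w a = R at *
  generalize thetaP w 0 = P0 at *
  generalize thetaR w 0 = R0 at *
  have k1 : 2 * (T2 ^ 2 * (P0 * R0)) = B2 ^ 2 * (R0 ^ 2 - P0 ^ 2) - C2 ^ 2 * (R0 ^ 2 + P0 ^ 2) := by
    linear_combination 2 * P0 * R0 * h1 - (R0 ^ 2 - P0 ^ 2) * b1 + (R0 ^ 2 + P0 ^ 2) * c1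
  have k2 : B2 ^ 2 * (R0 ^ 2 + P0 ^ 2) = (R ^ 2 + P ^ 2) ^ 2 := by
    linear_combination (B2 * B + R ^ 2 + P ^ 2) * b2 - B2 ^ 2 * b
  have k3 : C2 ^ 2 * (R0 ^ 2 - P0 ^ 2) = (R ^ 2 - P ^ 2) ^ 2 := by
    linear_combination (C2 * C + R ^ 2 - P ^ 2) * c2 - C2 ^ 2 * c
  linear_combination -T2 ^ 2 / 2 * h0 + (R0 ^ 4 - P0 ^ 4) / 4 * k1 + (R0 ^ 2 - P0 ^ 2) ^ 2 / 4 * k2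
    - (R0 ^ 2 + P0 ^ 2) ^ 2 / 4 * k3 - (P * R0 + R * P0) * (R ^ 2 * R0 ^ 2 - P ^ 2 * P0 ^ 2) * h2

lemma hasDerivAt_thetaP {w : ℝ} (hw : w < 0) (v : ℂ) : HasDerivAt (thetaP w) (deriv (thetaP w) v) v :=
  (differentiable_gtheta (one_pow 2) one_pos hw (1 / 2) v).hasDerivAt

lemma hasDerivAt_thetaR {w : ℝ} (hw : w < 0) (v : ℂ) : HasDerivAt (thetaR w) (deriv (thetaR w) v) v :=
  (differentiable_gtheta (one_pow 2) one_pos hw 0 v).hasDerivAt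

lemma deriv_theta_add_mul_theta_sub {w : ℝ} (hw : w < 0) (x z : ℂ) :
    deriv (theta w) (x + z) * theta w (x - z) - theta w (x + z) * deriv (theta w) (x - z) =
      thetaP w x * deriv (thetaR w) z - thetaR w x * deriv (thetaP w) z := by
  have h1 := (((hasDerivAt_theta hw (x + z)).comp_const_add x z).mul
    ((hasDerivAt_theta hw (x - z)).comp_const_sub x z))
  have h2 := ((hasDerivAt_thetaR hw z).const_mul (thetaP w x)).sub
    ((hasDerivAt_thetaP hw z).const_mul (thetaR w x))
  have h3 := h1.congr_of_eventuallyEq (f₁ := fun z => thetaP w x * thetaR w z - thetaR w x * thetaP w z)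
    (Filter.Eventually.of_forall fun z => (theta_add_mul_theta_sub hw x z).symm)
  linear_combination h3.unique h2

lemma tval_add_mul_tval_sub {w : ℝ} (hw : w < 0) (a b : ℤ) :
    tval w (a + b) * tval w (a - b) = thetaP w a * thetaR w b - thetaR w a * thetaP w b := by
  have h : (-1 : ℂ) ^ (a + b) * (-1) ^ (a - b) = 1 := zpow_mul_zpow_of_sq (by norm_num) (k := a) (by ring)
  have h1 := theta_add_mul_theta_sub hw a b
  rw [tval, tval]
  push_cast
  linear_combination theta w (a + b) * theta w (a - b) * h + h1

/-- The values of `theta`, its logarithmic derivative and the two level two theta functions at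
the integers, together with the identities relating them. -/
structure ThetaSystem (t Λ P R : ℤ → ℂ) (E : ℂ) : Prop where
  ne_zero : E ≠ 0
  apply_ne_zero : ∀ {a : ℤ}, ¬ (11 : ℤ) ∣ a → t a ≠ 0
  neg : ∀ a, t (-a) = -t a
  add_eleven_mul : ∀ a m, t (a + 11 * m) = t a
  log_neg : ∀ a, Λ (-a) = -Λ a
  log_add_eleven_mul : ∀ a m, Λ (a + 11 * m) = Λ a
  add_mul_sub : ∀ a b, t (a + b) * t (a - b) = P a * R b - R a * P b
  two_mul_sq : ∀ a, t (2 * a) ^ 2 * E ^ 6 =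
    t a ^ 2 * (P a * R 0 + R a * P 0) * (R a ^ 2 * R 0 ^ 2 - P a ^ 2 * P 0 ^ 2)
  zero_mul : P 0 * R 0 * (R 0 ^ 4 - P 0 ^ 4) = 2 * E ^ 6
  log_eq : ∀ {x y z : ℤ}, ¬ (11 : ℤ) ∣ x + z → ¬ (11 : ℤ) ∣ x - z → ¬ (11 : ℤ) ∣ y + z →
    ¬ (11 : ℤ) ∣ y - z → (Λ (x + z) - Λ (x - z) - Λ (y + z) + Λ (y - z)) *
      (t (x + z) * t (x - z) * (t (y + z) * t (y - z))) = E ^ 3 * (t (x + y) * t (x - y)) * t (2 * z)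

lemma thetaSystem {w : ℝ} (hw : w ≤ -1) :
    ThetaSystem (tval w) (logDer w) (fun a => thetaP w a) (fun a => thetaR w a) (ezero w) := by
  have hw0 : w < 0 := by linarith
  have hper (a m : ℤ) : theta w ((a + 11 * m : ℤ) : ℂ) = (-1) ^ m * theta w a := by
    push_cast; exact theta_add_eleven_mul w a m
  have hper' (a m : ℤ) : deriv (theta w) ((a + 11 * m : ℤ) : ℂ) = (-1) ^ m * deriv (theta w) a := by
    push_cast; exact deriv_theta_add_eleven_mul (w := w) a m
  have hneg (v : ℂ) : deriv (theta w) (-v) = deriv (theta w) v := by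
    have h1 := (hasDerivAt_theta hw0 (-v)).comp v (hasDerivAt_neg v)
    have h2 := h1.congr_of_eventuallyEq (f₁ := fun z => -theta w z)
      (Filter.Eventually.of_forall fun z => (theta_neg w z).symm)
    linear_combination -h2.unique (hasDerivAt_theta hw0 v).neg
  refine ⟨ezero_ne_zero hw0, fun h => tval_ne_zero hw0 h, fun a => ?_, fun a m => ?_, fun a => ?_,
    fun a m => ?_, fun a b => tval_add_mul_tval_sub hw0 a b, fun a => ?_, ?_, ?_⟩
  · rw [tval, tval, Int.cast_neg, theta_neg, zpow_neg_of_sq (by norm_num)]; ring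
  · rw [tval, tval, hper, zpow_add₀ (by norm_num), neg_one_zpow_eleven]
    linear_combination (-1) ^ a * theta w a * neg_one_zpow_mul_self m
  · rw [logDer, logDer, Int.cast_neg, theta_neg, hneg]; ring
  · rw [logDer, logDer, hper, hper', mul_left_comm, mul_div_mul_left _ _ (zpow_ne_zero _ (by norm_num))]
  · have h1 := theta_two_mul_sq hw0 a
    have h2 : tval w (2 * a) = theta w (2 * a) := by rw [tval, neg_one_zpow_two_mul]; simp
    have h3 : tval w a ^ 2 = theta w a ^ 2 := by
      rw [tval]; linear_combination theta w a ^ 2 * neg_one_zpow_mul_self a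
    rw [h2, h3, h1]; simp
  · simpa using thetaP_zero_mul hw0
  · intro x y z h1 h2 h3 h4
    have hz : (11 * w : ℂ) ≠ 0 := by
      simpa using hw0.ne
    have d1 := deriv_theta_eq_logDer hw0 h1
    have d2 := deriv_theta_eq_logDer hw0 h2
    have d3 := deriv_theta_eq_logDer hw0 h3
    have d4 := deriv_theta_eq_logDer hw0 h4
    have e0 := deriv_theta_zero hw
    rw [sigma_zero hw] at e0
    have e1 := deriv_theta_add_mul_theta_sub hw0 x z
    have e2 := deriv_theta_add_mul_theta_sub hw0 y z
    have e3 := deriv_theta_add_mul_theta_sub hw0 z z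
    rw [sub_self, theta_zero, e0] at e3
    have a1 := theta_add_mul_theta_sub hw0 x z
    have a2 := theta_add_mul_theta_sub hw0 y z
    have f1 := tval_add_mul_tval_sub hw0 x z
    have f2 := tval_add_mul_tval_sub hw0 y z
    have f3 := tval_add_mul_tval_sub hw0 x y
    have f4 : tval w (2 * z) = theta w (z + z) := by
      rw [tval, neg_one_zpow_two_mul]; push_cast; rw [one_mul, two_mul]
    push_cast at d1 d2 d3 d4
    rw [d1, d2] at e1
    rw [d3, d4] at e2
    rw [f1, f2, f3, f4]
    generalize logDer w (x + z) = L1 at *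
    generalize logDer w (x - z) = L2 at *
    generalize logDer w (y + z) = L3 at *
    generalize logDer w (y - z) = L4 at *
    have g1 : 11 * w * (L1 - L2) * (thetaP w x * thetaR w z - thetaR w x * thetaP w z) =
      thetaP w x * deriv (thetaR w) z - thetaR w x * deriv (thetaP w) z := by
      rw [← a1]; linear_combination e1
    have g2 : 11 * w * (L3 - L4) * (thetaP w y * thetaR w z - thetaR w y * thetaP w z) =
      thetaP w y * deriv (thetaR w) z - thetaR w y * deriv (thetaP w) z := by
      rw [← a2]; linear_combination e2
    refine mul_left_cancel₀ hz ?_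
    linear_combination (thetaP w y * thetaR w z - thetaR w y * thetaP w z) * g1
      - (thetaP w x * thetaR w z - thetaR w x * thetaP w z) * g2
      + (thetaP w x * thetaR w y - thetaR w x * thetaP w y) * e3

lemma ThetaSystem.comp_mul {t Λ P R : ℤ → ℂ} {E : ℂ} (h : ThetaSystem t Λ P R E) {c : ℤ}
    (hc : ¬ (11 : ℤ) ∣ c) : ThetaSystem (fun a => t (c * a)) (fun a => Λ (c * a)) (fun a => P (c * a))
      (fun a => R (c * a)) E := by
  have hp : Prime (11 : ℤ) := by norm_num
  have hd {a : ℤ} (ha : ¬ (11 : ℤ) ∣ a) : ¬ (11 : ℤ) ∣ c * a := fun k => (hp.dvd_or_dvd k).elim hc ha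
  refine ⟨h.ne_zero, fun ha => h.apply_ne_zero (hd ha), fun a => ?_, fun a m => ?_, fun a => ?_,
    fun a m => ?_, fun a b => ?_, fun a => ?_, ?_, fun {x y z} h1 h2 h3 h4 => ?_⟩
  · rw [mul_neg, h.neg]
  · rw [mul_add, mul_left_comm, h.add_eleven_mul]
  · rw [mul_neg, h.log_neg]
  · rw [mul_add, mul_left_comm, h.log_add_eleven_mul]
  · rw [mul_add, mul_sub, h.add_mul_sub]
  · simpa only [mul_zero, mul_left_comm] using h.two_mul_sq (c * a)
  · simpa only [mul_zero] using h.zero_mul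
  · simpa only [mul_add, mul_sub, mul_left_comm] using h.log_eq (x := c * x) (y := c * y) (z := c * z)
      (by rw [← mul_add]; exact hd h1) (by rw [← mul_sub]; exact hd h2) (by rw [← mul_add]; exact hd h3)
      (by rw [← mul_sub]; exact hd h4)

/-- The Laurent monomial with exponents `e` evaluated at `x`. -/
noncomputable def mon (x : Fin 5 → ℂ) (e : Fin 5 → ℤ) : ℂ := ∏ i, x i ^ e i

lemma mon_add {x : Fin 5 → ℂ} (hx : ∀ i, x i ≠ 0) (e f : Fin 5 → ℤ) : mon x (e + f) = mon x e * mon x f := by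
  simp only [mon, Pi.add_apply, ← Finset.prod_mul_distrib]
  exact Finset.prod_congr rfl fun i _ => zpow_add₀ (hx i) _ _

lemma mon_nsmul (x : Fin 5 → ℂ) (n : ℕ) (e : Fin 5 → ℤ) : mon x (n • e) = mon x e ^ n := by
  simp only [mon, Pi.smul_apply, ← Finset.prod_pow]
  exact Finset.prod_congr rfl fun i _ => by rw [nsmul_eq_mul, mul_comm, zpow_mul, zpow_natCast]

lemma mon_eq (x : Fin 5 → ℂ) (a b c d e : ℤ) :
    mon x ![a, b, c, d, e] = x 0 ^ a * x 1 ^ b * x 2 ^ c * x 3 ^ d * x 4 ^ e := by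
  simp [mon, Fin.prod_univ_five]

/-- The parametrisation of a Laurent monomial by the units `s`, `p`, `1 - s` and `p - s`. -/
lemma mon_factor {x : Fin 5 → ℂ} (hx : ∀ i, x i ≠ 0) {e : Fin 5 → ℤ} (e₀ : Fin 5 → ℤ) (i j k l : ℕ)
    (h : e = e₀ + i • ![1, -2, 0, 2, -1] + j • ![1, -3, 3, -1, 0] + k • ![2, -1, -1, 0, 0] +
      l • ![4, -3, 0, 0, -1]) :
    mon x e = mon x e₀ * (mon x ![1, -2, 0, 2, -1] ^ i * mon x ![1, -3, 3, -1, 0] ^ j *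
      mon x ![2, -1, -1, 0, 0] ^ k * mon x ![4, -3, 0, 0, -1] ^ l) := by
  rw [h]
  simp only [mon_add hx, mon_nsmul, mul_assoc]

/-- The signed values of `t`, which are negatives of positive numbers for `theta`. -/
noncomputable def coords (t : ℤ → ℂ) : Fin 5 → ℂ := ![t 1, -t 2, t 3, -t 4, t 5]

namespace ThetaSystem
variable {t Λ P R : ℤ → ℂ} {E : ℂ}

lemma eleven_sub (h : ThetaSystem t Λ P R E) (a : ℤ) : t (11 - a) = -t a := by
  rw [← h.neg, ← h.add_eleven_mul (-a) 1]; congr 1; ring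

lemma log_eleven_sub (h : ThetaSystem t Λ P R E) (a : ℤ) : Λ (11 - a) = -Λ a := by
  rw [← h.log_neg, ← h.log_add_eleven_mul (-a) 1]; congr 1; ring

lemma coords_ne_zero (h : ThetaSystem t Λ P R E) (i : Fin 5) : coords t i ≠ 0 := by
  fin_cases i <;> simp [coords] <;> exact h.apply_ne_zero (by norm_num)

lemma three_term (h : ThetaSystem t Λ P R E) (a b c d : ℤ) :
    t (a + b) * t (a - b) * (t (c + d) * t (c - d)) - t (a + c) * t (a - c) * (t (b + d) * t (b - d)) +
      t (a + d) * t (a - d) * (t (b + c) * t (b - c)) = 0 := by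
  simp only [h.add_mul_sub]; ring

lemma t6 (h : ThetaSystem t Λ P R E) : t 6 = -t 5 := h.eleven_sub 5
lemma t7 (h : ThetaSystem t Λ P R E) : t 7 = -t 4 := h.eleven_sub 4
lemma t8 (h : ThetaSystem t Λ P R E) : t 8 = -t 3 := h.eleven_sub 3
lemma t9 (h : ThetaSystem t Λ P R E) : t 9 = -t 2 := h.eleven_sub 2
lemma t10 (h : ThetaSystem t Λ P R E) : t 10 = -t 1 := h.eleven_sub 1

lemma t0 (h : ThetaSystem t Λ P R E) : t 0 = 0 := by
  have := h.neg 0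
  rw [neg_zero] at this
  exact self_eq_neg.mp this

section
variable (t)

/-- The unit `s` of the parametrisation. -/
noncomputable def unitS : ℂ := mon (coords t) ![1, -2, 0, 2, -1]

/-- The unit `p` of the parametrisation. -/
noncomputable def unitP : ℂ := mon (coords t) ![1, -3, 3, -1, 0]
end

lemma unit_one_sub_s (h : ThetaSystem t Λ P R E) : mon (coords t) ![2, -1, -1, 0, 0] = 1 - unitS t := by
  have h1 := h.three_term 5 4 3 2
  norm_num [h.t6, h.t7, h.t8, h.t9] at h1
  have n1 : t 1 ≠ 0 := h.apply_ne_zero (by norm_num)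
  have n2 : t 2 ≠ 0 := h.apply_ne_zero (by norm_num)
  have n3 : t 3 ≠ 0 := h.apply_ne_zero (by norm_num)
  have n4 : t 4 ≠ 0 := h.apply_ne_zero (by norm_num)
  have n5 : t 5 ≠ 0 := h.apply_ne_zero (by norm_num)
  simp only [unitS, mon_eq, coords, zpow_neg, Matrix.cons_val, zpow_ofNat]
  field_simp
  linear_combination h1

lemma unit_p_sub_s (h : ThetaSystem t Λ P R E) :
    mon (coords t) ![4, -3, 0, 0, -1] = unitP t - unitS t := by
  have h1 := h.three_term 4 3 1 0
  norm_num [h.t6, h.t7, h.t8, h.t9] at h1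
  have n1 : t 1 ≠ 0 := h.apply_ne_zero (by norm_num)
  have n2 : t 2 ≠ 0 := h.apply_ne_zero (by norm_num)
  have n3 : t 3 ≠ 0 := h.apply_ne_zero (by norm_num)
  have n4 : t 4 ≠ 0 := h.apply_ne_zero (by norm_num)
  have n5 : t 5 ≠ 0 := h.apply_ne_zero (by norm_num)
  simp only [unitS, unitP, mon_eq, coords, zpow_neg, Matrix.cons_val, zpow_ofNat]
  field_simp
  linear_combination h1

lemma unit_one_sub_p (h : ThetaSystem t Λ P R E) : mon (coords t) ![3, -3, 0, -1, 1] = 1 - unitP t := by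
  have h1 := h.three_term 3 2 1 0
  norm_num [h.t6, h.t7, h.t8, h.t9] at h1
  have n1 : t 1 ≠ 0 := h.apply_ne_zero (by norm_num)
  have n2 : t 2 ≠ 0 := h.apply_ne_zero (by norm_num)
  have n3 : t 3 ≠ 0 := h.apply_ne_zero (by norm_num)
  have n4 : t 4 ≠ 0 := h.apply_ne_zero (by norm_num)
  have n5 : t 5 ≠ 0 := h.apply_ne_zero (by norm_num)
  simp only [unitP, mon_eq, coords, zpow_neg, Matrix.cons_val, zpow_ofNat]
  field_simp
  linear_combination h1

/-- The relation between the units `s` and `p`. -/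
lemma unit_curve (h : ThetaSystem t Λ P R E) : unitP t ^ 2 = unitP t * (4 * unitS t - 3 * unitS t ^ 2 +
    unitS t ^ 3) - unitS t := by
  have hx := h.coords_ne_zero
  have h1 : mon (coords t) ![3, -3, 0, -1, 1] * mon (coords t) ![4, -3, 0, 0, -1] =
      mon (coords t) ![1, -3, 3, -1, 0] * mon (coords t) ![2, -1, -1, 0, 0] ^ 3 := by
    rw [← mon_nsmul, ← mon_add hx, ← mon_add hx]; congr 1; decide
  rw [h.unit_one_sub_p, h.unit_p_sub_s, h.unit_one_sub_s, ← unitP] at h1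
  linear_combination -h1

end ThetaSystem

namespace ThetaSystem
variable {t Λ P R : ℤ → ℂ} {E : ℂ}

lemma sq_eq (h : ThetaSystem t Λ P R E) (a : ℤ) : t a ^ 2 = P a * R 0 - R a * P 0 := by
  have := h.add_mul_sub a 0
  rw [add_zero, sub_zero] at this
  rw [← this, sq]

/-- The duplication formula as a binary cubic in `t a ^ 2` and `t (a + 1) * t (a - 1)`. -/
lemma exists_cubic (h : ThetaSystem t Λ P R E) : ∃ b c : ℂ,
    (∀ a, t a ^ 2 * (t 2 ^ 2 / t 1 ^ 8 * (t a ^ 2) ^ 3 + b * (t a ^ 2) ^ 2 * (t (a + 1) * t (a - 1)) +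
      c * t a ^ 2 * (t (a + 1) * t (a - 1)) ^ 2 - 4 / t 1 ^ 6 * (t (a + 1) * t (a - 1)) ^ 3) = t (2 * a) ^ 2) ∧
    (b ^ 2 * c ^ 2 - 4 * (t 2 ^ 2 / t 1 ^ 8) * c ^ 3 + 4 * b ^ 3 * (4 / t 1 ^ 6) -
      18 * (t 2 ^ 2 / t 1 ^ 8) * b * c * (4 / t 1 ^ 6) - 27 * (t 2 ^ 2 / t 1 ^ 8) ^ 2 * (4 / t 1 ^ 6) ^ 2) *
      t 1 ^ 12 * E ^ 12 = 16 := by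
  have hE := h.ne_zero
  have n1 : t 1 ≠ 0 := h.apply_ne_zero (by norm_num)
  have h0 := h.zero_mul
  have h1 := h.sq_eq 1
  have key (a : ℤ) : t a ^ 2 * (((P 1 * R 0 + R 1 * P 0) * t a ^ 2 - 2 * P 0 * R 0 * (t (a + 1) * t (a - 1))) *
      ((R 1 * R 0 - P 1 * P 0) * t a ^ 2 - (R 0 ^ 2 - P 0 ^ 2) * (t (a + 1) * t (a - 1))) *
      ((R 1 * R 0 + P 1 * P 0) * t a ^ 2 - (R 0 ^ 2 + P 0 ^ 2) * (t (a + 1) * t (a - 1)))) =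
      t 1 ^ 6 * (t (2 * a) ^ 2 * E ^ 6) := by
    have e : t 1 ^ 6 = (P 1 * R 0 - R 1 * P 0) ^ 3 := by rw [← h1]; ring
    rw [h.two_mul_sq, e, h.add_mul_sub a 1, h.sq_eq a]
    ring
  have key1 := key 1
  norm_num [h.t0] at key1
  generalize hA1 : P 1 * R 0 + R 1 * P 0 = A1 at *
  generalize hA2 : R 1 * R 0 - P 1 * P 0 = A2 at *
  generalize hA3 : R 1 * R 0 + P 1 * P 0 = A3 at *
  generalize hB1 : 2 * P 0 * R 0 = B1 at *
  generalize hB2 : R 0 ^ 2 - P 0 ^ 2 = B2 at *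
  generalize hB3 : R 0 ^ 2 + P 0 ^ 2 = B3 at *
  have c0 : B1 * B2 * B3 = 4 * E ^ 6 := by
    rw [← hB1, ← hB2, ← hB3]; linear_combination 2 * h0
  have c3 : A1 * A2 * A3 * t 1 ^ 2 = t 2 ^ 2 * E ^ 6 := by
    have : t 1 ^ 6 * (A1 * A2 * A3 * t 1 ^ 2) = t 1 ^ 6 * (t 2 ^ 2 * E ^ 6) := by linear_combination key1
    exact mul_left_cancel₀ (pow_ne_zero _ n1) this
  have d1 : A1 * B2 - A2 * B1 = t 1 ^ 2 * B3 := by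
    rw [h1, ← hA1, ← hA2, ← hB1, ← hB2, ← hB3]; ring
  have d2 : A1 * B3 - A3 * B1 = t 1 ^ 2 * B2 := by
    rw [h1, ← hA1, ← hA3, ← hB1, ← hB2, ← hB3]; ring
  have d3 : A2 * B3 - A3 * B2 = -t 1 ^ 2 * B1 := by
    rw [h1, ← hA2, ← hA3, ← hB1, ← hB2, ← hB3]; ring
  have hc3 : t 2 ^ 2 / t 1 ^ 8 = A1 * A2 * A3 / (t 1 ^ 6 * E ^ 6) := by
    field_simp; linear_combination -c3
  have hc0 : 4 / t 1 ^ 6 = B1 * B2 * B3 / (t 1 ^ 6 * E ^ 6) := by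
    field_simp; linear_combination -c0
  refine ⟨-(A1 * A2 * B3 + A1 * B2 * A3 + B1 * A2 * A3) / (t 1 ^ 6 * E ^ 6),
    (A1 * B2 * B3 + B1 * A2 * B3 + B1 * B2 * A3) / (t 1 ^ 6 * E ^ 6), fun a => ?_, ?_⟩
  · rw [hc3, hc0]
    have k := key a
    generalize t a ^ 2 = X at *
    generalize t (a + 1) * t (a - 1) = Y at *
    field_simp
    linear_combination k
  · rw [hc3, hc0]
    have hd : ((A1 * B2 - A2 * B1) * (A1 * B3 - A3 * B1) * (A2 * B3 - A3 * B2)) ^ 2 = 16 * t 1 ^ 12 * E ^ 12 := by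
      rw [d1, d2, d3]
      linear_combination t 1 ^ 12 * (B1 * B2 * B3 + 4 * E ^ 6) * c0
    field_simp
    linear_combination hd

end ThetaSystem

/-- The relations between the Laurent monomials in the coordinates `x`. -/
structure UnitSystem (x : Fin 5 → ℂ) (s p : ℂ) : Prop where
  ne_zero : ∀ i, x i ≠ 0
  mon_s : mon x ![1, -2, 0, 2, -1] = s
  mon_p : mon x ![1, -3, 3, -1, 0] = p
  mon_one_sub_s : mon x ![2, -1, -1, 0, 0] = 1 - s
  mon_p_sub_s : mon x ![4, -3, 0, 0, -1] = p - s
  curve : p ^ 2 = p * (4 * s - 3 * s ^ 2 + s ^ 3) - s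

namespace UnitSystem
variable {x : Fin 5 → ℂ} {s p : ℂ}

lemma factor (h : UnitSystem x s p) {e : Fin 5 → ℤ} (e₀ : Fin 5 → ℤ) (i j k l : ℕ)
    (he : e = e₀ + i • ![1, -2, 0, 2, -1] + j • ![1, -3, 3, -1, 0] + k • ![2, -1, -1, 0, 0] +
      l • ![4, -3, 0, 0, -1]) :
    mon x e = mon x e₀ * (s ^ i * p ^ j * (1 - s) ^ k * (p - s) ^ l) := by
  rw [mon_factor h.ne_zero e₀ i j k l he, h.mon_s, h.mon_p, h.mon_one_sub_s, h.mon_p_sub_s]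

lemma factor_mul (h : UnitSystem x s p) {e f : Fin 5 → ℤ} (e₀ : Fin 5 → ℤ) (i j k l : ℕ)
    (he : e + f = e₀ + i • ![1, -2, 0, 2, -1] + j • ![1, -3, 3, -1, 0] + k • ![2, -1, -1, 0, 0] +
      l • ![4, -3, 0, 0, -1]) :
    mon x e * mon x f = mon x e₀ * (s ^ i * p ^ j * (1 - s) ^ k * (p - s) ^ l) := by
  rw [← mon_add h.ne_zero, h.factor e₀ i j k l he]

lemma cubic_two (h : UnitSystem x s p) {b g : ℂ} (hb : b = -2 + 2 * s ^ 2 + (2 * s - 2 * s ^ 2) *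
    p) (hg : g = 1 + 2 * s ^ 2 - 9 * s ^ 3 + 7 * s ^ 4 - s ^ 5 + (2 * s - 22 * s ^ 2 + 54 * s ^ 3
    - 57 * s ^ 4 + 31 * s ^ 5 - 9 * s ^ 6 + s ^ 7) * p) : mon x ![-8, 8, 0, 0, 0] + b * mon x
    ![-10, 9, 1, 0, 0] + g * mon x ![-12, 10, 2, 0, 0] - 4 * mon x ![-3, 0, 3, 0, 0] - mon x ![0,
    -2, 0, 2, 0] = 0 := by
  subst hb hg
  linear_combination h.factor (e := ![-8, 8, 0, 0, 0]) ![-20, 16, 2, 0, 2] 0 0 2 2 (by decide) +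
    (-2 + 2 * s ^ 2 + (2 * s - 2 * s ^ 2) * p) * h.factor (e := ![-10, 9, 1, 0, 0]) ![-20, 16, 2,
    0, 2] 0 0 1 2 (by decide) + (1 + 2 * s ^ 2 - 9 * s ^ 3 + 7 * s ^ 4 - s ^ 5 + (2 * s - 22 * s ^
    2 + 54 * s ^ 3 - 57 * s ^ 4 + 31 * s ^ 5 - 9 * s ^ 6 + s ^ 7) * p) * h.factor (e := ![-12, 10,
    2, 0, 0]) ![-20, 16, 2, 0, 2] 0 0 0 2 (by decide) - 4 * h.factor (e := ![-3, 0, 3, 0, 0])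
    ![-20, 16, 2, 0, 2] 1 2 5 1 (by decide) - h.factor (e := ![0, -2, 0, 2, 0]) ![-20, 16, 2, 0,
    2] 2 2 8 0 (by decide) + mon x ![-20, 16, 2, 0, 2] * (5 * s ^ 3 - 11 * s ^ 4 + 7 * s ^ 5 - s ^
    6 + (-6 * s ^ 2 + 16 * s ^ 3 - 17 * s ^ 4 + 11 * s ^ 5 - 5 * s ^ 6 + s ^ 7) * p) * h.curve

lemma cubic_three (h : UnitSystem x s p) {b g : ℂ} (hb : b = -2 + 2 * s ^ 2 + (2 * s - 2 * s ^ 2)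
    * p) (hg : g = 1 + 2 * s ^ 2 - 9 * s ^ 3 + 7 * s ^ 4 - s ^ 5 + (2 * s - 22 * s ^ 2 + 54 * s ^
    3 - 57 * s ^ 4 + 31 * s ^ 5 - 9 * s ^ 6 + s ^ 7) * p) : mon x ![-8, 2, 6, 0, 0] + b * mon x
    ![-11, 6, 4, 1, 0] + g * mon x ![-14, 10, 2, 2, 0] - 4 * mon x ![-6, 3, 0, 3, 0] - mon x ![0,
    0, -2, 0, 2] = 0 := by
  subst hb hg
  linear_combination h.factor (e := ![-8, 2, 6, 0, 0]) ![-22, 16, 2, 2, 2] 0 2 2 2 (by decide) +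
    (-2 + 2 * s ^ 2 + (2 * s - 2 * s ^ 2) * p) * h.factor (e := ![-11, 6, 4, 1, 0]) ![-22, 16, 2,
    2, 2] 0 1 1 2 (by decide) + (1 + 2 * s ^ 2 - 9 * s ^ 3 + 7 * s ^ 4 - s ^ 5 + (2 * s - 22 * s ^
    2 + 54 * s ^ 3 - 57 * s ^ 4 + 31 * s ^ 5 - 9 * s ^ 6 + s ^ 7) * p) * h.factor (e := ![-14, 10,
    2, 2, 0]) ![-22, 16, 2, 2, 2] 0 0 0 2 (by decide) - 4 * h.factor (e := ![-6, 3, 0, 3, 0])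
    ![-22, 16, 2, 2, 2] 1 1 5 1 (by decide) - h.factor (e := ![0, 0, -2, 0, 2]) ![-22, 16, 2, 2,
    2] 0 2 10 0 (by decide) + mon x ![-22, 16, 2, 2, 2] * (s + 2 * s ^ 3 - 9 * s ^ 4 + 7 * s ^ 5 -
    s ^ 6 + (-2 + 6 * s - 23 * s ^ 2 + 47 * s ^ 3 - 44 * s ^ 4 + 22 * s ^ 5 - 7 * s ^ 6 + s ^ 7) *
    p + (1 - 3 * s ^ 2 + 2 * s ^ 3) * p ^ 2) * h.curve

lemma disc_eq (h : UnitSystem x s p) {b g : ℂ} (hb : b = -2 + 2 * s ^ 2 + (2 * s - 2 * s ^ 2) * p)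
    (hg : g = 1 + 2 * s ^ 2 - 9 * s ^ 3 + 7 * s ^ 4 - s ^ 5 + (2 * s - 22 * s ^ 2 + 54 * s ^ 3 -
    57 * s ^ 4 + 31 * s ^ 5 - 9 * s ^ 6 + s ^ 7) * p) {f : ℂ} (hf : f = -3 * s + 14 * s ^ 2 - 22 *
    s ^ 3 + 13 * s ^ 4 - s ^ 5 - s ^ 6 + (1 + 3 * s - 33 * s ^ 2 + 78 * s ^ 3 - 83 * s ^ 4 + 44 *
    s ^ 5 - 11 * s ^ 6 + s ^ 7) * p) : b ^ 2 * g ^ 2 * mon x ![-38, 26, 0, 0, 0] - 4 * g ^ 3 * mon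
    x ![-38, 26, 0, 0, 0] + 16 * b ^ 3 * mon x ![-27, 15, 0, 0, 0] - 72 * b * g * mon x ![-27, 15,
    0, 0, 0] - 432 * mon x ![-16, 4, 0, 0, 0] - 16 * f * mon x ![-17, 6, 0, -2, 1] = 0 := by
  have e : b ^ 2 * g ^ 2 * (s ^ 0 * p ^ 0 * (1 - s) ^ 0 * (p - s) ^ 2) - 4 * g ^ 3 * (s ^ 0 * p ^
    0 * (1 - s) ^ 0 * (p - s) ^ 2) + 16 * b ^ 3 * (s ^ 1 * p ^ 2 * (1 - s) ^ 6 * (p - s) ^ 1) - 72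
    * b * g * (s ^ 1 * p ^ 2 * (1 - s) ^ 6 * (p - s) ^ 1) - 432 * (s ^ 2 * p ^ 4 * (1 - s) ^ 12 *
    (p - s) ^ 0) - 16 * f * (s ^ 1 * p ^ 4 * (1 - s) ^ 12 * (p - s) ^ 0) = 0 := by
    subst hb hg hf
    linear_combination (-16 * s ^ 3 + 36 * s ^ 4 - 88 * s ^ 5 + 436 * s ^ 6 - 1032 * s ^ 7 + 1704
      * s ^ 8 - 3616 * s ^ 9 + 6988 * s ^ 10 - 8520 * s ^ 11 + 6192 * s ^ 12 - 2648 * s ^ 13 + 640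
      * s ^ 14 - 80 * s ^ 15 + 4 * s ^ 16 + (16 * s ^ 2 - 40 * s ^ 3 + 32 * s ^ 4 + 392 * s ^ 5 -
      2400 * s ^ 6 + 7120 * s ^ 7 - 18776 * s ^ 8 + 48128 * s ^ 9 - 94048 * s ^ 10 + 125864 * s ^
      11 - 114632 * s ^ 12 + 71784 * s ^ 13 - 30920 * s ^ 14 + 8976 * s ^ 15 - 1664 * s ^ 16 + 176
      * s ^ 17 - 8 * s ^ 18) * p + (20 * s ^ 2 - 488 * s ^ 3 + 3172 * s ^ 4 - 10248 * s ^ 5 +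
      17272 * s ^ 6 - 10256 * s ^ 7 - 5940 * s ^ 8 - 23928 * s ^ 9 + 150128 * s ^ 10 - 317880 * s
      ^ 11 + 399364 * s ^ 12 - 340352 * s ^ 13 + 207252 * s ^ 14 - 91904 * s ^ 15 + 29608 * s ^ 16
      - 6768 * s ^ 17 + 1040 * s ^ 18 - 96 * s ^ 19 + 4 * s ^ 20) * p ^ 2 + (-16 * s + 144 * s ^ 2
      - 672 * s ^ 3 + 2608 * s ^ 4 - 11808 * s ^ 5 + 52760 * s ^ 6 - 180296 * s ^ 7 + 442224 * s ^
      8 - 786184 * s ^ 9 + 1033496 * s ^ 10 - 1020592 * s ^ 11 + 764072 * s ^ 12 - 434504 * s ^ 13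
      + 186464 * s ^ 14 - 59328 * s ^ 15 + 13528 * s ^ 16 - 2080 * s ^ 17 + 192 * s ^ 18 - 8 * s ^
      19) * p ^ 3 + (144 * s ^ 4 - 1536 * s ^ 5 + 8128 * s ^ 6 - 27120 * s ^ 7 + 61952 * s ^ 8 -
      101152 * s ^ 9 + 121380 * s ^ 10 - 109008 * s ^ 11 + 73920 * s ^ 12 - 37776 * s ^ 13 + 14328
      * s ^ 14 - 3904 * s ^ 15 + 720 * s ^ 16 - 80 * s ^ 17 + 4 * s ^ 18) * p ^ 4) * h.curve
  linear_combination b ^ 2 * g ^ 2 * h.factor (e := ![-38, 26, 0, 0, 0]) ![-46, 32, 0, 0, 2] 0 0 0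
    2 (by decide) - 4 * g ^ 3 * h.factor (e := ![-38, 26, 0, 0, 0]) ![-46, 32, 0, 0, 2] 0 0 0 2
    (by decide) + 16 * b ^ 3 * h.factor (e := ![-27, 15, 0, 0, 0]) ![-46, 32, 0, 0, 2] 1 2 6 1 (by
    decide) - 72 * b * g * h.factor (e := ![-27, 15, 0, 0, 0]) ![-46, 32, 0, 0, 2] 1 2 6 1 (by
    decide) - 432 * h.factor (e := ![-16, 4, 0, 0, 0]) ![-46, 32, 0, 0, 2] 2 4 12 0 (by decide) -
    16 * f * h.factor (e := ![-17, 6, 0, -2, 1]) ![-46, 32, 0, 0, 2] 1 4 12 0 (by decide) + mon x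
    ![-46, 32, 0, 0, 2] * e

end UnitSystem

namespace ThetaSystem
variable {t Λ P R : ℤ → ℂ} {E : ℂ}

lemma unitSystem (h : ThetaSystem t Λ P R E) : UnitSystem (coords t) (unitS t) (unitP t) :=
  ⟨h.coords_ne_zero, rfl, rfl, h.unit_one_sub_s, h.unit_p_sub_s, h.unit_curve⟩

/-- The twelfth power of `E` as an algebraic function of the coordinates. -/
lemma pow_twelve (h : ThetaSystem t Λ P R E) {s p f : ℂ} (hs : unitS t = s) (hp : unitP t = p)
    (hf : f = -3 * s + 14 * s ^ 2 - 22 * s ^ 3 + 13 * s ^ 4 - s ^ 5 - s ^ 6 + (1 + 3 * s - 33 * s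
    ^ 2 + 78 * s ^ 3 - 83 * s ^ 4 + 44 * s ^ 5 - 11 * s ^ 6 + s ^ 7) * p) :
    E ^ 12 * (f * mon (coords t) ![-17, 6, 0, -2, 1]) = 1 := by
  have hU := h.unitSystem
  rw [hs, hp] at hU
  obtain ⟨b, c, hbc, hd⟩ := h.exists_cubic
  have n1 : t 1 ≠ 0 := h.apply_ne_zero (by norm_num)
  have n2 : t 2 ≠ 0 := h.apply_ne_zero (by norm_num)
  have n3 : t 3 ≠ 0 := h.apply_ne_zero (by norm_num)
  have n4 : t 4 ≠ 0 := h.apply_ne_zero (by norm_num)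
  have n5 : t 5 ≠ 0 := h.apply_ne_zero (by norm_num)
  have h3 := h.three_term 3 2 1 0
  have e2 := hbc 2
  have e3 := hbc 3
  norm_num [h.t6] at e2 e3 h3
  obtain ⟨β, hβ⟩ : ∃ β, β = -2 + 2 * s ^ 2 + (2 * s - 2 * s ^ 2) * p := ⟨_, rfl⟩
  obtain ⟨γ, hγ⟩ : ∃ γ, γ = 1 + 2 * s ^ 2 - 9 * s ^ 3 + 7 * s ^ 4 - s ^ 5 + (2 * s - 22 * s ^ 2 +
    54 * s ^ 3 - 57 * s ^ 4 + 31 * s ^ 5 - 9 * s ^ 6 + s ^ 7) * p := ⟨_, rfl⟩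
  have u2 := hU.cubic_two hβ hγ
  have u3 := hU.cubic_three hβ hγ
  have ud := hU.disc_eq hβ hγ hf
  simp only [mon_eq, coords, zpow_neg, Matrix.cons_val, zpow_ofNat] at u2 u3 ud ⊢
  obtain ⟨b₀, hb₀⟩ : ∃ b₀, b₀ = -(β * t 2 ^ 5 / t 1 ^ 11) := ⟨_, rfl⟩
  obtain ⟨c₀, hc₀⟩ : ∃ c₀, c₀ = γ * t 2 ^ 8 / t 1 ^ 14 := ⟨_, rfl⟩
  have v2 : t 2 ^ 2 * (t 2 ^ 2 / t 1 ^ 8 * (t 2 ^ 2) ^ 3 + b₀ * (t 2 ^ 2) ^ 2 * (t 3 * t 1) +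
      c₀ * t 2 ^ 2 * (t 3 * t 1) ^ 2 - 4 / t 1 ^ 6 * (t 3 * t 1) ^ 3) = t 4 ^ 2 := by
    rw [hb₀, hc₀]
    field_simp at u2 ⊢
    linear_combination u2
  have v3 : t 3 ^ 2 * (t 2 ^ 2 / t 1 ^ 8 * (t 3 ^ 2) ^ 3 + b₀ * (t 3 ^ 2) ^ 2 * (t 4 * t 2) +
      c₀ * t 3 ^ 2 * (t 4 * t 2) ^ 2 - 4 / t 1 ^ 6 * (t 4 * t 2) ^ 3) = t 5 ^ 2 := by
    rw [hb₀, hc₀]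
    field_simp at u3 ⊢
    linear_combination u3
  have w2 : (b - b₀) * t 2 ^ 2 + (c - c₀) * (t 3 * t 1) = 0 := by
    have : t 2 ^ 4 * (t 3 * t 1) * ((b - b₀) * t 2 ^ 2 + (c - c₀) * (t 3 * t 1)) = 0 := by
      linear_combination e2 - v2
    exact (mul_eq_zero.mp this).resolve_left (by positivity)
  have w3 : (b - b₀) * t 3 ^ 2 + (c - c₀) * (t 4 * t 2) = 0 := by
    have : t 3 ^ 4 * (t 4 * t 2) * ((b - b₀) * t 3 ^ 2 + (c - c₀) * (t 4 * t 2)) = 0 := by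
      linear_combination e3 - v3
    exact (mul_eq_zero.mp this).resolve_left (by positivity)
  have n : t 5 * t 1 ^ 3 ≠ 0 := by positivity
  have hb : b = b₀ := sub_eq_zero.mp ((mul_eq_zero.mp (by
    linear_combination t 4 * t 2 * w2 - t 3 * t 1 * w3 + (b - b₀) * h3 :
      t 5 * t 1 ^ 3 * (b - b₀) = 0)).resolve_left n)
  have hc : c = c₀ := sub_eq_zero.mp ((mul_eq_zero.mp (by
    linear_combination t 2 ^ 2 * w3 - t 3 ^ 2 * w2 + (c - c₀) * h3 :
      t 5 * t 1 ^ 3 * (c - c₀) = 0)).resolve_left n)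
  rw [hb, hc, hb₀, hc₀] at hd
  field_simp at ud hd ⊢
  have n16 : 16 * t 1 ^ 21 ≠ 0 := mul_ne_zero (by norm_num) (pow_ne_zero _ n1)
  refine mul_left_cancel₀ n16 ?_
  linear_combination t 4 ^ 2 * hd - E ^ 12 * ud

end ThetaSystem

namespace UnitSystem
variable {x : Fin 5 → ℂ} {s p f K : ℂ}

/-- The terms of weight 0 modulo 11. -/
lemma weight_zero (h : UnitSystem x s p) (hf : f = -3 * s + 14 * s ^ 2 - 22 * s ^ 3 + 13 * s ^ 4 -
    s ^ 5 - s ^ 6 + (1 + 3 * s - 33 * s ^ 2 + 78 * s ^ 3 - 83 * s ^ 4 + 44 * s ^ 5 - 11 * s ^ 6 +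
    s ^ 7) * p) (hK : K * (f * mon x ![-17, 6, 0, -2, 1]) = 1) : -2 / 11 * mon x ![-3, 3, -1, 0,
    0] - 1 / 11 * mon x ![-1, -2, 2, 1, -1] - 2 / 11 * mon x ![-2, 1, -1, 2, -1] - 3 / 11 * mon x
    ![0, -3, 0, 3, -1] + 5 / 11 * mon x ![-1, 1, 0, 0, 0] * mon x ![0, 0, 0, 0, -1] - 3 / 11 * mon
    x ![0, -1, 0, 1, 0] * mon x ![-1, 0, 0, 0, 0] + 2 / 11 * mon x ![0, 0, -1, 0, 1] * mon x ![0,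
    0, 0, -1, 0] + 7 / 11 * mon x ![0, 0, 1, -1, 0] * mon x ![0, -1, 0, 0, 0] + 1 / 11 * mon x
    ![1, 0, 0, 0, -1] * mon x ![0, 0, -1, 0, 0] = K * (-mon x ![-4, -3, 0, -5, -1] + 2 * mon x
    ![-4, -2, -3, -2, -2] + 2 * mon x ![-1, 1, 0, 0, 0] * mon x ![-5, -1, -4, -2, -1] - 3 * mon x
    ![-1, 1, 0, 0, 0] * mon x ![-4, -3, -3, -3, 0] + mon x ![0, -1, 0, 1, 0] * mon x ![-5, -2, -1,
    -4, -1] - mon x ![0, -1, 0, 1, 0] * mon x ![-3, -5, -3, 0, -2] - mon x ![0, 0, -1, 0, 1] * mon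
    x ![-5, 0, -2, -4, -2] - mon x ![0, 0, -1, 0, 1] * mon x ![1, -2, -3, -5, -4] + mon x ![0, 0,
    1, -1, 0] * mon x ![-3, -5, -2, 1, -4] - mon x ![0, 0, 1, -1, 0] * mon x ![-2, -3, 0, -5, -3]
    - mon x ![1, 0, 0, 0, -1] * mon x ![-5, 0, -3, -3, -2] + mon x ![1, 0, 0, 0, -1] * mon x ![-2,
    -4, -2, -1, -4]) := by
  linear_combination -2 / 11 * h.factor (e := ![-3, 3, -1, 0, 0]) ![-9, 7, 0, 0, 1] 0 0 1 1 (by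
    decide) - 1 / 11 * h.factor (e := ![-1, -2, 2, 1, -1]) ![-9, 7, 0, 0, 1] 1 1 1 1 (by decide) -
    2 / 11 * h.factor (e := ![-2, 1, -1, 2, -1]) ![-9, 7, 0, 0, 1] 1 0 1 1 (by decide) - 3 / 11 *
    h.factor (e := ![0, -3, 0, 3, -1]) ![-9, 7, 0, 0, 1] 2 1 3 0 (by decide) + 5 / 11 *
    h.factor_mul (e := ![-1, 1, 0, 0, 0]) (f := ![0, 0, 0, 0, -1]) ![-9, 7, 0, 0, 1] 0 0 0 2 (by
    decide) - 3 / 11 * h.factor_mul (e := ![0, -1, 0, 1, 0]) (f := ![-1, 0, 0, 0, 0]) ![-9, 7, 0,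
    0, 1] 1 1 3 0 (by decide) + 2 / 11 * h.factor_mul (e := ![0, 0, -1, 0, 1]) (f := ![0, 0, 0,
    -1, 0]) ![-9, 7, 0, 0, 1] 0 1 4 0 (by decide) + 7 / 11 * h.factor_mul (e := ![0, 0, 1, -1, 0])
    (f := ![0, -1, 0, 0, 0]) ![-9, 7, 0, 0, 1] 0 1 2 1 (by decide) + 1 / 11 * h.factor_mul (e :=
    ![1, 0, 0, 0, -1]) (f := ![0, 0, -1, 0, 0]) ![-9, 7, 0, 0, 1] 0 0 1 2 (by decide) + mon x
    ![-9, 7, 0, 0, 1] * (13 / 11 - 16 / 11 * s + 8 / 11 * s ^ 2) * h.curve - mon x ![-9, 7, 0, 0,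
    1] * (-s + 2 * s ^ 2 - s ^ 3 + (2 * s - 6 * s ^ 2 + 7 * s ^ 3 - 4 * s ^ 4 + s ^ 5) * p) * hK +
    K * (-s + 2 * s ^ 2 - s ^ 3 + (2 * s - 6 * s ^ 2 + 7 * s ^ 3 - 4 * s ^ 4 + s ^ 5) * p) * f *
    h.factor_mul (e := ![-9, 7, 0, 0, 1]) (f := ![-17, 6, 0, -2, 1]) ![-31, 21, -2, -5, 4] 2 1 1 0
    (by decide) + K * (-s + 2 * s ^ 2 - s ^ 3 + (2 * s - 6 * s ^ 2 + 7 * s ^ 3 - 4 * s ^ 4 + s ^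
    5) * p) * mon x ![-31, 21, -2, -5, 4] * (s ^ 2 * p ^ 1 * (1 - s) ^ 1 * (p - s) ^ 0) * hf + K *
    mon x ![-31, 21, -2, -5, 4] * (s ^ 7 + (3 * s ^ 3 - 20 * s ^ 4 + 58 * s ^ 5 - 99 * s ^ 6 + 89
    * s ^ 7 - 49 * s ^ 8 + 11 * s ^ 9 + 2 * s ^ 10 - s ^ 11) * p + (-s ^ 2 - s ^ 3 + 31 * s ^ 4 -
    112 * s ^ 5 + 268 * s ^ 6 - 354 * s ^ 7 + 315 * s ^ 8 - 186 * s ^ 9 + 67 * s ^ 10 - 13 * s ^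
    11 + s ^ 12) * p ^ 2 + (s ^ 2 + s ^ 3 - 33 * s ^ 4 + 29 * s ^ 5 - 39 * s ^ 6 + 29 * s ^ 7 - 9
    * s ^ 8 + s ^ 9) * p ^ 3 + (-2 * s + 7 * s ^ 2 + 9 * s ^ 3 + 6 * s ^ 4 - 6 * s ^ 5 + s ^ 6) *
    p ^ 4 + (1 - 5 * s - 3 * s ^ 2 + s ^ 3) * p ^ 5 + p ^ 6) * h.curve - K * (-h.factor (e :=
    ![-4, -3, 0, -5, -1]) ![-31, 21, -2, -5, 4] 1 2 4 4 (by decide) + 2 * h.factor (e := ![-4, -2,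
    -3, -2, -2]) ![-31, 21, -2, -5, 4] 2 1 4 4 (by decide) + 2 * h.factor_mul (e := ![-1, 1, 0, 0,
    0]) (f := ![-5, -1, -4, -2, -1]) ![-31, 21, -2, -5, 4] 2 1 5 3 (by decide) - 3 * h.factor_mul
    (e := ![-1, 1, 0, 0, 0]) (f := ![-4, -3, -3, -3, 0]) ![-31, 21, -2, -5, 4] 2 2 7 2 (by decide)
    + h.factor_mul (e := ![0, -1, 0, 1, 0]) (f := ![-5, -2, -1, -4, -1]) ![-31, 21, -2, -5, 4] 2 2
    5 3 (by decide) - h.factor_mul (e := ![0, -1, 0, 1, 0]) (f := ![-3, -5, -3, 0, -2]) ![-31, 21,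
    -2, -5, 4] 4 2 7 2 (by decide) - h.factor_mul (e := ![0, 0, -1, 0, 1]) (f := ![-5, 0, -2, -4,
    -2]) ![-31, 21, -2, -5, 4] 1 1 4 4 (by decide) - h.factor_mul (e := ![0, 0, -1, 0, 1]) (f :=
    ![1, -2, -3, -5, -4]) ![-31, 21, -2, -5, 4] 0 0 2 7 (by decide) + h.factor_mul (e := ![0, 0,
    1, -1, 0]) (f := ![-3, -5, -2, 1, -4]) ![-31, 21, -2, -5, 4] 3 1 2 5 (by decide) -
    h.factor_mul (e := ![0, 0, 1, -1, 0]) (f := ![-2, -3, 0, -5, -3]) ![-31, 21, -2, -5, 4] 0 1 0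
    7 (by decide) - h.factor_mul (e := ![1, 0, 0, 0, -1]) (f := ![-5, 0, -3, -3, -2]) ![-31, 21,
    -2, -5, 4] 1 0 1 6 (by decide) + h.factor_mul (e := ![1, 0, 0, 0, -1]) (f := ![-2, -4, -2, -1,
    -4]) ![-31, 21, -2, -5, 4] 2 0 0 7 (by decide))

/-- The terms of weight 1 modulo 11. -/
lemma weight_one (h : UnitSystem x s p) (hf : f = -3 * s + 14 * s ^ 2 - 22 * s ^ 3 + 13 * s ^ 4 -
    s ^ 5 - s ^ 6 + (1 + 3 * s - 33 * s ^ 2 + 78 * s ^ 3 - 83 * s ^ 4 + 44 * s ^ 5 - 11 * s ^ 6 +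
    s ^ 7) * p) (hK : K * (f * mon x ![-17, 6, 0, -2, 1]) = 1) : mon x ![-1, 0, 0, 1, -1] + 8 / 11
    * mon x ![0, -1, -1, 0, 1] - 1 / 11 * mon x ![-1, 1, 0, 0, 0] * mon x ![0, -1, 0, 1, -1] - 7 /
    11 * mon x ![0, 0, -1, 0, 1] * mon x ![0, -1, 0, 0, 0] - 5 / 11 * mon x ![0, 0, 1, -1, 0] *
    mon x ![0, 0, 0, 0, -1] + 6 / 11 * mon x ![1, 0, 0, 0, -1] * mon x ![-1, 0, 1, -1, 0] = K *
    (mon x ![-3, -5, -3, 1, -3] - mon x ![-3, -2, -4, -3, -1] - mon x ![-1, 1, 0, 0, 0] * mon x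
    ![-3, -5, -2, 2, -5] + mon x ![-1, 1, 0, 0, 0] * mon x ![1, -1, -3, -4, -6] - mon x ![0, -1,
    0, 1, 0] * mon x ![-4, -3, 0, -5, -1] + 2 * mon x ![0, -1, 0, 1, 0] * mon x ![-4, -2, -3, -2,
    -2] - mon x ![0, 0, -1, 0, 1] * mon x ![-3, -5, -2, 1, -4] + mon x ![0, 0, -1, 0, 1] * mon x
    ![-2, -3, 0, -5, -3] - 2 * mon x ![0, 0, 1, -1, 0] * mon x ![-5, -1, -4, -2, -1] + 3 * mon x
    ![0, 0, 1, -1, 0] * mon x ![-4, -3, -3, -3, 0] - 2 * mon x ![1, 0, 0, 0, -1] * mon x ![-4, -2,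
    0, -4, -3] + mon x ![1, 0, 0, 0, -1] * mon x ![-2, -3, -2, -1, -5]) := by
  linear_combination h.factor (e := ![-1, 0, 0, 1, -1]) ![-12, 9, 1, -1, 2] 1 0 1 2 (by decide) +
    8 / 11 * h.factor (e := ![0, -1, -1, 0, 1]) ![-12, 9, 1, -1, 2] 1 1 5 0 (by decide) - 1 / 11 *
    h.factor_mul (e := ![-1, 1, 0, 0, 0]) (f := ![0, -1, 0, 1, -1]) ![-12, 9, 1, -1, 2] 1 0 1 2
    (by decide) - 7 / 11 * h.factor_mul (e := ![0, 0, -1, 0, 1]) (f := ![0, -1, 0, 0, 0]) ![-12,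
    9, 1, -1, 2] 1 1 5 0 (by decide) - 5 / 11 * h.factor_mul (e := ![0, 0, 1, -1, 0]) (f := ![0,
    0, 0, 0, -1]) ![-12, 9, 1, -1, 2] 0 0 0 3 (by decide) + 6 / 11 * h.factor_mul (e := ![1, 0, 0,
    0, -1]) (f := ![-1, 0, 1, -1, 0]) ![-12, 9, 1, -1, 2] 0 0 0 3 (by decide) + mon x ![-12, 9, 1,
    -1, 2] * (s - 13 / 11 * s ^ 2 + 1 / 11 * s ^ 3 + (1 / 11) * p) * h.curve - mon x ![-12, 9, 1,
    -1, 2] * (-s ^ 2 + 2 * s ^ 3 - s ^ 4 + (2 * s ^ 2 - 5 * s ^ 3 + 4 * s ^ 4 - s ^ 5) * p) * hK +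
    K * (-s ^ 2 + 2 * s ^ 3 - s ^ 4 + (2 * s ^ 2 - 5 * s ^ 3 + 4 * s ^ 4 - s ^ 5) * p) * f *
    h.factor_mul (e := ![-12, 9, 1, -1, 2]) (f := ![-17, 6, 0, -2, 1]) ![-44, 33, -3, -4, 5] 2 3 5
    0 (by decide) + K * (-s ^ 2 + 2 * s ^ 3 - s ^ 4 + (2 * s ^ 2 - 5 * s ^ 3 + 4 * s ^ 4 - s ^ 5)
    * p) * mon x ![-44, 33, -3, -4, 5] * (s ^ 2 * p ^ 3 * (1 - s) ^ 5 * (p - s) ^ 0) * hf + K *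
    mon x ![-44, 33, -3, -4, 5] * (s ^ 10 + (-11 * s ^ 9 + 5 * s ^ 10 - 5 * s ^ 11 + 2 * s ^ 12) *
    p + (57 * s ^ 8 - 59 * s ^ 9 + 72 * s ^ 10 - 47 * s ^ 11 + 18 * s ^ 12 - 6 * s ^ 13 + s ^ 14)
    * p ^ 2 + (3 * s ^ 4 - 32 * s ^ 5 + 152 * s ^ 6 - 605 * s ^ 7 + 1085 * s ^ 8 - 1439 * s ^ 9 +
    1282 * s ^ 10 - 786 * s ^ 11 + 329 * s ^ 12 - 82 * s ^ 13 + 9 * s ^ 14) * p ^ 3 + (-s ^ 3 + s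
    ^ 4 + 63 * s ^ 5 - 71 * s ^ 6 + 612 * s ^ 7 - 1563 * s ^ 8 + 2652 * s ^ 9 - 3019 * s ^ 10 +
    2377 * s ^ 11 - 1322 * s ^ 12 + 504 * s ^ 13 - 123 * s ^ 14 + 17 * s ^ 15 - s ^ 16) * p ^ 4 +
    (4 * s ^ 3 - 70 * s ^ 4 - 84 * s ^ 5 + 148 * s ^ 6 - 299 * s ^ 7 + 307 * s ^ 8 - 240 * s ^ 9 +
    163 * s ^ 10 - 68 * s ^ 11 + 14 * s ^ 12 - s ^ 13) * p ^ 5 + (-2 * s ^ 2 + 62 * s ^ 3 + 8 * s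
    ^ 4 + 9 * s ^ 5 + 5 * s ^ 6 + 45 * s ^ 7 - 67 * s ^ 8 + 28 * s ^ 9 - 4 * s ^ 10) * p ^ 6 +
    (-28 * s ^ 2 - 7 * s ^ 3 + 18 * s ^ 4 - 47 * s ^ 5 + 37 * s ^ 6 - 10 * s ^ 7 + s ^ 8) * p ^ 7
    + (9 * s - 4 * s ^ 2 + 7 * s ^ 3 - 3 * s ^ 4) * p ^ 8 + (-1) * p ^ 9) * h.curve - K *
    (h.factor (e := ![-3, -5, -3, 1, -3]) ![-44, 33, -3, -4, 5] 4 3 9 4 (by decide) - h.factor (e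
    := ![-3, -2, -4, -3, -1]) ![-44, 33, -3, -4, 5] 2 3 10 4 (by decide) - h.factor_mul (e :=
    ![-1, 1, 0, 0, 0]) (f := ![-3, -5, -2, 2, -5]) ![-44, 33, -3, -4, 5] 4 2 5 6 (by decide) +
    h.factor_mul (e := ![-1, 1, 0, 0, 0]) (f := ![1, -1, -3, -4, -6]) ![-44, 33, -3, -4, 5] 0 0 0
    11 (by decide) - h.factor_mul (e := ![0, -1, 0, 1, 0]) (f := ![-4, -3, 0, -5, -1]) ![-44, 33,
    -3, -4, 5] 2 4 9 4 (by decide) + 2 * h.factor_mul (e := ![0, -1, 0, 1, 0]) (f := ![-4, -2, -3,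
    -2, -2]) ![-44, 33, -3, -4, 5] 3 3 9 4 (by decide) - h.factor_mul (e := ![0, 0, -1, 0, 1]) (f
    := ![-3, -5, -2, 1, -4]) ![-44, 33, -3, -4, 5] 4 3 9 4 (by decide) + h.factor_mul (e := ![0,
    0, -1, 0, 1]) (f := ![-2, -3, 0, -5, -3]) ![-44, 33, -3, -4, 5] 1 3 7 6 (by decide) - 2 *
    h.factor_mul (e := ![0, 0, 1, -1, 0]) (f := ![-5, -1, -4, -2, -1]) ![-44, 33, -3, -4, 5] 2 3 9
    4 (by decide) + 3 * h.factor_mul (e := ![0, 0, 1, -1, 0]) (f := ![-4, -3, -3, -3, 0]) ![-44,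
    33, -3, -4, 5] 2 4 11 3 (by decide) - 2 * h.factor_mul (e := ![1, 0, 0, 0, -1]) (f := ![-4,
    -2, 0, -4, -3]) ![-44, 33, -3, -4, 5] 1 2 3 8 (by decide) + h.factor_mul (e := ![1, 0, 0, 0,
    -1]) (f := ![-2, -3, -2, -1, -5]) ![-44, 33, -3, -4, 5] 2 1 2 9 (by decide))

/-- The terms of weight 2 modulo 11. -/
lemma weight_two (h : UnitSystem x s p) (K : ℂ) : -mon x ![-1, -1, 1, -1, 1] - 1 / 11 * mon x ![0,
    0, -1, 0, 0] + 3 / 11 * mon x ![-1, 1, 0, 0, 0] * mon x ![-1, 0, 0, 0, 0] + 8 / 11 * mon x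
    ![0, -1, 0, 1, 0] * mon x ![0, -1, -1, 0, 1] + 5 / 11 * mon x ![0, 0, -1, 0, 1] * mon x ![0,
    0, 0, 0, -1] + 1 / 11 * mon x ![0, 0, 1, -1, 0] * mon x ![0, -1, 0, 1, -1] - 4 / 11 * mon x
    ![1, 0, 0, 0, -1] * mon x ![1, 0, 0, -1, -1] = K * (mon x ![-5, 0, -3, -3, -2] - mon x ![-2,
    -4, -2, -1, -4] - mon x ![-1, 1, 0, 0, 0] * mon x ![-5, -2, -1, -4, -1] + mon x ![-1, 1, 0, 0,
    0] * mon x ![-3, -5, -3, 0, -2] + mon x ![0, -1, 0, 1, 0] * mon x ![-3, -5, -3, 1, -3] - mon x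
    ![0, -1, 0, 1, 0] * mon x ![-3, -2, -4, -3, -1] + 2 * mon x ![0, 0, -1, 0, 1] * mon x ![-5,
    -1, -4, -2, -1] - 3 * mon x ![0, 0, -1, 0, 1] * mon x ![-4, -3, -3, -3, 0] + mon x ![0, 0, 1,
    -1, 0] * mon x ![-3, -5, -2, 2, -5] - mon x ![0, 0, 1, -1, 0] * mon x ![1, -1, -3, -4, -6] - 3
    * mon x ![1, 0, 0, 0, -1] * mon x ![-3, -3, -4, -1, -2] + 2 * mon x ![1, 0, 0, 0, -1] * mon x
    ![-2, -4, -5, -2, 0]) := by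
  linear_combination -h.factor (e := ![-1, -1, 1, -1, 1]) ![-18, 15, 0, -1, 3] 1 2 5 1 (by decide)
    - 1 / 11 * h.factor (e := ![0, 0, -1, 0, 0]) ![-18, 15, 0, -1, 3] 1 1 4 2 (by decide) + 3 / 11
    * h.factor_mul (e := ![-1, 1, 0, 0, 0]) (f := ![-1, 0, 0, 0, 0]) ![-18, 15, 0, -1, 3] 1 1 3 2
    (by decide) + 8 / 11 * h.factor_mul (e := ![0, -1, 0, 1, 0]) (f := ![0, -1, -1, 0, 1]) ![-18,
    15, 0, -1, 3] 2 2 7 0 (by decide) + 5 / 11 * h.factor_mul (e := ![0, 0, -1, 0, 1]) (f := ![0,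
    0, 0, 0, -1]) ![-18, 15, 0, -1, 3] 1 1 4 2 (by decide) + 1 / 11 * h.factor_mul (e := ![0, 0,
    1, -1, 0]) (f := ![0, -1, 0, 1, -1]) ![-18, 15, 0, -1, 3] 1 1 2 3 (by decide) - 4 / 11 *
    h.factor_mul (e := ![1, 0, 0, 0, -1]) (f := ![1, 0, 0, -1, -1]) ![-18, 15, 0, -1, 3] 0 0 0 5
    (by decide) + mon x ![-18, 15, 0, -1, 3] * (4 / 11 * s ^ 4 + (7 / 11 * s ^ 2 - 46 / 11 * s ^ 3
    + 51 / 11 * s ^ 4 - 32 / 11 * s ^ 5 + 8 / 11 * s ^ 6) * p + (5 / 11 * s + 10 / 11 * s ^ 2 - 3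
    / 11 * s ^ 3) * p ^ 2 + (-4 / 11) * p ^ 3) * h.curve + K * mon x ![-47, 35, -2, -5, 6] * (s ^
    11 + (-12 * s ^ 10 + 4 * s ^ 11 - 3 * s ^ 12 + s ^ 13) * p + (-s ^ 7 + 10 * s ^ 8 + 20 * s ^ 9
    + 77 * s ^ 10 - 171 * s ^ 11 + 225 * s ^ 12 - 183 * s ^ 13 + 90 * s ^ 14 - 25 * s ^ 15 + 3 * s
    ^ 16) * p ^ 2 + (2 * s ^ 5 - 20 * s ^ 6 + 88 * s ^ 7 - 436 * s ^ 8 + 584 * s ^ 9 - 627 * s ^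
    10 + 448 * s ^ 11 - 242 * s ^ 12 + 129 * s ^ 13 - 64 * s ^ 14 + 21 * s ^ 15 - 3 * s ^ 16) * p
    ^ 3 + (-3 * s ^ 4 + 32 * s ^ 5 - 146 * s ^ 6 + 843 * s ^ 7 - 1323 * s ^ 8 + 1626 * s ^ 9 -
    1373 * s ^ 10 + 854 * s ^ 11 - 435 * s ^ 12 + 177 * s ^ 13 - 48 * s ^ 14 + 6 * s ^ 15) * p ^ 4
    + (2 * s ^ 4 - 41 * s ^ 5 - 452 * s ^ 6 + 617 * s ^ 7 - 741 * s ^ 8 + 551 * s ^ 9 - 270 * s ^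
    10 + 126 * s ^ 11 - 62 * s ^ 12 + 21 * s ^ 13 - 3 * s ^ 14) * p ^ 5 + (s ^ 2 - 16 * s ^ 3 +
    139 * s ^ 4 + 90 * s ^ 5 - 3 * s ^ 6 - 21 * s ^ 7 + 95 * s ^ 8 - 139 * s ^ 9 + 87 * s ^ 10 -
    26 * s ^ 11 + 3 * s ^ 12) * p ^ 6 + (4 * s ^ 2 - 77 * s ^ 3 - 63 * s ^ 4 + 38 * s ^ 5 - 57 * s
    ^ 6 + 52 * s ^ 7 - 20 * s ^ 8 + 3 * s ^ 9) * p ^ 7 + (-s + 34 * s ^ 2 + 12 * s ^ 3 + 5 * s ^ 4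
    - 6 * s ^ 5 + s ^ 6) * p ^ 8 + (-8 * s - 3 * s ^ 2 + s ^ 3) * p ^ 9 + p ^ 10) * h.curve - K *
    (h.factor (e := ![-5, 0, -3, -3, -2]) ![-47, 35, -2, -5, 6] 2 2 7 6 (by decide) - h.factor (e
    := ![-2, -4, -2, -1, -4]) ![-47, 35, -2, -5, 6] 3 2 6 7 (by decide) - h.factor_mul (e := ![-1,
    1, 0, 0, 0]) (f := ![-5, -2, -1, -4, -1]) ![-47, 35, -2, -5, 6] 2 3 8 5 (by decide) +
    h.factor_mul (e := ![-1, 1, 0, 0, 0]) (f := ![-3, -5, -3, 0, -2]) ![-47, 35, -2, -5, 6] 4 3 10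
    4 (by decide) + h.factor_mul (e := ![0, -1, 0, 1, 0]) (f := ![-3, -5, -3, 1, -3]) ![-47, 35,
    -2, -5, 6] 5 3 10 4 (by decide) - h.factor_mul (e := ![0, -1, 0, 1, 0]) (f := ![-3, -2, -4,
    -3, -1]) ![-47, 35, -2, -5, 6] 3 3 11 4 (by decide) + 2 * h.factor_mul (e := ![0, 0, -1, 0,
    1]) (f := ![-5, -1, -4, -2, -1]) ![-47, 35, -2, -5, 6] 3 3 12 3 (by decide) - 3 * h.factor_mul
    (e := ![0, 0, -1, 0, 1]) (f := ![-4, -3, -3, -3, 0]) ![-47, 35, -2, -5, 6] 3 4 14 2 (by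
    decide) + h.factor_mul (e := ![0, 0, 1, -1, 0]) (f := ![-3, -5, -2, 2, -5]) ![-47, 35, -2, -5,
    6] 4 2 5 7 (by decide) - h.factor_mul (e := ![0, 0, 1, -1, 0]) (f := ![1, -1, -3, -4, -6])
    ![-47, 35, -2, -5, 6] 0 0 0 12 (by decide) - 3 * h.factor_mul (e := ![1, 0, 0, 0, -1]) (f :=
    ![-3, -3, -4, -1, -2]) ![-47, 35, -2, -5, 6] 3 2 8 6 (by decide) + 2 * h.factor_mul (e := ![1,
    0, 0, 0, -1]) (f := ![-2, -4, -5, -2, 0]) ![-47, 35, -2, -5, 6] 3 3 12 4 (by decide))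

/-- The terms of weight 3 modulo 11. -/
lemma weight_three (h : UnitSystem x s p) (hf : f = -3 * s + 14 * s ^ 2 - 22 * s ^ 3 + 13 * s ^ 4
    - s ^ 5 - s ^ 6 + (1 + 3 * s - 33 * s ^ 2 + 78 * s ^ 3 - 83 * s ^ 4 + 44 * s ^ 5 - 11 * s ^ 6
    + s ^ 7) * p) (hK : K * (f * mon x ![-17, 6, 0, -2, 1]) = 1) : -6 / 11 * mon x ![-1, 0, 1, -1,
    0] - 1 / 11 * mon x ![0, -1, 0, 1, 0] * mon x ![0, 0, -1, 0, 0] - 1 / 11 * mon x ![0, 0, -1,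
    0, 1] * mon x ![0, -1, 0, 1, -1] - 3 / 11 * mon x ![0, 0, 1, -1, 0] * mon x ![-1, 0, 0, 0, 0]
    - 2 / 11 * mon x ![1, 0, 0, 0, -1] * mon x ![-1, 1, -1, 0, 0] = K * (2 * mon x ![-4, -2, 0,
    -4, -3] - mon x ![-2, -3, -2, -1, -5] + mon x ![-1, 1, 0, 0, 0] * mon x ![-4, -3, 0, -5, -1] -
    2 * mon x ![-1, 1, 0, 0, 0] * mon x ![-4, -2, -3, -2, -2] + mon x ![0, -1, 0, 1, 0] * mon x
    ![-5, 0, -3, -3, -2] - mon x ![0, -1, 0, 1, 0] * mon x ![-2, -4, -2, -1, -4] - mon x ![0, 0,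
    -1, 0, 1] * mon x ![-3, -5, -2, 2, -5] + mon x ![0, 0, -1, 0, 1] * mon x ![1, -1, -3, -4, -6]
    + mon x ![0, 0, 1, -1, 0] * mon x ![-5, -2, -1, -4, -1] - mon x ![0, 0, 1, -1, 0] * mon x
    ![-3, -5, -3, 0, -2] + mon x ![1, 0, 0, 0, -1] * mon x ![-3, -5, -2, 0, -3] - 2 * mon x ![1,
    0, 0, 0, -1] * mon x ![-3, -4, -3, -3, 0]) := by
  linear_combination -6 / 11 * h.factor (e := ![-1, 0, 1, -1, 0]) ![-8, 7, -1, 0, 1] 0 1 1 1 (by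
    decide) - 1 / 11 * h.factor_mul (e := ![0, -1, 0, 1, 0]) (f := ![0, 0, -1, 0, 0]) ![-8, 7, -1,
    0, 1] 1 1 3 0 (by decide) - 1 / 11 * h.factor_mul (e := ![0, 0, -1, 0, 1]) (f := ![0, -1, 0,
    1, -1]) ![-8, 7, -1, 0, 1] 1 1 3 0 (by decide) - 3 / 11 * h.factor_mul (e := ![0, 0, 1, -1,
    0]) (f := ![-1, 0, 0, 0, 0]) ![-8, 7, -1, 0, 1] 0 1 1 1 (by decide) - 2 / 11 * h.factor_mul (e
    := ![1, 0, 0, 0, -1]) (f := ![-1, 1, -1, 0, 0]) ![-8, 7, -1, 0, 1] 0 0 0 2 (by decide) + mon x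
    ![-8, 7, -1, 0, 1] * (-1 + 9 / 11 * s) * h.curve - mon x ![-8, 7, -1, 0, 1] * (s - s ^ 2 + (-3
    * s + 6 * s ^ 2 - 4 * s ^ 3 + s ^ 4) * p) * hK + K * (s - s ^ 2 + (-3 * s + 6 * s ^ 2 - 4 * s
    ^ 3 + s ^ 4) * p) * f * h.factor_mul (e := ![-8, 7, -1, 0, 1]) (f := ![-17, 6, 0, -2, 1])
    ![-35, 26, -4, -4, 4] 2 2 3 0 (by decide) + K * (s - s ^ 2 + (-3 * s + 6 * s ^ 2 - 4 * s ^ 3 +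
    s ^ 4) * p) * mon x ![-35, 26, -4, -4, 4] * (s ^ 2 * p ^ 2 * (1 - s) ^ 3 * (p - s) ^ 0) * hf +
    K * mon x ![-35, 26, -4, -4, 4] * (s ^ 8 + (-9 * s ^ 7 + 3 * s ^ 8 - 2 * s ^ 9 + s ^ 10) * p +
    (-3 * s ^ 3 + 26 * s ^ 4 - 95 * s ^ 5 + 226 * s ^ 6 - 259 * s ^ 7 + 198 * s ^ 8 - 87 * s ^ 9 +
    13 * s ^ 10 + 3 * s ^ 11 - s ^ 12) * p ^ 2 + (s ^ 2 - 4 * s ^ 3 - 21 * s ^ 4 + 105 * s ^ 5 -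
    443 * s ^ 6 + 790 * s ^ 7 - 886 * s ^ 8 + 661 * s ^ 9 - 317 * s ^ 10 + 93 * s ^ 11 - 15 * s ^
    12 + s ^ 13) * p ^ 3 + (4 * s ^ 2 - 19 * s ^ 3 + 118 * s ^ 4 - 147 * s ^ 5 + 166 * s ^ 6 - 132
    * s ^ 7 + 56 * s ^ 8 - 12 * s ^ 9 + s ^ 10) * p ^ 4 + (-s - 2 * s ^ 2 - 28 * s ^ 3 + 2 * s ^ 4
    + 10 * s ^ 5 - 2 * s ^ 6) * p ^ 5 + (3 * s + 8 * s ^ 2 - 4 * s ^ 3) * p ^ 6 + (-1) * p ^ 7) *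
    h.curve - K * (2 * h.factor (e := ![-4, -2, 0, -4, -3]) ![-35, 26, -4, -4, 4] 1 2 2 6 (by
    decide) - h.factor (e := ![-2, -3, -2, -1, -5]) ![-35, 26, -4, -4, 4] 2 1 1 7 (by decide) +
    h.factor_mul (e := ![-1, 1, 0, 0, 0]) (f := ![-4, -3, 0, -5, -1]) ![-35, 26, -4, -4, 4] 1 3 5
    4 (by decide) - 2 * h.factor_mul (e := ![-1, 1, 0, 0, 0]) (f := ![-4, -2, -3, -2, -2]) ![-35,
    26, -4, -4, 4] 2 2 5 4 (by decide) + h.factor_mul (e := ![0, -1, 0, 1, 0]) (f := ![-5, 0, -3,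
    -3, -2]) ![-35, 26, -4, -4, 4] 2 2 5 4 (by decide) - h.factor_mul (e := ![0, -1, 0, 1, 0]) (f
    := ![-2, -4, -2, -1, -4]) ![-35, 26, -4, -4, 4] 3 2 4 5 (by decide) - h.factor_mul (e := ![0,
    0, -1, 0, 1]) (f := ![-3, -5, -2, 2, -5]) ![-35, 26, -4, -4, 4] 4 2 5 4 (by decide) +
    h.factor_mul (e := ![0, 0, -1, 0, 1]) (f := ![1, -1, -3, -4, -6]) ![-35, 26, -4, -4, 4] 0 0 0
    9 (by decide) + h.factor_mul (e := ![0, 0, 1, -1, 0]) (f := ![-5, -2, -1, -4, -1]) ![-35, 26,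
    -4, -4, 4] 1 3 5 4 (by decide) - h.factor_mul (e := ![0, 0, 1, -1, 0]) (f := ![-3, -5, -3, 0,
    -2]) ![-35, 26, -4, -4, 4] 3 3 7 3 (by decide) + h.factor_mul (e := ![1, 0, 0, 0, -1]) (f :=
    ![-3, -5, -2, 0, -3]) ![-35, 26, -4, -4, 4] 3 2 4 5 (by decide) - 2 * h.factor_mul (e := ![1,
    0, 0, 0, -1]) (f := ![-3, -4, -3, -3, 0]) ![-35, 26, -4, -4, 4] 2 3 8 3 (by decide))

/-- The terms of weight 4 modulo 11. -/
lemma weight_four (h : UnitSystem x s p) (hf : f = -3 * s + 14 * s ^ 2 - 22 * s ^ 3 + 13 * s ^ 4 -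
    s ^ 5 - s ^ 6 + (1 + 3 * s - 33 * s ^ 2 + 78 * s ^ 3 - 83 * s ^ 4 + 44 * s ^ 5 - 11 * s ^ 6 +
    s ^ 7) * p) (hK : K * (f * mon x ![-17, 6, 0, -2, 1]) = 1) : 4 / 11 * mon x ![1, 0, 0, -1, -1]
    - 8 / 11 * mon x ![-1, 1, 0, 0, 0] * mon x ![0, -1, -1, 0, 1] - 6 / 11 * mon x ![0, -1, 0, 1,
    0] * mon x ![-1, 0, 1, -1, 0] + 3 / 11 * mon x ![0, 0, -1, 0, 1] * mon x ![-1, 0, 0, 0, 0] + 2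
    / 11 * mon x ![1, 0, 0, 0, -1] * mon x ![0, 0, 0, -1, 0] = K * (3 * mon x ![-3, -3, -4, -1,
    -2] - 2 * mon x ![-2, -4, -5, -2, 0] - mon x ![-1, 1, 0, 0, 0] * mon x ![-3, -5, -3, 1, -3] +
    mon x ![-1, 1, 0, 0, 0] * mon x ![-3, -2, -4, -3, -1] + 2 * mon x ![0, -1, 0, 1, 0] * mon x
    ![-4, -2, 0, -4, -3] - mon x ![0, -1, 0, 1, 0] * mon x ![-2, -3, -2, -1, -5] - mon x ![0, 0,
    -1, 0, 1] * mon x ![-5, -2, -1, -4, -1] + mon x ![0, 0, -1, 0, 1] * mon x ![-3, -5, -3, 0, -2]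
    - mon x ![0, 0, 1, -1, 0] * mon x ![-4, -3, 0, -5, -1] + 2 * mon x ![0, 0, 1, -1, 0] * mon x
    ![-4, -2, -3, -2, -2] - mon x ![1, 0, 0, 0, -1] * mon x ![-5, 0, -2, -4, -2] - mon x ![1, 0,
    0, 0, -1] * mon x ![1, -2, -3, -5, -4]) := by
  linear_combination 4 / 11 * h.factor (e := ![1, 0, 0, -1, -1]) ![-11, 9, 0, -1, 2] 0 0 0 3 (by
    decide) - 8 / 11 * h.factor_mul (e := ![-1, 1, 0, 0, 0]) (f := ![0, -1, -1, 0, 1]) ![-11, 9,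
    0, -1, 2] 1 1 4 0 (by decide) - 6 / 11 * h.factor_mul (e := ![0, -1, 0, 1, 0]) (f := ![-1, 0,
    1, -1, 0]) ![-11, 9, 0, -1, 2] 1 1 2 1 (by decide) + 3 / 11 * h.factor_mul (e := ![0, 0, -1,
    0, 1]) (f := ![-1, 0, 0, 0, 0]) ![-11, 9, 0, -1, 2] 1 1 4 0 (by decide) + 2 / 11 *
    h.factor_mul (e := ![1, 0, 0, 0, -1]) (f := ![0, 0, 0, -1, 0]) ![-11, 9, 0, -1, 2] 0 0 0 3 (by
    decide) + mon x ![-11, 9, 0, -1, 2] * (-6 / 11 * s ^ 2 + (6 / 11) * p) * h.curve - mon x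
    ![-11, 9, 0, -1, 2] * ((-s + 4 * s ^ 2 - 6 * s ^ 3 + 4 * s ^ 4 - s ^ 5) * p) * hK + K * ((-s +
    4 * s ^ 2 - 6 * s ^ 3 + 4 * s ^ 4 - s ^ 5) * p) * f * h.factor_mul (e := ![-11, 9, 0, -1, 2])
    (f := ![-17, 6, 0, -2, 1]) ![-38, 28, -3, -5, 5] 2 2 3 0 (by decide) + K * ((-s + 4 * s ^ 2 -
    6 * s ^ 3 + 4 * s ^ 4 - s ^ 5) * p) * mon x ![-38, 28, -3, -5, 5] * (s ^ 2 * p ^ 2 * (1 - s) ^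
    3 * (p - s) ^ 0) * hf + K * mon x ![-38, 28, -3, -5, 5] * (s ^ 9 + (-s ^ 7 - 8 * s ^ 8 + 2 * s
    ^ 9 - s ^ 10) * p + (-s ^ 5 + 13 * s ^ 6 + 16 * s ^ 7 - 24 * s ^ 8 + 76 * s ^ 9 - 103 * s ^ 10
    + 74 * s ^ 11 - 27 * s ^ 12 + 4 * s ^ 13) * p ^ 2 + (3 * s ^ 3 - 30 * s ^ 4 + 116 * s ^ 5 -
    433 * s ^ 6 + 810 * s ^ 7 - 1177 * s ^ 8 + 1197 * s ^ 9 - 821 * s ^ 10 + 364 * s ^ 11 - 99 * s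
    ^ 12 + 15 * s ^ 13 - s ^ 14) * p ^ 3 + (-s ^ 2 + 9 * s ^ 3 + 11 * s ^ 4 + 42 * s ^ 5 + 54 * s
    ^ 6 - 73 * s ^ 7 + 22 * s ^ 8 + 15 * s ^ 9 - 11 * s ^ 10 + 2 * s ^ 11) * p ^ 4 + (-4 * s ^ 2 -
    11 * s ^ 3 - 60 * s ^ 4 + 16 * s ^ 5 + 11 * s ^ 6 - 10 * s ^ 7 + 2 * s ^ 8) * p ^ 5 + (s + 12
    * s ^ 2 + 24 * s ^ 3 - 11 * s ^ 4 + 2 * s ^ 5) * p ^ 6 + (-6 * s - 3 * s ^ 2 + s ^ 3) * p ^ 7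
    + p ^ 8) * h.curve - K * (3 * h.factor (e := ![-3, -3, -4, -1, -2]) ![-38, 28, -3, -5, 5] 3 2
    7 4 (by decide) - 2 * h.factor (e := ![-2, -4, -5, -2, 0]) ![-38, 28, -3, -5, 5] 3 3 11 2 (by
    decide) - h.factor_mul (e := ![-1, 1, 0, 0, 0]) (f := ![-3, -5, -3, 1, -3]) ![-38, 28, -3, -5,
    5] 4 2 6 4 (by decide) + h.factor_mul (e := ![-1, 1, 0, 0, 0]) (f := ![-3, -2, -4, -3, -1])
    ![-38, 28, -3, -5, 5] 2 2 7 4 (by decide) + 2 * h.factor_mul (e := ![0, -1, 0, 1, 0]) (f :=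
    ![-4, -2, 0, -4, -3]) ![-38, 28, -3, -5, 5] 2 2 3 6 (by decide) - h.factor_mul (e := ![0, -1,
    0, 1, 0]) (f := ![-2, -3, -2, -1, -5]) ![-38, 28, -3, -5, 5] 3 1 2 7 (by decide) -
    h.factor_mul (e := ![0, 0, -1, 0, 1]) (f := ![-5, -2, -1, -4, -1]) ![-38, 28, -3, -5, 5] 2 3 8
    3 (by decide) + h.factor_mul (e := ![0, 0, -1, 0, 1]) (f := ![-3, -5, -3, 0, -2]) ![-38, 28,
    -3, -5, 5] 4 3 10 2 (by decide) - h.factor_mul (e := ![0, 0, 1, -1, 0]) (f := ![-4, -3, 0, -5,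
    -1]) ![-38, 28, -3, -5, 5] 1 3 5 5 (by decide) + 2 * h.factor_mul (e := ![0, 0, 1, -1, 0]) (f
    := ![-4, -2, -3, -2, -2]) ![-38, 28, -3, -5, 5] 2 2 5 5 (by decide) - h.factor_mul (e := ![1,
    0, 0, 0, -1]) (f := ![-5, 0, -2, -4, -2]) ![-38, 28, -3, -5, 5] 1 1 2 7 (by decide) -
    h.factor_mul (e := ![1, 0, 0, 0, -1]) (f := ![1, -2, -3, -5, -4]) ![-38, 28, -3, -5, 5] 0 0 0
    10 (by decide))

/-- The terms of weight 5 modulo 11. -/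
lemma weight_five (h : UnitSystem x s p) (hf : f = -3 * s + 14 * s ^ 2 - 22 * s ^ 3 + 13 * s ^ 4 -
    s ^ 5 - s ^ 6 + (1 + 3 * s - 33 * s ^ 2 + 78 * s ^ 3 - 83 * s ^ 4 + 44 * s ^ 5 - 11 * s ^ 6 +
    s ^ 7) * p) (hK : K * (f * mon x ![-17, 6, 0, -2, 1]) = 1) : 2 / 11 * mon x ![-1, 1, -1, 0, 0]
    + 1 / 11 * mon x ![-1, 1, 0, 0, 0] * mon x ![0, 0, -1, 0, 0] + 4 / 11 * mon x ![0, -1, 0, 1,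
    0] * mon x ![1, 0, 0, -1, -1] + 8 / 11 * mon x ![0, 0, 1, -1, 0] * mon x ![0, -1, -1, 0, 1] -
    7 / 11 * mon x ![1, 0, 0, 0, -1] * mon x ![0, -1, 0, 0, 0] = K * (-mon x ![-3, -5, -2, 0, -3]
    + 2 * mon x ![-3, -4, -3, -3, 0] - mon x ![-1, 1, 0, 0, 0] * mon x ![-5, 0, -3, -3, -2] + mon
    x ![-1, 1, 0, 0, 0] * mon x ![-2, -4, -2, -1, -4] + 3 * mon x ![0, -1, 0, 1, 0] * mon x ![-3,
    -3, -4, -1, -2] - 2 * mon x ![0, -1, 0, 1, 0] * mon x ![-2, -4, -5, -2, 0] + mon x ![0, 0, -1,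
    0, 1] * mon x ![-4, -3, 0, -5, -1] - 2 * mon x ![0, 0, -1, 0, 1] * mon x ![-4, -2, -3, -2, -2]
    + mon x ![0, 0, 1, -1, 0] * mon x ![-3, -5, -3, 1, -3] - mon x ![0, 0, 1, -1, 0] * mon x ![-3,
    -2, -4, -3, -1] - mon x ![1, 0, 0, 0, -1] * mon x ![-3, -5, -2, 1, -4] + mon x ![1, 0, 0, 0,
    -1] * mon x ![-2, -3, 0, -5, -3]) := by
  linear_combination 2 / 11 * h.factor (e := ![-1, 1, -1, 0, 0]) ![-7, 5, 0, 0, 1] 0 0 1 1 (by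
    decide) + 1 / 11 * h.factor_mul (e := ![-1, 1, 0, 0, 0]) (f := ![0, 0, -1, 0, 0]) ![-7, 5, 0,
    0, 1] 0 0 1 1 (by decide) + 4 / 11 * h.factor_mul (e := ![0, -1, 0, 1, 0]) (f := ![1, 0, 0,
    -1, -1]) ![-7, 5, 0, 0, 1] 0 0 0 2 (by decide) + 8 / 11 * h.factor_mul (e := ![0, 0, 1, -1,
    0]) (f := ![0, -1, -1, 0, 1]) ![-7, 5, 0, 0, 1] 0 1 3 0 (by decide) - 7 / 11 * h.factor_mul (e
    := ![1, 0, 0, 0, -1]) (f := ![0, -1, 0, 0, 0]) ![-7, 5, 0, 0, 1] 0 0 0 2 (by decide) + mon x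
    ![-7, 5, 0, 0, 1] * (-3 / 11) * h.curve - mon x ![-7, 5, 0, 0, 1] * ((1 - 3 * s + 3 * s ^ 2 -
    s ^ 3) * p) * hK + K * ((1 - 3 * s + 3 * s ^ 2 - s ^ 3) * p) * f * h.factor_mul (e := ![-7, 5,
    0, 0, 1]) (f := ![-17, 6, 0, -2, 1]) ![-33, 21, 0, -5, 4] 2 1 3 0 (by decide) + K * ((1 - 3 *
    s + 3 * s ^ 2 - s ^ 3) * p) * mon x ![-33, 21, 0, -5, 4] * (s ^ 2 * p ^ 1 * (1 - s) ^ 3 * (p -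
    s) ^ 0) * hf + K * mon x ![-33, 21, 0, -5, 4] * (-s ^ 5 + 3 * s ^ 6 - 5 * s ^ 7 + 4 * s ^ 8 -
    3 * s ^ 9 + s ^ 10 + (4 * s ^ 4 - 8 * s ^ 5 - 4 * s ^ 6 + 60 * s ^ 7 - 108 * s ^ 8 + 106 * s ^
    9 - 59 * s ^ 10 + 17 * s ^ 11 - 2 * s ^ 12) * p + (-3 * s ^ 2 + 21 * s ^ 3 - 98 * s ^ 4 + 263
    * s ^ 5 - 518 * s ^ 6 + 651 * s ^ 7 - 546 * s ^ 8 + 295 * s ^ 9 - 95 * s ^ 10 + 16 * s ^ 11 -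
    s ^ 12) * p ^ 2 + (s - 2 * s ^ 2 + s ^ 3 + 49 * s ^ 4 - 72 * s ^ 5 + 76 * s ^ 6 - 43 * s ^ 7 +
    11 * s ^ 8 - s ^ 9) * p ^ 3 + (s - 13 * s ^ 2 + 3 * s ^ 3 - 12 * s ^ 4 + 7 * s ^ 5 - s ^ 6) *
    p ^ 4 + (4 * s + 3 * s ^ 2 - s ^ 3) * p ^ 5 + (-1) * p ^ 6) * h.curve - K * (-h.factor (e :=
    ![-3, -5, -2, 0, -3]) ![-33, 21, 0, -5, 4] 3 1 5 4 (by decide) + 2 * h.factor (e := ![-3, -4,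
    -3, -3, 0]) ![-33, 21, 0, -5, 4] 2 2 9 2 (by decide) - h.factor_mul (e := ![-1, 1, 0, 0, 0])
    (f := ![-5, 0, -3, -3, -2]) ![-33, 21, 0, -5, 4] 1 0 3 5 (by decide) + h.factor_mul (e :=
    ![-1, 1, 0, 0, 0]) (f := ![-2, -4, -2, -1, -4]) ![-33, 21, 0, -5, 4] 2 0 2 6 (by decide) + 3 *
    h.factor_mul (e := ![0, -1, 0, 1, 0]) (f := ![-3, -3, -4, -1, -2]) ![-33, 21, 0, -5, 4] 3 1 7
    3 (by decide) - 2 * h.factor_mul (e := ![0, -1, 0, 1, 0]) (f := ![-2, -4, -5, -2, 0]) ![-33,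
    21, 0, -5, 4] 3 2 11 1 (by decide) + h.factor_mul (e := ![0, 0, -1, 0, 1]) (f := ![-4, -3, 0,
    -5, -1]) ![-33, 21, 0, -5, 4] 1 2 7 3 (by decide) - 2 * h.factor_mul (e := ![0, 0, -1, 0, 1])
    (f := ![-4, -2, -3, -2, -2]) ![-33, 21, 0, -5, 4] 2 1 7 3 (by decide) + h.factor_mul (e :=
    ![0, 0, 1, -1, 0]) (f := ![-3, -5, -3, 1, -3]) ![-33, 21, 0, -5, 4] 3 1 5 4 (by decide) -
    h.factor_mul (e := ![0, 0, 1, -1, 0]) (f := ![-3, -2, -4, -3, -1]) ![-33, 21, 0, -5, 4] 1 1 6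
    4 (by decide) - h.factor_mul (e := ![1, 0, 0, 0, -1]) (f := ![-3, -5, -2, 1, -4]) ![-33, 21,
    0, -5, 4] 3 0 2 6 (by decide) + h.factor_mul (e := ![1, 0, 0, 0, -1]) (f := ![-2, -3, 0, -5,
    -3]) ![-33, 21, 0, -5, 4] 0 0 0 8 (by decide))

/-- The terms of weight 6 modulo 11. -/
lemma weight_six (h : UnitSystem x s p) (hf : f = -3 * s + 14 * s ^ 2 - 22 * s ^ 3 + 13 * s ^ 4 -
    s ^ 5 - s ^ 6 + (1 + 3 * s - 33 * s ^ 2 + 78 * s ^ 3 - 83 * s ^ 4 + 44 * s ^ 5 - 11 * s ^ 6 +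
    s ^ 7) * p) (hK : K * (f * mon x ![-17, 6, 0, -2, 1]) = 1) : -mon x ![0, 0, 0, -1, 0] - 2 / 11
    * mon x ![0, 0, 0, -1, 0] + 6 / 11 * mon x ![-1, 1, 0, 0, 0] * mon x ![-1, 0, 1, -1, 0] + 2 /
    11 * mon x ![0, -1, 0, 1, 0] * mon x ![-1, 1, -1, 0, 0] - 8 / 11 * mon x ![0, 0, -1, 0, 1] *
    mon x ![0, -1, -1, 0, 1] - 1 / 11 * mon x ![0, 0, 1, -1, 0] * mon x ![0, 0, -1, 0, 0] + 5 / 11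
    * mon x ![1, 0, 0, 0, -1] * mon x ![0, 0, 0, 0, -1] = K * (mon x ![-5, 0, -2, -4, -2] + mon x
    ![1, -2, -3, -5, -4] - 2 * mon x ![-1, 1, 0, 0, 0] * mon x ![-4, -2, 0, -4, -3] + mon x ![-1,
    1, 0, 0, 0] * mon x ![-2, -3, -2, -1, -5] - mon x ![0, -1, 0, 1, 0] * mon x ![-3, -5, -2, 0,
    -3] + 2 * mon x ![0, -1, 0, 1, 0] * mon x ![-3, -4, -3, -3, 0] - mon x ![0, 0, -1, 0, 1] * mon
    x ![-3, -5, -3, 1, -3] + mon x ![0, 0, -1, 0, 1] * mon x ![-3, -2, -4, -3, -1] + mon x ![0, 0,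
    1, -1, 0] * mon x ![-5, 0, -3, -3, -2] - mon x ![0, 0, 1, -1, 0] * mon x ![-2, -4, -2, -1, -4]
    + 2 * mon x ![1, 0, 0, 0, -1] * mon x ![-5, -1, -4, -2, -1] - 3 * mon x ![1, 0, 0, 0, -1] *
    mon x ![-4, -3, -3, -3, 0]) := by
  linear_combination -h.factor (e := ![0, 0, 0, -1, 0]) ![-19, 15, 0, 0, 3] 0 1 3 3 (by decide) -
    2 / 11 * h.factor (e := ![0, 0, 0, -1, 0]) ![-19, 15, 0, 0, 3] 0 1 3 3 (by decide) + 6 / 11 *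
    h.factor_mul (e := ![-1, 1, 0, 0, 0]) (f := ![-1, 0, 1, -1, 0]) ![-19, 15, 0, 0, 3] 0 1 2 3
    (by decide) + 2 / 11 * h.factor_mul (e := ![0, -1, 0, 1, 0]) (f := ![-1, 1, -1, 0, 0]) ![-19,
    15, 0, 0, 3] 1 1 4 2 (by decide) - 8 / 11 * h.factor_mul (e := ![0, 0, -1, 0, 1]) (f := ![0,
    -1, -1, 0, 1]) ![-19, 15, 0, 0, 3] 1 2 8 0 (by decide) - 1 / 11 * h.factor_mul (e := ![0, 0,
    1, -1, 0]) (f := ![0, 0, -1, 0, 0]) ![-19, 15, 0, 0, 3] 0 1 3 3 (by decide) + 5 / 11 *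
    h.factor_mul (e := ![1, 0, 0, 0, -1]) (f := ![0, 0, 0, 0, -1]) ![-19, 15, 0, 0, 3] 0 0 0 5 (by
    decide) + mon x ![-19, 15, 0, 0, 3] * (-3 * s ^ 2 + 20 * s ^ 3 - 610 / 11 * s ^ 4 + 81 * s ^ 5
    - 69 * s ^ 6 + 34 * s ^ 7 - 9 * s ^ 8 + s ^ 9 + (-s + 76 / 11 * s ^ 2 - 167 / 11 * s ^ 3 + 204
    / 11 * s ^ 4 - 106 / 11 * s ^ 5 + 19 / 11 * s ^ 6) * p + (-8 / 11 + 25 / 11 * s - 51 / 11 * s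
    ^ 2 + 19 / 11 * s ^ 3) * p ^ 2 + (5 / 11) * p ^ 3) * h.curve - mon x ![-19, 15, 0, 0, 3] * (3
    * s ^ 3 - 20 * s ^ 4 + 55 * s ^ 5 - 81 * s ^ 6 + 69 * s ^ 7 - 34 * s ^ 8 + 9 * s ^ 9 - s ^ 10
    + (s ^ 2 - 18 * s ^ 3 + 103 * s ^ 4 - 299 * s ^ 5 + 518 * s ^ 6 - 576 * s ^ 7 + 424 * s ^ 8 -
    207 * s ^ 9 + 65 * s ^ 10 - 12 * s ^ 11 + s ^ 12) * p) * hK + K * (3 * s ^ 3 - 20 * s ^ 4 + 55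
    * s ^ 5 - 81 * s ^ 6 + 69 * s ^ 7 - 34 * s ^ 8 + 9 * s ^ 9 - s ^ 10 + (s ^ 2 - 18 * s ^ 3 +
    103 * s ^ 4 - 299 * s ^ 5 + 518 * s ^ 6 - 576 * s ^ 7 + 424 * s ^ 8 - 207 * s ^ 9 + 65 * s ^
    10 - 12 * s ^ 11 + s ^ 12) * p) * f * h.factor_mul (e := ![-19, 15, 0, 0, 3]) (f := ![-17, 6,
    0, -2, 1]) ![-41, 29, -2, -5, 6] 2 1 1 0 (by decide) + K * (3 * s ^ 3 - 20 * s ^ 4 + 55 * s ^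
    5 - 81 * s ^ 6 + 69 * s ^ 7 - 34 * s ^ 8 + 9 * s ^ 9 - s ^ 10 + (s ^ 2 - 18 * s ^ 3 + 103 * s
    ^ 4 - 299 * s ^ 5 + 518 * s ^ 6 - 576 * s ^ 7 + 424 * s ^ 8 - 207 * s ^ 9 + 65 * s ^ 10 - 12 *
    s ^ 11 + s ^ 12) * p) * mon x ![-41, 29, -2, -5, 6] * (s ^ 2 * p ^ 1 * (1 - s) ^ 1 * (p - s) ^
    0) * hf + K * mon x ![-41, 29, -2, -5, 6] * (-s ^ 9 + 2 * s ^ 10 + (-9 * s ^ 5 + 111 * s ^ 6 -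
    613 * s ^ 7 + 2019 * s ^ 8 - 4344 * s ^ 9 + 6423 * s ^ 10 - 6707 * s ^ 11 + 4913 * s ^ 12 -
    2442 * s ^ 13 + 746 * s ^ 14 - 92 * s ^ 15 - 20 * s ^ 16 + 9 * s ^ 17 - s ^ 18) * p + (20 * s
    ^ 5 - 269 * s ^ 6 + 1526 * s ^ 7 - 5559 * s ^ 8 + 13756 * s ^ 9 - 23967 * s ^ 10 + 30541 * s ^
    11 - 28911 * s ^ 12 + 20419 * s ^ 13 - 10695 * s ^ 14 + 4082 * s ^ 15 - 1099 * s ^ 16 + 197 *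
    s ^ 17 - 21 * s ^ 18 + s ^ 19) * p ^ 2 + (s ^ 3 - 3 * s ^ 4 - 7 * s ^ 5 + 358 * s ^ 6 - 1335 *
    s ^ 7 + 2742 * s ^ 8 - 4067 * s ^ 9 + 4276 * s ^ 10 - 3214 * s ^ 11 + 1702 * s ^ 12 - 610 * s
    ^ 13 + 139 * s ^ 14 - 18 * s ^ 15 + s ^ 16) * p ^ 3 + (-2 * s ^ 3 - 47 * s ^ 4 - s ^ 5 + 52 *
    s ^ 6 + 162 * s ^ 7 - 321 * s ^ 8 + 356 * s ^ 9 - 234 * s ^ 10 + 84 * s ^ 11 - 15 * s ^ 12 + s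
    ^ 13) * p ^ 4 + (3 * s ^ 2 + 35 * s ^ 3 + 27 * s ^ 4 - 155 * s ^ 5 + 151 * s ^ 6 - 151 * s ^ 7
    + 93 * s ^ 8 - 27 * s ^ 9 + 3 * s ^ 10) * p ^ 5 + (-s - 24 * s ^ 2 + 12 * s ^ 3 + 17 * s ^ 4 +
    13 * s ^ 5 - 12 * s ^ 6 + 2 * s ^ 7) * p ^ 6 + (8 * s - 5 * s ^ 2 - 6 * s ^ 3 + 2 * s ^ 4) * p
    ^ 7 + (-1 + s) * p ^ 8) * h.curve - K * (h.factor (e := ![-5, 0, -2, -4, -2]) ![-41, 29, -2,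
    -5, 6] 1 1 3 7 (by decide) + h.factor (e := ![1, -2, -3, -5, -4]) ![-41, 29, -2, -5, 6] 0 0 1
    10 (by decide) - 2 * h.factor_mul (e := ![-1, 1, 0, 0, 0]) (f := ![-4, -2, 0, -4, -3]) ![-41,
    29, -2, -5, 6] 1 1 1 8 (by decide) + h.factor_mul (e := ![-1, 1, 0, 0, 0]) (f := ![-2, -3, -2,
    -1, -5]) ![-41, 29, -2, -5, 6] 2 0 0 9 (by decide) - h.factor_mul (e := ![0, -1, 0, 1, 0]) (f
    := ![-3, -5, -2, 0, -3]) ![-41, 29, -2, -5, 6] 4 2 6 5 (by decide) + 2 * h.factor_mul (e :=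
    ![0, -1, 0, 1, 0]) (f := ![-3, -4, -3, -3, 0]) ![-41, 29, -2, -5, 6] 3 3 10 3 (by decide) -
    h.factor_mul (e := ![0, 0, -1, 0, 1]) (f := ![-3, -5, -3, 1, -3]) ![-41, 29, -2, -5, 6] 4 2 8
    4 (by decide) + h.factor_mul (e := ![0, 0, -1, 0, 1]) (f := ![-3, -2, -4, -3, -1]) ![-41, 29,
    -2, -5, 6] 2 2 9 4 (by decide) + h.factor_mul (e := ![0, 0, 1, -1, 0]) (f := ![-5, 0, -3, -3,
    -2]) ![-41, 29, -2, -5, 6] 1 1 3 7 (by decide) - h.factor_mul (e := ![0, 0, 1, -1, 0]) (f :=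
    ![-2, -4, -2, -1, -4]) ![-41, 29, -2, -5, 6] 2 1 2 8 (by decide) + 2 * h.factor_mul (e := ![1,
    0, 0, 0, -1]) (f := ![-5, -1, -4, -2, -1]) ![-41, 29, -2, -5, 6] 2 1 5 6 (by decide) - 3 *
    h.factor_mul (e := ![1, 0, 0, 0, -1]) (f := ![-4, -3, -3, -3, 0]) ![-41, 29, -2, -5, 6] 2 2 7
    5 (by decide))

/-- The terms of weight 7 modulo 11. -/
lemma weight_seven (h : UnitSystem x s p) (hf : f = -3 * s + 14 * s ^ 2 - 22 * s ^ 3 + 13 * s ^ 4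
    - s ^ 5 - s ^ 6 + (1 + 3 * s - 33 * s ^ 2 + 78 * s ^ 3 - 83 * s ^ 4 + 44 * s ^ 5 - 11 * s ^ 6
    + s ^ 7) * p) (hK : K * (f * mon x ![-17, 6, 0, -2, 1]) = 1) : 7 / 11 * mon x ![0, -1, 0, 0,
    0] - 4 / 11 * mon x ![-1, 1, 0, 0, 0] * mon x ![1, 0, 0, -1, -1] - 2 / 11 * mon x ![0, -1, 0,
    1, 0] * mon x ![0, 0, 0, -1, 0] + 1 / 11 * mon x ![0, 0, -1, 0, 1] * mon x ![0, 0, -1, 0, 0] -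
    6 / 11 * mon x ![0, 0, 1, -1, 0] * mon x ![-1, 0, 1, -1, 0] - 1 / 11 * mon x ![1, 0, 0, 0, -1]
    * mon x ![0, -1, 0, 1, -1] = K * (mon x ![-3, -5, -2, 1, -4] - mon x ![-2, -3, 0, -5, -3] - 3
    * mon x ![-1, 1, 0, 0, 0] * mon x ![-3, -3, -4, -1, -2] + 2 * mon x ![-1, 1, 0, 0, 0] * mon x
    ![-2, -4, -5, -2, 0] + mon x ![0, -1, 0, 1, 0] * mon x ![-5, 0, -2, -4, -2] + mon x ![0, -1,
    0, 1, 0] * mon x ![1, -2, -3, -5, -4] - mon x ![0, 0, -1, 0, 1] * mon x ![-5, 0, -3, -3, -2] +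
    mon x ![0, 0, -1, 0, 1] * mon x ![-2, -4, -2, -1, -4] + 2 * mon x ![0, 0, 1, -1, 0] * mon x
    ![-4, -2, 0, -4, -3] - mon x ![0, 0, 1, -1, 0] * mon x ![-2, -3, -2, -1, -5] - mon x ![1, 0,
    0, 0, -1] * mon x ![-3, -5, -2, 2, -5] + mon x ![1, 0, 0, 0, -1] * mon x ![1, -1, -3, -4, -6])
    := by
  linear_combination 7 / 11 * h.factor (e := ![0, -1, 0, 0, 0]) ![-12, 10, 0, -1, 2] 1 1 3 1 (by
    decide) - 4 / 11 * h.factor_mul (e := ![-1, 1, 0, 0, 0]) (f := ![1, 0, 0, -1, -1]) ![-12, 10,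
    0, -1, 2] 0 0 0 3 (by decide) - 2 / 11 * h.factor_mul (e := ![0, -1, 0, 1, 0]) (f := ![0, 0,
    0, -1, 0]) ![-12, 10, 0, -1, 2] 1 1 3 1 (by decide) + 1 / 11 * h.factor_mul (e := ![0, 0, -1,
    0, 1]) (f := ![0, 0, -1, 0, 0]) ![-12, 10, 0, -1, 2] 1 1 5 0 (by decide) - 6 / 11 *
    h.factor_mul (e := ![0, 0, 1, -1, 0]) (f := ![-1, 0, 1, -1, 0]) ![-12, 10, 0, -1, 2] 0 1 1 2
    (by decide) - 1 / 11 * h.factor_mul (e := ![1, 0, 0, 0, -1]) (f := ![0, -1, 0, 1, -1]) ![-12,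
    10, 0, -1, 2] 1 0 0 3 (by decide) + mon x ![-12, 10, 0, -1, 2] * (-s + 26 / 11 * s ^ 2 - 10 /
    11 * s ^ 3 + (-10 / 11 + 5 / 11 * s) * p) * h.curve - mon x ![-12, 10, 0, -1, 2] * (s ^ 2 - 2
    * s ^ 3 + s ^ 4 + (s - 7 * s ^ 2 + 15 * s ^ 3 - 14 * s ^ 4 + 6 * s ^ 5 - s ^ 6) * p) * hK + K
    * (s ^ 2 - 2 * s ^ 3 + s ^ 4 + (s - 7 * s ^ 2 + 15 * s ^ 3 - 14 * s ^ 4 + 6 * s ^ 5 - s ^ 6) *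
    p) * f * h.factor_mul (e := ![-12, 10, 0, -1, 2]) (f := ![-17, 6, 0, -2, 1]) ![-46, 35, -3,
    -4, 5] 2 3 6 0 (by decide) + K * (s ^ 2 - 2 * s ^ 3 + s ^ 4 + (s - 7 * s ^ 2 + 15 * s ^ 3 - 14
    * s ^ 4 + 6 * s ^ 5 - s ^ 6) * p) * mon x ![-46, 35, -3, -4, 5] * (s ^ 2 * p ^ 3 * (1 - s) ^ 6
    * (p - s) ^ 0) * hf + K * mon x ![-46, 35, -3, -4, 5] * (-s ^ 11 + (12 * s ^ 10 - 4 * s ^ 11 +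
    3 * s ^ 12 - s ^ 13) * p + (-s ^ 8 - 59 * s ^ 9 + 29 * s ^ 10 - 21 * s ^ 11 + 7 * s ^ 12) * p
    ^ 2 + (-3 * s ^ 4 + 39 * s ^ 5 - 224 * s ^ 6 + 766 * s ^ 7 - 1524 * s ^ 8 + 2492 * s ^ 9 -
    2711 * s ^ 10 + 2038 * s ^ 11 - 992 * s ^ 12 + 245 * s ^ 13 + 20 * s ^ 14 - 35 * s ^ 15 + 10 *
    s ^ 16 - s ^ 17) * p ^ 3 + (-2 * s ^ 3 + 30 * s ^ 4 - 233 * s ^ 5 + 1106 * s ^ 6 - 4026 * s ^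
    7 + 9025 * s ^ 8 - 15493 * s ^ 9 + 20016 * s ^ 10 - 19571 * s ^ 11 + 14463 * s ^ 12 - 7993 * s
    ^ 13 + 3238 * s ^ 14 - 928 * s ^ 15 + 177 * s ^ 16 - 20 * s ^ 17 + s ^ 18) * p ^ 4 + (s ^ 2 -
    5 * s ^ 3 - s ^ 4 + 155 * s ^ 5 - 153 * s ^ 6 + 945 * s ^ 7 - 1700 * s ^ 8 + 2006 * s ^ 9 -
    1660 * s ^ 10 + 964 * s ^ 11 - 386 * s ^ 12 + 100 * s ^ 13 - 15 * s ^ 14 + s ^ 15) * p ^ 5 +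
    (-7 * s ^ 3 - 32 * s ^ 4 - 314 * s ^ 5 + 286 * s ^ 6 - 284 * s ^ 7 + 238 * s ^ 8 - 143 * s ^ 9
    + 57 * s ^ 10 - 12 * s ^ 11 + s ^ 12) * p ^ 6 + (3 * s ^ 2 + 44 * s ^ 3 + 113 * s ^ 4 - 44 * s
    ^ 5 - 4 * s ^ 6 + 15 * s ^ 7 - 8 * s ^ 8 + s ^ 9) * p ^ 7 + (-s - 23 * s ^ 2 - 36 * s ^ 3 + 21
    * s ^ 4 - 8 * s ^ 5 + 2 * s ^ 6) * p ^ 8 + (8 * s + 3 * s ^ 2 - s ^ 3) * p ^ 9 + (-1) * p ^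
    10) * h.curve - K * (h.factor (e := ![-3, -5, -2, 1, -4]) ![-46, 35, -3, -4, 5] 4 3 8 5 (by
    decide) - h.factor (e := ![-2, -3, 0, -5, -3]) ![-46, 35, -3, -4, 5] 1 3 6 7 (by decide) - 3 *
    h.factor_mul (e := ![-1, 1, 0, 0, 0]) (f := ![-3, -3, -4, -1, -2]) ![-46, 35, -3, -4, 5] 3 3
    10 4 (by decide) + 2 * h.factor_mul (e := ![-1, 1, 0, 0, 0]) (f := ![-2, -4, -5, -2, 0])
    ![-46, 35, -3, -4, 5] 3 4 14 2 (by decide) + h.factor_mul (e := ![0, -1, 0, 1, 0]) (f := ![-5,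
    0, -2, -4, -2]) ![-46, 35, -3, -4, 5] 2 3 8 5 (by decide) + h.factor_mul (e := ![0, -1, 0, 1,
    0]) (f := ![1, -2, -3, -5, -4]) ![-46, 35, -3, -4, 5] 1 2 6 8 (by decide) - h.factor_mul (e :=
    ![0, 0, -1, 0, 1]) (f := ![-5, 0, -3, -3, -2]) ![-46, 35, -3, -4, 5] 2 3 10 4 (by decide) +
    h.factor_mul (e := ![0, 0, -1, 0, 1]) (f := ![-2, -4, -2, -1, -4]) ![-46, 35, -3, -4, 5] 3 3 9
    5 (by decide) + 2 * h.factor_mul (e := ![0, 0, 1, -1, 0]) (f := ![-4, -2, 0, -4, -3]) ![-46,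
    35, -3, -4, 5] 1 3 5 7 (by decide) - h.factor_mul (e := ![0, 0, 1, -1, 0]) (f := ![-2, -3, -2,
    -1, -5]) ![-46, 35, -3, -4, 5] 2 2 4 8 (by decide) - h.factor_mul (e := ![1, 0, 0, 0, -1]) (f
    := ![-3, -5, -2, 2, -5]) ![-46, 35, -3, -4, 5] 4 2 5 7 (by decide) + h.factor_mul (e := ![1,
    0, 0, 0, -1]) (f := ![1, -1, -3, -4, -6]) ![-46, 35, -3, -4, 5] 0 0 0 12 (by decide))

/-- The terms of weight 8 modulo 11. -/
lemma weight_eight (h : UnitSystem x s p) (hf : f = -3 * s + 14 * s ^ 2 - 22 * s ^ 3 + 13 * s ^ 4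
    - s ^ 5 - s ^ 6 + (1 + 3 * s - 33 * s ^ 2 + 78 * s ^ 3 - 83 * s ^ 4 + 44 * s ^ 5 - 11 * s ^ 6
    + s ^ 7) * p) (hK : K * (f * mon x ![-17, 6, 0, -2, 1]) = 1) : -5 / 11 * mon x ![0, 0, 0, 0,
    -1] - 2 / 11 * mon x ![-1, 1, 0, 0, 0] * mon x ![-1, 1, -1, 0, 0] + 7 / 11 * mon x ![0, -1, 0,
    1, 0] * mon x ![0, -1, 0, 0, 0] + 6 / 11 * mon x ![0, 0, -1, 0, 1] * mon x ![-1, 0, 1, -1, 0]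
    + 4 / 11 * mon x ![0, 0, 1, -1, 0] * mon x ![1, 0, 0, -1, -1] + 3 / 11 * mon x ![1, 0, 0, 0,
    -1] * mon x ![-1, 0, 0, 0, 0] = K * (-2 * mon x ![-5, -1, -4, -2, -1] + 3 * mon x ![-4, -3,
    -3, -3, 0] + mon x ![-1, 1, 0, 0, 0] * mon x ![-3, -5, -2, 0, -3] - 2 * mon x ![-1, 1, 0, 0,
    0] * mon x ![-3, -4, -3, -3, 0] + mon x ![0, -1, 0, 1, 0] * mon x ![-3, -5, -2, 1, -4] - mon x
    ![0, -1, 0, 1, 0] * mon x ![-2, -3, 0, -5, -3] - 2 * mon x ![0, 0, -1, 0, 1] * mon x ![-4, -2,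
    0, -4, -3] + mon x ![0, 0, -1, 0, 1] * mon x ![-2, -3, -2, -1, -5] + 3 * mon x ![0, 0, 1, -1,
    0] * mon x ![-3, -3, -4, -1, -2] - 2 * mon x ![0, 0, 1, -1, 0] * mon x ![-2, -4, -5, -2, 0] -
    mon x ![1, 0, 0, 0, -1] * mon x ![-5, -2, -1, -4, -1] + mon x ![1, 0, 0, 0, -1] * mon x ![-3,
    -5, -3, 0, -2]) := by
  linear_combination -5 / 11 * h.factor (e := ![0, 0, 0, 0, -1]) ![-11, 9, 1, -2, 2] 1 0 1 2 (by
    decide) - 2 / 11 * h.factor_mul (e := ![-1, 1, 0, 0, 0]) (f := ![-1, 1, -1, 0, 0]) ![-11, 9,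
    1, -2, 2] 1 0 2 1 (by decide) + 7 / 11 * h.factor_mul (e := ![0, -1, 0, 1, 0]) (f := ![0, -1,
    0, 0, 0]) ![-11, 9, 1, -2, 2] 2 1 4 0 (by decide) + 6 / 11 * h.factor_mul (e := ![0, 0, -1, 0,
    1]) (f := ![-1, 0, 1, -1, 0]) ![-11, 9, 1, -2, 2] 1 1 4 0 (by decide) + 4 / 11 * h.factor_mul
    (e := ![0, 0, 1, -1, 0]) (f := ![1, 0, 0, -1, -1]) ![-11, 9, 1, -2, 2] 0 0 0 3 (by decide) + 3
    / 11 * h.factor_mul (e := ![1, 0, 0, 0, -1]) (f := ![-1, 0, 0, 0, 0]) ![-11, 9, 1, -2, 2] 1 0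
    1 2 (by decide) + mon x ![-11, 9, 1, -2, 2] * (2 / 11 * s - 10 / 11 * s ^ 2 + 4 / 11 * s ^ 3 +
    (4 / 11) * p) * h.curve - mon x ![-11, 9, 1, -2, 2] * ((s ^ 2 - 4 * s ^ 3 + 6 * s ^ 4 - 4 * s
    ^ 5 + s ^ 6) * p) * hK + K * ((s ^ 2 - 4 * s ^ 3 + 6 * s ^ 4 - 4 * s ^ 5 + s ^ 6) * p) * f *
    h.factor_mul (e := ![-11, 9, 1, -2, 2]) (f := ![-17, 6, 0, -2, 1]) ![-29, 18, -2, -3, 3] 0 1 0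
    0 (by decide) + K * ((s ^ 2 - 4 * s ^ 3 + 6 * s ^ 4 - 4 * s ^ 5 + s ^ 6) * p) * mon x ![-29,
    18, -2, -3, 3] * (s ^ 0 * p ^ 1 * (1 - s) ^ 0 * (p - s) ^ 0) * hf + K * mon x ![-29, 18, -2,
    -3, 3] * (-s ^ 6 + s ^ 7 + (-2 * s ^ 3 + 4 * s ^ 4 + 3 * s ^ 5 - 6 * s ^ 6 + 3 * s ^ 7 - 3 * s
    ^ 8 + s ^ 9) * p + (4 * s ^ 2 + 6 * s ^ 3 - 70 * s ^ 4 + 143 * s ^ 5 - 163 * s ^ 6 + 123 * s ^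
    7 - 54 * s ^ 8 + 12 * s ^ 9 - s ^ 10) * p ^ 2 + (-7 * s + 17 * s ^ 2 - 6 * s ^ 3 + 4 * s ^ 4 -
    14 * s ^ 5 + 7 * s ^ 6 - s ^ 7) * p ^ 3 + (3 - 9 * s + 3 * s ^ 2 + 4 * s ^ 3 - s ^ 4) * p ^ 4
    + (1 - s) * p ^ 5) * h.curve - K * (-2 * h.factor (e := ![-5, -1, -4, -2, -1]) ![-29, 18, -2,
    -3, 3] 1 1 5 3 (by decide) + 3 * h.factor (e := ![-4, -3, -3, -3, 0]) ![-29, 18, -2, -3, 3] 1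
    2 7 2 (by decide) + h.factor_mul (e := ![-1, 1, 0, 0, 0]) (f := ![-3, -5, -2, 0, -3]) ![-29,
    18, -2, -3, 3] 2 1 3 4 (by decide) - 2 * h.factor_mul (e := ![-1, 1, 0, 0, 0]) (f := ![-3, -4,
    -3, -3, 0]) ![-29, 18, -2, -3, 3] 1 2 7 2 (by decide) + h.factor_mul (e := ![0, -1, 0, 1, 0])
    (f := ![-3, -5, -2, 1, -4]) ![-29, 18, -2, -3, 3] 3 1 3 4 (by decide) - h.factor_mul (e :=
    ![0, -1, 0, 1, 0]) (f := ![-2, -3, 0, -5, -3]) ![-29, 18, -2, -3, 3] 0 1 1 6 (by decide) - 2 *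
    h.factor_mul (e := ![0, 0, -1, 0, 1]) (f := ![-4, -2, 0, -4, -3]) ![-29, 18, -2, -3, 3] 0 1 2
    5 (by decide) + h.factor_mul (e := ![0, 0, -1, 0, 1]) (f := ![-2, -3, -2, -1, -5]) ![-29, 18,
    -2, -3, 3] 1 0 1 6 (by decide) + 3 * h.factor_mul (e := ![0, 0, 1, -1, 0]) (f := ![-3, -3, -4,
    -1, -2]) ![-29, 18, -2, -3, 3] 1 1 4 4 (by decide) - 2 * h.factor_mul (e := ![0, 0, 1, -1, 0])
    (f := ![-2, -4, -5, -2, 0]) ![-29, 18, -2, -3, 3] 1 2 8 2 (by decide) - h.factor_mul (e :=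
    ![1, 0, 0, 0, -1]) (f := ![-5, -2, -1, -4, -1]) ![-29, 18, -2, -3, 3] 0 1 2 5 (by decide) +
    h.factor_mul (e := ![1, 0, 0, 0, -1]) (f := ![-3, -5, -3, 0, -2]) ![-29, 18, -2, -3, 3] 2 1 4
    4 (by decide))

/-- The terms of weight 9 modulo 11. -/
lemma weight_nine (h : UnitSystem x s p) (hf : f = -3 * s + 14 * s ^ 2 - 22 * s ^ 3 + 13 * s ^ 4 -
    s ^ 5 - s ^ 6 + (1 + 3 * s - 33 * s ^ 2 + 78 * s ^ 3 - 83 * s ^ 4 + 44 * s ^ 5 - 11 * s ^ 6 +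
    s ^ 7) * p) (hK : K * (f * mon x ![-17, 6, 0, -2, 1]) = 1) : mon x ![-2, 1, -1, 1, 0] + 1 / 11
    * mon x ![0, -1, 0, 1, -1] + 2 / 11 * mon x ![-1, 1, 0, 0, 0] * mon x ![0, 0, 0, -1, 0] - 5 /
    11 * mon x ![0, -1, 0, 1, 0] * mon x ![0, 0, 0, 0, -1] - 4 / 11 * mon x ![0, 0, -1, 0, 1] *
    mon x ![1, 0, 0, -1, -1] + 2 / 11 * mon x ![0, 0, 1, -1, 0] * mon x ![-1, 1, -1, 0, 0] = K *
    (mon x ![-3, -5, -2, 2, -5] - mon x ![1, -1, -3, -4, -6] - mon x ![-1, 1, 0, 0, 0] * mon x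
    ![-5, 0, -2, -4, -2] - mon x ![-1, 1, 0, 0, 0] * mon x ![1, -2, -3, -5, -4] - 2 * mon x ![0,
    -1, 0, 1, 0] * mon x ![-5, -1, -4, -2, -1] + 3 * mon x ![0, -1, 0, 1, 0] * mon x ![-4, -3, -3,
    -3, 0] - 3 * mon x ![0, 0, -1, 0, 1] * mon x ![-3, -3, -4, -1, -2] + 2 * mon x ![0, 0, -1, 0,
    1] * mon x ![-2, -4, -5, -2, 0] - mon x ![0, 0, 1, -1, 0] * mon x ![-3, -5, -2, 0, -3] + 2 *
    mon x ![0, 0, 1, -1, 0] * mon x ![-3, -4, -3, -3, 0] + mon x ![1, 0, 0, 0, -1] * mon x ![-4,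
    -3, 0, -5, -1] - 2 * mon x ![1, 0, 0, 0, -1] * mon x ![-4, -2, -3, -2, -2]) := by
  linear_combination h.factor (e := ![-2, 1, -1, 1, 0]) ![-5, 4, 0, -1, 1] 1 0 1 0 (by decide) + 1
    / 11 * h.factor (e := ![0, -1, 0, 1, -1]) ![-5, 4, 0, -1, 1] 1 0 0 1 (by decide) + 2 / 11 *
    h.factor_mul (e := ![-1, 1, 0, 0, 0]) (f := ![0, 0, 0, -1, 0]) ![-5, 4, 0, -1, 1] 0 0 0 1 (by
    decide) - 5 / 11 * h.factor_mul (e := ![0, -1, 0, 1, 0]) (f := ![0, 0, 0, 0, -1]) ![-5, 4, 0,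
    -1, 1] 1 0 0 1 (by decide) - 4 / 11 * h.factor_mul (e := ![0, 0, -1, 0, 1]) (f := ![1, 0, 0,
    -1, -1]) ![-5, 4, 0, -1, 1] 0 0 1 1 (by decide) + 2 / 11 * h.factor_mul (e := ![0, 0, 1, -1,
    0]) (f := ![-1, 1, -1, 0, 0]) ![-5, 4, 0, -1, 1] 0 0 0 1 (by decide) - mon x ![-5, 4, 0, -1,
    1] * (s - s ^ 2) * hK + K * (s - s ^ 2) * f * h.factor_mul (e := ![-5, 4, 0, -1, 1]) (f :=
    ![-17, 6, 0, -2, 1]) ![-39, 29, -3, -4, 4] 2 3 6 0 (by decide) + K * (s - s ^ 2) * mon x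
    ![-39, 29, -3, -4, 4] * (s ^ 2 * p ^ 3 * (1 - s) ^ 6 * (p - s) ^ 0) * hf + K * mon x ![-39,
    29, -3, -4, 4] * (s ^ 9 + (s ^ 7 - 13 * s ^ 8 + 7 * s ^ 9 - 4 * s ^ 10 + s ^ 11) * p + (-s ^ 5
    - 5 * s ^ 6 + 75 * s ^ 7 - 99 * s ^ 8 + 106 * s ^ 9 - 69 * s ^ 10 + 25 * s ^ 11 - 4 * s ^ 12)
    * p ^ 2 + (-3 * s ^ 3 + 45 * s ^ 4 - 226 * s ^ 5 + 584 * s ^ 6 - 1370 * s ^ 7 + 2202 * s ^ 8 -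
    2569 * s ^ 9 + 2163 * s ^ 10 - 1293 * s ^ 11 + 536 * s ^ 12 - 148 * s ^ 13 + 25 * s ^ 14 - 2 *
    s ^ 15) * p ^ 3 + (-s ^ 2 - 5 * s ^ 3 + 8 * s ^ 4 + 212 * s ^ 5 - 403 * s ^ 6 + 526 * s ^ 7 -
    414 * s ^ 8 + 183 * s ^ 9 - 36 * s ^ 10 - s ^ 11 + s ^ 12) * p ^ 4 + (15 * s ^ 2 - 73 * s ^ 3
    + 13 * s ^ 4 + 8 * s ^ 5 - 69 * s ^ 6 + 91 * s ^ 7 - 56 * s ^ 8 + 17 * s ^ 9 - 2 * s ^ 10) * p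
    ^ 5 + (-6 * s + 36 * s ^ 2 - 11 * s ^ 3 + 19 * s ^ 4 - 15 * s ^ 5 + 6 * s ^ 6 - s ^ 7) * p ^ 6
    + (1 - 9 * s) * p ^ 7 + p ^ 8) * h.curve - K * (h.factor (e := ![-3, -5, -2, 2, -5]) ![-39,
    29, -3, -4, 4] 4 2 5 5 (by decide) - h.factor (e := ![1, -1, -3, -4, -6]) ![-39, 29, -3, -4,
    4] 0 0 0 10 (by decide) - h.factor_mul (e := ![-1, 1, 0, 0, 0]) (f := ![-5, 0, -2, -4, -2])
    ![-39, 29, -3, -4, 4] 1 2 5 5 (by decide) - h.factor_mul (e := ![-1, 1, 0, 0, 0]) (f := ![1,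
    -2, -3, -5, -4]) ![-39, 29, -3, -4, 4] 0 1 3 8 (by decide) - 2 * h.factor_mul (e := ![0, -1,
    0, 1, 0]) (f := ![-5, -1, -4, -2, -1]) ![-39, 29, -3, -4, 4] 3 3 10 2 (by decide) + 3 *
    h.factor_mul (e := ![0, -1, 0, 1, 0]) (f := ![-4, -3, -3, -3, 0]) ![-39, 29, -3, -4, 4] 3 4 12
    1 (by decide) - 3 * h.factor_mul (e := ![0, 0, -1, 0, 1]) (f := ![-3, -3, -4, -1, -2]) ![-39,
    29, -3, -4, 4] 3 3 11 2 (by decide) + 2 * h.factor_mul (e := ![0, 0, -1, 0, 1]) (f := ![-2,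
    -4, -5, -2, 0]) ![-39, 29, -3, -4, 4] 3 4 15 0 (by decide) - h.factor_mul (e := ![0, 0, 1, -1,
    0]) (f := ![-3, -5, -2, 0, -3]) ![-39, 29, -3, -4, 4] 3 3 7 4 (by decide) + 2 * h.factor_mul
    (e := ![0, 0, 1, -1, 0]) (f := ![-3, -4, -3, -3, 0]) ![-39, 29, -3, -4, 4] 2 4 11 2 (by
    decide) + h.factor_mul (e := ![1, 0, 0, 0, -1]) (f := ![-4, -3, 0, -5, -1]) ![-39, 29, -3, -4,
    4] 1 3 6 5 (by decide) - 2 * h.factor_mul (e := ![1, 0, 0, 0, -1]) (f := ![-4, -2, -3, -2,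
    -2]) ![-39, 29, -3, -4, 4] 2 2 6 5 (by decide))

/-- The terms of weight 10 modulo 11. -/
lemma weight_ten (h : UnitSystem x s p) (hf : f = -3 * s + 14 * s ^ 2 - 22 * s ^ 3 + 13 * s ^ 4 -
    s ^ 5 - s ^ 6 + (1 + 3 * s - 33 * s ^ 2 + 78 * s ^ 3 - 83 * s ^ 4 + 44 * s ^ 5 - 11 * s ^ 6 +
    s ^ 7) * p) (hK : K * (f * mon x ![-17, 6, 0, -2, 1]) = 1) : -3 / 11 * mon x ![-1, 0, 0, 0, 0]
    - 7 / 11 * mon x ![-1, 1, 0, 0, 0] * mon x ![0, -1, 0, 0, 0] + 1 / 11 * mon x ![0, -1, 0, 1,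
    0] * mon x ![0, -1, 0, 1, -1] - 2 / 11 * mon x ![0, 0, -1, 0, 1] * mon x ![-1, 1, -1, 0, 0] -
    2 / 11 * mon x ![0, 0, 1, -1, 0] * mon x ![0, 0, 0, -1, 0] - 8 / 11 * mon x ![1, 0, 0, 0, -1]
    * mon x ![0, -1, -1, 0, 1] = K * (mon x ![-5, -2, -1, -4, -1] - mon x ![-3, -5, -3, 0, -2] -
    mon x ![-1, 1, 0, 0, 0] * mon x ![-3, -5, -2, 1, -4] + mon x ![-1, 1, 0, 0, 0] * mon x ![-2,
    -3, 0, -5, -3] + mon x ![0, -1, 0, 1, 0] * mon x ![-3, -5, -2, 2, -5] - mon x ![0, -1, 0, 1,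
    0] * mon x ![1, -1, -3, -4, -6] + mon x ![0, 0, -1, 0, 1] * mon x ![-3, -5, -2, 0, -3] - 2 *
    mon x ![0, 0, -1, 0, 1] * mon x ![-3, -4, -3, -3, 0] + mon x ![0, 0, 1, -1, 0] * mon x ![-5,
    0, -2, -4, -2] + mon x ![0, 0, 1, -1, 0] * mon x ![1, -2, -3, -5, -4] - mon x ![1, 0, 0, 0,
    -1] * mon x ![-3, -5, -3, 1, -3] + mon x ![1, 0, 0, 0, -1] * mon x ![-3, -2, -4, -3, -1]) :=
    by
  linear_combination -3 / 11 * h.factor (e := ![-1, 0, 0, 0, 0]) ![-8, 6, 1, -2, 2] 1 0 1 1 (by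
    decide) - 7 / 11 * h.factor_mul (e := ![-1, 1, 0, 0, 0]) (f := ![0, -1, 0, 0, 0]) ![-8, 6, 1,
    -2, 2] 1 0 1 1 (by decide) + 1 / 11 * h.factor_mul (e := ![0, -1, 0, 1, 0]) (f := ![0, -1, 0,
    1, -1]) ![-8, 6, 1, -2, 2] 2 0 1 1 (by decide) - 2 / 11 * h.factor_mul (e := ![0, 0, -1, 0,
    1]) (f := ![-1, 1, -1, 0, 0]) ![-8, 6, 1, -2, 2] 1 0 3 0 (by decide) - 2 / 11 * h.factor_mul
    (e := ![0, 0, 1, -1, 0]) (f := ![0, 0, 0, -1, 0]) ![-8, 6, 1, -2, 2] 0 0 0 2 (by decide) - 8 /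
    11 * h.factor_mul (e := ![1, 0, 0, 0, -1]) (f := ![0, -1, -1, 0, 1]) ![-8, 6, 1, -2, 2] 1 0 2
    1 (by decide) + mon x ![-8, 6, 1, -2, 2] * (-2 / 11) * h.curve - mon x ![-8, 6, 1, -2, 2] * (2
    * s ^ 2 - 3 * s ^ 3 + s ^ 4 + (-2 * s + 3 * s ^ 2 - s ^ 3) * p) * hK + K * (2 * s ^ 2 - 3 * s
    ^ 3 + s ^ 4 + (-2 * s + 3 * s ^ 2 - s ^ 3) * p) * f * h.factor_mul (e := ![-8, 6, 1, -2, 2])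
    (f := ![-17, 6, 0, -2, 1]) ![-40, 30, -3, -5, 5] 2 3 5 0 (by decide) + K * (2 * s ^ 2 - 3 * s
    ^ 3 + s ^ 4 + (-2 * s + 3 * s ^ 2 - s ^ 3) * p) * mon x ![-40, 30, -3, -5, 5] * (s ^ 2 * p ^ 3
    * (1 - s) ^ 5 * (p - s) ^ 0) * hf + K * mon x ![-40, 30, -3, -5, 5] * (s ^ 10 + (s ^ 8 - 12 *
    s ^ 9 + 5 * s ^ 10 - 3 * s ^ 11 + s ^ 12) * p + (-11 * s ^ 7 + 77 * s ^ 8 - 77 * s ^ 9 + 60 *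
    s ^ 10 - 20 * s ^ 11 - 5 * s ^ 12 + 5 * s ^ 13 - s ^ 14) * p ^ 2 + (-6 * s ^ 4 + 67 * s ^ 5 -
    287 * s ^ 6 + 685 * s ^ 7 - 1389 * s ^ 8 + 1868 * s ^ 9 - 1763 * s ^ 10 + 1148 * s ^ 11 - 490
    * s ^ 12 + 128 * s ^ 13 - 18 * s ^ 14 + s ^ 15) * p ^ 3 + (6 * s ^ 3 - 73 * s ^ 4 + 294 * s ^
    5 - 616 * s ^ 6 + 1230 * s ^ 7 - 1650 * s ^ 8 + 1583 * s ^ 9 - 1065 * s ^ 10 + 470 * s ^ 11 -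
    126 * s ^ 12 + 18 * s ^ 13 - s ^ 14) * p ^ 4 + (15 * s ^ 3 - 29 * s ^ 4 - 117 * s ^ 5 + 190 *
    s ^ 6 - 241 * s ^ 7 + 189 * s ^ 8 - 77 * s ^ 9 + 15 * s ^ 10 - s ^ 11) * p ^ 5 + (-12 * s ^ 2
    + 39 * s ^ 3 - 9 * s ^ 4 + 34 * s ^ 5 - 33 * s ^ 6 + 10 * s ^ 7 - s ^ 8) * p ^ 6 + (4 * s - 10
    * s ^ 2 - 8 * s ^ 3 + 7 * s ^ 4 - s ^ 5) * p ^ 7 + (-1 + 3 * s - s ^ 2) * p ^ 8) * h.curve - K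
    * (h.factor (e := ![-5, -2, -1, -4, -1]) ![-40, 30, -3, -5, 5] 2 3 7 4 (by decide) - h.factor
    (e := ![-3, -5, -3, 0, -2]) ![-40, 30, -3, -5, 5] 4 3 9 3 (by decide) - h.factor_mul (e :=
    ![-1, 1, 0, 0, 0]) (f := ![-3, -5, -2, 1, -4]) ![-40, 30, -3, -5, 5] 4 2 5 5 (by decide) +
    h.factor_mul (e := ![-1, 1, 0, 0, 0]) (f := ![-2, -3, 0, -5, -3]) ![-40, 30, -3, -5, 5] 1 2 3
    7 (by decide) + h.factor_mul (e := ![0, -1, 0, 1, 0]) (f := ![-3, -5, -2, 2, -5]) ![-40, 30,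
    -3, -5, 5] 5 2 5 5 (by decide) - h.factor_mul (e := ![0, -1, 0, 1, 0]) (f := ![1, -1, -3, -4,
    -6]) ![-40, 30, -3, -5, 5] 1 0 0 10 (by decide) + h.factor_mul (e := ![0, 0, -1, 0, 1]) (f :=
    ![-3, -5, -2, 0, -3]) ![-40, 30, -3, -5, 5] 4 3 9 3 (by decide) - 2 * h.factor_mul (e := ![0,
    0, -1, 0, 1]) (f := ![-3, -4, -3, -3, 0]) ![-40, 30, -3, -5, 5] 3 4 13 1 (by decide) +
    h.factor_mul (e := ![0, 0, 1, -1, 0]) (f := ![-5, 0, -2, -4, -2]) ![-40, 30, -3, -5, 5] 1 2 4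
    6 (by decide) + h.factor_mul (e := ![0, 0, 1, -1, 0]) (f := ![1, -2, -3, -5, -4]) ![-40, 30,
    -3, -5, 5] 0 1 2 9 (by decide) - h.factor_mul (e := ![1, 0, 0, 0, -1]) (f := ![-3, -5, -3, 1,
    -3]) ![-40, 30, -3, -5, 5] 4 2 6 5 (by decide) + h.factor_mul (e := ![1, 0, 0, 0, -1]) (f :=
    ![-3, -2, -4, -3, -1]) ![-40, 30, -3, -5, 5] 2 2 7 5 (by decide))

end UnitSystem

/-- The terms `(c, k, e)`, standing for `c * E ^ k * x ^ e`, of weight different from zero. -/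
def wTerms : List (ℚ × ℕ × (Fin 5 → ℤ)) := [(1, 14, ![-5, -2, -1, -4, -1]), (-1, 14, ![-3, -5, -3,
    0, -2]), (3 / 11, 2, ![-1, 0, 0, 0, 0]), (1, 14, ![-3, -5, -3, 1, -3]), (-1, 14, ![-3, -2, -4,
    -3, -1]), (-8 / 11, 2, ![0, -1, -1, 0, 1]), (2, 14, ![-4, -2, 0, -4, -3]), (-1, 14, ![-2, -3,
    -2, -1, -5]), (6 / 11, 2, ![-1, 0, 1, -1, 0]), (-1, 14, ![-3, -5, -2, 0, -3]), (2, 14, ![-3,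
    -4, -3, -3, 0]), (-2 / 11, 2, ![-1, 1, -1, 0, 0]), (1, 14, ![-3, -5, -2, 1, -4]), (-1, 14,
    ![-2, -3, 0, -5, -3]), (-7 / 11, 2, ![0, -1, 0, 0, 0]), (1, 14, ![-3, -5, -2, 2, -5]), (-1,
    14, ![1, -1, -3, -4, -6]), (-1 / 11, 2, ![0, -1, 0, 1, -1]), (1, 14, ![-5, 0, -3, -3, -2]),
    (-1, 14, ![-2, -4, -2, -1, -4]), (1 / 11, 2, ![0, 0, -1, 0, 0]), (3, 14, ![-3, -3, -4, -1,
    -2]), (-2, 14, ![-2, -4, -5, -2, 0]), (-4 / 11, 2, ![1, 0, 0, -1, -1]), (1, 14, ![-5, 0, -2,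
    -4, -2]), (1, 14, ![1, -2, -3, -5, -4]), (2 / 11, 2, ![0, 0, 0, -1, 0]), (-2, 14, ![-5, -1,
    -4, -2, -1]), (3, 14, ![-4, -3, -3, -3, 0]), (5 / 11, 2, ![0, 0, 0, 0, -1])]

/-- The weight zero contribution. -/
noncomputable def wSix (x : Fin 5 → ℂ) (E : ℂ) : ℂ :=
  E ^ 14 * (2 * mon x ![-4, -2, -3, -2, -2] - mon x ![-4, -3, 0, -5, -1])

/-- The contribution of the nonzero weights. -/
noncomputable def wRest (x : Fin 5 → ℂ) (E : ℂ) : ℂ :=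
  (wTerms.map fun τ => (τ.1 : ℂ) * (E ^ τ.2.1 * mon x τ.2.2)).sum

namespace UnitSystem
variable {x : Fin 5 → ℂ} {s p : ℂ}

lemma mul_wSix_add_wRest (h : UnitSystem x s p) (E f : ℂ) (hf : f = -3 * s + 14 * s ^ 2 - 22 * s ^
    3 + 13 * s ^ 4 - s ^ 5 - s ^ 6 + (1 + 3 * s - 33 * s ^ 2 + 78 * s ^ 3 - 83 * s ^ 4 + 44 * s ^
    5 - 11 * s ^ 6 + s ^ 7) * p) (hK : E ^ 12 * (f * mon x ![-17, 6, 0, -2, 1]) = 1) : E ^ 3 * (-2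
    / 11 * mon x ![-3, 3, -1, 0, 0] - 1 / 11 * mon x ![-1, -2, 2, 1, -1] - 2 / 11 * mon x ![-2, 1,
    -1, 2, -1] - 3 / 11 * mon x ![0, -3, 0, 3, -1]) - E ^ 3 * (-mon x ![-2, 1, -1, 1, 0] + mon x
    ![-1, -1, 1, -1, 1] - mon x ![-1, 0, 0, 1, -1] + mon x ![0, 0, 0, -1, 0]) = E * (1 - mon x
    ![-1, 1, 0, 0, 0] + mon x ![0, -1, 0, 1, 0] - mon x ![0, 0, -1, 0, 1] + mon x ![0, 0, 1, -1,
    0] - mon x ![1, 0, 0, 0, -1]) * (wSix x E + wRest x E) := by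
  simp only [wSix, wRest, wTerms, List.map_cons, List.map_nil, List.sum_cons, List.sum_nil]
  push_cast
  linear_combination E ^ 3 * (h.weight_zero hf hK + h.weight_one hf hK + h.weight_two (E ^ 12) +
    h.weight_three hf hK + h.weight_four hf hK + h.weight_five hf hK + h.weight_six hf hK +
    h.weight_seven hf hK + h.weight_eight hf hK + h.weight_nine hf hK + h.weight_ten hf hK)

end UnitSystem

namespace ThetaSystem
variable {t Λ P R : ℤ → ℂ} {E : ℂ}

lemma log_one_add_log_two (h : ThetaSystem t Λ P R E) : Λ 1 + Λ 2 = E ^ 3 * (-2 / 11 * mon (coords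
    t) ![-3, 3, -1, 0, 0] - 1 / 11 * mon (coords t) ![-1, -2, 2, 1, -1] - 2 / 11 * mon (coords t)
    ![-2, 1, -1, 2, -1] - 3 / 11 * mon (coords t) ![0, -3, 0, 3, -1]) := by
  have n1 : t 1 ≠ 0 := h.apply_ne_zero (by norm_num)
  have n2 : t 2 ≠ 0 := h.apply_ne_zero (by norm_num)
  have n3 : t 3 ≠ 0 := h.apply_ne_zero (by norm_num)
  have n4 : t 4 ≠ 0 := h.apply_ne_zero (by norm_num)
  have n5 : t 5 ≠ 0 := h.apply_ne_zero (by norm_num)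
  have l6 : Λ 6 = -Λ 5 := by simpa using h.log_eleven_sub 5
  have la : 3 * Λ 1 - Λ 3 = E ^ 3 * (-mon (coords t) ![-3, 3, -1, 0, 0]) := by
    have := h.log_eq (x := 0) (y := 2) (z := 1) (by norm_num) (by norm_num) (by norm_num)
      (by norm_num)
    norm_num [h.neg, h.log_neg, h.t6, h.t8, l6] at this
    simp only [mon_eq, coords, zpow_neg, Matrix.cons_val, zpow_ofNat]
    field_simp
    linear_combination this
  have lb : Λ 1 + 2 * Λ 2 - Λ 5 = E ^ 3 * (-mon (coords t) ![-1, -2, 2, 1, -1]) := by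
    have := h.log_eq (x := 0) (y := 3) (z := 2) (by norm_num) (by norm_num) (by norm_num)
      (by norm_num)
    norm_num [h.neg, h.log_neg, h.t6, h.t8, l6] at this
    simp only [mon_eq, coords, zpow_neg, Matrix.cons_val, zpow_ofNat]
    field_simp
    linear_combination this
  have lc : 2 * Λ 1 + Λ 3 - Λ 5 = E ^ 3 * (-mon (coords t) ![-2, 1, -1, 2, -1]) := by
    have := h.log_eq (x := 0) (y := 4) (z := 1) (by norm_num) (by norm_num) (by norm_num)
      (by norm_num)
    norm_num [h.neg, h.log_neg, h.t6, h.t8, l6] at this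
    simp only [mon_eq, coords, zpow_neg, Matrix.cons_val, zpow_ofNat]
    field_simp
    linear_combination this
  have ld : 3 * Λ 2 + Λ 5 = E ^ 3 * (-mon (coords t) ![0, -3, 0, 3, -1]) := by
    have := h.log_eq (x := 0) (y := 4) (z := 2) (by norm_num) (by norm_num) (by norm_num)
      (by norm_num)
    norm_num [h.neg, h.log_neg, h.t6, h.t8, l6] at this
    simp only [mon_eq, coords, zpow_neg, Matrix.cons_val, zpow_ofNat]
    field_simp
    linear_combination this
  linear_combination 2 / 11 * la + 1 / 11 * lb + 2 / 11 * lc + 3 / 11 * ld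

theorem log_sub_sum (h : ThetaSystem t Λ P R E) : Λ 1 + Λ 2 - E ^ 3 * (t 2 * t (2 * 2) / (t (1 -
    2) * t 1 * t (1 + 2)) + t 3 * t (2 * 3) / (t (1 - 3) * t 1 * t (1 + 3)) + t 4 * t (2 * 4) / (t
    (1 - 4) * t 1 * t (1 + 4)) + t 5 * t (2 * 5) / (t (1 - 5) * t 1 * t (1 + 5))) = E * (1 + (t (2
    * 1) / t 1 + t (2 * 2) / t 2 + t (2 * 3) / t 3 + t (2 * 4) / t 4 + t (2 * 5) / t 5)) * (wSix
    (coords t) E + wRest (coords t) E) := by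
  have n1 : t 1 ≠ 0 := h.apply_ne_zero (by norm_num)
  have n2 : t 2 ≠ 0 := h.apply_ne_zero (by norm_num)
  have n3 : t 3 ≠ 0 := h.apply_ne_zero (by norm_num)
  have n4 : t 4 ≠ 0 := h.apply_ne_zero (by norm_num)
  have n5 : t 5 ≠ 0 := h.apply_ne_zero (by norm_num)
  have key := h.unitSystem.mul_wSix_add_wRest E _ rfl (h.pow_twelve rfl rfl rfl)
  have e1 : t 2 * t (2 * 2) / (t (1 - 2) * t 1 * t (1 + 2)) + t 3 * t (2 * 3) / (t (1 - 3) * t 1 *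
    t (1 + 3)) + t 4 * t (2 * 4) / (t (1 - 4) * t 1 * t (1 + 4)) + t 5 * t (2 * 5) / (t (1 - 5) *
    t 1 * t (1 + 5)) = -mon (coords t) ![-2, 1, -1, 1, 0] + mon (coords t) ![-1, -1, 1, -1, 1] -
    mon (coords t) ![-1, 0, 0, 1, -1] + mon (coords t) ![0, 0, 0, -1, 0] := by
    norm_num [h.neg, h.t6, h.t8, h.t10]
    simp only [mon_eq, coords, zpow_neg, Matrix.cons_val, zpow_ofNat]
    field_simp
    ring
  have e2 : 1 + (t (2 * 1) / t 1 + t (2 * 2) / t 2 + t (2 * 3) / t 3 + t (2 * 4) / t 4 + t (2 * 5)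
    / t 5) = 1 - mon (coords t) ![-1, 1, 0, 0, 0] + mon (coords t) ![0, -1, 0, 1, 0] - mon (coords
    t) ![0, 0, -1, 0, 1] + mon (coords t) ![0, 0, 1, -1, 0] - mon (coords t) ![1, 0, 0, 0, -1] :=
    by
    norm_num [h.neg, h.t6, h.t8, h.t10]
    simp only [mon_eq, coords, zpow_neg, Matrix.cons_val, zpow_ofNat]
    field_simp
    ring
  rw [h.log_one_add_log_two, e1, e2, ← key]

end ThetaSystem

namespace ThetaSystem
variable {t Λ P R : ℤ → ℂ} {E : ℂ}

lemma sum_Icc_one_five {M : Type*} [AddCommMonoid M] (f : ℤ → M) :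
    ∑ b ∈ Icc (1 : ℤ) 5, f b = f 1 + f 2 + f 3 + f 4 + f 5 := by
  rw [show Icc (1 : ℤ) 5 = {1, 2, 3, 4, 5} by decide]
  simp [add_assoc]

lemma sums_one (h : ThetaSystem t Λ P R E) :
    t (1 * 2) * t (1 * (2 * 2)) / (t (1 * (1 - 2)) * t (1 * 1) * t (1 * (1 + 2))) +
        t (1 * 3) * t (1 * (2 * 3)) / (t (1 * (1 - 3)) * t (1 * 1) * t (1 * (1 + 3))) +
        t (1 * 4) * t (1 * (2 * 4)) / (t (1 * (1 - 4)) * t (1 * 1) * t (1 * (1 + 4))) +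
        t (1 * 5) * t (1 * (2 * 5)) / (t (1 * (1 - 5)) * t (1 * 1) * t (1 * (1 + 5))) =
      ∑ b ∈ (Icc (1 : ℤ) 5).erase 1, t b * t (2 * b) / (t (1 - b) * t 1 * t (1 + b)) ∧
    t (1 * (2 * 1)) / t (1 * 1) + t (1 * (2 * 2)) / t (1 * 2) + t (1 * (2 * 3)) / t (1 * 3) +
        t (1 * (2 * 4)) / t (1 * 4) + t (1 * (2 * 5)) / t (1 * 5) =
      ∑ b ∈ Icc (1 : ℤ) 5, t (2 * b) / t b := by
  have n1 : t 1 ≠ 0 := h.apply_ne_zero (by norm_num)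
  have n2 : t 2 ≠ 0 := h.apply_ne_zero (by norm_num)
  have n3 : t 3 ≠ 0 := h.apply_ne_zero (by norm_num)
  have n4 : t 4 ≠ 0 := h.apply_ne_zero (by norm_num)
  have n5 : t 5 ≠ 0 := h.apply_ne_zero (by norm_num)
  constructor
  · rw [show (Icc (1 : ℤ) 5).erase 1 = {2, 3, 4, 5} by decide]
    norm_num [h.neg, h.t6, h.t8, h.t10]
    field_simp
    ring
  · rw [sum_Icc_one_five]
    norm_num [h.neg, h.t6, h.t8, h.t10]
    try ring

lemma sums_two (h : ThetaSystem t Λ P R E) :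
    t (2 * 2) * t (2 * (2 * 2)) / (t (2 * (1 - 2)) * t (2 * 1) * t (2 * (1 + 2))) +
        t (2 * 3) * t (2 * (2 * 3)) / (t (2 * (1 - 3)) * t (2 * 1) * t (2 * (1 + 3))) +
        t (2 * 4) * t (2 * (2 * 4)) / (t (2 * (1 - 4)) * t (2 * 1) * t (2 * (1 + 4))) +
        t (2 * 5) * t (2 * (2 * 5)) / (t (2 * (1 - 5)) * t (2 * 1) * t (2 * (1 + 5))) =
      ∑ b ∈ (Icc (1 : ℤ) 5).erase 2, t b * t (2 * b) / (t (2 - b) * t 2 * t (2 + b)) ∧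
    t (2 * (2 * 1)) / t (2 * 1) + t (2 * (2 * 2)) / t (2 * 2) + t (2 * (2 * 3)) / t (2 * 3) +
        t (2 * (2 * 4)) / t (2 * 4) + t (2 * (2 * 5)) / t (2 * 5) =
      ∑ b ∈ Icc (1 : ℤ) 5, t (2 * b) / t b := by
  have n1 : t 1 ≠ 0 := h.apply_ne_zero (by norm_num)
  have n2 : t 2 ≠ 0 := h.apply_ne_zero (by norm_num)
  have n3 : t 3 ≠ 0 := h.apply_ne_zero (by norm_num)
  have n4 : t 4 ≠ 0 := h.apply_ne_zero (by norm_num)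
  have n5 : t 5 ≠ 0 := h.apply_ne_zero (by norm_num)
  have u12 : t 12 = t 1 := h.add_eleven_mul 1 1
  have u16 : t 16 = t 5 := h.add_eleven_mul 5 1
  have u20 : t 20 = -t 2 := by simpa using (h.add_eleven_mul (-2) 2).trans (h.neg 2)
  constructor
  · rw [show (Icc (1 : ℤ) 5).erase 2 = {1, 3, 4, 5} by decide]
    norm_num [h.neg, h.t6, h.t7, h.t8, h.t10, u12, u16, u20]
    field_simp
    ring
  · rw [sum_Icc_one_five]
    norm_num [h.neg, h.t6, h.t7, h.t8, h.t10, u12, u16, u20]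
    try ring

lemma sums_three (h : ThetaSystem t Λ P R E) :
    t (3 * 2) * t (3 * (2 * 2)) / (t (3 * (1 - 2)) * t (3 * 1) * t (3 * (1 + 2))) +
        t (3 * 3) * t (3 * (2 * 3)) / (t (3 * (1 - 3)) * t (3 * 1) * t (3 * (1 + 3))) +
        t (3 * 4) * t (3 * (2 * 4)) / (t (3 * (1 - 4)) * t (3 * 1) * t (3 * (1 + 4))) +
        t (3 * 5) * t (3 * (2 * 5)) / (t (3 * (1 - 5)) * t (3 * 1) * t (3 * (1 + 5))) =
      ∑ b ∈ (Icc (1 : ℤ) 5).erase 3, t b * t (2 * b) / (t (3 - b) * t 3 * t (3 + b)) ∧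
    t (3 * (2 * 1)) / t (3 * 1) + t (3 * (2 * 2)) / t (3 * 2) + t (3 * (2 * 3)) / t (3 * 3) +
        t (3 * (2 * 4)) / t (3 * 4) + t (3 * (2 * 5)) / t (3 * 5) =
      ∑ b ∈ Icc (1 : ℤ) 5, t (2 * b) / t b := by
  have n1 : t 1 ≠ 0 := h.apply_ne_zero (by norm_num)
  have n2 : t 2 ≠ 0 := h.apply_ne_zero (by norm_num)
  have n3 : t 3 ≠ 0 := h.apply_ne_zero (by norm_num)
  have n4 : t 4 ≠ 0 := h.apply_ne_zero (by norm_num)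
  have n5 : t 5 ≠ 0 := h.apply_ne_zero (by norm_num)
  have u12 : t 12 = t 1 := h.add_eleven_mul 1 1
  have u15 : t 15 = t 4 := h.add_eleven_mul 4 1
  have u18 : t 18 = -t 4 := by simpa using (h.add_eleven_mul (-4) 2).trans (h.neg 4)
  have u24 : t 24 = t 2 := h.add_eleven_mul 2 2
  have u30 : t 30 = -t 3 := by simpa using (h.add_eleven_mul (-3) 3).trans (h.neg 3)
  constructor
  · rw [show (Icc (1 : ℤ) 5).erase 3 = {1, 2, 4, 5} by decide]
    norm_num [h.neg, h.t6, h.t7, h.t8, h.t9, h.t10, u12, u15, u18, u24, u30]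
    field_simp
    ring
  · rw [sum_Icc_one_five]
    norm_num [h.neg, h.t6, h.t7, h.t8, h.t9, h.t10, u12, u15, u18, u24, u30]
    try ring

lemma sums_four (h : ThetaSystem t Λ P R E) :
    t (4 * 2) * t (4 * (2 * 2)) / (t (4 * (1 - 2)) * t (4 * 1) * t (4 * (1 + 2))) +
        t (4 * 3) * t (4 * (2 * 3)) / (t (4 * (1 - 3)) * t (4 * 1) * t (4 * (1 + 3))) +
        t (4 * 4) * t (4 * (2 * 4)) / (t (4 * (1 - 4)) * t (4 * 1) * t (4 * (1 + 4))) +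
        t (4 * 5) * t (4 * (2 * 5)) / (t (4 * (1 - 5)) * t (4 * 1) * t (4 * (1 + 5))) =
      ∑ b ∈ (Icc (1 : ℤ) 5).erase 4, t b * t (2 * b) / (t (4 - b) * t 4 * t (4 + b)) ∧
    t (4 * (2 * 1)) / t (4 * 1) + t (4 * (2 * 2)) / t (4 * 2) + t (4 * (2 * 3)) / t (4 * 3) +
        t (4 * (2 * 4)) / t (4 * 4) + t (4 * (2 * 5)) / t (4 * 5) =
      ∑ b ∈ Icc (1 : ℤ) 5, t (2 * b) / t b := by
  have n1 : t 1 ≠ 0 := h.apply_ne_zero (by norm_num)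
  have n2 : t 2 ≠ 0 := h.apply_ne_zero (by norm_num)
  have n3 : t 3 ≠ 0 := h.apply_ne_zero (by norm_num)
  have n4 : t 4 ≠ 0 := h.apply_ne_zero (by norm_num)
  have n5 : t 5 ≠ 0 := h.apply_ne_zero (by norm_num)
  have u12 : t 12 = t 1 := h.add_eleven_mul 1 1
  have u16 : t 16 = t 5 := h.add_eleven_mul 5 1
  have u20 : t 20 = -t 2 := by simpa using (h.add_eleven_mul (-2) 2).trans (h.neg 2)
  have u24 : t 24 = t 2 := h.add_eleven_mul 2 2
  have u32 : t 32 = -t 1 := by simpa using (h.add_eleven_mul (-1) 3).trans (h.neg 1)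
  have u40 : t 40 = -t 4 := by simpa using (h.add_eleven_mul (-4) 4).trans (h.neg 4)
  constructor
  · rw [show (Icc (1 : ℤ) 5).erase 4 = {1, 2, 3, 5} by decide]
    norm_num [h.neg, h.t6, h.t7, h.t8, h.t9, h.t10, u12, u16, u20, u24, u32, u40]
    field_simp
    ring
  · rw [sum_Icc_one_five]
    norm_num [h.neg, h.t6, h.t7, h.t8, h.t9, h.t10, u12, u16, u20, u24, u32, u40]
    try ring

lemma sums_five (h : ThetaSystem t Λ P R E) :
    t (5 * 2) * t (5 * (2 * 2)) / (t (5 * (1 - 2)) * t (5 * 1) * t (5 * (1 + 2))) +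
        t (5 * 3) * t (5 * (2 * 3)) / (t (5 * (1 - 3)) * t (5 * 1) * t (5 * (1 + 3))) +
        t (5 * 4) * t (5 * (2 * 4)) / (t (5 * (1 - 4)) * t (5 * 1) * t (5 * (1 + 4))) +
        t (5 * 5) * t (5 * (2 * 5)) / (t (5 * (1 - 5)) * t (5 * 1) * t (5 * (1 + 5))) =
      ∑ b ∈ (Icc (1 : ℤ) 5).erase 5, t b * t (2 * b) / (t (5 - b) * t 5 * t (5 + b)) ∧
    t (5 * (2 * 1)) / t (5 * 1) + t (5 * (2 * 2)) / t (5 * 2) + t (5 * (2 * 3)) / t (5 * 3) +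
        t (5 * (2 * 4)) / t (5 * 4) + t (5 * (2 * 5)) / t (5 * 5) =
      ∑ b ∈ Icc (1 : ℤ) 5, t (2 * b) / t b := by
  have n1 : t 1 ≠ 0 := h.apply_ne_zero (by norm_num)
  have n2 : t 2 ≠ 0 := h.apply_ne_zero (by norm_num)
  have n3 : t 3 ≠ 0 := h.apply_ne_zero (by norm_num)
  have n4 : t 4 ≠ 0 := h.apply_ne_zero (by norm_num)
  have n5 : t 5 ≠ 0 := h.apply_ne_zero (by norm_num)
  have u15 : t 15 = t 4 := h.add_eleven_mul 4 1
  have u20 : t 20 = -t 2 := by simpa using (h.add_eleven_mul (-2) 2).trans (h.neg 2)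
  have u25 : t 25 = t 3 := h.add_eleven_mul 3 2
  have u30 : t 30 = -t 3 := by simpa using (h.add_eleven_mul (-3) 3).trans (h.neg 3)
  have u40 : t 40 = -t 4 := by simpa using (h.add_eleven_mul (-4) 4).trans (h.neg 4)
  have u50 : t 50 = -t 5 := by simpa using (h.add_eleven_mul (-5) 5).trans (h.neg 5)
  constructor
  · rw [show (Icc (1 : ℤ) 5).erase 5 = {1, 2, 3, 4} by decide]
    norm_num [h.neg, h.t6, h.t7, h.t8, h.t9, h.t10, u15, u20, u25, u30, u40, u50]
    field_simp
    ring
  · rw [sum_Icc_one_five]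
    norm_num [h.neg, h.t6, h.t7, h.t8, h.t9, h.t10, u15, u20, u25, u30, u40, u50]
    try ring

lemma log_sub_sum_erase (h : ThetaSystem t Λ P R E) {c : ℤ} (hc : c ∈ Icc (1 : ℤ) 5) :
    Λ c + Λ (2 * c) - E ^ 3 * ∑ b ∈ (Icc (1 : ℤ) 5).erase c,
        t b * t (2 * b) / (t (c - b) * t c * t (c + b)) =
      E * (1 + ∑ b ∈ Icc (1 : ℤ) 5, t (2 * b) / t b) *
        (wSix (coords fun a => t (c * a)) E + wRest (coords fun a => t (c * a)) E) := by
  rw [show Icc (1 : ℤ) 5 = {1, 2, 3, 4, 5} by decide] at hc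
  simp only [mem_insert, mem_singleton] at hc
  have hc11 : ¬ (11 : ℤ) ∣ c := by rcases hc with rfl | rfl | rfl | rfl | rfl <;> norm_num
  have key := (h.comp_mul hc11).log_sub_sum
  rcases hc with rfl | rfl | rfl | rfl | rfl
  · rw [← h.sums_one.1, ← h.sums_one.2, ← key]; norm_num
  · rw [← h.sums_two.1, ← h.sums_two.2, ← key]; norm_num
  · rw [← h.sums_three.1, ← h.sums_three.2, ← key]; norm_num
  · rw [← h.sums_four.1, ← h.sums_four.2, ← key]; norm_num
  · rw [← h.sums_five.1, ← h.sums_five.2, ← key]; norm_num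

end ThetaSystem

/-- The quotient of the theta part of `D (3 * c)` by the partition product. -/
noncomputable def thetaQuot (w : ℝ) (c : ℤ) : ℂ :=
  wSix (coords fun a => tval w (c * a)) (ezero w) + wRest (coords fun a => tval w (c * a)) (ezero w)

lemma thetaPart_eq {w : ℝ} (hw : w ≤ -1) {c : ℤ} (hc : c ∈ Icc (1 : ℤ) 5) :
    thetaPart w c = qpow w (1 / 24) * (pent w : ℝ) * thetaQuot w c := by
  rw [thetaPart, (thetaSystem hw).log_sub_sum_erase hc, thetaQuot, ← sum_eplus (by linarith)]
  congr 1
  rw [mul_add, mul_one, mul_sum]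
  congr 1
  refine sum_congr rfl fun b hb => (eplus_eq_tval hw ?_).symm
  rw [show Icc (1 : ℤ) 5 = {1, 2, 3, 4, 5} by decide] at hb
  simp only [mem_insert, mem_singleton] at hb
  rcases hb with rfl | rfl | rfl | rfl | rfl <;> norm_num

namespace ThetaSystem
variable {t Λ P R : ℤ → ℂ} {E : ℂ}

lemma wSix_one (t : ℤ → ℂ) (E : ℂ) : wSix (coords fun a => t (1 * a)) E = E ^ 14 * (2 *
    mon (coords t) ![-4, -2, -3, -2, -2] - mon (coords t) ![-4, -3, 0, -5, -1]) := by
  simp only [one_mul, wSix]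

lemma wSix_two (h : ThetaSystem t Λ P R E) : wSix (coords fun a => t (2 * a)) E = E ^ 14 * (mon
    (coords t) ![-1, -4, -5, -3, 0] - 2 * mon (coords t) ![-2, -4, -2, -2, -3]) := by
  simp only [wSix, mon_eq, coords, zpow_neg, Matrix.cons_val, zpow_ofNat]
  congr 1
  norm_num [h.t6, h.t8, h.t10]
  ring

lemma wSix_three (h : ThetaSystem t Λ P R E) : wSix (coords fun a => t (3 * a)) E = E ^ 14 * (2 *
    mon (coords t) ![-2, -3, -4, -2, -2] - mon (coords t) ![-5, 0, -4, -1, -3]) := by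
  have u12 : t 12 = t 1 := h.add_eleven_mul 1 1
  have u15 : t 15 = t 4 := h.add_eleven_mul 4 1
  simp only [wSix, mon_eq, coords, zpow_neg, Matrix.cons_val, zpow_ofNat]
  congr 1
  norm_num [h.t6, h.t9, u12, u15]
  ring

lemma wSix_four (h : ThetaSystem t Λ P R E) : wSix (coords fun a => t (4 * a)) E = E ^ 14 * (2 *
    mon (coords t) ![-3, -2, -2, -4, -2] + mon (coords t) ![0, -1, -3, -4, -5]) := by
  have u12 : t 12 = t 1 := h.add_eleven_mul 1 1
  have u16 : t 16 = t 5 := h.add_eleven_mul 5 1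
  have u20 : t 20 = -t 2 := by simpa using (h.add_eleven_mul (-2) 2).trans (h.neg 2)
  simp only [wSix, mon_eq, coords, zpow_neg, Matrix.cons_val, zpow_ofNat]
  congr 1
  norm_num [h.t8, u12, u16, u20]
  ring

lemma wSix_five (h : ThetaSystem t Λ P R E) : wSix (coords fun a => t (5 * a)) E = E ^ 14 * (mon
    (coords t) ![-3, -5, -1, 0, -4] - 2 * mon (coords t) ![-2, -2, -2, -3, -4]) := by
  have u15 : t 15 = t 4 := h.add_eleven_mul 4 1
  have u20 : t 20 = -t 2 := by simpa using (h.add_eleven_mul (-2) 2).trans (h.neg 2)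
  have u25 : t 25 = t 3 := h.add_eleven_mul 3 2
  simp only [wSix, mon_eq, coords, zpow_neg, Matrix.cons_val, zpow_ofNat]
  congr 1
  norm_num [h.t10, u15, u20, u25]
  ring

end ThetaSystem

namespace UnitSystem
variable {x : Fin 5 → ℂ} {s p : ℂ}

lemma first_combination (h : UnitSystem x s p) : -(2 * mon x ![-4, -2, -3, -2, -2] - mon x ![-4,
    -3, 0, -5, -1]) - 3 * (mon x ![-1, -4, -5, -3, 0] - 2 * mon x ![-2, -4, -2, -2, -3]) - 2 * (2
    * mon x ![-2, -3, -4, -2, -2] - mon x ![-5, 0, -4, -1, -3]) - (2 * mon x ![-3, -2, -2, -4, -2]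
    + mon x ![0, -1, -3, -4, -5]) - (mon x ![-3, -5, -1, 0, -4] - 2 * mon x ![-2, -2, -2, -3, -4])
    = 2 * mon x ![-2, -2, -2, -3, -4] + 3 * mon x ![-2, -1, -4, -3, -3] + 3 * mon x ![0, -3, -3,
    -3, -4] := by
  linear_combination h.factor (e := ![-4, -3, 0, -5, -1]) ![-28, 20, -3, -4, 2] 1 3 6 2 (by
    decide) - 2 * h.factor (e := ![-4, -2, -3, -2, -2]) ![-28, 20, -3, -4, 2] 2 2 6 2 (by decide)
    - 3 * h.factor (e := ![-1, -4, -5, -3, 0]) ![-28, 20, -3, -4, 2] 2 3 11 0 (by decide) + 6 *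
    h.factor (e := ![-2, -4, -2, -2, -3]) ![-28, 20, -3, -4, 2] 2 2 5 3 (by decide) + 2 * h.factor
    (e := ![-5, 0, -4, -1, -3]) ![-28, 20, -3, -4, 2] 2 1 4 3 (by decide) - 4 * h.factor (e :=
    ![-2, -3, -4, -2, -2]) ![-28, 20, -3, -4, 2] 2 2 7 2 (by decide) - h.factor (e := ![0, -1, -3,
    -4, -5]) ![-28, 20, -3, -4, 2] 0 0 0 7 (by decide) - 2 * h.factor (e := ![-3, -2, -2, -4, -2])
    ![-28, 20, -3, -4, 2] 1 2 5 3 (by decide) - h.factor (e := ![-3, -5, -1, 0, -4]) ![-28, 20,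
    -3, -4, 2] 3 2 4 3 (by decide) + 2 * h.factor (e := ![-2, -2, -2, -3, -4]) ![-28, 20, -3, -4,
    2] 1 1 2 5 (by decide) - 2 * h.factor (e := ![-2, -2, -2, -3, -4]) ![-28, 20, -3, -4, 2] 1 1 2
    5 (by decide) - 3 * h.factor (e := ![-2, -1, -4, -3, -3]) ![-28, 20, -3, -4, 2] 1 1 4 4 (by
    decide) - 3 * h.factor (e := ![0, -3, -3, -3, -4]) ![-28, 20, -3, -4, 2] 1 1 3 5 (by decide) +
    mon x ![-28, 20, -3, -4, 2] * (s ^ 6 + (-5 * s ^ 4 + 16 * s ^ 5 - 35 * s ^ 6 + 26 * s ^ 7 - 7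
    * s ^ 8) * p + (14 * s ^ 3 - 62 * s ^ 4 + 168 * s ^ 5 - 214 * s ^ 6 + 164 * s ^ 7 - 81 * s ^ 8
    + 24 * s ^ 9 - 3 * s ^ 10) * p ^ 2 + (-3 * s + 16 * s ^ 2 - 51 * s ^ 3 + 45 * s ^ 4 - 25 * s ^
    5 + 11 * s ^ 6 - 3 * s ^ 7) * p ^ 3 + (12 * s ^ 2 - 10 * s ^ 3 + 3 * s ^ 4) * p ^ 4 + (-1) * p
    ^ 5) * h.curve

lemma second_combination (h : UnitSystem x s p) : 2 * (2 * mon x ![-4, -2, -3, -2, -2] - mon x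
    ![-4, -3, 0, -5, -1]) + (mon x ![-1, -4, -5, -3, 0] - 2 * mon x ![-2, -4, -2, -2, -3]) + 2 *
    (2 * mon x ![-2, -3, -4, -2, -2] - mon x ![-5, 0, -4, -1, -3]) + 3 * (2 * mon x ![-3, -2, -2,
    -4, -2] + mon x ![0, -1, -3, -4, -5]) = mon x ![-3, -3, 0, -4, -3] + 6 * mon x ![-2, -3, -4,
    -2, -2] := by
  linear_combination -2 * h.factor (e := ![-4, -3, 0, -5, -1]) ![-28, 20, -3, -4, 2] 1 3 6 2 (by
    decide) + 4 * h.factor (e := ![-4, -2, -3, -2, -2]) ![-28, 20, -3, -4, 2] 2 2 6 2 (by decide)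
    + h.factor (e := ![-1, -4, -5, -3, 0]) ![-28, 20, -3, -4, 2] 2 3 11 0 (by decide) - 2 *
    h.factor (e := ![-2, -4, -2, -2, -3]) ![-28, 20, -3, -4, 2] 2 2 5 3 (by decide) - 2 * h.factor
    (e := ![-5, 0, -4, -1, -3]) ![-28, 20, -3, -4, 2] 2 1 4 3 (by decide) + 4 * h.factor (e :=
    ![-2, -3, -4, -2, -2]) ![-28, 20, -3, -4, 2] 2 2 7 2 (by decide) + 3 * h.factor (e := ![0, -1,
    -3, -4, -5]) ![-28, 20, -3, -4, 2] 0 0 0 7 (by decide) + 6 * h.factor (e := ![-3, -2, -2, -4,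
    -2]) ![-28, 20, -3, -4, 2] 1 2 5 3 (by decide) - h.factor (e := ![-3, -3, 0, -4, -3]) ![-28,
    20, -3, -4, 2] 1 2 3 4 (by decide) - 6 * h.factor (e := ![-2, -3, -4, -2, -2]) ![-28, 20, -3,
    -4, 2] 2 2 7 2 (by decide) + mon x ![-28, 20, -3, -4, 2] * (-3 * s ^ 6 + (2 * s ^ 4 + 13 * s ^
    5 + s ^ 7 - s ^ 8) * p + (-10 * s ^ 3 - 10 * s ^ 4 - 36 * s ^ 5 + 54 * s ^ 6 - 48 * s ^ 7 + 27
    * s ^ 8 - 8 * s ^ 9 + s ^ 10) * p ^ 2 + (s + 7 * s ^ 2 + 34 * s ^ 3 - 20 * s ^ 4 + 14 * s ^ 5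
    - 7 * s ^ 6 + s ^ 7) * p ^ 3 + (-10 * s - 6 * s ^ 2 + s ^ 4) * p ^ 4 + (3) * p ^ 5) * h.curve

lemma third_combination (h : UnitSystem x s p) : -(2 * mon x ![-4, -2, -3, -2, -2] - mon x ![-4,
    -3, 0, -5, -1]) - (mon x ![-1, -4, -5, -3, 0] - 2 * mon x ![-2, -4, -2, -2, -3]) - 3 * (2 *
    mon x ![-2, -3, -4, -2, -2] - mon x ![-5, 0, -4, -1, -3]) - 2 * (mon x ![-3, -5, -1, 0, -4] -
    2 * mon x ![-2, -2, -2, -3, -4]) = 5 * mon x ![-2, -2, -2, -3, -4] + 2 * mon x ![-2, -1, -4,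
    -3, -3] + 2 * mon x ![0, -3, -3, -3, -4] := by
  linear_combination h.factor (e := ![-4, -3, 0, -5, -1]) ![-22, 13, -2, -3, 1] 0 2 4 2 (by
    decide) - 2 * h.factor (e := ![-4, -2, -3, -2, -2]) ![-22, 13, -2, -3, 1] 1 1 4 2 (by decide)
    - h.factor (e := ![-1, -4, -5, -3, 0]) ![-22, 13, -2, -3, 1] 1 2 9 0 (by decide) + 2 *
    h.factor (e := ![-2, -4, -2, -2, -3]) ![-22, 13, -2, -3, 1] 1 1 3 3 (by decide) + 3 * h.factor
    (e := ![-5, 0, -4, -1, -3]) ![-22, 13, -2, -3, 1] 1 0 2 3 (by decide) - 6 * h.factor (e :=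
    ![-2, -3, -4, -2, -2]) ![-22, 13, -2, -3, 1] 1 1 5 2 (by decide) - 2 * h.factor (e := ![-3,
    -5, -1, 0, -4]) ![-22, 13, -2, -3, 1] 2 1 2 3 (by decide) + 4 * h.factor (e := ![-2, -2, -2,
    -3, -4]) ![-22, 13, -2, -3, 1] 0 0 0 5 (by decide) - 5 * h.factor (e := ![-2, -2, -2, -3, -4])
    ![-22, 13, -2, -3, 1] 0 0 0 5 (by decide) - 2 * h.factor (e := ![-2, -1, -4, -3, -3]) ![-22,
    13, -2, -3, 1] 0 0 2 4 (by decide) - 2 * h.factor (e := ![0, -3, -3, -3, -4]) ![-22, 13, -2,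
    -3, 1] 0 0 1 5 (by decide) + mon x ![-22, 13, -2, -3, 1] * (-5 * s ^ 3 + 13 * s ^ 4 - 7 * s ^
    5 + (9 * s ^ 2 - 33 * s ^ 3 + 30 * s ^ 4 - 14 * s ^ 5 + 6 * s ^ 6 - s ^ 7) * p + (-1 + 5 * s +
    3 * s ^ 2 - 3 * s ^ 3 - s ^ 4) * p ^ 2 + (-3 + 2 * s) * p ^ 3) * h.curve

lemma fourth_combination (h : UnitSystem x s p) : -(2 * mon x ![-4, -2, -3, -2, -2] - mon x ![-4,
    -3, 0, -5, -1]) - (mon x ![-1, -4, -5, -3, 0] - 2 * mon x ![-2, -4, -2, -2, -3]) + (2 * mon x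
    ![-2, -3, -4, -2, -2] - mon x ![-5, 0, -4, -1, -3]) + 3 * (2 * mon x ![-3, -2, -2, -4, -2] +
    mon x ![0, -1, -3, -4, -5]) + 2 * (mon x ![-3, -5, -1, 0, -4] - 2 * mon x ![-2, -2, -2, -3,
    -4]) = 3 * mon x ![-3, -2, -2, -4, -2] + 3 * mon x ![-2, -3, -4, -2, -2] + 2 * mon x ![-1, -3,
    -3, -4, -2] := by
  linear_combination h.factor (e := ![-4, -3, 0, -5, -1]) ![-28, 20, -3, -4, 2] 1 3 6 2 (by
    decide) - 2 * h.factor (e := ![-4, -2, -3, -2, -2]) ![-28, 20, -3, -4, 2] 2 2 6 2 (by decide)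
    - h.factor (e := ![-1, -4, -5, -3, 0]) ![-28, 20, -3, -4, 2] 2 3 11 0 (by decide) + 2 *
    h.factor (e := ![-2, -4, -2, -2, -3]) ![-28, 20, -3, -4, 2] 2 2 5 3 (by decide) - h.factor (e
    := ![-5, 0, -4, -1, -3]) ![-28, 20, -3, -4, 2] 2 1 4 3 (by decide) + 2 * h.factor (e := ![-2,
    -3, -4, -2, -2]) ![-28, 20, -3, -4, 2] 2 2 7 2 (by decide) + 3 * h.factor (e := ![0, -1, -3,
    -4, -5]) ![-28, 20, -3, -4, 2] 0 0 0 7 (by decide) + 6 * h.factor (e := ![-3, -2, -2, -4, -2])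
    ![-28, 20, -3, -4, 2] 1 2 5 3 (by decide) + 2 * h.factor (e := ![-3, -5, -1, 0, -4]) ![-28,
    20, -3, -4, 2] 3 2 4 3 (by decide) - 4 * h.factor (e := ![-2, -2, -2, -3, -4]) ![-28, 20, -3,
    -4, 2] 1 1 2 5 (by decide) - 3 * h.factor (e := ![-3, -2, -2, -4, -2]) ![-28, 20, -3, -4, 2] 1
    2 5 3 (by decide) - 3 * h.factor (e := ![-2, -3, -4, -2, -2]) ![-28, 20, -3, -4, 2] 2 2 7 2
    (by decide) - 2 * h.factor (e := ![-1, -3, -3, -4, -2]) ![-28, 20, -3, -4, 2] 1 2 6 3 (by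
    decide) + mon x ![-28, 20, -3, -4, 2] * (-3 * s ^ 6 + (s ^ 4 + 21 * s ^ 5 - 14 * s ^ 6 + 9 * s
    ^ 7 - 2 * s ^ 8) * p + (-7 * s ^ 3 - 47 * s ^ 4 + 63 * s ^ 5 - 73 * s ^ 6 + 54 * s ^ 7 - 27 *
    s ^ 8 + 8 * s ^ 9 - s ^ 10) * p ^ 2 + (-s + 24 * s ^ 2 + 2 * s ^ 3 + 8 * s ^ 4 - 6 * s ^ 5 + 4
    * s ^ 6 - s ^ 7) * p ^ 3 + (-13 * s - s ^ 2 - s ^ 3) * p ^ 4 + (3) * p ^ 5) * h.curve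

lemma fifth_combination (h : UnitSystem x s p) : -4 * (2 * mon x ![-4, -2, -3, -2, -2] - mon x
    ![-4, -3, 0, -5, -1]) - 3 * (2 * mon x ![-2, -3, -4, -2, -2] - mon x ![-5, 0, -4, -1, -3]) + 2
    * (2 * mon x ![-3, -2, -2, -4, -2] + mon x ![0, -1, -3, -4, -5]) + (mon x ![-3, -5, -1, 0, -4]
    - 2 * mon x ![-2, -2, -2, -3, -4]) = 4 * mon x ![-2, -2, -2, -3, -4] + mon x ![-2, -1, -4, -3,
    -3] + 5 * mon x ![-1, -3, -3, -4, -2] := by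
  linear_combination 4 * h.factor (e := ![-4, -3, 0, -5, -1]) ![-20, 14, -3, -4, 0] 1 3 6 0 (by
    decide) - 8 * h.factor (e := ![-4, -2, -3, -2, -2]) ![-20, 14, -3, -4, 0] 2 2 6 0 (by decide)
    + 3 * h.factor (e := ![-5, 0, -4, -1, -3]) ![-20, 14, -3, -4, 0] 2 1 4 1 (by decide) - 6 *
    h.factor (e := ![-2, -3, -4, -2, -2]) ![-20, 14, -3, -4, 0] 2 2 7 0 (by decide) + 2 * h.factor
    (e := ![0, -1, -3, -4, -5]) ![-20, 14, -3, -4, 0] 0 0 0 5 (by decide) + 4 * h.factor (e :=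
    ![-3, -2, -2, -4, -2]) ![-20, 14, -3, -4, 0] 1 2 5 1 (by decide) + h.factor (e := ![-3, -5,
    -1, 0, -4]) ![-20, 14, -3, -4, 0] 3 2 4 1 (by decide) - 2 * h.factor (e := ![-2, -2, -2, -3,
    -4]) ![-20, 14, -3, -4, 0] 1 1 2 3 (by decide) - 4 * h.factor (e := ![-2, -2, -2, -3, -4])
    ![-20, 14, -3, -4, 0] 1 1 2 3 (by decide) - h.factor (e := ![-2, -1, -4, -3, -3]) ![-20, 14,
    -3, -4, 0] 1 1 4 2 (by decide) - 5 * h.factor (e := ![-1, -3, -3, -4, -2]) ![-20, 14, -3, -4,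
    0] 1 2 6 1 (by decide) + mon x ![-20, 14, -3, -4, 0] * (-2 * s ^ 4 + (-4 * s ^ 2 + 32 * s ^ 3
    - 44 * s ^ 4 + 28 * s ^ 5 - 6 * s ^ 6) * p + (-8 * s + 6 * s ^ 2 - 4 * s ^ 3) * p ^ 2 + (2) *
    p ^ 3) * h.curve

lemma sixth_combination (h : UnitSystem x s p) : -4 * (2 * mon x ![-4, -2, -3, -2, -2] - mon x
    ![-4, -3, 0, -5, -1]) - 2 * (mon x ![-1, -4, -5, -3, 0] - 2 * mon x ![-2, -4, -2, -2, -3]) - 2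
    * (2 * mon x ![-2, -3, -4, -2, -2] - mon x ![-5, 0, -4, -1, -3]) + (2 * mon x ![-3, -2, -2,
    -4, -2] + mon x ![0, -1, -3, -4, -5]) + 2 * (mon x ![-3, -5, -1, 0, -4] - 2 * mon x ![-2, -2,
    -2, -3, -4]) = mon x ![-2, -2, -2, -3, -4] + 3 * mon x ![-2, -1, -4, -3, -3] + 4 * mon x ![-1,
    -3, -3, -4, -2] := by
  linear_combination 4 * h.factor (e := ![-4, -3, 0, -5, -1]) ![-28, 20, -3, -4, 2] 1 3 6 2 (by
    decide) - 8 * h.factor (e := ![-4, -2, -3, -2, -2]) ![-28, 20, -3, -4, 2] 2 2 6 2 (by decide)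
    - 2 * h.factor (e := ![-1, -4, -5, -3, 0]) ![-28, 20, -3, -4, 2] 2 3 11 0 (by decide) + 4 *
    h.factor (e := ![-2, -4, -2, -2, -3]) ![-28, 20, -3, -4, 2] 2 2 5 3 (by decide) + 2 * h.factor
    (e := ![-5, 0, -4, -1, -3]) ![-28, 20, -3, -4, 2] 2 1 4 3 (by decide) - 4 * h.factor (e :=
    ![-2, -3, -4, -2, -2]) ![-28, 20, -3, -4, 2] 2 2 7 2 (by decide) + h.factor (e := ![0, -1, -3,
    -4, -5]) ![-28, 20, -3, -4, 2] 0 0 0 7 (by decide) + 2 * h.factor (e := ![-3, -2, -2, -4, -2])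
    ![-28, 20, -3, -4, 2] 1 2 5 3 (by decide) + 2 * h.factor (e := ![-3, -5, -1, 0, -4]) ![-28,
    20, -3, -4, 2] 3 2 4 3 (by decide) - 4 * h.factor (e := ![-2, -2, -2, -3, -4]) ![-28, 20, -3,
    -4, 2] 1 1 2 5 (by decide) - h.factor (e := ![-2, -2, -2, -3, -4]) ![-28, 20, -3, -4, 2] 1 1 2
    5 (by decide) - 3 * h.factor (e := ![-2, -1, -4, -3, -3]) ![-28, 20, -3, -4, 2] 1 1 4 4 (by
    decide) - 4 * h.factor (e := ![-1, -3, -3, -4, -2]) ![-28, 20, -3, -4, 2] 1 2 6 3 (by decide)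
    + mon x ![-28, 20, -3, -4, 2] * (-s ^ 6 + (-5 * s ^ 4 + 32 * s ^ 5 - 44 * s ^ 6 + 28 * s ^ 7 -
    6 * s ^ 8) * p + (8 * s ^ 3 - 80 * s ^ 4 + 156 * s ^ 5 - 166 * s ^ 6 + 112 * s ^ 7 - 54 * s ^
    8 + 16 * s ^ 9 - 2 * s ^ 10) * p ^ 2 + (-2 * s + 20 * s ^ 2 - 14 * s ^ 3 + 4 * s ^ 4 - 2 * s ^
    5 + 6 * s ^ 6 - 2 * s ^ 7) * p ^ 3 + (-8 * s + 7 * s ^ 2 - 4 * s ^ 3) * p ^ 4 + p ^ 5) *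
    h.curve

end UnitSystem

/-- On `(0, 1)` the function `f` is the sum of a power series with nonnegative coefficients. -/
def PosSeries (f : ℝ → ℝ) : Prop :=
  ∃ c : ℕ → ℝ, (∀ n, 0 ≤ c n) ∧ ∀ y, 0 < y → y < 1 → HasSum (fun n => c n * y ^ n) (f y)

namespace PosSeries
variable {f g : ℝ → ℝ}

lemma congr (h : PosSeries f) (hg : ∀ y, 0 < y → y < 1 → g y = f y) : PosSeries g := by
  obtain ⟨c, hc, hs⟩ := h
  exact ⟨c, hc, fun y h0 h1 => hg y h0 h1 ▸ hs y h0 h1⟩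

lemma add (hf : PosSeries f) (hg : PosSeries g) : PosSeries fun y => f y + g y := by
  obtain ⟨c, hc, hs⟩ := hf
  obtain ⟨d, hd, ht⟩ := hg
  refine ⟨fun n => c n + d n, fun n => add_nonneg (hc n) (hd n), fun y h0 h1 => ?_⟩
  simpa only [add_mul] using (hs y h0 h1).add (ht y h0 h1)

lemma const_mul (hf : PosSeries f) {a : ℝ} (ha : 0 ≤ a) : PosSeries fun y => a * f y := by
  obtain ⟨c, hc, hs⟩ := hf
  refine ⟨fun n => a * c n, fun n => mul_nonneg ha (hc n), fun y h0 h1 => ?_⟩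
  simpa only [mul_assoc] using (hs y h0 h1).mul_left a

lemma mul (hf : PosSeries f) (hg : PosSeries g) : PosSeries fun y => f y * g y := by
  obtain ⟨c, hc, hs⟩ := hf
  obtain ⟨d, hd, ht⟩ := hg
  refine ⟨fun n => ∑ kl ∈ antidiagonal n, c kl.1 * d kl.2,
    fun n => sum_nonneg fun kl _ => mul_nonneg (hc _) (hd _), fun y h0 h1 => ?_⟩
  have e : (fun n => (∑ kl ∈ antidiagonal n, c kl.1 * d kl.2) * y ^ n) =
      fun n => ∑ kl ∈ antidiagonal n, (c kl.1 * y ^ kl.1) * (d kl.2 * y ^ kl.2) := by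
    funext n
    rw [sum_mul]
    refine sum_congr rfl fun kl hkl => ?_
    rw [← mem_antidiagonal.mp hkl, pow_add]; ring
  have n1 := (hs y h0 h1).summable.norm
  have n2 := (ht y h0 h1).summable.norm
  show HasSum _ (f y * g y)
  rw [e, ← (hs y h0 h1).tsum_eq, ← (ht y h0 h1).tsum_eq,
    tsum_mul_tsum_eq_tsum_sum_antidiagonal_of_summable_norm n1 n2]
  exact (summable_norm_sum_mul_antidiagonal_of_summable_norm n1 n2).of_norm.hasSum

lemma pow_id (k : ℕ) : PosSeries fun y => y ^ k := by
  refine ⟨fun n => if n = k then 1 else 0, fun n => by positivity, fun y _ _ => ?_⟩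
  simpa using hasSum_single (f := fun n => (if n = k then (1 : ℝ) else 0) * y ^ n) k
    fun n hn => by simp [hn]

lemma one : PosSeries fun _ => 1 := by simpa using pow_id 0

lemma pow (hf : PosSeries f) (n : ℕ) : PosSeries fun y => f y ^ n := by
  induction n with
  | zero => simpa using one
  | succ n ih => simpa only [pow_succ] using ih.mul hf

lemma prod {ι : Type*} (s : Finset ι) {F : ι → ℝ → ℝ} (h : ∀ i ∈ s, PosSeries (F i)) :
    PosSeries fun y => ∏ i ∈ s, F i y := by
  classical
  induction s using Finset.induction_on with
  | empty => simpa using one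
  | insert a s ha ih =>
    simp only [prod_insert ha]
    exact (h a (mem_insert_self a s)).mul (ih fun i hi => h i (mem_insert_of_mem hi))

lemma inv_one_sub_pow {k : ℕ} (hk : k ≠ 0) : PosSeries fun y => (1 - y ^ k)⁻¹ := by
  have hinj : Function.Injective fun n : ℕ => k * n := fun a b h => by
    simpa [hk] using h
  refine ⟨Function.extend (fun n : ℕ => k * n) (fun _ => 1) 0, fun n => ?_, fun y h0 h1 => ?_⟩
  · by_cases h : ∃ m, k * m = n
    · obtain ⟨m, rfl⟩ := h
      rw [hinj.extend_apply (fun _ => (1 : ℝ)) 0 m]; norm_num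
    · rw [Function.extend_apply' _ _ _ (by simpa using h)]; rfl
  · rw [← hinj.hasSum_iff]
    · refine (hasSum_geometric_of_lt_one (by positivity)
        (pow_lt_one₀ h0.le h1 hk)).congr_fun fun n => ?_
      simp only [Function.comp_apply]
      rw [hinj.extend_apply (fun _ => (1 : ℝ)) 0 n, one_mul, pow_mul]
    · intro n hn
      rw [Function.extend_apply' _ _ _ (by simpa using hn)]; simp

lemma one_sub_pow_add_div {i j : ℕ} (hi : i ≠ 0) (hj : j ≠ 0) :
    PosSeries fun y => (1 - y ^ (i + j)) / ((1 - y ^ i) * (1 - y ^ j)) := by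
  refine ((inv_one_sub_pow hi).add ((pow_id j).mul (inv_one_sub_pow hj))).congr fun y h0 h1 => ?_
  have e1 : 1 - y ^ i ≠ 0 := (sub_pos.mpr (pow_lt_one₀ h0.le h1 hi)).ne'
  have e2 : 1 - y ^ j ≠ 0 := (sub_pos.mpr (pow_lt_one₀ h0.le h1 hj)).ne'
  field_simp
  ring

/-- Power series with nonnegative coefficients are closed under pointwise limits. -/
lemma of_tendsto {F : ℕ → ℝ → ℝ} (hF : ∀ N, PosSeries (F N))
    (h : ∀ y, 0 < y → y < 1 → Tendsto (fun N => F N y) atTop (𝓝 (f y))) : PosSeries f := by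
  choose c hc hs using hF
  have hb : ∀ y, 0 < y → y < 1 → ∃ B, ∀ N n, c N n * y ^ n ≤ B := fun y h0 h1 => by
    obtain ⟨B, hB⟩ := (h y h0 h1).bddAbove_range
    refine ⟨B, fun N n => le_trans ?_ (hB ⟨N, rfl⟩)⟩
    exact le_hasSum (hs N y h0 h1) n fun m _ => mul_nonneg (hc N m) (pow_nonneg h0.le m)
  let U : Ultrafilter ℕ := hyperfilter ℕ
  have hU : (U : Filter ℕ) ≤ atTop := Nat.hyperfilter_le_atTop
  have hlim : ∀ n, ∃ d, 0 ≤ d ∧ Tendsto (fun N => c N n) U (𝓝 d) := fun n => by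
    obtain ⟨B, hB⟩ := hb (1 / 2) (by norm_num) (by norm_num)
    obtain ⟨d, hd, hd'⟩ := (isCompact_Icc (a := (0 : ℝ)) (b := B * 2 ^ n)).ultrafilter_le_nhds
      (U.map fun N => c N n) (by
        rw [le_principal_iff, Ultrafilter.mem_coe, Ultrafilter.mem_map]
        refine Filter.univ_mem' fun N => ⟨hc N n, ?_⟩
        have h2 : (1 / 2 : ℝ) ^ n * 2 ^ n = 1 := by rw [← mul_pow]; norm_num
        calc c N n = c N n * (1 / 2) ^ n * 2 ^ n := by rw [mul_assoc, h2, mul_one]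
          _ ≤ B * 2 ^ n := mul_le_mul_of_nonneg_right (hB N n) (by positivity))
    exact ⟨d, hd.1, hd'⟩
  choose d hd hdl using hlim
  refine ⟨d, hd, fun y h0 h1 => ?_⟩
  obtain ⟨ρ, hy, hρ⟩ := exists_between h1
  have hρ0 : 0 < ρ := h0.trans hy
  obtain ⟨B, hB⟩ := hb ρ hρ0 hρ
  have hgeo : Summable fun n : ℕ => B * (y / ρ) ^ n :=
    (summable_geometric_of_lt_one (by positivity) ((div_lt_one hρ0).mpr hy)).mul_left B
  have hle : ∀ N n, ‖c N n * y ^ n‖ ≤ B * (y / ρ) ^ n := fun N n => by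
    rw [Real.norm_of_nonneg (mul_nonneg (hc N n) (pow_nonneg h0.le n))]
    calc c N n * y ^ n = c N n * ρ ^ n * (y / ρ) ^ n := by
          rw [mul_assoc, ← mul_pow, mul_div_cancel₀ _ hρ0.ne']
      _ ≤ B * (y / ρ) ^ n := mul_le_mul_of_nonneg_right (hB N n) (by positivity)
  have ht := tendsto_tsum_of_dominated_convergence (𝓕 := (U : Filter ℕ)) hgeo
    (fun n => (hdl n).mul_const (y ^ n)) (Eventually.of_forall hle)
  have hsum : Summable fun n => d n * y ^ n :=
    Summable.of_norm_bounded hgeo fun n =>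
      le_of_tendsto ((hdl n).mul_const (y ^ n)).norm (Eventually.of_forall fun N => hle N n)
  have he : f y = ∑' n, d n * y ^ n :=
    tendsto_nhds_unique ((h y h0 h1).mono_left hU)
      (ht.congr fun N => (hs N y h0 h1).tsum_eq)
  rw [he]
  exact hsum.hasSum

lemma poch_inv {a : ℕ} (ha : a ≠ 0) : PosSeries fun y => (poch (y ^ a) (y ^ 11))⁻¹ := by
  refine of_tendsto (F := fun N y => ∏ k ∈ range N, (1 - y ^ (a + 11 * k))⁻¹)
    (fun N => prod _ fun k _ => inv_one_sub_pow (by omega)) fun y h0 h1 => ?_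
  have hQ0 : 0 < y ^ 11 := by positivity
  have hQ1 : y ^ 11 < 1 := pow_lt_one₀ h0.le h1 (by norm_num)
  refine ((tendsto_poch hQ0 hQ1 (y ^ a)).inv₀
    (poch_pos hQ0 hQ1 (pow_lt_one₀ h0.le h1 ha)).ne').congr fun N => ?_
  rw [← prod_inv_distrib]
  refine prod_congr rfl fun k _ => ?_
  rw [← pow_mul, ← pow_add]

end PosSeries

/-- The product of `1 - y ^ n` over the `n ≡ ±k` modulo 11. -/
noncomputable def pairProd (k : ℕ) (y : ℝ) : ℝ :=
  poch (y ^ k) (y ^ 11) * poch (y ^ (11 - k)) (y ^ 11)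

namespace PosSeries

lemma pairProd_inv {k : ℕ} (hk : k ≠ 0) (hk' : k < 11) : PosSeries fun y => (pairProd k y)⁻¹ := by
  simp only [pairProd, mul_inv]
  exact (poch_inv hk).mul (poch_inv (by omega))

lemma poch_div_pairProd_sq {k : ℕ} (hk : k ≠ 0) (hk' : k < 11) :
    PosSeries fun y => poch (y ^ 11) (y ^ 11) * (pairProd k y)⁻¹ ^ 2 := by
  have key : PosSeries fun y => poch (y ^ 11) (y ^ 11) * (poch (y ^ k) (y ^ 11) *
      poch (y ^ (k + 11)) (y ^ 11) * poch (y ^ (11 - k)) (y ^ 11) ^ 2)⁻¹ := by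
    refine of_tendsto (F := fun N y => ∏ n ∈ range N,
      ((1 - y ^ ((k + 11 * n) + (11 - k + 11 * n))) /
          ((1 - y ^ (k + 11 * n)) * (1 - y ^ (11 - k + 11 * n))) *
        ((1 - y ^ ((k + 11 + 11 * n) + (11 - k + 11 * n))) /
          ((1 - y ^ (k + 11 + 11 * n)) * (1 - y ^ (11 - k + 11 * n))))))
      (fun N => prod _ fun n _ => (one_sub_pow_add_div (by omega) (by omega)).mul
        (one_sub_pow_add_div (by omega) (by omega))) fun y h0 h1 => ?_
    have hQ0 : 0 < y ^ 11 := by positivity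
    have hQ1 : y ^ 11 < 1 := pow_lt_one₀ h0.le h1 (by norm_num)
    have hp : ∀ {a : ℕ}, a ≠ 0 → poch (y ^ a) (y ^ 11) ≠ 0 := fun ha =>
      (poch_pos hQ0 hQ1 (pow_lt_one₀ h0.le h1 ha)).ne'
    have l0 := (tendsto_poch hQ0 hQ1 (y ^ 11)).comp
      (tendsto_id.const_mul_atTop' (r := 2) (by norm_num))
    refine (l0.mul ((((tendsto_poch hQ0 hQ1 (y ^ k)).mul (tendsto_poch hQ0 hQ1 (y ^ (k + 11)))).mul
      ((tendsto_poch hQ0 hQ1 (y ^ (11 - k))).pow 2)).inv₀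
      (mul_ne_zero (mul_ne_zero (hp hk) (hp (by omega)))
        (pow_ne_zero 2 (hp (by omega)))))).congr fun N => ?_
    simp only [Function.comp_apply, id]
    induction N with
    | zero => simp
    | succ N ih =>
      conv_rhs => rw [prod_range_succ, ← ih]
      rw [show 2 * (N + 1) = 2 * N + 1 + 1 by ring]
      simp only [prod_range_succ]
      have e : ∀ (a m : ℕ), y ^ a * (y ^ 11) ^ m = y ^ (a + 11 * m) := fun a m => by
        rw [← pow_mul, ← pow_add]
      simp only [e]
      rw [show k + 11 * N + (11 - k + 11 * N) = 11 + 11 * (2 * N) by omega,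
        show k + 11 + 11 * N + (11 - k + 11 * N) = 11 + 11 * (2 * N + 1) by omega]
      generalize 1 - y ^ (11 - k + 11 * N) = u
      simp only [div_eq_mul_inv, mul_inv, mul_pow]
      ring
  refine ((inv_one_sub_pow hk).mul key).congr fun y h0 h1 => ?_
  have hQ0 : 0 < y ^ 11 := by positivity
  have hQ1 : y ^ 11 < 1 := pow_lt_one₀ h0.le h1 (by norm_num)
  have e := poch_eq_mul hQ0 hQ1 (y ^ k)
  rw [← pow_add] at e
  have h2 : poch (y ^ (k + 11)) (y ^ 11) ≠ 0 :=
    (poch_pos hQ0 hQ1 (pow_lt_one₀ h0.le h1 (by omega))).ne'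
  have h3 : 1 - y ^ k ≠ 0 := (sub_pos.mpr (pow_lt_one₀ h0.le h1 hk)).ne'
  rw [pairProd, e]
  generalize 1 - y ^ k = u at h3 ⊢
  generalize poch (y ^ (k + 11)) (y ^ 11) = v at h2 ⊢
  generalize poch (y ^ (11 - k)) (y ^ 11) = x
  simp only [mul_inv, mul_pow, inv_pow]
  field_simp

lemma poch_mul_prod (n : Fin 5 → ℕ) (k : Fin 5) (hk : 2 ≤ n k) :
    PosSeries fun y => poch (y ^ 11) (y ^ 11) * ∏ i : Fin 5, (pairProd (i + 1) y)⁻¹ ^ n i := by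
  have h1 : PosSeries fun y => ∏ i : Fin 5, (pairProd (i + 1) y)⁻¹ ^ (if i = k then n k - 2 else n i) :=
    prod _ fun i _ => (pairProd_inv (by omega) (by omega)).pow _
  refine ((poch_div_pairProd_sq (k := k + 1) (by omega) (by omega)).mul h1).congr fun y h0 h1 => ?_
  rw [mul_assoc]
  congr 1
  rw [← mul_prod_erase (univ : Finset (Fin 5)) (fun i : Fin 5 => (pairProd ((i : ℕ) + 1) y)⁻¹ ^ n i)
      (mem_univ k),
    ← mul_prod_erase (univ : Finset (Fin 5))
      (fun i : Fin 5 => (pairProd ((i : ℕ) + 1) y)⁻¹ ^ (if i = k then n k - 2 else n i))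
      (mem_univ k), ← mul_assoc, if_pos rfl, ← pow_add,
    Nat.add_sub_cancel' hk]
  exact congrArg _ (prod_congr rfl fun i hi => by rw [if_neg (ne_of_mem_erase hi)])

end PosSeries

lemma tendsto_qpow {x : ℝ} (hx : 0 < x) : Tendsto (fun w => qpow w x) atBot (𝓝 0) := by
  rw [tendsto_zero_iff_norm_tendsto_zero]
  simp only [norm_qpow, Complex.ofReal_re]
  exact Real.tendsto_exp_atBot.comp (tendsto_id.atBot_mul_const hx)

/-- Near `w = -∞` the function `f` is the sum of the `a n * q ^ (n / 24)`, with only finitely many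
negative exponents. -/
def HasLaurent (f : ℝ → ℂ) (a : ℤ → ℂ) : Prop :=
  (∃ N : ℤ, ∀ n < N, a n = 0) ∧
    ∀ᶠ w : ℝ in atBot, HasSum (fun n : ℤ => a n * qpow w (n / 24)) (f w)

namespace HasLaurent
variable {f g : ℝ → ℂ} {a b : ℤ → ℂ}

lemma add (hf : HasLaurent f a) (hg : HasLaurent g b) :
    HasLaurent (fun w => f w + g w) (fun n => a n + b n) := by
  obtain ⟨⟨N, hN⟩, hf⟩ := hf
  obtain ⟨⟨M, hM⟩, hg⟩ := hg
  refine ⟨⟨min N M, fun n hn => ?_⟩, ?_⟩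
  · beta_reduce
    rw [hN n (hn.trans_le (min_le_left _ _)), hM n (hn.trans_le (min_le_right _ _)), add_zero]
  · filter_upwards [hf, hg] with w h1 h2
    simpa only [add_mul] using h1.add h2

lemma const_mul (hf : HasLaurent f a) (c : ℂ) :
    HasLaurent (fun w => c * f w) (fun n => c * a n) := by
  obtain ⟨⟨N, hN⟩, hf⟩ := hf
  refine ⟨⟨N, fun n hn => by beta_reduce; rw [hN n hn, mul_zero]⟩, ?_⟩
  filter_upwards [hf] with w h1
  simpa only [mul_assoc] using h1.mul_left c

lemma eq_zero (h : HasLaurent (fun _ => 0) a) : a = 0 := by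
  by_contra hne
  obtain ⟨⟨N, hN⟩, hs⟩ := h
  obtain ⟨m, hm⟩ := Function.ne_iff.mp hne
  obtain ⟨k, hk, hmin⟩ := Int.exists_least_of_bdd (P := fun n => a n ≠ 0)
    ⟨N, fun z hz => by by_contra hlt; exact hz (hN z (not_le.mp hlt))⟩ ⟨m, hm⟩
  obtain ⟨w₀, hw₀⟩ := eventually_atBot.mp hs
  have hs' : ∀ w ≤ w₀, HasSum (fun n : ℤ => a n * qpow w ((n - k) / 24)) 0 := fun w hw => by
    have := (hw₀ w hw).mul_right (qpow w (-k / 24))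
    rw [zero_mul] at this
    refine this.congr_fun fun n => ?_
    rw [mul_assoc, ← qpow_add]
    congr 2; ring
  have hnorm : ∀ (w : ℝ) (n : ℤ), ‖a n * qpow w ((n - k) / 24)‖ =
      ‖a n‖ * Real.exp (w * (((n - k : ℤ) : ℝ) / 24)) := fun w n => by
    have e : ((n : ℂ) - k) / 24 = ((((n - k : ℤ) : ℝ) / 24 : ℝ) : ℂ) := by push_cast; ring
    rw [norm_mul, e, norm_qpow, Complex.ofReal_re]
  have ht := tendsto_tsum_of_dominated_convergence (𝓕 := atBot)
    (f := fun (w : ℝ) (n : ℤ) => a n * qpow w ((n - k) / 24))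
    (g := fun n => if n = k then a k else 0) (hs' w₀ le_rfl).summable.norm (fun n => by
      rcases lt_trichotomy n k with hn | rfl | hn
      · have : a n = 0 := by by_contra h0; exact absurd (hmin n h0) (not_le.mpr hn)
        simp [this, hn.ne]
      · simp [qpow_zero]
      · rw [if_neg hn.ne', ← mul_zero (a n)]
        refine Tendsto.const_mul (a n) ?_
        have e : ((n : ℂ) - k) / 24 = ((((n - k : ℤ) : ℝ) / 24 : ℝ) : ℂ) := by push_cast; ring
        rw [e]
        exact tendsto_qpow (div_pos (by exact_mod_cast sub_pos.mpr hn) (by norm_num)))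
    (by
      filter_upwards [eventually_le_atBot w₀] with w hw n
      rw [hnorm, hnorm]
      rcases lt_or_ge n k with hn | hn
      · have : a n = 0 := by by_contra h0; exact absurd (hmin n h0) (not_le.mpr hn)
        simp [this]
      · have : (0 : ℝ) ≤ ((n - k : ℤ) : ℝ) / 24 :=
          div_nonneg (by exact_mod_cast sub_nonneg.mpr hn) (by norm_num)
        gcongr)
  rw [tsum_ite_eq] at ht
  refine hk (tendsto_nhds_unique ht (tendsto_const_nhds.congr' ?_))
  filter_upwards [eventually_le_atBot w₀] with w hw
  exact (hs' w hw).tsum_eq.symm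

lemma of_injective {φ : ℕ → ℤ} (hφ : Function.Injective φ) {N : ℤ} (hN : ∀ n, N ≤ φ n) {c : ℕ → ℂ}
    (h : ∀ᶠ w : ℝ in atBot, HasSum (fun n => c n * qpow w (φ n / 24)) (f w)) :
    HasLaurent f (Function.extend φ c 0) := by
  refine ⟨⟨N, fun n hn => Function.extend_apply' _ _ _ ?_⟩, ?_⟩
  · rintro ⟨m, rfl⟩
    exact absurd (hN m) (not_le.mpr hn)
  · filter_upwards [h] with w hw
    rw [← hφ.hasSum_iff]
    · refine hw.congr_fun fun n => ?_
      simp only [Function.comp_apply, hφ.extend_apply]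
    · intro n hn
      rw [Function.extend_apply' _ _ _ (by simpa using hn)]; simp

end HasLaurent

/-- Near `w = -∞` the function `f` is a Laurent series in `q ^ (1 / 24)` without exponents
congruent to 6 modulo 11 (in powers of `q`). -/
def NoSix (f : ℝ → ℂ) : Prop :=
  ∃ a, HasLaurent f a ∧ ∀ n : ℤ, (n : ZMod 264) = 144 → a n = 0

namespace NoSix
variable {f g : ℝ → ℂ}

lemma congr (hf : NoSix f) (h : ∀ᶠ w in atBot, g w = f w) : NoSix g := by
  obtain ⟨a, ⟨hN, hs⟩, h0⟩ := hf
  refine ⟨a, ⟨hN, ?_⟩, h0⟩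
  filter_upwards [hs, h] with w h1 h2
  rwa [h2]

lemma zero : NoSix fun _ => 0 :=
  ⟨0, ⟨⟨0, fun _ _ => rfl⟩, by simp⟩, fun _ _ => rfl⟩

lemma add (hf : NoSix f) (hg : NoSix g) : NoSix fun w => f w + g w := by
  obtain ⟨a, ha, ha0⟩ := hf
  obtain ⟨b, hb, hb0⟩ := hg
  exact ⟨_, ha.add hb, fun n hn => by rw [ha0 n hn, hb0 n hn, add_zero]⟩

lemma const_mul (hf : NoSix f) (c : ℂ) : NoSix fun w => c * f w := by
  obtain ⟨a, ha, ha0⟩ := hf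
  exact ⟨_, ha.const_mul c, fun n hn => by rw [ha0 n hn, mul_zero]⟩

lemma list_sum {ι : Type*} (l : List ι) {F : ι → ℝ → ℂ} (h : ∀ i ∈ l, NoSix (F i)) :
    NoSix fun w => (l.map fun i => F i w).sum := by
  induction l with
  | nil => simpa using zero
  | cons i l ih =>
    simp only [List.map_cons, List.sum_cons]
    exact (h i List.mem_cons_self).add (ih fun j hj => h j (List.mem_cons_of_mem i hj))

lemma sum {ι : Type*} (s : Finset ι) {F : ι → ℝ → ℂ} (h : ∀ i ∈ s, NoSix (F i)) :
    NoSix fun w => ∑ i ∈ s, F i w := by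
  classical
  induction s using Finset.induction_on with
  | empty => simpa using zero
  | insert i s hi ih =>
    simp only [sum_insert hi]
    exact (h i (mem_insert_self i s)).add (ih fun j hj => h j (mem_insert_of_mem hj))

end NoSix

/-- `f` is a power of `q ^ (1 / 24)` with exponent in the class `k`, times an analytic function
of `q ^ 11`. -/
def InClass (k : ZMod 264) (f : ℝ → ℂ) : Prop :=
  ∃ k' : ℤ, (k' : ZMod 264) = k ∧ ∃ g : ℂ → ℂ, AnalyticAt ℂ g 0 ∧
    ∀ᶠ w : ℝ in atBot, f w = qpow w (k' / 24) * g (qpow w 11)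

/-- As `InClass`, with an analytic function that does not vanish at 0. -/
def UnitInClass (k : ZMod 264) (f : ℝ → ℂ) : Prop :=
  ∃ k' : ℤ, (k' : ZMod 264) = k ∧ ∃ g : ℂ → ℂ, AnalyticAt ℂ g 0 ∧ g 0 ≠ 0 ∧
    ∀ᶠ w : ℝ in atBot, f w = qpow w (k' / 24) * g (qpow w 11)

lemma UnitInClass.inClass {k : ZMod 264} {f : ℝ → ℂ} (h : UnitInClass k f) : InClass k f := by
  obtain ⟨k', hk, g, hg, -, hf⟩ := h
  exact ⟨k', hk, g, hg, hf⟩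

lemma tendsto_qpow_eleven : Tendsto (fun w => qpow w 11) atBot (𝓝 0) := by
  simpa using tendsto_qpow (x := 11) (by norm_num)

lemma qpow_nat_mul (w : ℝ) (n : ℕ) (x : ℂ) : qpow w (n * x) = qpow w x ^ n := by
  rw [qpow, qpow, ← Complex.exp_nat_mul]
  congr 1; ring

lemma InClass.noSix {k : ZMod 264} {f : ℝ → ℂ} (h : InClass k f) (hk : k ≠ 144) : NoSix f := by
  obtain ⟨k', rfl, g, ⟨p, hp⟩, hf⟩ := h
  rw [hasFPowerSeriesAt_iff] at hp
  have hinj : Function.Injective fun n : ℕ => k' + 264 * (n : ℤ) := fun a b hab => by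
    simp only at hab; omega
  refine ⟨_, HasLaurent.of_injective hinj (N := k') (c := p.coeff) (fun n => by omega) ?_, ?_⟩
  · filter_upwards [hf, tendsto_qpow_eleven.eventually hp] with w h1 h2
    rw [h1]
    rw [zero_add] at h2
    refine (h2.mul_left (qpow w (k' / 24))).congr_fun fun n => ?_
    rw [← qpow_nat_mul, smul_eq_mul, ← mul_assoc, ← qpow_add, mul_comm (p.coeff n)]
    congr 2
    push_cast; ring
  · intro n hn
    refine Function.extend_apply' _ _ _ ?_
    rintro ⟨m, rfl⟩
    apply hk
    rw [← hn]
    push_cast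
    rw [show (264 : ZMod 264) = 0 from by decide, zero_mul, add_zero]

namespace UnitInClass
variable {k l : ZMod 264} {f g : ℝ → ℂ}

lemma congr (hf : UnitInClass k f) (h : ∀ᶠ w in atBot, g w = f w) : UnitInClass k g := by
  obtain ⟨k', hk, p, hp, hp0, hf⟩ := hf
  refine ⟨k', hk, p, hp, hp0, ?_⟩
  filter_upwards [hf, h] with w h1 h2
  rw [h2, h1]

lemma qpow_div (n : ℤ) : UnitInClass n fun w => qpow w (n / 24) :=
  ⟨n, rfl, fun _ => 1, analyticAt_const, one_ne_zero, by simp⟩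

lemma one : UnitInClass 0 fun _ => 1 := by simpa [qpow_zero] using qpow_div 0

lemma mul (hf : UnitInClass k f) (hg : UnitInClass l g) :
    UnitInClass (k + l) fun w => f w * g w := by
  obtain ⟨k', rfl, p, hp, hp0, hf⟩ := hf
  obtain ⟨l', rfl, r, hr, hr0, hg⟩ := hg
  refine ⟨k' + l', by push_cast; rfl, fun z => p z * r z, hp.mul hr, mul_ne_zero hp0 hr0, ?_⟩
  filter_upwards [hf, hg] with w h1 h2
  rw [h1, h2, show (((k' + l' : ℤ) : ℂ)) / 24 = k' / 24 + l' / 24 by push_cast; ring, qpow_add]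
  ring

lemma inv (hf : UnitInClass k f) : UnitInClass (-k) fun w => (f w)⁻¹ := by
  obtain ⟨k', rfl, p, hp, hp0, hf⟩ := hf
  refine ⟨-k', by push_cast; rfl, fun z => (p z)⁻¹, hp.inv hp0, inv_ne_zero hp0, ?_⟩
  filter_upwards [hf] with w h1
  rw [h1, mul_inv, show (((-k' : ℤ) : ℂ)) / 24 = -(k' / 24) by push_cast; ring, qpow_neg]

lemma const_mul (hf : UnitInClass k f) {c : ℂ} (hc : c ≠ 0) : UnitInClass k fun w => c * f w := by
  obtain ⟨k', rfl, p, hp, hp0, hf⟩ := hf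
  refine ⟨k', rfl, fun z => c * p z, analyticAt_const.mul hp, mul_ne_zero hc hp0, ?_⟩
  filter_upwards [hf] with w h1
  rw [h1]; ring

lemma pow (hf : UnitInClass k f) (n : ℕ) : UnitInClass (n * k) fun w => f w ^ n := by
  induction n with
  | zero => simpa using one
  | succ n ih =>
    have := ih.mul hf
    rw [show (n : ZMod 264) * k + k = (n + 1 : ℕ) * k by push_cast; ring] at this
    simpa only [pow_succ] using this

lemma zpow (hf : UnitInClass k f) (n : ℤ) : UnitInClass (n * k) fun w => f w ^ n := by
  obtain ⟨m, rfl | rfl⟩ := n.eq_nat_or_neg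
  · simpa using hf.pow m
  · simpa using (hf.pow m).inv

lemma prod {ι : Type*} (s : Finset ι) {κ : ι → ZMod 264} {F : ι → ℝ → ℂ}
    (h : ∀ i ∈ s, UnitInClass (κ i) (F i)) :
    UnitInClass (∑ i ∈ s, κ i) fun w => ∏ i ∈ s, F i w := by
  classical
  induction s using Finset.induction_on with
  | empty => simpa using one
  | insert i s hi ih =>
    simp only [sum_insert hi, prod_insert hi]
    exact (h i (mem_insert_self i s)).mul (ih fun j hj => h j (mem_insert_of_mem hj))

end UnitInClass

lemma summable_half_pow_natAbs : Summable fun n : ℤ => (1 / 2 : ℝ) ^ n.natAbs := by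
  have h := summable_geometric_of_lt_one (r := (1 / 2 : ℝ)) (by norm_num) (by norm_num)
  exact Summable.of_nat_of_neg (by simpa using h) (by simpa using h)

lemma UnitInClass.tsum {k : ℤ} {f : ℝ → ℂ} {N : ℤ → ℤ} {h : ℤ → ℂ → ℂ} (hN : ∀ i, |i| ≤ N i)
    (hN0 : N 0 = 0) (hd : ∀ i, DifferentiableOn ℂ (h i) (Metric.ball 0 (1 / 2)))
    (hb : ∀ i, ∀ z ∈ Metric.ball (0 : ℂ) (1 / 2), ‖h i z‖ ≤ 2) (h0 : h 0 0 ≠ 0)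
    (hf : ∀ᶠ w : ℝ in atBot,
      f w = ∑' i, qpow w (k / 24) * (qpow w (11 * N i) * h i (qpow w 11))) :
    UnitInClass k f := by
  have hnat : ∀ i, i.natAbs ≤ (N i).toNat := fun i => by
    have := hN i
    rw [Int.abs_eq_natAbs] at this
    omega
  refine ⟨k, rfl, fun z => ∑' i, z ^ (N i).toNat * h i z, ?_, ?_, ?_⟩
  · refine DifferentiableOn.analyticAt (s := Metric.ball 0 (1 / 2)) ?_
      (Metric.ball_mem_nhds 0 (by norm_num))
    refine Complex.differentiableOn_tsum_of_summable_norm (summable_half_pow_natAbs.mul_right 2)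
      (fun i => ((differentiable_id.pow _).differentiableOn).mul (hd i)) Metric.isOpen_ball
      fun i z hz => ?_
    have hz' : ‖z‖ ≤ 1 / 2 := (mem_ball_zero_iff.mp hz).le
    rw [norm_mul, norm_pow]
    refine mul_le_mul ?_ (hb i z hz) (norm_nonneg _) (by positivity)
    calc ‖z‖ ^ (N i).toNat ≤ (1 / 2) ^ (N i).toNat := by gcongr
      _ ≤ (1 / 2) ^ i.natAbs := pow_le_pow_of_le_one (by norm_num) (by norm_num) (hnat i)
  · beta_reduce
    rw [tsum_eq_single 0 fun i hi => by rw [zero_pow (by have := hnat i; omega), zero_mul]]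
    simpa [hN0] using h0
  · filter_upwards [hf] with w hw
    rw [hw, tsum_mul_left]
    congr 1
    refine tsum_congr fun i => ?_
    rw [← qpow_nat_mul]
    congr 2
    have : ((N i).toNat : ℤ) = N i := Int.toNat_of_nonneg ((abs_nonneg i).trans (hN i))
    rw [mul_comm, ← Int.cast_natCast, this]

lemma two_mul_half_mul_succ (n : ℤ) : 2 * (n * (n + 1) / 2) = n * (n + 1) :=
  Int.mul_ediv_cancel' (Int.even_mul_succ_self n).two_dvd

lemma abs_le_pentagonal {n a : ℤ} (ha : a ∈ Icc (1 : ℤ) 5) :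
    |n| ≤ 11 * (n * (n + 1) / 2) - a * n := by
  obtain ⟨h1, h5⟩ := mem_Icc.mp ha
  have h := two_mul_half_mul_succ n
  rcases le_total 0 n with hn | hn
  · rw [abs_of_nonneg hn]
    nlinarith [mul_nonneg hn (sub_nonneg.mpr h5), Int.le_self_sq n]
  · rw [abs_of_nonpos hn]
    rcases eq_or_ne n 0 with rfl | h0
    · simp
    · have : n ≤ -1 := by omega
      nlinarith

lemma theta_neg_unitInClass {a : ℤ} (ha : a ∈ Icc (1 : ℤ) 5) :
    UnitInClass ((3 * (11 - 2 * a) ^ 2 : ℤ)) fun w => theta w (-a) := by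
  refine UnitInClass.tsum (N := fun n => 11 * (n * (n + 1) / 2) - a * n)
    (h := fun n _ => (-1) ^ n) (fun n => abs_le_pentagonal ha) (by simp)
    (fun n => differentiableOn_const _) (fun n z _ => ?_) (by simp) (Eventually.of_forall fun w => ?_)
  · rw [norm_zpow, norm_neg, norm_one, one_zpow]; norm_num
  · refine tsum_congr fun n => ?_
    rw [← mul_assoc (qpow w _), ← qpow_add, mul_comm ((-1 : ℂ) ^ n)]
    congr 2
    have h : (2 : ℂ) * ((n * (n + 1) / 2 : ℤ) : ℂ) = n * (n + 1) := by
      exact_mod_cast two_mul_half_mul_succ n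
    push_cast
    linear_combination (-121 / 2 : ℂ) * h

lemma neg_one_zpow_ne_zero (n : ℤ) : (-1 : ℂ) ^ n ≠ 0 := zpow_ne_zero n (by norm_num)

lemma tval_unitInClass {n : ℤ} (hn : ¬ 11 ∣ n) :
    UnitInClass ((3 * (11 - 2 * n) ^ 2 : ℤ)) fun w => tval w n := by
  have hcl : ∀ k l : ℤ, (264 : ℤ) ∣ k - l → (k : ZMod 264) = l := fun k l h =>
    ((ZMod.intCast_eq_intCast_iff_dvd_sub l k 264).mpr (by exact_mod_cast h)).symm
  have key : ∀ a ∈ Icc (1 : ℤ) 5, ∀ m : ℤ, UnitInClass ((3 * (11 - 2 * (a + 11 * m)) ^ 2 : ℤ))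
      fun w => theta w ((a : ℂ) + 11 * m) := fun a ha m => by
    have h := ((theta_neg_unitInClass ha).const_mul (c := -(-1) ^ m)
      (neg_ne_zero.mpr (neg_one_zpow_ne_zero m)))
    rw [hcl _ (3 * (11 - 2 * (a + 11 * m)) ^ 2) ⟨- m * a - 11 * ((m - 1) * ((m - 1) + 1) / 2), by
      have := two_mul_half_mul_succ (m - 1)
      linear_combination (1452 : ℤ) * this⟩] at h
    refine h.congr (Eventually.of_forall fun w => ?_)
    rw [theta_add_eleven_mul, theta_neg]; ring
  obtain ⟨a, ha, m, h | h⟩ : ∃ a ∈ Icc (1 : ℤ) 5, ∃ m : ℤ, n = a + 11 * m ∨ n = -(a + 11 * m) := by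
    by_cases h5 : n % 11 ≤ 5
    · exact ⟨n % 11, mem_Icc.mpr ⟨by omega, h5⟩, n / 11, Or.inl (by omega)⟩
    · exact ⟨11 - n % 11, mem_Icc.mpr ⟨by omega, by omega⟩, -(n / 11) - 1, Or.inr (by omega)⟩
  · have := (key a ha m).const_mul (neg_one_zpow_ne_zero n)
    rw [← h] at this
    refine this.congr (Eventually.of_forall fun w => ?_)
    rw [tval, h]; push_cast; rfl
  · have hk := (key a ha m).const_mul (neg_ne_zero.mpr (neg_one_zpow_ne_zero n))
    rw [hcl _ (3 * (11 - 2 * n) ^ 2) ⟨n, by rw [h]; ring⟩] at hk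
    refine hk.congr (Eventually.of_forall fun w => ?_)
    rw [tval, neg_mul, ← mul_neg, ← theta_neg, h]; push_cast; rfl

lemma two_mul_half_mul_three_sub_one (n : ℤ) : 2 * (n * (3 * n - 1) / 2) = n * (3 * n - 1) := by
  refine Int.mul_ediv_cancel' (Even.two_dvd ?_)
  rcases Int.even_or_odd n with h | h
  · exact h.mul_right _
  · obtain ⟨k, rfl⟩ := h
    exact Even.mul_left ⟨3 * k + 1, by ring⟩ _

lemma ezero_unitInClass : UnitInClass 121 ezero := by
  refine UnitInClass.tsum (k := 121) (N := fun n => 11 * (n * (3 * n - 1) / 2))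
    (h := fun n _ => (-1) ^ n) (fun n => ?_) (by simp)
    (fun n => differentiableOn_const _) (fun n z _ => ?_) (by simp) (Eventually.of_forall fun w => ?_)
  · have h := two_mul_half_mul_three_sub_one n
    rcases le_total 0 n with hn | hn
    · rw [abs_of_nonneg hn]
      rcases eq_or_ne n 0 with rfl | h0
      · simp
      · have : 1 ≤ n := by omega
        nlinarith
    · rw [abs_of_nonpos hn]; nlinarith
  · rw [norm_zpow, norm_neg, norm_one, one_zpow]; norm_num
  · refine tsum_congr fun n => ?_
    rw [← mul_assoc (qpow w _), ← qpow_add, mul_comm ((-1 : ℂ) ^ n)]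
    congr 2
    have h : (2 : ℂ) * ((n * (3 * n - 1) / 2 : ℤ) : ℂ) = n * (3 * n - 1) := by
      exact_mod_cast two_mul_half_mul_three_sub_one n
    push_cast
    linear_combination (-121 / 2 : ℂ) * h

lemma bracket_inv_of_pos {w : ℝ} {l : ℤ} :
    (bracket w l)⁻¹ = qpow w (11 / 2 * l) / (1 - qpow w (11 * l)) := by
  have e : bracket w l = (qpow w (11 / 2 * l))⁻¹ * (1 - qpow w (11 * l)) := by
    rw [bracket, mul_sub, mul_one, qpow_neg, ← qpow_neg, ← qpow_add]
    congr 2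
    ring
  rw [e, mul_inv, inv_inv, div_eq_mul_inv (qpow _ _)]

lemma bracket_inv {w : ℝ} {l : ℤ} (hl : l ≠ 0) :
    (bracket w l)⁻¹ = l.sign * (qpow w (11 / 2 * (l.natAbs : ℂ)) /
      (1 - qpow w 11 ^ l.natAbs)) := by
  rw [← qpow_nat_mul, mul_comm (l.natAbs : ℂ) 11]
  have hc : ((l.natAbs : ℂ)) = ((|l| : ℤ) : ℂ) := Nat.cast_natAbs l
  rw [hc]
  rcases hl.lt_or_gt with h | h
  · rw [Int.sign_eq_neg_one_of_neg h, abs_of_neg h, ← bracket_inv_of_pos, Int.cast_neg l, bracket_neg]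
    simp [inv_neg]
  · rw [Int.sign_eq_one_of_pos h, abs_of_pos h, ← bracket_inv_of_pos]
    simp

lemma psum_unitInClass {c : ℤ} (hc : c ∈ Icc (1 : ℤ) 5) :
    UnitInClass ((132 * c : ℤ)) fun w => psum w 0 c := by
  obtain ⟨h1, h5⟩ := mem_Icc.mp hc
  have hne : ∀ m : ℤ, c + 11 * m ≠ 0 := fun m => by omega
  have hlt : ∀ (m : ℤ), ∀ z ∈ Metric.ball (0 : ℂ) (1 / 2), ‖z ^ (c + 11 * m).natAbs‖ ≤ 1 / 2 :=
    fun m z hz => by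
      have hz' : ‖z‖ ≤ 1 / 2 := (mem_ball_zero_iff.mp hz).le
      have := hne m
      rw [norm_pow]
      exact (pow_le_of_le_one (norm_nonneg z) (hz'.trans (by norm_num)) (by omega)).trans hz'
  have hnorm : ∀ (m : ℤ), ∀ z ∈ Metric.ball (0 : ℂ) (1 / 2),
      1 / 2 ≤ ‖1 - z ^ (c + 11 * m).natAbs‖ := fun m z hz => by
    have := norm_sub_norm_le (1 : ℂ) (z ^ (c + 11 * m).natAbs)
    rw [norm_one] at this
    linarith [hlt m z hz]
  have hN : ∀ m : ℤ, ∃ N : ℤ, 2 * N = 33 * m ^ 2 + |c + 11 * m| - c ∧ |m| ≤ N := fun m => by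
    have e := two_mul_half_mul_three_sub_one m
    rcases le_or_gt 0 m with h | h
    · refine ⟨11 * (m * (3 * m - 1) / 2) + 11 * m, ?_, ?_⟩
      · rw [abs_of_nonneg (by omega)]; linear_combination (11 : ℤ) * e
      · rw [abs_of_nonneg h]; nlinarith
    · refine ⟨11 * (m * (3 * m - 1) / 2) - c, ?_, ?_⟩
      · rw [abs_of_neg (by omega)]; linear_combination (11 : ℤ) * e
      · rw [abs_of_neg h]; nlinarith
  choose N hN2 hN using hN
  refine UnitInClass.tsum (N := N)
    (h := fun m z => (-1) ^ m * (((c + 11 * m).sign : ℂ) / (1 - z ^ (c + 11 * m).natAbs)))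
    hN (by have := hN2 0; rw [mul_zero, add_zero, abs_of_pos (by omega)] at this; omega)
    (fun m => ?_) (fun m z hz => ?_) ?_ (Eventually.of_forall fun w => ?_)
  · refine DifferentiableOn.const_mul (DifferentiableOn.div (differentiableOn_const _)
      ((differentiableOn_const _).sub (differentiable_id.pow _).differentiableOn) fun z hz => ?_) _
    exact norm_pos_iff.mp (lt_of_lt_of_le (by norm_num) (hnorm m z hz))
  · rw [norm_mul, norm_zpow, norm_neg, norm_one, one_zpow, one_mul, norm_div]
    have hs : ‖(((c + 11 * m).sign : ℤ) : ℂ)‖ = 1 := by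
      rcases (hne m).lt_or_gt with h | h
      · rw [Int.sign_eq_neg_one_of_neg h]; simp
      · rw [Int.sign_eq_one_of_pos h]; simp
    rw [hs, div_le_iff₀ (lt_of_lt_of_le (by norm_num) (hnorm m z hz))]
    linarith [hnorm m z hz]
  · have : c.natAbs ≠ 0 := by omega
    rw [mul_zero, add_zero, Int.sign_eq_one_of_pos (by omega), zero_pow this]; simp
  · refine tsum_congr fun m => ?_
    rw [psum_term, div_eq_mul_inv _ (bracket _ _)]
    have e : (c : ℂ) + ((0 : ℤ) + 11 * m) = ((c + 11 * m : ℤ) : ℂ) := by push_cast; ring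
    rw [e, bracket_inv (hne m)]
    have hq : qpow w (3 / 2 * (((0 : ℤ) : ℂ) + 11 * m) ^ 2) *
        qpow w (11 / 2 * ((c + 11 * m).natAbs : ℂ)) =
        qpow w (((132 * c : ℤ) : ℂ) / 24) * qpow w (11 * N m) := by
      rw [← qpow_add, ← qpow_add]
      congr 1
      have h : (2 : ℂ) * N m = 33 * m ^ 2 + ((c + 11 * m).natAbs : ℂ) - c := by
        rw [Nat.cast_natAbs]; exact_mod_cast hN2 m
      push_cast
      linear_combination (-11 / 2 : ℂ) * h
    rw [div_eq_mul_inv _ (1 - qpow w 11 ^ _)]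
    linear_combination ((-1) ^ m * ((c + 11 * m).sign : ℂ) *
      (1 - qpow w 11 ^ (c + 11 * m).natAbs)⁻¹) * hq

lemma mock_noSix {c : ℤ} (hc : c ∈ Icc (1 : ℤ) 5) :
    NoSix fun w => qpow w (1 / 24) * mock w c := by
  have h := (((UnitInClass.qpow_div (1 - 36 * c ^ 2)).mul (psum_unitInClass hc)).mul
    ezero_unitInClass.inv).const_mul (neg_one_zpow_ne_zero c)
  refine (h.congr (g := fun w => qpow w (1 / 24) * mock w c)
    (Eventually.of_forall fun w => ?_)).inClass.noSix ?_
  · have e : qpow w (((1 - 36 * c ^ 2 : ℤ) : ℂ) / 24) =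
        qpow w (1 / 24) * qpow w (-(3 / 2 * c ^ 2)) := by
      rw [← qpow_add]; congr 1; push_cast; ring
    rw [e, mock, div_eq_mul_inv]; ring
  · obtain ⟨h1, h5⟩ := mem_Icc.mp hc
    interval_cases c <;> decide

lemma coords_unitInClass {c : ℤ} (hc : ¬ 11 ∣ c) (i : Fin 5) :
    UnitInClass ((3 * (11 - 2 * (c * (i + 1))) ^ 2 : ℤ))
      fun w => coords (fun a => tval w (c * a)) i := by
  have h : ∀ a ∈ Icc (1 : ℤ) 5, UnitInClass ((3 * (11 - 2 * (c * a)) ^ 2 : ℤ))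
      fun w => tval w (c * a) := fun a ha => by
    refine tval_unitInClass fun hd => ?_
    rcases (Int.prime_iff_natAbs_prime.mpr (by norm_num)).dvd_or_dvd hd with h1 | h1
    · exact hc h1
    · have := mem_Icc.mp ha
      omega
  fin_cases i
  · exact h 1 (by decide)
  · simpa [coords] using (h 2 (by decide)).const_mul (c := -1) (by norm_num)
  · exact h 3 (by decide)
  · simpa [coords] using (h 4 (by decide)).const_mul (c := -1) (by norm_num)
  · exact h 5 (by decide)

lemma mon_unitInClass {c : ℤ} (hc : ¬ 11 ∣ c) (e : Fin 5 → ℤ) :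
    UnitInClass ((∑ i, e i * (3 * (11 - 2 * (c * (i + 1))) ^ 2) : ℤ))
      fun w => mon (coords fun a => tval w (c * a)) e := by
  have := UnitInClass.prod univ fun i _ => (coords_unitInClass hc i).zpow (e i)
  push_cast at this ⊢
  exact this

lemma wTerms_class : ∀ τ ∈ wTerms, ∀ c ∈ Icc (1 : ℤ) 5,
    ((1 + 121 * τ.2.1 + ∑ i, τ.2.2 i * (3 * (11 - 2 * (c * (i + 1))) ^ 2) : ℤ)) % 264 ≠ 144 := by
  decide

lemma wRest_noSix {c : ℤ} (hc : c ∈ Icc (1 : ℤ) 5) :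
    NoSix fun w => qpow w (1 / 24) * wRest (coords fun a => tval w (c * a)) (ezero w) := by
  have hc' : ¬ 11 ∣ c := fun h => by have := mem_Icc.mp hc; omega
  simp only [wRest, ← List.sum_map_mul_left]
  refine NoSix.list_sum wTerms fun τ hτ => ?_
  have h := ((UnitInClass.qpow_div 1).mul (ezero_unitInClass.pow τ.2.1)).mul
    (mon_unitInClass hc' τ.2.2)
  refine ((h.inClass.noSix fun hk => wTerms_class τ hτ c hc ?_).const_mul τ.1).congr
    (Eventually.of_forall fun w => ?_)
  · have : (((1 + 121 * τ.2.1 + ∑ i, τ.2.2 i * (3 * (11 - 2 * (c * (i + 1))) ^ 2) : ℤ)) : ZMod 264)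
        = ((144 : ℤ) : ZMod 264) := by
      rw [Int.cast_add, Int.cast_add, Int.cast_mul, mul_comm]
      push_cast at hk ⊢
      rw [← hk]
    exact (ZMod.intCast_eq_intCast_iff' _ _ 264).mp this
  · push_cast
    ring

lemma thetaQuot_noSix {c : ℤ} (hc : c ∈ Icc (1 : ℤ) 5) :
    NoSix fun w => qpow w (1 / 24) * (mock w c + thetaQuot w c) -
      qpow w (1 / 24) * wSix (coords fun a => tval w (c * a)) (ezero w) := by
  refine ((mock_noSix hc).add (wRest_noSix hc)).congr (Eventually.of_forall fun w => ?_)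
  rw [thetaQuot]
  ring

lemma qpow_noSix {n : ℤ} (hn : (n : ZMod 264) ≠ 144) : NoSix fun w => qpow w (n / 24) :=
  (UnitInClass.qpow_div n).inClass.noSix hn

/-- `f` is `q ^ 6` times a power series in `q ^ 11` with nonnegative coefficients. -/
def PosSix (f : ℝ → ℂ) : Prop :=
  ∃ F, PosSeries F ∧ ∀ᶠ w : ℝ in atBot, f w = qpow w 6 * (F (Real.exp (w * 11)) : ℝ)

namespace PosSix
variable {f g : ℝ → ℂ}

lemma add (hf : PosSix f) (hg : PosSix g) : PosSix fun w => f w + g w := by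
  obtain ⟨F, hF, hf⟩ := hf
  obtain ⟨G, hG, hg⟩ := hg
  refine ⟨_, hF.add hG, ?_⟩
  filter_upwards [hf, hg] with w h1 h2
  rw [h1, h2]; push_cast; ring

lemma nat_mul (hf : PosSix f) (n : ℕ) : PosSix fun w => n * f w := by
  obtain ⟨F, hF, hf⟩ := hf
  refine ⟨_, hF.const_mul n.cast_nonneg, ?_⟩
  filter_upwards [hf] with w h1
  rw [h1]; push_cast; ring

lemma hasLaurent (hf : PosSix f) : ∃ a, HasLaurent f a ∧ ∀ m : ℕ, ∃ r : ℝ, 0 ≤ r ∧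
    a (144 + 264 * m) = r := by
  obtain ⟨F, ⟨c, hc, hs⟩, hf⟩ := hf
  have hinj : Function.Injective fun n : ℕ => 144 + 264 * (n : ℤ) := fun a b hab => by
    simp only at hab; omega
  refine ⟨_, HasLaurent.of_injective hinj (N := 144) (c := fun n => (c n : ℂ))
    (fun n => by omega) ?_, fun m => ⟨c m, hc m, hinj.extend_apply _ _ m⟩⟩
  filter_upwards [hf, eventually_lt_atBot 0] with w h1 hw
  have h2 := hs (Real.exp (w * 11)) (Real.exp_pos _) (exp_lt_one_of_neg (by linarith))
  rw [h1]
  refine ((Complex.hasSum_ofReal.mpr h2).mul_left (qpow w 6)).congr_fun fun n => ?_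
  have e : qpow w (((144 + 264 * (n : ℤ) : ℤ) : ℂ) / 24) = qpow w 6 * qpow w 11 ^ n := by
    rw [← qpow_nat_mul, ← qpow_add]; congr 1; push_cast; ring
  have e' : qpow w 11 = (Real.exp (w * 11) : ℝ) := by
    rw [← qpow_ofReal]; norm_num
  rw [e, e']
  push_cast
  ring

end PosSix

lemma thetaAbs_eq (w : ℝ) (k : ℕ) (hk : k ≤ 11) : thetaAbs w k =
    Real.exp (w * (1 / 8 * (11 - 2 * k) ^ 2)) * (pairProd k (Real.exp (w * 11)) *
      poch (Real.exp (w * 11) ^ 11) (Real.exp (w * 11) ^ 11)) := by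
  have e : ∀ n : ℕ, Real.exp (w * 11) ^ n = Real.exp (w * (11 * n)) := fun n => by
    rw [← Real.exp_nat_mul]; congr 1; ring
  rw [thetaAbs, pairProd, nome]
  simp only [e]
  rw [mul_comm (poch _ _) (poch (Real.exp (w * (11 * (k : ℝ)))) _), Nat.cast_sub hk]
  push_cast
  congr 2 <;> ring_nf

lemma coords_tval (w : ℝ) (hw : w < 0) (i : Fin 5) :
    coords (tval w) i = (thetaAbs w ((i + 1 : ℕ)) : ℝ) := by
  have h := fun a : ℝ => theta_ofReal hw a
  fin_cases i
  · simpa [coords, tval] using congrArg Neg.neg (h 1)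
  · simpa [coords, tval] using congrArg Neg.neg (h 2)
  · simpa [coords, tval, Odd.neg_one_zpow (show Odd (3 : ℤ) by decide)] using congrArg Neg.neg (h 3)
  · simpa [coords, tval, Even.neg_one_zpow (show Even (4 : ℤ) by decide)] using
      congrArg Neg.neg (h 4)
  · simpa [coords, tval, Odd.neg_one_zpow (show Odd (5 : ℤ) by decide)] using congrArg Neg.neg (h 5)

lemma prod_zpow_exponents {P : ℝ} (hP : P ≠ 0) (e : Fin 5 → ℤ) :
    ∏ i, P ^ e i = P ^ (∑ i, e i) := by
  simp only [Fin.prod_univ_five, Fin.sum_univ_five, zpow_add₀ hP]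

lemma mon_posSix {e : Fin 5 → ℤ} (s : ℕ) (he : ∀ i, e i ≤ 0) (hsum : ∑ i, e i = -13)
    (hk : ∃ k, e k ≤ -2)
    (hs : 1695 + ∑ i, e i * (3 * (11 - 2 * (i + 1)) ^ 2) = 144 + 264 * (s : ℤ)) :
    PosSix fun w => qpow w (1 / 24) * (ezero w ^ 14 * mon (coords (tval w)) e) := by
  obtain ⟨k, hk⟩ := hk
  refine ⟨_, (PosSeries.pow_id s).mul
    (PosSeries.poch_mul_prod (fun i => (e i).natAbs) k (by omega)), ?_⟩
  filter_upwards [eventually_lt_atBot 0] with w hw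
  have h0 : 0 < Real.exp (w * 11) := Real.exp_pos _
  have h1 : Real.exp (w * 11) < 1 := exp_lt_one_of_neg (by linarith)
  have hE : ezeroR w = Real.exp (w * (121 / 24)) *
      poch (Real.exp (w * 11) ^ 11) (Real.exp (w * 11) ^ 11) := by
    rw [ezeroR, nome, ← Real.exp_nat_mul]
    congr 3 <;> ring_nf
  have hP : 0 < poch (Real.exp (w * 11) ^ 11) (Real.exp (w * 11) ^ 11) :=
    poch_pos (by positivity) (pow_lt_one₀ h0.le h1 (by norm_num))
      (pow_lt_one₀ h0.le h1 (by norm_num))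
  have ht : ∀ i : Fin 5, thetaAbs w ((i + 1 : ℕ)) ^ e i =
      Real.exp (w * (e i * (1 / 8 * (11 - 2 * ((i : ℝ) + 1)) ^ 2))) *
        (pairProd (i + 1) (Real.exp (w * 11)))⁻¹ ^ (e i).natAbs *
        poch (Real.exp (w * 11) ^ 11) (Real.exp (w * 11) ^ 11) ^ e i := fun i => by
    rw [thetaAbs_eq w _ (by omega), mul_zpow, mul_zpow, ← Real.rpow_intCast (Real.exp _),
      ← Real.exp_mul]
    have hn : e i = -((e i).natAbs : ℤ) := by have := he i; omega
    have hz : ∀ x : ℝ, x ^ e i = x⁻¹ ^ (e i).natAbs := fun x => by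
      conv_lhs => rw [hn]
      rw [zpow_neg, zpow_natCast, inv_pow]
    rw [hz (pairProd _ _), ← mul_assoc]
    congr 3
    push_cast; ring
  have hx : 1 / 24 + 14 * (121 / 24) + ∑ i : Fin 5, ((e i : ℝ) * (1 / 8 * (11 - 2 * ((i : ℝ) + 1)) ^ 2)) =
      (6 : ℝ) + s * 11 := by
    have := congrArg (Int.cast : ℤ → ℝ) hs
    push_cast at this
    simp only [Fin.sum_univ_five] at this ⊢
    linear_combination this / 24
  have key : Real.exp (w * (1 / 24)) * (ezeroR w ^ 14 * ∏ i : Fin 5, thetaAbs w ((i + 1 : ℕ)) ^ e i)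
      = Real.exp (w * 6) * (Real.exp (w * 11) ^ s *
        (poch (Real.exp (w * 11) ^ 11) (Real.exp (w * 11) ^ 11) *
          ∏ i : Fin 5, (pairProd (i + 1) (Real.exp (w * 11)))⁻¹ ^ (e i).natAbs)) := by
    simp only [ht, prod_mul_distrib, prod_zpow_exponents hP.ne', hsum, hE, ← Real.exp_sum]
    have hq : Real.exp (w * (1 / 24)) * Real.exp (w * (121 / 24)) ^ 14 *
        Real.exp (∑ i : Fin 5, w * ((e i : ℝ) * (1 / 8 * (11 - 2 * ((i : ℝ) + 1)) ^ 2))) =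
        Real.exp (w * 6) * Real.exp (w * 11) ^ s := by
      rw [← Real.exp_nat_mul, ← Real.exp_nat_mul, ← Real.exp_add, ← Real.exp_add, ← Real.exp_add,
        ← mul_sum]
      congr 1
      push_cast
      linear_combination w * hx
    generalize poch (Real.exp (w * 11) ^ 11) (Real.exp (w * 11) ^ 11) = P at hP ⊢
    have hPP : P ^ 14 * P ^ (-13 : ℤ) = P := by
      rw [← zpow_natCast, ← zpow_add₀ hP.ne']; norm_num
    rw [mul_pow]
    generalize ∏ i : Fin 5, (pairProd (i + 1) (Real.exp (w * 11)))⁻¹ ^ (e i).natAbs = Z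
    generalize Real.exp (∑ i : Fin 5, w * ((e i : ℝ) * (1 / 8 * (11 - 2 * ((i : ℝ) + 1)) ^ 2))) = X at hq ⊢
    calc _ = Real.exp (w * (1 / 24)) * Real.exp (w * (121 / 24)) ^ 14 * X *
          (P ^ 14 * P ^ (-13 : ℤ)) * Z := by ring
      _ = _ := by rw [hq, hPP]; ring
  have hc := congrArg (fun x : ℝ => (x : ℂ)) key
  have hq : ∀ x : ℝ, ((Real.exp (w * x) : ℝ) : ℂ) = qpow w x := fun x => (qpow_ofReal w x).symm
  have hm : mon (coords (tval w)) e = ∏ i : Fin 5, ((thetaAbs w ((i + 1 : ℕ)) : ℝ) : ℂ) ^ e i :=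
    prod_congr rfl fun i _ => by rw [coords_tval w hw]
  rw [hm, ezero_eq hw]
  rw [Complex.ofReal_mul, Complex.ofReal_mul (Real.exp (w * 6)), hq, hq] at hc
  rw [Complex.ofReal_mul (ezeroR w ^ 14), Complex.ofReal_pow, Complex.ofReal_prod] at hc
  simp only [Complex.ofReal_zpow] at hc
  push_cast at hc ⊢
  exact hc

/-- The integer combination of the first six residue classes with coefficients `v`. -/
def rankComb (v : Fin 6 → ℤ) (n : ℕ) : ℤ := ∑ a : Fin 6, v a * rankCount (a : ℕ) 11 n

noncomputable def rankCombGF (v : Fin 6 → ℤ) (w : ℝ) : ℝ :=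
  ∑ a : Fin 6, v a * (partGF w * (lambert (5 - (a : ℕ)) w - lambert (6 - (a : ℕ)) w))

lemma hasSum_rankComb (v : Fin 6 → ℤ) {w : ℝ} (hw : w ≤ -1) :
    HasSum (fun n : ℕ => (if n = 0 then 0 else (rankComb v n : ℝ)) * Real.exp (w * n))
      (rankCombGF v w) := by
  refine (hasSum_sum fun (a : Fin 6) _ =>
    (hasSum_rankCount hw a (by omega)).mul_left (v a : ℝ)).congr_fun fun n => ?_
  rw [rankComb]
  split_ifs
  · simp
  · push_cast
    rw [sum_mul]
    exact sum_congr rfl fun a _ => by ring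

/-- The part of `dlam w (3 * c) + 3 * c / 11` other than the factor `pent w`. -/
noncomputable def shiftedSum (w : ℝ) (c : ℤ) : ℂ := qpow w (1 / 24) * (mock w c + thetaQuot w c)

lemma partGF_mul_dlam {w : ℝ} (hw : w ≤ -1) {c : ℤ} (hc : c ∈ Icc (1 : ℤ) 5) :
    (partGF w : ℂ) * (dlam w (3 * c) + 3 * c / 11) = shiftedSum w c := by
  have hp : (pent w : ℂ) * (partGF w : ℂ) = 1 := by exact_mod_cast pent_mul_partGF hw
  rw [dlam_eq_mock_add hw hc, thetaPart_eq hw hc, shiftedSum]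
  linear_combination qpow w (1 / 24) * (mock w c + thetaQuot w c) * hp

lemma rankCombGF_eq (v : Fin 6 → ℤ) (hv : ∑ a, v a = 0) {w : ℝ} (hw : w ≤ -1) :
    (rankCombGF v w : ℂ) = (v 2 - v 3) * shiftedSum w 1 + (v 1 - 2 * v 0) * shiftedSum w 2 +
      (v 4 - v 3) * shiftedSum w 3 + (v 4 - v 5) * shiftedSum w 4 +
      (v 1 - v 2) * shiftedSum w 5 + ((v 0 - v 1) * qpow w ((0 : ℤ) / 24) +
      (v 4 - v 3) * qpow w ((-48 : ℤ) / 24) + (v 5 - v 4) * qpow w ((-168 : ℤ) / 24) +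
      (v 1 - v 2) * qpow w ((-360 : ℤ) / 24)) := by
  have hp : (pent w : ℂ) * (partGF w : ℂ) = 1 := by exact_mod_cast pent_mul_partGF hw
  have s1 := partGF_mul_dlam hw (c := 1) (by decide)
  have s2 := partGF_mul_dlam hw (c := 2) (by decide)
  have s3 := partGF_mul_dlam hw (c := 3) (by decide)
  have s4 := partGF_mul_dlam hw (c := 4) (by decide)
  have s5 := partGF_mul_dlam hw (c := 5) (by decide)
  have r0 := dlam_sub hw 0
  have r1 := dlam_sub hw 1
  have r2 := dlam_sub hw 2
  have r3 := dlam_sub hw 3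
  have n5 := dlam_neg w 5
  have n2 := dlam_neg w 2
  have d0 := dlam_neg w 0
  have l : ∀ i : ℤ, ((lambert i w : ℝ) : ℂ) = dlam w i := fun i => lambert_eq_dlam hw i
  have l0 := l 0
  have l1 := l 1
  have l2 := l 2
  have l3 := l 3
  have l4 := l 4
  have l5 := l 5
  have l6 := l 6
  have hv' : (v 0 : ℂ) + v 1 + v 2 + v 3 + v 4 + v 5 = 0 := by
    rw [Fin.sum_univ_six] at hv
    exact_mod_cast hv
  rw [rankCombGF, Fin.sum_univ_six]
  norm_num at s1 s2 s3 s4 s5 r0 r1 r2 r3 n5 n2 d0 l0 l1 l2 l3 l4 l5 l6 ⊢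
  have d0' : dlam w 0 = 0 := by linear_combination d0 / 2
  rw [l0, l1, l2, l3, l4, l5, l6, d0']
  generalize (partGF w : ℂ) = G at *
  have e5 : G * (dlam w 5 + 5 / 11) = qpow w 0 - shiftedSum w 2 := by
    linear_combination G * r0 + G * n5 + qpow w 0 * hp - s2
  have e2 : G * (dlam w 2 + 2 / 11) = -qpow w (-2) - shiftedSum w 3 := by
    linear_combination G * r1 + G * n2 - qpow w (-2) * hp - s3
  have e1 : G * (dlam w 1 + 1 / 11) = shiftedSum w 4 - qpow w (-7) := by
    linear_combination -G * r2 - qpow w (-7) * hp + s4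
  have e4 : G * (dlam w 4 + 4 / 11) = shiftedSum w 5 + qpow w (-15) := by
    linear_combination -G * r3 + qpow w (-15) * hp + s5
  linear_combination (v 0 : ℂ) * (e5 - s2) + v 1 * (e4 - e5) + v 2 * (s1 - e4) + v 3 * (e2 - s1) +
    v 4 * (e1 - e2) - v 5 * e1 + G / 11 * hv'

lemma rankCombGF_noSix (v : Fin 6 → ℤ) (hv : ∑ a, v a = 0) :
    NoSix fun w => (rankCombGF v w : ℂ) - qpow w (1 / 24) *
      ((v 2 - v 3) * wSix (coords fun a => tval w (1 * a)) (ezero w) +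
        (v 1 - 2 * v 0) * wSix (coords fun a => tval w (2 * a)) (ezero w) +
        (v 4 - v 3) * wSix (coords fun a => tval w (3 * a)) (ezero w) +
        (v 4 - v 5) * wSix (coords fun a => tval w (4 * a)) (ezero w) +
        (v 1 - v 2) * wSix (coords fun a => tval w (5 * a)) (ezero w)) := by
  have h := fun (c : ℤ) (hc : c ∈ Icc (1 : ℤ) 5) (α : ℂ) => (thetaQuot_noSix hc).const_mul α
  have hq := fun (n : ℤ) (hn : (n : ZMod 264) ≠ 144) (α : ℂ) => (qpow_noSix hn).const_mul α
  refine ((((((h 1 (by decide) (v 2 - v 3)).add (h 2 (by decide) (v 1 - 2 * v 0))).add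
    (h 3 (by decide) (v 4 - v 3))).add (h 4 (by decide) (v 4 - v 5))).add
    (h 5 (by decide) (v 1 - v 2))).add ((((hq 0 (by decide) (v 0 - v 1)).add
    (hq (-48) (by decide) (v 4 - v 3))).add (hq (-168) (by decide) (v 5 - v 4))).add
    (hq (-360) (by decide) (v 1 - v 2)))).congr ?_
  filter_upwards [eventually_le_atBot (-1)] with w hw
  rw [rankCombGF_eq v hv hw]
  simp only [shiftedSum]
  ring

/-- A combination of the weight zero contributions with nonnegative coefficients bounds the
rank combination from below. -/
lemma rankComb_nonneg {v : Fin 6 → ℤ} (hv : ∑ a, v a = 0) {g : ℝ → ℂ} (hg : PosSix g)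
    (h : ∀ w ≤ -1, qpow w (1 / 24) *
      ((v 2 - v 3) * wSix (coords fun a => tval w (1 * a)) (ezero w) +
        (v 1 - 2 * v 0) * wSix (coords fun a => tval w (2 * a)) (ezero w) +
        (v 4 - v 3) * wSix (coords fun a => tval w (3 * a)) (ezero w) +
        (v 4 - v 5) * wSix (coords fun a => tval w (4 * a)) (ezero w) +
        (v 1 - v 2) * wSix (coords fun a => tval w (5 * a)) (ezero w)) = g w) (n : ℕ) :
    0 ≤ rankComb v (11 * n + 6) := by
  obtain ⟨a, ha, ha0⟩ := hg.hasLaurent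
  obtain ⟨b, hb, hb0⟩ := rankCombGF_noSix v hv
  have hinj : Function.Injective fun n : ℕ => 24 * (n : ℤ) := fun a b hab => by
    simp only at hab; omega
  have hr := HasLaurent.of_injective (f := fun w => (rankCombGF v w : ℂ)) hinj (N := 0)
    (c := fun n => ((if n = 0 then 0 else (rankComb v n : ℝ) : ℝ) : ℂ)) (fun n => by omega) (by
      filter_upwards [eventually_le_atBot (-1)] with w hw
      refine (Complex.hasSum_ofReal.mpr (hasSum_rankComb v hw)).congr_fun fun n => ?_
      rw [Complex.ofReal_mul, ← qpow_ofReal]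
      congr 2
      push_cast; ring)
  have hz := (hr.add (ha.const_mul (-1))).add (hb.const_mul (-1))
  have hz' := HasLaurent.eq_zero ⟨hz.1, by
    filter_upwards [hz.2, eventually_le_atBot (-1)] with w h1 hw
    rw [h w hw] at h1
    convert h1 using 1
    ring⟩
  have hn := congrFun hz' (144 + 264 * n)
  have hex := hinj.extend_apply
    (fun n => ((if n = 0 then 0 else (rankComb v n : ℝ) : ℝ) : ℂ)) 0 (11 * n + 6)
  obtain ⟨r, hr0, hr1⟩ := ha0 n
  have e : (144 + 264 * (n : ℤ)) = 24 * ((11 * n + 6 : ℕ) : ℤ) := by push_cast; ring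
  rw [hr1, hb0 _ (by push_cast; rw [show (264 : ZMod 264) = 0 from by decide]; ring), e, hex,
    if_neg (by omega)] at hn
  have : ((rankComb v (11 * n + 6) : ℝ) : ℂ) = (r : ℂ) := by
    simp only [Pi.zero_apply] at hn
    linear_combination hn
  have := Complex.ofReal_injective this
  exact_mod_cast this ▸ hr0

lemma vecSix_apply (a b c d e f : ℤ) :
    (![a, b, c, d, e, f] : Fin 6 → ℤ) 0 = a ∧ (![a, b, c, d, e, f] : Fin 6 → ℤ) 1 = b ∧
    (![a, b, c, d, e, f] : Fin 6 → ℤ) 2 = c ∧ (![a, b, c, d, e, f] : Fin 6 → ℤ) 3 = d ∧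
    (![a, b, c, d, e, f] : Fin 6 → ℤ) 4 = e ∧ (![a, b, c, d, e, f] : Fin 6 → ℤ) 5 = f :=
  ⟨rfl, rfl, rfl, rfl, rfl, rfl⟩

lemma rankComb_vecSix (a b c d e f : ℤ) (n : ℕ) :
    rankComb ![a, b, c, d, e, f] n = a * rankCount 0 11 n + b * rankCount 1 11 n +
      c * rankCount 2 11 n + d * rankCount 3 11 n + e * rankCount 4 11 n +
      f * rankCount 5 11 n := by
  rw [rankComb, Fin.sum_univ_six]
  rfl

lemma rankComb_nonneg_first (n : ℕ) : 0 ≤ rankComb ![1, -1, 0, 1, -1, 0] (11 * n + 6) := by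
  refine rankComb_nonneg (by decide) ((((mon_posSix (e := ![-2, -2, -2, -3, -4]) 2 (by decide) (by decide) (by decide)
    (by decide)).nat_mul 2).add
    ((mon_posSix (e := ![-2, -1, -4, -3, -3]) 2 (by decide) (by decide) (by decide)
    (by decide)).nat_mul 3)).add
    ((mon_posSix (e := ![0, -3, -3, -3, -4]) 3 (by decide) (by decide) (by decide)
    (by decide)).nat_mul 3)) (fun w hw => ?_) n
  have h := thetaSystem hw
  rw [ThetaSystem.wSix_one (tval w), h.wSix_two, h.wSix_three, h.wSix_four, h.wSix_five]
  norm_num [vecSix_apply]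
  linear_combination qpow w (1 / 24) * ezero w ^ 14 * h.unitSystem.first_combination

lemma rankComb_nonneg_second (n : ℕ) : 0 ≤ rankComb ![0, 1, 1, -1, 1, -2] (11 * n + 6) := by
  refine rankComb_nonneg (by decide) (((mon_posSix (e := ![-3, -3, 0, -4, -3]) 1 (by decide) (by decide) (by decide)
    (by decide)).nat_mul 1).add
    ((mon_posSix (e := ![-2, -3, -4, -2, -2]) 1 (by decide) (by decide) (by decide)
    (by decide)).nat_mul 6)) (fun w hw => ?_) n
  have h := thetaSystem hw
  rw [ThetaSystem.wSix_one (tval w), h.wSix_two, h.wSix_three, h.wSix_four, h.wSix_five]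
  norm_num [vecSix_apply]
  linear_combination qpow w (1 / 24) * ezero w ^ 14 * h.unitSystem.second_combination

lemma rankComb_nonneg_third (n : ℕ) : 0 ≤ rankComb ![0, -1, 1, 2, -1, -1] (11 * n + 6) := by
  refine rankComb_nonneg (by decide) ((((mon_posSix (e := ![-2, -2, -2, -3, -4]) 2 (by decide) (by decide) (by decide)
    (by decide)).nat_mul 5).add
    ((mon_posSix (e := ![-2, -1, -4, -3, -3]) 2 (by decide) (by decide) (by decide)
    (by decide)).nat_mul 2)).add
    ((mon_posSix (e := ![0, -3, -3, -3, -4]) 3 (by decide) (by decide) (by decide)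
    (by decide)).nat_mul 2)) (fun w hw => ?_) n
  have h := thetaSystem hw
  rw [ThetaSystem.wSix_one (tval w), h.wSix_two, h.wSix_three, h.wSix_four, h.wSix_five]
  norm_num [vecSix_apply]
  linear_combination qpow w (1 / 24) * ezero w ^ 14 * h.unitSystem.third_combination

lemma rankComb_nonneg_fourth (n : ℕ) : 0 ≤ rankComb ![1, 1, -1, 0, 1, -2] (11 * n + 6) := by
  refine rankComb_nonneg (by decide) ((((mon_posSix (e := ![-3, -2, -2, -4, -2]) 1 (by decide) (by decide) (by decide)
    (by decide)).nat_mul 3).add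
    ((mon_posSix (e := ![-2, -3, -4, -2, -2]) 1 (by decide) (by decide) (by decide)
    (by decide)).nat_mul 3)).add
    ((mon_posSix (e := ![-1, -3, -3, -4, -2]) 2 (by decide) (by decide) (by decide)
    (by decide)).nat_mul 2)) (fun w hw => ?_) n
  have h := thetaSystem hw
  rw [ThetaSystem.wSix_one (tval w), h.wSix_two, h.wSix_three, h.wSix_four, h.wSix_five]
  norm_num [vecSix_apply]
  linear_combination qpow w (1 / 24) * ezero w ^ 14 * h.unitSystem.fourth_combination

lemma rankComb_nonneg_fifth (n : ℕ) : 0 ≤ rankComb ![0, 0, -1, 3, 0, -2] (11 * n + 6) := by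
  refine rankComb_nonneg (by decide) ((((mon_posSix (e := ![-2, -2, -2, -3, -4]) 2 (by decide) (by decide) (by decide)
    (by decide)).nat_mul 4).add
    ((mon_posSix (e := ![-2, -1, -4, -3, -3]) 2 (by decide) (by decide) (by decide)
    (by decide)).nat_mul 1)).add
    ((mon_posSix (e := ![-1, -3, -3, -4, -2]) 2 (by decide) (by decide) (by decide)
    (by decide)).nat_mul 5)) (fun w hw => ?_) n
  have h := thetaSystem hw
  rw [ThetaSystem.wSix_one (tval w), h.wSix_two, h.wSix_three, h.wSix_four, h.wSix_five]
  norm_num [vecSix_apply]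
  linear_combination qpow w (1 / 24) * ezero w ^ 14 * h.unitSystem.fifth_combination

lemma rankComb_nonneg_sixth (n : ℕ) : 0 ≤ rankComb ![1, 0, -2, 2, 0, -1] (11 * n + 6) := by
  refine rankComb_nonneg (by decide) ((((mon_posSix (e := ![-2, -2, -2, -3, -4]) 2 (by decide) (by decide) (by decide)
    (by decide)).nat_mul 1).add
    ((mon_posSix (e := ![-2, -1, -4, -3, -3]) 2 (by decide) (by decide) (by decide)
    (by decide)).nat_mul 3)).add
    ((mon_posSix (e := ![-1, -3, -3, -4, -2]) 2 (by decide) (by decide) (by decide)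
    (by decide)).nat_mul 4)) (fun w hw => ?_) n
  have h := thetaSystem hw
  rw [ThetaSystem.wSix_one (tval w), h.wSix_two, h.wSix_three, h.wSix_four, h.wSix_five]
  norm_num [vecSix_apply]
  linear_combination qpow w (1 / 24) * ezero w ^ 14 * h.unitSystem.sixth_combination

end RankEleven

/-- Four-term and six-term rank inequalities for the residue 6 modulo 11. -/
theorem rank_inequalities_residue_six_higher (n : ℕ) :
    (rankCount 0 11 (11  *  n  +  6)  +  rankCount 3 11 (11  *  n  +  6) ≥ rankCount 1 11 (11  *  n  +  6)  +  rankCount 4 11 (11  *  n  +  6))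
    ∧ (rankCount 1 11 (11  *  n  +  6)  +  rankCount 2 11 (11  *  n  +  6)  +  rankCount 4 11 (11  *  n  +  6) ≥ rankCount 3 11 (11  *  n  +  6)  +  2 * rankCount 5 11 (11  *  n  +  6))
    ∧ (rankCount 2 11 (11  *  n  +  6)  +  2 * rankCount 3 11 (11  *  n  +  6) ≥ rankCount 1 11 (11  *  n  +  6)  +  rankCount 4 11 (11  *  n  +  6)  +  rankCount 5 11 (11  *  n  +  6))
    ∧ (rankCount 0 11 (11  *  n  +  6)  +  rankCount 1 11 (11  *  n  +  6)  +  rankCount 4 11 (11  *  n  +  6) ≥ rankCount 2 11 (11  *  n  +  6)  +  2 * rankCount 5 11 (11  *  n  +  6))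
    ∧ (3 * rankCount 3 11 (11  *  n  +  6) ≥ rankCount 2 11 (11  *  n  +  6)  +  2 * rankCount 5 11 (11  *  n  +  6))
    ∧ (rankCount 0 11 (11  *  n  +  6)  +  2 * rankCount 3 11 (11  *  n  +  6) ≥ 2 * rankCount 2 11 (11  *  n  +  6)  +  rankCount 5 11 (11  *  n  +  6)) := by
  have h1 := RankEleven.rankComb_nonneg_first n
  have h2 := RankEleven.rankComb_nonneg_second n
  have h3 := RankEleven.rankComb_nonneg_third n
  have h4 := RankEleven.rankComb_nonneg_fourth n
  have h5 := RankEleven.rankComb_nonneg_fifth n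
  have h6 := RankEleven.rankComb_nonneg_sixth n
  rw [RankEleven.rankComb_vecSix] at h1 h2 h3 h4 h5 h6
  omega
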